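/- ∫₀^∞ I₀(t)[K₀(t)]⁵·t·(1 − 8t²) dt = (7π³/(108√3))·∫₀¹ [₂F₁(−1/3,1/3;1|x)]²·(1−x)^{−1/2} dx. -/

import Mathlib

open Real MeasureTheory Set

/-- Modified Bessel function `I₀(t) = (1/π)∫₀^π exp(t cos θ) dθ`. -/
noncomputable def I0 (t : ℝ) : ℝ := (1 / π) * ∫ θ in (0:ℝ)..π, exp (t * cos θ)

/-- Modified Bessel function `K₀(t) = ∫₀^∞ exp(−t cosh u) du`. -/
noncomputable def K0 (t : ℝ) : ℝ := ∫ u in Ioi (0:ℝ), exp (-(t * Real.cosh u))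

/-- Rising factorial `(a)ₙ = a(a+1)⋯(a+n−1)`. -/
noncomputable def ris (a : ℝ) (n : ℕ) : ℝ := ∏ k ∈ Finset.range n, (a + k)

/-- Generalized hypergeometric series `ₚF_q(a; b | x)`. -/
noncomputable def pFq (a b : List ℝ) (x : ℝ) : ℝ :=
  ∑' n : ℕ, ((a.map fun p => ris p n).prod / (b.map fun q => ris q n).prod) * x ^ n
    / (n.factorial : ℝ)

namespace BL

/-- derivative under a compact integral -/
lemma pderiv {a b : ℝ} (hab : a ≤ b) {f f' : ℝ → ℝ → ℝ} {U : Set ℝ} (hU : IsOpen U) {x₀ : ℝ}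
    (hx : x₀ ∈ U) (hf : ∀ x ∈ U, ContinuousOn (f x) (Icc a b))
    (hf' : ContinuousOn (fun p : ℝ × ℝ => f' p.1 p.2) (U ×ˢ Icc a b))
    (hd : ∀ x ∈ U, ∀ y ∈ Icc a b, HasDerivAt (fun x => f x y) (f' x y) x) :
    HasDerivAt (fun x => ∫ y in a..b, f x y) (∫ y in a..b, f' x₀ y) x₀ := by
  obtain ⟨ε, hε, hb⟩ := Metric.nhds_basis_closedBall.mem_iff.1 (hU.mem_nhds hx)
  have hK : IsCompact (Metric.closedBall x₀ ε ×ˢ Icc a b) :=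
    (isCompact_closedBall x₀ ε).prod isCompact_Icc
  obtain ⟨C, hC⟩ := hK.exists_bound_of_continuousOn (hf'.mono (prod_mono hb subset_rfl))
  have hI : Set.uIoc a b ⊆ Icc a b := by rw [uIoc_of_le hab]; exact Ioc_subset_Icc_self
  refine (intervalIntegral.hasDerivAt_integral_of_dominated_loc_of_deriv_le
    (s := Metric.closedBall x₀ ε) (bound := fun _ => C) (Metric.closedBall_mem_nhds x₀ hε)
    ?_ ?_ ?_ ?_ ?_ ?_).2
  · filter_upwards [hU.mem_nhds hx] with x hx
    exact ((hf x hx).mono hI).aestronglyMeasurable measurableSet_uIoc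
  · apply ContinuousOn.intervalIntegrable; rw [uIcc_of_le hab]; exact hf x₀ hx
  · refine ContinuousOn.aestronglyMeasurable ?_ measurableSet_uIoc
    exact (hf'.comp (f := fun y => (x₀, y)) (by fun_prop) (fun y hy => ⟨hx, hI hy⟩))
  · exact .of_forall fun t ht x hx => hC (x, t) ⟨hx, hI ht⟩
  · exact intervalIntegrable_const
  · exact .of_forall fun t ht x hx => hd x (hb hx) t (hI ht)

noncomputable def I1 (t : ℝ) : ℝ := (1 / π) * ∫ θ in (0:ℝ)..π, cos θ * exp (t * cos θ)
noncomputable def Kk (k : ℕ) (t : ℝ) : ℝ :=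
  ∫ u in Ioi (0:ℝ), Real.cosh u ^ k * exp (-(t * Real.cosh u))
noncomputable def K1 (t : ℝ) : ℝ := Kk 1 t

lemma K0_eq : K0 = Kk 0 := by ext t; simp [K0, Kk]

lemma I0_deriv (t : ℝ) : HasDerivAt I0 (I1 t) t := by
  unfold I0 I1
  refine HasDerivAt.const_mul _ ?_
  refine pderiv pi_pos.le (f := fun t θ => exp (t * cos θ))
    (f' := fun t θ => cos θ * exp (t * cos θ)) isOpen_univ (mem_univ _) ?_ ?_ ?_
  · intro x _; fun_prop
  · fun_prop
  · intro x _ y _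
    exact ((hasDerivAt_id x).mul_const (cos y)).exp.congr_deriv (by simp [mul_comm])

lemma I1_deriv' (t : ℝ) : HasDerivAt I1
    ((1 / π) * ∫ θ in (0:ℝ)..π, cos θ ^ 2 * exp (t * cos θ)) t := by
  unfold I1
  refine HasDerivAt.const_mul _ ?_
  refine pderiv pi_pos.le (f := fun t θ => cos θ * exp (t * cos θ))
    (f' := fun t θ => cos θ ^ 2 * exp (t * cos θ)) isOpen_univ (mem_univ _) ?_ ?_ ?_
  · intro x _; fun_prop
  · fun_prop
  · intro x _ y _
    exact ((((hasDerivAt_id x).mul_const (cos y)).exp).const_mul (cos y)).congr_deriv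
      (by simp only [id]; ring)

lemma tI1_deriv (t : ℝ) : HasDerivAt (fun t => t * I1 t) (t * I0 t) t := by
  have h := (hasDerivAt_id t).mul (I1_deriv' t)
  refine h.congr_deriv ?_
  have h0 : ∫ θ in (0:ℝ)..π, (cos θ * exp (t * cos θ) - t * sin θ ^ 2 * exp (t * cos θ)) = 0 := by
    have : ∀ θ ∈ uIcc 0 π, HasDerivAt (fun θ => sin θ * exp (t * cos θ))
      (cos θ * exp (t * cos θ) - t * sin θ ^ 2 * exp (t * cos θ)) θ := by
      intro θ _
      exact ((hasDerivAt_sin θ).mul (((hasDerivAt_cos θ).const_mul t).exp)).congr_deriv (by ring)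
    rw [intervalIntegral.integral_eq_sub_of_hasDerivAt this]
    · simp
    · apply Continuous.intervalIntegrable; fun_prop
  have h1 : t * I0 t - (I1 t + t * ((1 / π) * ∫ θ in (0:ℝ)..π, cos θ ^ 2 * exp (t * cos θ)))
      = -(1 / π) * ∫ θ in (0:ℝ)..π, (cos θ * exp (t * cos θ) - t * sin θ ^ 2 * exp (t * cos θ)) := by
    unfold I0 I1
    have : ∀ θ, cos θ * exp (t * cos θ) - t * sin θ ^ 2 * exp (t * cos θ)
      = cos θ * exp (t * cos θ) - (t * exp (t * cos θ) - t * (cos θ ^ 2 * exp (t * cos θ))) := by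
      intro θ; rw [sin_sq]; ring
    simp_rw [this]
    rw [intervalIntegral.integral_sub, intervalIntegral.integral_sub,
      intervalIntegral.integral_const_mul, intervalIntegral.integral_const_mul]
    · ring
    all_goals apply Continuous.intervalIntegrable; fun_prop
  rw [h0] at h1
  simp only [id, one_mul]
  linarith

lemma I0_pos (t : ℝ) : 0 < I0 t := by
  unfold I0
  refine mul_pos (by positivity) ?_
  apply intervalIntegral.intervalIntegral_pos_of_pos_on
  · apply Continuous.intervalIntegrable; fun_prop
  · intro x _; positivity
  · exact pi_pos

lemma I0_le {t : ℝ} (ht : 0 ≤ t) : I0 t ≤ exp t := by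
  have : ∫ θ in (0:ℝ)..π, exp (t * cos θ) ≤ ∫ θ in (0:ℝ)..π, exp t := by
    apply intervalIntegral.integral_mono_on pi_pos.le
    · apply Continuous.intervalIntegrable; fun_prop
    · apply Continuous.intervalIntegrable; fun_prop
    · intro θ _
      exact exp_le_exp.2 (by nlinarith [cos_le_one θ])
  unfold I0
  rw [intervalIntegral.integral_const] at this
  rw [one_div, inv_mul_le_iff₀ pi_pos]
  simpa using this

lemma I0_zero : I0 0 = 1 := by simp [I0, pi_ne_zero]

lemma I1_abs_le {t : ℝ} (ht : 0 ≤ t) : |I1 t| ≤ t * exp t := by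
  have h0 : I1 t = (1 / π) * ∫ θ in (0:ℝ)..π, cos θ * (exp (t * cos θ) - 1) := by
    unfold I1
    simp_rw [mul_sub, mul_one]
    rw [intervalIntegral.integral_sub]
    · simp
    all_goals apply Continuous.intervalIntegrable; fun_prop
  have h1 : ‖∫ θ in (0:ℝ)..π, cos θ * (exp (t * cos θ) - 1)‖ ≤ (t * exp t) * |π - 0| := by
    apply intervalIntegral.norm_integral_le_of_norm_le_const
    intro θ _
    rw [norm_mul, Real.norm_eq_abs, Real.norm_eq_abs]
    have e1 : |exp (t * cos θ) - 1| ≤ |t * cos θ| * exp |t * cos θ| := by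
      rcases le_total 0 (t * cos θ) with h | h
      · rw [abs_of_nonneg h, abs_of_nonneg (by linarith [add_one_le_exp (t * cos θ)])]
        have := add_one_le_exp (-(t * cos θ))
        have h2 : exp (t * cos θ) * exp (-(t * cos θ)) = 1 := by rw [← exp_add]; simp
        nlinarith [exp_pos (t * cos θ)]
      · rw [abs_of_nonpos h, abs_of_nonpos (by simpa using h)]
        have := add_one_le_exp (t * cos θ)
        have := one_le_exp (x := -(t * cos θ)) (by linarith)
        nlinarith
    have e2 : |t * cos θ| ≤ t := by
      rw [abs_mul, abs_of_nonneg ht]; nlinarith [abs_cos_le_one θ]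
    calc |cos θ| * |exp (t * cos θ) - 1| ≤ 1 * (t * exp t) := by
          apply mul_le_mul (abs_cos_le_one θ) (e1.trans _) (abs_nonneg _) zero_le_one
          gcongr
      _ = _ := one_mul _
  rw [h0, abs_mul, abs_of_pos (by positivity : (0:ℝ) < 1 / π), one_div, inv_mul_le_iff₀ pi_pos]
  simpa [abs_of_pos pi_pos, mul_comm] using h1

lemma cosh_ge (u : ℝ) : exp u / 2 ≤ Real.cosh u := by
  rw [Real.cosh_eq]; linarith [exp_pos (-u)]

lemma kInt (k : ℕ) {t : ℝ} (ht : 0 < t) :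
    IntegrableOn (fun u => Real.cosh u ^ k * exp (-(t * Real.cosh u))) (Ioi 0) := by
  have h : IntegrableOn (fun u : ℝ => ((k+1).factorial / t ^ (k+1) * 2) * exp (-u)) (Ioi 0) :=
    (integrableOn_exp_neg_Ioi 0).const_mul _
  refine h.mono' ?_ ?_
  · exact (by fun_prop : Continuous fun u => Real.cosh u ^ k * exp (-(t * Real.cosh u))).aestronglyMeasurable
  · refine .of_forall fun u => ?_
    have hc : 0 < Real.cosh u := Real.cosh_pos u
    rw [norm_of_nonneg (by positivity)]
    have h1 := Real.pow_div_factorial_le_exp (t * Real.cosh u) (by positivity) (k+1)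
    rw [div_le_iff₀ (by positivity), mul_pow] at h1
    have h2 := cosh_ge u
    rw [exp_neg, exp_neg, ← div_eq_mul_inv, ← div_eq_mul_inv, div_le_div_iff₀ (by positivity) (by positivity)]
    rw [div_mul_eq_mul_div, div_mul_eq_mul_div, le_div_iff₀ (by positivity)]
    calc Real.cosh u ^ k * exp u * t ^ (k+1) ≤ Real.cosh u ^ k * (2 * Real.cosh u) * t ^ (k+1) := by
          gcongr; linarith
      _ = 2 * (t ^ (k+1) * Real.cosh u ^ (k+1)) := by ring
      _ ≤ 2 * (exp (t * Real.cosh u) * ((k+1).factorial)) := by gcongr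
      _ = _ := by ring

lemma Kk_deriv (k : ℕ) {t : ℝ} (ht : 0 < t) : HasDerivAt (Kk k) (-Kk (k+1) t) t := by
  have h := (hasDerivAt_integral_of_dominated_loc_of_deriv_le (μ := volume.restrict (Ioi (0:ℝ)))
    (F := fun t u => Real.cosh u ^ k * exp (-(t * Real.cosh u)))
    (F' := fun t u => -(Real.cosh u ^ (k+1) * exp (-(t * Real.cosh u))))
    (x₀ := t) (s := Ioi (t/2)) (bound := fun u => Real.cosh u ^ (k+1) * exp (-((t/2) * Real.cosh u)))
    (Ioi_mem_nhds (by linarith)) ?_ (kInt k ht) ?_ ?_ (kInt (k+1) (by linarith)) ?_).2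
  · rw [integral_neg] at h; exact h
  · exact .of_forall fun t => (by fun_prop : Continuous fun u => Real.cosh u ^ k * exp (-(t * Real.cosh u))).aestronglyMeasurable
  · exact (by fun_prop : Continuous fun u => -(Real.cosh u ^ (k+1) * exp (-(t * Real.cosh u)))).aestronglyMeasurable
  · refine .of_forall fun u x hx => ?_
    have hc : 0 < Real.cosh u := Real.cosh_pos u
    rw [norm_neg, norm_of_nonneg (by positivity)]
    have : t / 2 < x := hx
    gcongr
  · refine .of_forall fun u x hx => ?_
    exact (((((hasDerivAt_id x).mul_const (Real.cosh u)).neg).exp).const_mul (Real.cosh u ^ k)).congr_deriv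
      (by simp only [id, Pi.neg_apply]; ring)

lemma K0_deriv {t : ℝ} (ht : 0 < t) : HasDerivAt K0 (-K1 t) t := by
  rw [K0_eq]; exact Kk_deriv 0 ht

lemma exp_cosh_tendsto {t : ℝ} (ht : 0 < t) :
    Filter.Tendsto (fun u => exp (-(t * Real.cosh u))) Filter.atTop (nhds 0) := by
  refine tendsto_exp_neg_atTop_nhds_zero.comp (Filter.Tendsto.const_mul_atTop ht ?_)
  refine Filter.tendsto_atTop_mono (f := fun u => exp u / 2) cosh_ge ?_
  exact tendsto_exp_atTop.atTop_div_const (by norm_num)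

lemma sinh_exp_int {t : ℝ} (ht : 0 < t) :
    IntegrableOn (fun u => t * (Real.sinh u * exp (-(t * Real.cosh u)))) (Ioi 0) ∧
    ∫ u in Ioi (0:ℝ), t * (Real.sinh u * exp (-(t * Real.cosh u))) = exp (-t) := by
  have hi : IntegrableOn (fun u => t * (Real.sinh u * exp (-(t * Real.cosh u)))) (Ioi 0) := by
    refine Integrable.const_mul ?_ _
    refine (kInt 1 ht).mono' ?_ ?_
    · exact (by fun_prop : Continuous fun u => Real.sinh u * exp (-(t * Real.cosh u))).aestronglyMeasurable
    · refine (ae_restrict_mem measurableSet_Ioi).mono fun u hu => ?_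
      have : 0 ≤ Real.sinh u := Real.sinh_nonneg_iff.2 (le_of_lt hu)
      rw [norm_of_nonneg (by positivity), pow_one]
      gcongr
      exact (Real.sinh_lt_cosh u).le
  refine ⟨hi, ?_⟩
  have hd : ∀ u ∈ Ici (0:ℝ), HasDerivAt (fun u => -exp (-(t * Real.cosh u)))
      (t * (Real.sinh u * exp (-(t * Real.cosh u)))) u := by
    intro u _
    exact ((((Real.hasDerivAt_cosh u).const_mul t).neg).exp).neg.congr_deriv
      (by simp only [Pi.neg_apply]; ring)
  rw [integral_Ioi_of_hasDerivAt_of_tendsto' hd hi (by simpa using (exp_cosh_tendsto ht).neg)]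
  simp

lemma K2_rel {t : ℝ} (ht : 0 < t) : t * Kk 2 t = Kk 1 t + t * Kk 0 t := by
  have hd : ∀ u ∈ Ici (0:ℝ), HasDerivAt (fun u => Real.sinh u * exp (-(t * Real.cosh u)))
      (Real.cosh u ^ 1 * exp (-(t * Real.cosh u)) - (t * (Real.cosh u ^ 2 * exp (-(t * Real.cosh u)))
        - t * (Real.cosh u ^ 0 * exp (-(t * Real.cosh u))))) u := by
    intro u _
    have := Real.cosh_sq u
    exact ((Real.hasDerivAt_sinh u).mul (((Real.hasDerivAt_cosh u).const_mul t).neg.exp)).congr_deriv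
      (by simp only [Pi.neg_apply]; rw [this]; ring)
  have hint := ((kInt 1 ht).sub (((kInt 2 ht).const_mul t).sub ((kInt 0 ht).const_mul t)))
  have hlim : Filter.Tendsto (fun u => Real.sinh u * exp (-(t * Real.cosh u))) Filter.atTop (nhds 0) := by
    have h1 : Filter.Tendsto (fun x : ℝ => x * exp (-(t * x))) Filter.atTop (nhds 0) := by
      have := tendsto_rpow_mul_exp_neg_mul_atTop_nhds_zero 1 t ht
      simpa using this
    have hc : Filter.Tendsto Real.cosh Filter.atTop Filter.atTop :=
      Filter.tendsto_atTop_mono (f := fun u => exp u / 2) cosh_ge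
        (tendsto_exp_atTop.atTop_div_const (by norm_num))
    refine squeeze_zero' ?_ ?_ (h1.comp hc)
    · filter_upwards [Filter.eventually_ge_atTop 0] with u hu
      have : 0 ≤ Real.sinh u := Real.sinh_nonneg_iff.2 hu
      positivity
    · filter_upwards with u
      simp only [Function.comp]
      gcongr
      exact (Real.sinh_lt_cosh u).le
  have := integral_Ioi_of_hasDerivAt_of_tendsto' hd hint hlim
  have e : ∫ u in Ioi (0:ℝ), (Real.cosh u ^ 1 * exp (-(t * Real.cosh u)) - (t * (Real.cosh u ^ 2 * exp (-(t * Real.cosh u)))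
        - t * (Real.cosh u ^ 0 * exp (-(t * Real.cosh u))))) = Kk 1 t - (t * Kk 2 t - t * Kk 0 t) := by
    unfold Kk
    have i2 : IntegrableOn (fun u => t * (Real.cosh u ^ 2 * exp (-(t * Real.cosh u)))
        - t * (Real.cosh u ^ 0 * exp (-(t * Real.cosh u)))) (Ioi 0) :=
      ((kInt 2 ht).const_mul t).sub ((kInt 0 ht).const_mul t)
    rw [integral_sub (kInt 1 ht) i2,
      integral_sub ((kInt 2 ht).const_mul t) ((kInt 0 ht).const_mul t), integral_const_mul, integral_const_mul]
  rw [e] at this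
  simp at this
  linarith

lemma tK1_deriv {t : ℝ} (ht : 0 < t) : HasDerivAt (fun t => t * K1 t) (-(t * K0 t)) t := by
  have h := (hasDerivAt_id t).mul (Kk_deriv 1 ht)
  have := K2_rel ht
  exact h.congr_deriv (by simp only [id, K0_eq]; linarith)

lemma K0_pos {t : ℝ} (ht : 0 < t) : 0 < K0 t := by
  rw [K0_eq]; unfold Kk
  rw [setIntegral_pos_iff_support_of_nonneg_ae]
  · rw [Function.support_eq_univ (fun u => by positivity)]; simp
  · exact .of_forall fun u => by simp only [Pi.zero_apply]; positivity
  · exact kInt 0 ht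

lemma exp_neg_le_rpow {x e : ℝ} (hx : 0 < x) (he : 0 < e) (he1 : e ≤ 1) : exp (-x) ≤ x ^ (-e) := by
  rw [rpow_def_of_pos hx]
  apply exp_le_exp.2
  rcases le_total x 1 with h | h
  · have := log_nonpos hx.le h
    nlinarith
  · have := log_le_sub_one_of_pos hx
    have := log_nonneg h
    nlinarith

/-- the basic bound for `K₀` -/
lemma K0_le : ∃ C : ℝ, 0 < C ∧ ∀ t : ℝ, 0 < t → K0 t ≤ C * exp (-t/2) * t ^ (-(1/8):ℝ) := by
  refine ⟨32, by norm_num, fun t ht => ?_⟩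
  rw [K0_eq]; unfold Kk
  have hb : IntegrableOn (fun u : ℝ => (exp (-t/2) * t ^ (-(1/8):ℝ) * 4) * exp (-(1/8) * u)) (Ioi 0) := by
    refine Integrable.const_mul ?_ _
    exact integrableOn_exp_mul_Ioi (by norm_num) 0
  have hm : ∫ u in Ioi (0:ℝ), Real.cosh u ^ 0 * exp (-(t * Real.cosh u)) ≤
     ∫ u in Ioi (0:ℝ), (exp (-t/2) * t ^ (-(1/8):ℝ) * 4) * exp (-(1/8) * u) := by
    refine setIntegral_mono_on (kInt 0 ht) hb measurableSet_Ioi fun u hu => ?_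
    have hc := cosh_ge u
    have h1 := Real.one_le_cosh u
    have hE := exp_pos u
    have e1 : exp (-(t * Real.cosh u)) ≤ exp (-t/2) * exp (-(t * exp u / 4)) := by
      rw [← exp_add]; apply exp_le_exp.2
      nlinarith
    have e2 := exp_neg_le_rpow (x := t * exp u / 4) (e := 1/8) (by positivity) (by norm_num) (by norm_num)
    have e3 : (t * exp u / 4) ^ (-(1/8):ℝ) = t ^ (-(1/8):ℝ) * exp (-(1/8) * u) * 4 ^ (1/8:ℝ) := by
      rw [div_rpow (by positivity) (by norm_num), mul_rpow ht.le hE.le, ← Real.exp_mul, mul_comm u,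
        rpow_neg (by norm_num : (0:ℝ) ≤ 4)]
      field_simp
    have e4 : (4:ℝ) ^ (1/8:ℝ) ≤ 4 := by
      calc (4:ℝ) ^ (1/8:ℝ) ≤ 4 ^ (1:ℝ) := rpow_le_rpow_of_exponent_le (by norm_num) (by norm_num)
        _ = 4 := by norm_num
    rw [pow_zero, one_mul]
    refine e1.trans ?_
    rw [mul_assoc, mul_assoc]
    gcongr
    refine e2.trans ?_
    rw [e3, mul_assoc]
    rw [mul_comm 4]
    gcongr
  refine hm.trans ?_
  rw [integral_const_mul, integral_exp_mul_Ioi (by norm_num)]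
  simp
  apply le_of_eq; ring

lemma tK1_bounds {t : ℝ} (ht : 0 < t) : exp (-t) ≤ t * K1 t ∧ t * K1 t ≤ exp (-t) + t * K0 t := by
  obtain ⟨hi, he⟩ := sinh_exp_int ht
  have e1 : t * K1 t = ∫ u in Ioi (0:ℝ), t * (Real.cosh u ^ 1 * exp (-(t * Real.cosh u))) := by
    rw [integral_const_mul]; rfl
  constructor
  · rw [e1, ← he]
    refine setIntegral_mono_on hi ((kInt 1 ht).const_mul t) measurableSet_Ioi fun u hu => ?_
    rw [pow_one]
    gcongr
    exact (Real.sinh_lt_cosh u).le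
  · rw [e1, ← he, K0_eq, Kk, ← integral_const_mul, ← integral_add hi ((kInt 0 ht).const_mul t)]
    refine setIntegral_mono_on ((kInt 1 ht).const_mul t) (hi.add ((kInt 0 ht).const_mul t)) measurableSet_Ioi fun u hu => ?_
    have : Real.cosh u ≤ Real.sinh u + 1 := by
      have := Real.cosh_sub_sinh u
      have : exp (-u) ≤ 1 := exp_le_one_iff.2 (by have : 0 < u := hu; linarith)
      linarith
    have h3 := exp_pos (-(t * Real.cosh u))
    have : Real.cosh u * exp (-(t * Real.cosh u)) ≤ (Real.sinh u + 1) * exp (-(t * Real.cosh u)) := by gcongr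
    simp only [pow_one, pow_zero, one_mul, Pi.add_apply]
    nlinarith

end BL

namespace BL

lemma pcont {a b : ℝ} (hab : a ≤ b) {f : ℝ → ℝ → ℝ} {U : Set ℝ} (hU : IsOpen U) {x₀ : ℝ}
    (hx : x₀ ∈ U) (hf : ContinuousOn (fun p : ℝ × ℝ => f p.1 p.2) (U ×ˢ Icc a b)) :
    ContinuousAt (fun x => ∫ y in a..b, f x y) x₀ := by
  obtain ⟨ε, hε, hb⟩ := Metric.nhds_basis_closedBall.mem_iff.1 (hU.mem_nhds hx)
  have hK : IsCompact (Metric.closedBall x₀ ε ×ˢ Icc a b) :=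
    (isCompact_closedBall x₀ ε).prod isCompact_Icc
  obtain ⟨C, hC⟩ := hK.exists_bound_of_continuousOn (hf.mono (prod_mono hb subset_rfl))
  have hI : Set.uIoc a b ⊆ Icc a b := by rw [uIoc_of_le hab]; exact Ioc_subset_Icc_self
  refine intervalIntegral.continuousAt_of_dominated_interval (bound := fun _ => C) ?_ ?_ ?_ ?_
  · filter_upwards [hU.mem_nhds hx] with x hx
    refine ContinuousOn.aestronglyMeasurable ?_ measurableSet_uIoc
    exact (hf.comp (f := fun y => (x, y)) (by fun_prop) (fun y hy => ⟨hx, hI hy⟩))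
  · filter_upwards [Metric.closedBall_mem_nhds x₀ hε] with x hx
    exact .of_forall fun t ht => hC (x, t) ⟨hx, hI ht⟩
  · exact intervalIntegrable_const
  · refine .of_forall fun t ht => ?_
    have : ContinuousOn (fun x => f x t) U :=
      hf.comp (f := fun x => (x, t)) (by fun_prop) (fun x hx => ⟨hx, hI ht⟩)
    exact this.continuousAt (hU.mem_nhds hx)

lemma cont_slice {a b : ℝ} {f : ℝ → ℝ → ℝ} {U : Set ℝ}
    (hf : ContinuousOn (fun p : ℝ × ℝ => f p.1 p.2) (U ×ˢ Icc a b)) {x : ℝ} (hx : x ∈ U) :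
    ContinuousOn (f x) (Icc a b) :=
  hf.comp (f := fun y => (x, y)) (by fun_prop) (fun y hy => ⟨hx, hy⟩)

lemma avg_ode {U : Set ℝ} (hU : IsOpen U) {f f1 f2 fθ : ℝ → ℝ → ℝ} {σ q : ℝ → ℝ}
    (hσ : ContinuousOn σ U) (hσ0 : ∀ x ∈ U, σ x ≠ 0)
    (hf : ContinuousOn (fun p : ℝ × ℝ => f p.1 p.2) (U ×ˢ Icc 0 π))
    (hf1 : ContinuousOn (fun p : ℝ × ℝ => f1 p.1 p.2) (U ×ˢ Icc 0 π))
    (hf2 : ContinuousOn (fun p : ℝ × ℝ => f2 p.1 p.2) (U ×ˢ Icc 0 π))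
    (d1 : ∀ x ∈ U, ∀ y ∈ Icc 0 π, HasDerivAt (fun x => f x y) (f1 x y / σ x) x)
    (d2 : ∀ x ∈ U, ∀ y ∈ Icc 0 π, HasDerivAt (fun x => f1 x y) (f2 x y / σ x) x)
    (dθ : ∀ x ∈ U, ∀ y ∈ Icc 0 π, HasDerivAt (fun y => fθ x y) (q x * f x y - f2 x y) y)
    (h0 : ∀ x ∈ U, fθ x 0 = 0) (hπ : ∀ x ∈ U, fθ x π = 0) {x : ℝ} (hx : x ∈ U) :
    HasDerivAt (fun x => ∫ y in (0:ℝ)..π, f x y) ((∫ y in (0:ℝ)..π, f1 x y) / σ x) x ∧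
    HasDerivAt (fun x => ∫ y in (0:ℝ)..π, f1 x y) (q x * (∫ y in (0:ℝ)..π, f x y) / σ x) x := by
  have hs : ContinuousOn (fun p : ℝ × ℝ => σ p.1) (U ×ˢ Icc 0 π) :=
    hσ.comp continuous_fst.continuousOn fun p hp => hp.1
  constructor
  · have := pderiv pi_pos.le hU hx (fun x hx => cont_slice hf hx)
      (hf1.div hs fun p hp => hσ0 _ hp.1) d1
    simpa [intervalIntegral.integral_div] using this
  · have := pderiv pi_pos.le hU hx (fun x hx => cont_slice hf1 hx)
      (hf2.div hs fun p hp => hσ0 _ hp.1) d2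
    rw [intervalIntegral.integral_div] at this
    refine this.congr_deriv ?_
    congr 1
    have i1 : IntervalIntegrable (fun y => q x * f x y) volume 0 π := by
      apply ContinuousOn.intervalIntegrable; rw [uIcc_of_le pi_pos.le]
      exact (cont_slice hf hx).const_mul _
    have i2 : IntervalIntegrable (fun y => f2 x y) volume 0 π := by
      apply ContinuousOn.intervalIntegrable; rw [uIcc_of_le pi_pos.le]
      exact cont_slice hf2 hx
    have e := intervalIntegral.integral_eq_sub_of_hasDerivAt
      (f := fun y => fθ x y) (a := 0) (b := π) (fun y hy => dθ x hx y (by rwa [uIcc_of_le pi_pos.le] at hy)) (i1.sub i2)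
    rw [h0 x hx, hπ x hx, intervalIntegral.integral_sub i1 i2, intervalIntegral.integral_const_mul] at e
    linarith

lemma ode_unique {b c : ℝ} {F F1 G G1 σ q : ℝ → ℝ} (hσ0 : ∀ x ∈ Ioo 0 b, σ x ≠ 0)
    (hG : ∀ x ∈ Ioo 0 b, G x ≠ 0)
    (dF : ∀ x ∈ Ioo 0 b, HasDerivAt F (F1 x / σ x) x)
    (dF1 : ∀ x ∈ Ioo 0 b, HasDerivAt F1 (q x * F x / σ x) x)
    (dG : ∀ x ∈ Ioo 0 b, HasDerivAt G (G1 x / σ x) x)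
    (dG1 : ∀ x ∈ Ioo 0 b, HasDerivAt G1 (q x * G x / σ x) x)
    (lF : Filter.Tendsto F (nhdsWithin 0 (Ioi 0)) (nhds c))
    (lF1 : Filter.Tendsto F1 (nhdsWithin 0 (Ioi 0)) (nhds 0))
    (lG : Filter.Tendsto G (nhdsWithin 0 (Ioi 0)) (nhds 1))
    (lG1 : Filter.Tendsto G1 (nhdsWithin 0 (Ioi 0)) (nhds 0)) :
    ∀ x ∈ Ioo 0 b, F x = c * G x := by
  intro x hx
  have hb : 0 < b := hx.1.trans hx.2
  have key : ∀ (H : ℝ → ℝ) (l : ℝ), (∀ x ∈ Ioo 0 b, HasDerivAt H 0 x) →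
      Filter.Tendsto H (nhdsWithin 0 (Ioi 0)) (nhds l) → ∀ x ∈ Ioo 0 b, H x = l := by
    intro H l hd hl x hx
    have hc : ∀ y ∈ Ioo 0 b, H y = H x := fun y hy =>
      isOpen_Ioo.is_const_of_deriv_eq_zero (convex_Ioo 0 b).isPreconnected
        (fun z hz => (hd z hz).differentiableAt.differentiableWithinAt) (fun z hz => (hd z hz).deriv) hy hx
    have : Filter.Tendsto H (nhdsWithin 0 (Ioi 0)) (nhds (H x)) := by
      refine tendsto_const_nhds.congr' ?_
      filter_upwards [Ioo_mem_nhdsGT hb] with y hy using (hc y hy).symm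
    exact tendsto_nhds_unique this hl
  have hW : ∀ x ∈ Ioo 0 b, G x * F1 x - F x * G1 x = 0 := by
    refine key _ 0 (fun x hx => ?_) ?_
    · have := ((dG x hx).mul (dF1 x hx)).sub ((dF x hx).mul (dG1 x hx))
      refine this.congr_deriv ?_
      have := hσ0 x hx
      field_simp; ring
    · simpa using (lG.mul lF1).sub (lF.mul lG1)
  have hq : F x / G x = c := by
    refine key (fun x => F x / G x) c (fun x hx => ?_) ?_ x hx
    · refine ((dF x hx).div (dG x hx) (hG x hx)).congr_deriv ?_
      have h1 := hσ0 x hx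
      have h2 := hW x hx
      have h3 := hG x hx
      rw [div_eq_zero_iff]; left
      field_simp
      linarith
    · have := lF.div lG one_ne_zero
      rw [div_one] at this; exact this
  rw [← hq, div_mul_cancel₀ _ (hG x hx)]

lemma kY_deriv {Y : ℝ} (hY : 0 < Y) :
    HasDerivAt (fun Y => K0 (√Y)) (-(K1 (√Y) / √Y) / 2) Y := by
  have h := (K0_deriv (sqrt_pos.2 hY)).comp Y (hasDerivAt_sqrt hY.ne')
  exact h.congr_deriv (by field_simp)

lemma mY_deriv {Y : ℝ} (hY : 0 < Y) :
    HasDerivAt (fun Y => K1 (√Y) / √Y) (-(K0 (√Y)) / (2 * Y) - (K1 (√Y) / √Y) / Y) Y := by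
  have hs := sqrt_pos.2 hY
  have h := ((tK1_deriv hs).comp Y (hasDerivAt_sqrt hY.ne')).div (hasDerivAt_id Y) hY.ne'
  have h2 := h.congr_of_eventuallyEq (f₁ := fun Y => K1 (√Y) / √Y) (by
    filter_upwards [lt_mem_nhds hY] with y hy
    have hs := sqrt_pos.2 hy
    have := mul_self_sqrt hy.le
    simp only [Function.comp, id, Pi.div_apply]
    rw [div_eq_div_iff hs.ne' hy.ne']
    linear_combination (-(K1 (√y))) * this)
  refine h2.congr_deriv ?_
  have hsq := sq_sqrt hY.le
  simp only [Function.comp, id]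
  set s := √Y
  rw [← hsq]
  field_simp

lemma K0_antitone : AntitoneOn K0 (Ioi 0) := by
  refine antitoneOn_of_deriv_nonpos (convex_Ioi 0) ?_ ?_ ?_
  · exact fun t ht => (K0_deriv ht).continuousAt.continuousWithinAt
  · rw [interior_Ioi]; exact fun t ht => (K0_deriv ht).differentiableAt.differentiableWithinAt
  · rw [interior_Ioi]; intro t ht
    rw [(K0_deriv ht).deriv]
    have := (tK1_bounds ht).1
    have h2 : 0 < t * K1 t := (exp_pos _).trans_le this
    have := pos_of_mul_pos_right h2 (le_of_lt ht)
    linarith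

lemma aux_m {Y : ℝ} (hY : Y ≠ 0) (k m : ℝ) : (-k / (2 * Y) - m / Y) * Y = -k / 2 - m := by
  field_simp

lemma graf {t ρ : ℝ} (ht : 0 < t) (hρ : ρ ∈ Ioo 0 t) :
    (∫ θ in (0:ℝ)..π, K0 (√(ρ^2 + t^2 - 2*ρ*t*cos θ))) = π * K0 t * I0 ρ := by
  have Ypos : ∀ ρ ∈ Ioo (-t) t, ∀ θ : ℝ, 0 < ρ^2 + t^2 - 2*ρ*t*cos θ := by
    intro ρ hρ θ
    have h1 := neg_one_le_cos θ
    have h2 := cos_le_one θ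
    rcases le_total 0 ρ with h | h
    · have : ρ * t * cos θ ≤ ρ * t * 1 := by gcongr
      nlinarith [mul_pos (sub_pos.2 hρ.2) (sub_pos.2 hρ.2)]
    · have : (-ρ) * t * (-cos θ) ≤ (-ρ) * t * 1 := by
        apply mul_le_mul_of_nonneg_left (by linarith); nlinarith
      nlinarith [mul_pos (show 0 < t + ρ by linarith [hρ.1]) (show 0 < t + ρ by linarith [hρ.1])]
  have ckY : ContinuousOn (fun p : ℝ × ℝ => K0 (√(p.1^2 + t^2 - 2*p.1*t*cos p.2))) (Ioo (-t) t ×ˢ Icc 0 π) := by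
    intro p hp
    refine ContinuousAt.continuousWithinAt ?_
    exact ContinuousAt.comp (g := fun Y => K0 (√Y)) (f := fun p : ℝ × ℝ => p.1^2 + t^2 - 2*p.1*t*cos p.2)
      (kY_deriv (Ypos p.1 hp.1 p.2)).continuousAt (by fun_prop)
  have cmY : ContinuousOn (fun p : ℝ × ℝ => K1 (√(p.1^2 + t^2 - 2*p.1*t*cos p.2)) /
      √(p.1^2 + t^2 - 2*p.1*t*cos p.2)) (Ioo (-t) t ×ˢ Icc 0 π) := by
    intro p hp
    refine ContinuousAt.continuousWithinAt ?_
    exact ContinuousAt.comp (g := fun Y => K1 (√Y) / √Y) (f := fun p : ℝ × ℝ => p.1^2 + t^2 - 2*p.1*t*cos p.2)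
      (mY_deriv (Ypos p.1 hp.1 p.2)).continuousAt (by fun_prop)
  set f1 : ℝ → ℝ → ℝ := fun ρ θ => -(K1 (√(ρ^2 + t^2 - 2*ρ*t*cos θ)) /
      √(ρ^2 + t^2 - 2*ρ*t*cos θ)) * (ρ^2 - ρ*t*cos θ) with hf1
  set f2 : ℝ → ℝ → ℝ := fun ρ θ => -(-(K0 (√(ρ^2 + t^2 - 2*ρ*t*cos θ))) / (2 * (ρ^2 + t^2 - 2*ρ*t*cos θ))
    - (K1 (√(ρ^2 + t^2 - 2*ρ*t*cos θ)) / √(ρ^2 + t^2 - 2*ρ*t*cos θ)) / (ρ^2 + t^2 - 2*ρ*t*cos θ))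
     * (2*ρ^2 - 2*ρ*t*cos θ) * (ρ^2 - ρ*t*cos θ) - (K1 (√(ρ^2 + t^2 - 2*ρ*t*cos θ)) /
      √(ρ^2 + t^2 - 2*ρ*t*cos θ)) * (2*ρ^2 - ρ*t*cos θ) with hf2
  set fθ : ℝ → ℝ → ℝ := fun ρ θ => -(K1 (√(ρ^2 + t^2 - 2*ρ*t*cos θ)) /
      √(ρ^2 + t^2 - 2*ρ*t*cos θ)) * (ρ*t*sin θ) with hfθ
  have cf1 : ContinuousOn (fun p : ℝ × ℝ => f1 p.1 p.2) (Ioo (-t) t ×ˢ Icc 0 π) :=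
    cmY.neg.mul (by fun_prop)
  have cf2 : ContinuousOn (fun p : ℝ × ℝ => f2 p.1 p.2) (Ioo (-t) t ×ˢ Icc 0 π) := by
    refine ContinuousOn.sub (ContinuousOn.mul (ContinuousOn.mul (ContinuousOn.neg (ContinuousOn.sub
      (ckY.neg.div (by fun_prop) ?_) (cmY.div (by fun_prop) ?_))) (by fun_prop)) (by fun_prop)) (cmY.mul (by fun_prop))
    · intro p hp; have := Ypos p.1 hp.1 p.2; positivity
    · intro p hp; exact (Ypos p.1 hp.1 p.2).ne'
  have hsub : Ioo 0 t ⊆ Ioo (-t) t := Ioo_subset_Ioo_left (by linarith)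
  have hsub2 : Ioo 0 t ×ˢ Icc 0 π ⊆ Ioo (-t) t ×ˢ Icc 0 π := prod_mono hsub subset_rfl
  have dYρ : ∀ x y, HasDerivAt (fun x => x^2 + t^2 - 2*x*t*cos y) (2*x - 2*t*cos y) x := by
    intro x y
    have := ((hasDerivAt_pow 2 x).add_const (t^2)).sub ((((hasDerivAt_id x).const_mul 2).mul_const t).mul_const (cos y))
    exact this.congr_deriv (by simp)
  have dYθ : ∀ x y, HasDerivAt (fun y => x^2 + t^2 - 2*x*t*cos y) (2*x*t*sin y) y := by
    intro x y
    have := ((hasDerivAt_cos y).const_mul (2*x*t)).const_sub (x^2 + t^2)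
    exact this.congr_deriv (by ring)
  have A := fun x hx => avg_ode (U := Ioo 0 t) isOpen_Ioo (f := fun ρ θ => K0 (√(ρ^2 + t^2 - 2*ρ*t*cos θ)))
    (f1 := f1) (f2 := f2) (fθ := fθ) (σ := fun x => x) (q := fun x => x^2) (by fun_prop)
    (fun x hx => hx.1.ne') (ckY.mono hsub2) (cf1.mono hsub2) (cf2.mono hsub2)
    (by
      intro x hx y _
      refine ((kY_deriv (Ypos x (hsub hx) y)).comp x (dYρ x y)).congr_deriv ?_
      have := hx.1.ne'
      simp only [hf1]
      rw [eq_div_iff this]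
      ring)
    (by
      intro x hx y _
      have h := ((mY_deriv (Ypos x (hsub hx) y)).comp x (dYρ x y)).fun_neg.fun_mul
        ((hasDerivAt_pow 2 x).fun_sub (((hasDerivAt_id x).mul_const t).mul_const (cos y)))
      refine h.congr_deriv ?_
      have := hx.1.ne'
      simp only [hf2]
      rw [eq_div_iff this]
      simp only [Pi.neg_apply, Function.comp, id]
      ring)
    (by
      intro x hx y _
      have hY := (Ypos x (hsub hx) y)
      have h := ((mY_deriv hY).comp y (dYθ x y)).fun_neg.fun_mul
        ((hasDerivAt_sin y).const_mul (x*t))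
      refine h.congr_deriv ?_
      simp only [hf2, Pi.neg_apply, Function.comp]
      have e : sin y ^ 2 = 1 - cos y ^ 2 := sin_sq y
      have hm : (-(K0 (√(x^2 + t^2 - 2*x*t*cos y))) / (2 * (x^2 + t^2 - 2*x*t*cos y))
        - (K1 (√(x^2 + t^2 - 2*x*t*cos y)) / √(x^2 + t^2 - 2*x*t*cos y)) / (x^2 + t^2 - 2*x*t*cos y))
         * (x^2 + t^2 - 2*x*t*cos y) = - K0 (√(x^2 + t^2 - 2*x*t*cos y)) / 2 -
         (K1 (√(x^2 + t^2 - 2*x*t*cos y)) / √(x^2 + t^2 - 2*x*t*cos y)) := by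
        exact aux_m hY.ne' _ _
      linear_combination (-2*x^2) * hm + (-2 * (-(K0 (√(x^2 + t^2 - 2*x*t*cos y))) / (2 * (x^2 + t^2 - 2*x*t*cos y))
        - (K1 (√(x^2 + t^2 - 2*x*t*cos y)) / √(x^2 + t^2 - 2*x*t*cos y)) / (x^2 + t^2 - 2*x*t*cos y)) * (x*t)^2) * e)
    (by intro x _; simp [hfθ]) (by intro x _; simp [hfθ]) (x := x) hx
  have c0 := pcont pi_pos.le isOpen_Ioo (f := fun ρ θ => K0 (√(ρ^2 + t^2 - 2*ρ*t*cos θ))) (x₀ := 0)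
    ⟨by linarith, ht⟩ ckY
  have c1 := pcont pi_pos.le isOpen_Ioo (f := f1) (x₀ := 0) ⟨by linarith, ht⟩ cf1
  have l0 := c0.tendsto.mono_left (nhdsWithin_le_nhds (s := Ioi 0))
  have l1 := c1.tendsto.mono_left (nhdsWithin_le_nhds (s := Ioi 0))
  have e0 : ∫ y in (0:ℝ)..π, K0 (√(0^2 + t^2 - 2*0*t*cos y)) = π * K0 t := by
    simp [sqrt_sq ht.le]
  have e1 : ∫ y in (0:ℝ)..π, f1 0 y = 0 := by simp [hf1]
  simp only [e0, e1] at l0 l1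
  refine ode_unique (G := I0) (G1 := fun t => t * I1 t) (σ := fun x => x) (q := fun x => x^2)
    (fun x hx => hx.1.ne') (fun x _ => (I0_pos x).ne') (fun x hx => (A x hx).1) (fun x hx => (A x hx).2)
    ?_ ?_ l0 l1 ?_ ?_ ρ hρ
  · intro x hx
    exact (I0_deriv x).congr_deriv (by field_simp [hx.1.ne'])
  · intro x hx
    exact (tI1_deriv x).congr_deriv (by field_simp [hx.1.ne'])
  · have := (I0_deriv 0).continuousAt.tendsto.mono_left (nhdsWithin_le_nhds (s := Ioi 0))
    rwa [I0_zero] at this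
  · have := (tI1_deriv 0).continuousAt.tendsto.mono_left (nhdsWithin_le_nhds (s := Ioi 0))
    rwa [zero_mul] at this

noncomputable def nn (t : ℝ) : ℝ := I0 t * K0 t

lemma nn_formula {t : ℝ} (ht : 0 < t) :
    nn t = (2 / π) * ∫ θ in (0:ℝ)..(π/2), K0 (2 * t * sin θ) := by
  obtain ⟨C, hC, hK⟩ := K0_le
  have hl : Filter.Tendsto (fun ρ => ∫ θ in (0:ℝ)..π, K0 (√(ρ^2 + t^2 - 2*ρ*t*cos θ)))
      (nhdsWithin t (Iio t)) (nhds (∫ θ in (0:ℝ)..π, K0 (2 * t * sin (θ / 2)))) := by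
    refine intervalIntegral.tendsto_integral_filter_of_dominated_convergence
      (fun θ => C * (t * θ / π) ^ (-(1/8):ℝ)) ?_ ?_ ?_ ?_
    · filter_upwards [Ioo_mem_nhdsLT ht] with ρ hρ
      refine ContinuousOn.aestronglyMeasurable (fun θ hθ => ?_) measurableSet_uIoc
      refine ContinuousAt.continuousWithinAt ?_
      refine ContinuousAt.comp (g := fun Y => K0 (√Y)) (f := fun θ => ρ^2 + t^2 - 2*ρ*t*cos θ)
        (kY_deriv ?_).continuousAt (by fun_prop)
      have := cos_le_one θ
      have : ρ * t * cos θ ≤ ρ * t * 1 := by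
        apply mul_le_mul_of_nonneg_left this; nlinarith [hρ.1, hρ.2]
      nlinarith [mul_pos (sub_pos.2 hρ.2) (sub_pos.2 hρ.2)]
    · filter_upwards [Ioo_mem_nhdsLT (show t/2 < t by linarith)] with ρ hρ
      refine .of_forall fun θ hθ => ?_
      rw [uIoc_of_le pi_pos.le] at hθ
      have hp := pi_pos
      have s1 : θ / π ≤ sin (θ / 2) := by
        have := mul_le_sin (x := θ/2) (by linarith [hθ.1]) (by linarith [hθ.2])
        calc θ / π = 2 / π * (θ / 2) := by field_simp
          _ ≤ _ := this
      have hq : 0 < θ / π := div_pos hθ.1 hp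
      have hY : (t * θ / π)^2 ≤ ρ^2 + t^2 - 2*ρ*t*cos θ := by
        have hc : cos θ = 1 - 2 * sin (θ/2)^2 := by
          rw [← cos_sq_add_sin_sq (θ/2), show θ = 2 * (θ/2) by ring, cos_two_mul]; ring_nf
          rw [cos_sq']; ring
        have : (θ/π)^2 ≤ sin (θ/2)^2 := by gcongr
        have h3 : (t * θ / π)^2 = t^2 * (θ/π)^2 := by ring
        rw [hc, h3]
        have : t^2 * (θ/π)^2 ≤ t^2 * sin (θ/2)^2 := by gcongr
        have : 0 ≤ sin (θ/2)^2 := sq_nonneg _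
        have h5 : 0 ≤ t * (ρ - t/2) := mul_nonneg ht.le (by linarith [hρ.1])
        nlinarith [sq_nonneg (ρ - t), mul_nonneg h5 this]
      have hx : 0 < t * θ / π := by have := hθ.1; positivity
      have hx2 := le_sqrt_of_sq_le hY
      rw [norm_of_nonneg (K0_pos (hx.trans_le hx2)).le]
      refine (K0_antitone hx (hx.trans_le hx2) hx2).trans ((hK _ hx).trans ?_)
      have : exp (-(t * θ / π)/2) ≤ 1 := exp_le_one_iff.2 (by linarith)
      have : C * exp (-(t * θ / π)/2) ≤ C * 1 := by gcongr
      calc _ ≤ C * 1 * (t * θ / π) ^ (-(1/8):ℝ) := by gcongr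
        _ = _ := by rw [mul_one]
    · have : IntervalIntegrable (fun θ : ℝ => C * (t / π) ^ (-(1/8):ℝ) * θ ^ (-(1/8):ℝ)) volume 0 π :=
        (intervalIntegral.intervalIntegrable_rpow' (by norm_num)).const_mul _
      refine this.congr fun θ hθ => ?_
      rw [uIoc_of_le pi_pos.le] at hθ
      have := hθ.1.le
      rw [mul_assoc, ← mul_rpow (by positivity) (by positivity)]
      congr 2; ring
    · refine .of_forall fun θ hθ => ?_
      rw [uIoc_of_le pi_pos.le] at hθ
      have hs : 0 < sin (θ/2) := sin_pos_of_pos_of_lt_pi (by linarith [hθ.1]) (by linarith [hθ.2, pi_pos])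
      have e : t^2 + t^2 - 2*t*t*cos θ = (2 * t * sin (θ/2))^2 := by
        have hc : cos θ = 1 - 2 * sin (θ/2)^2 := by
          rw [show θ = 2 * (θ/2) by ring, cos_two_mul]; ring_nf
          rw [cos_sq']; ring
        rw [hc]; ring
      have hp : 0 < 2 * t * sin (θ/2) := by positivity
      have h := ContinuousAt.comp (x := t) (g := fun Y => K0 (√Y)) (f := fun ρ => ρ^2 + t^2 - 2*ρ*t*cos θ)
        (by rw [e]; exact (kY_deriv (by positivity)).continuousAt) (by fun_prop)
      have h2 := h.tendsto.mono_left (nhdsWithin_le_nhds (s := Iio t))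
      simp only [Function.comp_def] at h2
      rw [e, sqrt_sq hp.le] at h2
      exact h2
  have hr : Filter.Tendsto (fun ρ => ∫ θ in (0:ℝ)..π, K0 (√(ρ^2 + t^2 - 2*ρ*t*cos θ)))
      (nhdsWithin t (Iio t)) (nhds (π * K0 t * I0 t)) := by
    have := ((I0_deriv t).continuousAt.tendsto.mono_left (nhdsWithin_le_nhds (s := Iio t))).const_mul (π * K0 t)
    refine this.congr' ?_
    filter_upwards [Ioo_mem_nhdsLT ht] with ρ hρ using (graf ht hρ).symm
  have he := tendsto_nhds_unique hl hr
  have h2 := intervalIntegral.integral_comp_div (f := fun θ => K0 (2 * t * sin θ)) (a := 0) (b := π) (c := 2) two_ne_zero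
  rw [h2] at he
  simp only [zero_div, smul_eq_mul] at he
  unfold nn
  have : (2 / π) * ∫ θ in (0:ℝ)..(π/2), K0 (2 * t * sin θ) = (2 * ∫ θ in (0:ℝ)..(π/2), K0 (2 * t * sin θ)) / π := by ring
  rw [this, he]
  field_simp

end BL

namespace BL

/-- decreasing majorant -/
noncomputable def mj (s : ℝ) : ℝ := s ^ (-(1/8):ℝ) * exp (-(1/8) * s)

lemma mj_pos {s : ℝ} (hs : 0 < s) : 0 < mj s := by unfold mj; positivity

lemma mj_anti : AntitoneOn mj (Ioi 0) := by
  intro a ha b hb hab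
  have ha' : 0 < a := ha
  unfold mj
  have h1 : b ^ (-(1/8):ℝ) ≤ a ^ (-(1/8):ℝ) := rpow_le_rpow_of_nonpos ha' hab (by norm_num)
  have h2 : exp (-(1/8) * b) ≤ exp (-(1/8) * a) := exp_le_exp.2 (by linarith)
  have hb' : 0 < b := hb
  gcongr

lemma mj_int : IntegrableOn mj (Ioi 0) := by
  have := integrableOn_rpow_mul_exp_neg_mul_rpow (p := 1) (s := -(1/8)) (b := 1/8) (by norm_num) (by norm_num) (by norm_num)
  refine this.congr_fun (fun s _ => ?_) measurableSet_Ioi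
  simp [mj]

lemma mj_cont : ContinuousOn mj (Ioi 0) := by
  intro s hs
  have hs' : s ≠ 0 := (ne_of_lt hs).symm
  refine ContinuousAt.continuousWithinAt ?_
  unfold mj
  exact (continuousAt_rpow_const s _ (Or.inl hs')).mul (by fun_prop)

lemma sin_lower {t θ : ℝ} (ht : 0 < t) (hθ : θ ∈ Ioc 0 (π/2)) :
    0 < 4 * t / π * θ ∧ 4 * t / π * θ ≤ 2 * t * sin θ := by
  have hp := pi_pos
  have h0 := hθ.1
  refine ⟨by positivity, ?_⟩
  have := mul_le_sin hθ.1.le hθ.2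
  calc 4 * t / π * θ = 2 * t * (2 / π * θ) := by ring
    _ ≤ _ := by gcongr

lemma mjt_int {t : ℝ} (ht : 0 < t) : IntegrableOn (fun θ => mj (4 * t / π * θ)) (Ioi 0) := by
  have hp := pi_pos
  have := (integrableOn_Ioi_comp_mul_left_iff mj 0 (a := 4 * t / π) (by positivity)).2
  rw [mul_zero] at this
  exact this mj_int

/-- constant -/
noncomputable def mA : ℝ := π / 4 * ∫ s in Ioi 0, mj s

lemma mA_nonneg : 0 ≤ mA := by
  unfold mA
  have : 0 ≤ ∫ s in Ioi 0, mj s := setIntegral_nonneg measurableSet_Ioi fun s hs => (mj_pos hs).le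
  have := pi_pos
  positivity

lemma lemA_int {φ : ℝ → ℝ} {C t : ℝ} (ht : 0 < t) (hφ : ContinuousOn φ (Ioi 0))
    (hb : ∀ s, 0 < s → |φ s| ≤ C * mj s) (hC : 0 ≤ C) {w : ℝ → ℝ} (hw : Continuous w) (hw1 : ∀ θ, |w θ| ≤ 1) :
    IntervalIntegrable (fun θ => φ (2 * t * sin θ) * w θ) volume 0 (π/2) := by
  have hp : 0 ≤ π/2 := by have := pi_pos; positivity
  rw [intervalIntegrable_iff_integrableOn_Ioc_of_le hp]
  refine (((mjt_int ht).mono_set Ioc_subset_Ioi_self).const_mul C).mono' ?_ ?_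
  · refine ContinuousOn.aestronglyMeasurable (ContinuousOn.mul ?_ hw.continuousOn) measurableSet_Ioc
    exact hφ.comp (by fun_prop) fun θ hθ => (sin_lower ht hθ).1.trans_le (sin_lower ht hθ).2
  · refine (ae_restrict_mem measurableSet_Ioc).mono fun θ hθ => ?_
    obtain ⟨h1, h2⟩ := sin_lower ht hθ
    rw [norm_mul, Real.norm_eq_abs, Real.norm_eq_abs]
    calc |φ (2 * t * sin θ)| * |w θ| ≤ (C * mj (2 * t * sin θ)) * 1 := by
          have := hb _ (h1.trans_le h2)
          exact mul_le_mul this (hw1 θ) (abs_nonneg _) ((abs_nonneg _).trans this)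
      _ ≤ C * mj (4 * t / π * θ) := by
          rw [mul_one]; gcongr
          exact mj_anti h1 (h1.trans_le h2) h2

lemma lemA {φ : ℝ → ℝ} {C t : ℝ} (ht : 0 < t)
    (hb : ∀ s, 0 < s → |φ s| ≤ C * mj s) (hC : 0 ≤ C) {w : ℝ → ℝ} (hw1 : ∀ θ, |w θ| ≤ 1) :
    |∫ θ in (0:ℝ)..(π/2), φ (2 * t * sin θ) * w θ| ≤ C * mA / t := by
  have hp : 0 ≤ π/2 := by have := pi_pos; positivity
  have hpi := pi_pos
  have h1 : ‖∫ θ in (0:ℝ)..(π/2), φ (2 * t * sin θ) * w θ‖ ≤ ∫ θ in (0:ℝ)..(π/2), C * mj (4 * t / π * θ) := by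
    refine intervalIntegral.norm_integral_le_of_norm_le hp ?_ ?_
    · refine .of_forall fun θ hθ => ?_
      obtain ⟨h1, h2⟩ := sin_lower ht hθ
      rw [norm_mul, Real.norm_eq_abs, Real.norm_eq_abs]
      calc |φ (2 * t * sin θ)| * |w θ| ≤ (C * mj (2 * t * sin θ)) * 1 := by
            have := hb _ (h1.trans_le h2)
            exact mul_le_mul this (hw1 θ) (abs_nonneg _) ((abs_nonneg _).trans this)
        _ ≤ C * mj (4 * t / π * θ) := by
            rw [mul_one]; gcongr
            exact mj_anti h1 (h1.trans_le h2) h2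
    · rw [intervalIntegrable_iff_integrableOn_Ioc_of_le hp]
      exact (((mjt_int ht).mono_set Ioc_subset_Ioi_self).const_mul C)
  rw [Real.norm_eq_abs] at h1
  refine h1.trans ?_
  rw [intervalIntegral.integral_const_mul, intervalIntegral.integral_of_le hp, mul_div_assoc C mA t]
  refine mul_le_mul_of_nonneg_left ?_ hC
  calc ∫ θ in Ioc 0 (π/2), mj (4 * t / π * θ) ≤ ∫ θ in Ioi 0, mj (4 * t / π * θ) := by
        refine setIntegral_mono_set (mjt_int ht) ?_ (Filter.Eventually.of_forall Ioc_subset_Ioi_self)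
        refine (ae_restrict_mem measurableSet_Ioi).mono fun θ hθ => ?_
        have : 0 < θ := hθ
        exact (mj_pos (by positivity)).le
    _ = mA / t := by
        rw [integral_comp_mul_left_Ioi mj 0 (b := 4 * t / π) (by positivity), mul_zero, mA, smul_eq_mul]
        field_simp

lemma sq_exp_le {s : ℝ} (hs : 0 < s) : s ^ 2 * (s ^ (-(1/8):ℝ) * exp (-(1/4) * s)) ≤ 128 * mj s := by
  unfold mj
  have h := Real.pow_div_factorial_le_exp (s/8) (by positivity) 2
  have e : exp (-(1/4) * s) = exp (-(1/8) * s) * exp (-(s/8)) := by rw [← exp_add]; ring_nf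
  have h2 : s ^ 2 * exp (-(s/8)) ≤ 128 := by
    rw [exp_neg, ← div_eq_mul_inv, div_le_iff₀ (exp_pos _)]
    simp [Nat.factorial] at h
    nlinarith
  rw [e]
  have : 0 < s ^ (-(1/8):ℝ) * exp (-(1/8) * s) := by positivity
  nlinarith

lemma e4_le {s : ℝ} (hs : 0 < s) : s ^ (-(1/8):ℝ) * exp (-(1/4) * s) ≤ mj s := by
  unfold mj
  have : exp (-(1/4) * s) ≤ exp (-(1/8) * s) := exp_le_exp.2 (by linarith)
  gcongr

/-- bound function -/
noncomputable def ej (s : ℝ) : ℝ := s ^ (-(1/8):ℝ) * exp (-(1/4) * s)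

lemma ej_pos {s : ℝ} (hs : 0 < s) : 0 < ej s := by unfold ej; positivity

lemma ej_cube {s : ℝ} (hs : 0 < s) : s ^ 3 * ej s ≤ 416 := by
  unfold ej
  have h3 := Real.pow_div_factorial_le_exp (s/4) (by positivity) 3
  have h2 := Real.pow_div_factorial_le_exp (s/4) (by positivity) 2
  simp [Nat.factorial] at h2 h3
  have e : exp (-(1/4) * s) = (exp (s/4))⁻¹ := by rw [← exp_neg]; ring_nf
  have h1 : s ^ (-(1/8):ℝ) ≤ 1 + 1/s := by
    rcases le_total s 1 with h | h
    · have : s ^ (-(1/8):ℝ) ≤ s ^ (-1:ℝ) := rpow_le_rpow_of_exponent_ge hs h (by norm_num)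
      rw [rpow_neg_one] at this
      have e := one_div s
      linarith
    · have : s ^ (-(1/8):ℝ) ≤ 1 := rpow_le_one_of_one_le_of_nonpos h (by norm_num)
      have : 0 < 1/s := by positivity
      linarith
  rw [e]
  calc s ^ 3 * (s ^ (-(1/8):ℝ) * (exp (s/4))⁻¹) ≤ s ^ 3 * ((1 + 1/s) * (exp (s/4))⁻¹) := by gcongr
    _ = (s^3 + s^2) / exp (s/4) := by field_simp
    _ ≤ 416 := by
      rw [div_le_iff₀ (exp_pos _)]
      nlinarith

lemma one_sub_cos_le {θ : ℝ} (hθ : θ ∈ Icc 0 (π/2)) : |1 - cos θ| ≤ sin θ ^ 2 := by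
  have h0 : 0 ≤ cos θ := cos_nonneg_of_neg_pi_div_two_le_of_le (by linarith [hθ.1, pi_pos]) hθ.2
  have h1 := cos_le_one θ
  rw [abs_of_nonneg (by linarith), sin_sq]
  nlinarith

/-- cancellation lemma -/
lemma lemB {Ψ ψ : ℝ → ℝ} {C t : ℝ} (ht : 0 < t) (hC : 0 ≤ C)
    (hd : ∀ s, 0 < s → HasDerivAt Ψ (ψ s / s) s) (hψ : ContinuousOn ψ (Ioi 0))
    (hb : ∀ s, 0 < s → |Ψ s| ≤ C * ej s)
    (hb' : ∀ s, 0 < s → |ψ s| ≤ C * ej s) :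
    |∫ θ in (0:ℝ)..(π/2), (Ψ (2 * t * sin θ) + ψ (2 * t * sin θ))| ≤ C * (52 + 64 * mA) / t ^ 3 := by
  have hpi := pi_pos
  have hp : 0 ≤ π/2 := by positivity
  have hΨ : ContinuousOn Ψ (Ioi 0) := fun s hs => (hd s hs).continuousAt.continuousWithinAt
  set φ : ℝ → ℝ := fun s => Ψ s + ψ s with hφ
  have hφc : ContinuousOn φ (Ioi 0) := hΨ.add hψ
  have hφb : ∀ s, 0 < s → |φ s| ≤ (2 * C) * ej s := fun s hs =>
    (abs_add_le _ _).trans (by linarith [hb s hs, hb' s hs])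
  have hφm : ∀ s, 0 < s → |φ s| ≤ (2 * C) * mj s := fun s hs =>
    (hφb s hs).trans (mul_le_mul_of_nonneg_left (e4_le hs) (by linarith))
  have hI1 := lemA_int ht hφc hφm (by linarith) continuous_cos abs_cos_le_one
  have hI2 := lemA_int ht hφc hφm (by linarith) (w := fun _ => 1) continuous_const (by simp)
  have hI3 := hI2.sub hI1
  have e1 : ∫ θ in (0:ℝ)..(π/2), φ (2 * t * sin θ) * cos θ = Ψ (2 * t) := by
    have h := intervalIntegral.integral_eq_sub_of_hasDeriv_right_of_le (a := 0) (b := π/2) hp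
      (f := fun θ => if θ = 0 then 0 else sin θ * Ψ (2 * t * sin θ))
      (f' := fun θ => φ (2 * t * sin θ) * cos θ) ?_ ?_ hI1
    · rw [h]; simp [hpi.ne']
    · intro θ hθ
      rcases hθ.1.eq_or_lt with h0 | h0
      · subst h0
        rw [← Ioc_insert_left hp, continuousWithinAt_insert_self]
        have hl : Filter.Tendsto (fun θ : ℝ => C * (sin θ * ej (2 * t * sin θ))) (nhdsWithin 0 (Ioc 0 (π/2))) (nhds 0) := by
          have h1 : Filter.Tendsto (fun θ : ℝ => C * ((2*t) ^ (-(1/8):ℝ) * (sin θ) ^ (7/8:ℝ))) (nhdsWithin 0 (Ioc 0 (π/2))) (nhds 0) := by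
            have : ContinuousAt (fun θ : ℝ => C * ((2*t) ^ (-(1/8):ℝ) * (sin θ) ^ (7/8:ℝ))) 0 := by
              refine continuousAt_const.mul (continuousAt_const.mul ?_)
              exact continuous_sin.continuousAt.rpow_const (Or.inr (by norm_num))
            have := this.tendsto.mono_left (nhdsWithin_le_nhds (s := Ioc 0 (π/2)))
            simpa [zero_rpow] using this
          refine squeeze_zero' ?_ ?_ h1
          · filter_upwards [self_mem_nhdsWithin] with θ hθ
            have hs : 0 < sin θ := sin_pos_of_pos_of_lt_pi hθ.1 (by linarith [hθ.2])
            have := ej_pos (s := 2 * t * sin θ) (by positivity)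
            positivity
          · filter_upwards [self_mem_nhdsWithin] with θ hθ
            have hs : 0 < sin θ := sin_pos_of_pos_of_lt_pi hθ.1 (by linarith [hθ.2])
            refine mul_le_mul_of_nonneg_left ?_ hC
            unfold ej
            rw [mul_rpow (by positivity) hs.le]
            have e : sin θ ^ (7/8:ℝ) = sin θ * sin θ ^ (-(1/8):ℝ) := by
              nth_rewrite 2 [← rpow_one (sin θ)]
              rw [← rpow_add hs]; norm_num
            have h1 : exp (-(1/4) * (2 * t * sin θ)) ≤ 1 := exp_le_one_iff.2 (by nlinarith [mul_pos ht hs])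
            have h2 : 0 < sin θ * ((2*t) ^ (-(1/8):ℝ) * sin θ ^ (-(1/8):ℝ)) := by positivity
            rw [e]; nlinarith
        rw [ContinuousWithinAt]
        simp only [if_true]
        refine squeeze_zero_norm' ?_ hl
        filter_upwards [self_mem_nhdsWithin] with θ hθ
        have hs : 0 < sin θ := sin_pos_of_pos_of_lt_pi hθ.1 (by linarith [hθ.2])
        rw [if_neg hθ.1.ne', norm_mul, Real.norm_eq_abs, Real.norm_eq_abs, abs_of_pos hs]
        nlinarith [hb (2 * t * sin θ) (by positivity)]
      · have hs : 0 < sin θ := sin_pos_of_pos_of_lt_pi h0 (by linarith [hθ.2])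
        have : ContinuousAt (fun θ => sin θ * Ψ (2 * t * sin θ)) θ := by
          refine continuous_sin.continuousAt.mul ?_
          exact ContinuousAt.comp (f := fun θ => 2 * t * sin θ) (g := Ψ) (hd _ (by positivity)).continuousAt (by fun_prop)
        refine (this.congr ?_).continuousWithinAt
        filter_upwards [isOpen_ne.mem_nhds h0.ne'] with y hy
        rw [if_neg hy]
    · intro θ hθ
      have hs : 0 < sin θ := sin_pos_of_pos_of_lt_pi hθ.1 (by linarith [hθ.2])
      have h1 := (hd (2 * t * sin θ) (by positivity)).comp θ ((hasDerivAt_sin θ).const_mul (2*t))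
      have h2 := (hasDerivAt_sin θ).fun_mul h1
      refine HasDerivAt.hasDerivWithinAt ?_
      refine (h2.congr_of_eventuallyEq ?_).congr_deriv ?_
      · filter_upwards [isOpen_ne.mem_nhds hθ.1.ne'] with y hy
        rw [if_neg hy]; rfl
      · simp only [hφ, Function.comp]; field_simp
  have e2 : ∫ θ in (0:ℝ)..(π/2), (Ψ (2 * t * sin θ) + ψ (2 * t * sin θ)) =
      Ψ (2 * t) + ∫ θ in (0:ℝ)..(π/2), φ (2 * t * sin θ) * (1 - cos θ) := by
    rw [← e1, ← intervalIntegral.integral_add hI1]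
    · congr 1; ext θ; simp only [hφ]; ring
    · refine hI3.congr ?_
      intro θ _; simp only; ring
  have e3 : ∫ θ in (0:ℝ)..(π/2), φ (2 * t * sin θ) * (1 - cos θ) =
      (1/(4*t^2)) * ∫ θ in (0:ℝ)..(π/2), (fun s => s^2 * φ s) (2 * t * sin θ) * ((if θ ∈ Ioc 0 (π/2) then (1 - cos θ)/ sin θ ^2 else 0)) := by
    rw [← intervalIntegral.integral_const_mul]
    rw [intervalIntegral.integral_of_le hp, intervalIntegral.integral_of_le hp]
    refine setIntegral_congr_fun measurableSet_Ioc fun θ hθ => ?_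
    have hs : 0 < sin θ := sin_pos_of_pos_of_lt_pi hθ.1 (by linarith [hθ.2])
    simp only [if_pos hθ]
    generalize φ (2 * t * sin θ) = y
    field_simp
    ring
  have e4 := lemA (φ := fun s => s^2 * φ s) (C := 2 * C * 128) ht ?_ (by linarith)
    (w := fun θ => (if θ ∈ Ioc 0 (π/2) then (1 - cos θ)/ sin θ ^2 else 0)) ?_
  · rw [e2, e3]
    refine (abs_add_le _ _).trans ?_
    have h1 : |Ψ (2 * t)| ≤ C * 52 / t^3 := by
      refine (hb _ (by positivity)).trans ?_
      have := ej_cube (s := 2 * t) (by positivity)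
      rw [mul_div_assoc]
      refine mul_le_mul_of_nonneg_left ?_ hC
      rw [le_div_iff₀ (by positivity)]
      nlinarith
    rw [abs_mul, abs_of_pos (by positivity : 0 < 1/(4*t^2))]
    calc _ ≤ C * 52 / t^3 + 1/(4*t^2) * (2 * C * 128 * mA / t) := by gcongr
      _ = _ := by field_simp; ring
  · intro s hs
    rw [abs_mul, abs_of_pos (by positivity : 0 < s^2)]
    have h1 := hφb s hs
    have h2 := sq_exp_le hs
    calc s^2 * |φ s| ≤ s^2 * (2 * C * ej s) := by gcongr
      _ = 2 * C * (s^2 * (s ^ (-(1/8):ℝ) * exp (-(1/4) * s))) := by unfold ej; ring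
      _ ≤ _ := by rw [mul_assoc (2*C)]; gcongr
  · intro θ
    split_ifs with h
    · have hs : 0 < sin θ := sin_pos_of_pos_of_lt_pi h.1 (by linarith [h.2])
      rw [abs_div, abs_of_pos (by positivity : 0 < sin θ^2)]
      rw [div_le_one (by positivity)]
      exact one_sub_cos_le ⟨h.1.le, h.2⟩
    · simp

lemma lemD {Ψ ψ : ℝ → ℝ} {C t : ℝ} (ht : 0 < t) (hC : 0 ≤ C)
    (hd : ∀ s, 0 < s → HasDerivAt Ψ (ψ s / s) s) (hψ : ContinuousOn ψ (Ioi 0))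
    (hb : ∀ s, 0 < s → |Ψ s| ≤ C * mj s)
    (hb' : ∀ s, 0 < s → |ψ s| ≤ C * mj s) :
    HasDerivAt (fun t => ∫ θ in (0:ℝ)..(π/2), Ψ (2 * t * sin θ)) ((∫ θ in (0:ℝ)..(π/2), ψ (2 * t * sin θ)) / t) t := by
  have hpi := pi_pos
  have hp : 0 ≤ π/2 := by positivity
  have hΨ : ContinuousOn Ψ (Ioi 0) := fun s hs => (hd s hs).continuousAt.continuousWithinAt
  rw [div_eq_inv_mul (∫ θ in (0:ℝ)..(π/2), ψ (2 * t * sin θ)) t, ← intervalIntegral.integral_const_mul]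
  have hm : ∀ x, 0 < x → ∀ φ : ℝ → ℝ, ContinuousOn φ (Ioi 0) → AEStronglyMeasurable (fun θ => φ (2 * x * sin θ)) (volume.restrict (Set.uIoc 0 (π/2))) := by
    intro x hx φ hφ
    rw [uIoc_of_le hp]
    refine ContinuousOn.aestronglyMeasurable ?_ measurableSet_Ioc
    exact hφ.comp (by fun_prop) fun θ hθ => (sin_lower hx hθ).1.trans_le (sin_lower hx hθ).2
  refine (intervalIntegral.hasDerivAt_integral_of_dominated_loc_of_deriv_le (s := Ioi (t/2))
    (F' := fun t θ => t⁻¹ * ψ (2 * t * sin θ)) (bound := fun θ => (2/t) * (C * mj (4 * (t/2) / π * θ))) (Ioi_mem_nhds (by linarith)) ?_ ?_ ?_ ?_ ?_ ?_).2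
  · filter_upwards [Ioi_mem_nhds ht] with x hx using hm x hx _ hΨ
  · simpa using lemA_int ht hΨ hb hC (w := fun _ => 1) continuous_const (by simp)
  · exact (hm t ht _ hψ).const_mul _
  · refine .of_forall fun θ hθ x hx => ?_
    rw [uIoc_of_le hp] at hθ
    have hx : t/2 < x := hx
    have hx0 : 0 < x := by linarith
    obtain ⟨h1, h2⟩ := sin_lower (half_pos ht) hθ
    have hs : 0 < sin θ := sin_pos_of_pos_of_lt_pi hθ.1 (by linarith [hθ.2])
    have h3 : 2 * (t/2) * sin θ ≤ 2 * x * sin θ := by gcongr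
    rw [norm_mul, norm_inv, Real.norm_eq_abs, Real.norm_eq_abs, abs_of_pos hx0]
    have h4 : x⁻¹ ≤ 2/t := by rw [inv_le_comm₀ hx0 (by positivity)]; rw [inv_div]; exact hx.le
    have h5 := hb' (2 * x * sin θ) (by positivity)
    have h6 := mj_anti h1 (h1.trans_le (h2.trans h3)) (h2.trans h3)
    have h7 : |ψ (2 * x * sin θ)| ≤ C * mj (4 * (t/2) / π * θ) := h5.trans (by gcongr)
    gcongr
  · rw [intervalIntegrable_iff_integrableOn_Ioc_of_le hp]
    exact (((mjt_int (half_pos ht)).mono_set Ioc_subset_Ioi_self).const_mul C).const_mul _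
  · refine .of_forall fun θ hθ x hx => ?_
    rw [uIoc_of_le hp] at hθ
    have hx : t/2 < x := hx
    have hx0 : 0 < x := by linarith
    have hs : 0 < sin θ := sin_pos_of_pos_of_lt_pi hθ.1 (by linarith [hθ.2])
    have h1 := (hd (2 * x * sin θ) (by positivity)).comp x (((hasDerivAt_id x).const_mul 2).mul_const (sin θ))
    refine h1.congr_deriv ?_
    generalize ψ (2 * x * sin θ) = y
    field_simp

end BL

namespace BL

noncomputable def n1 (t : ℝ) : ℝ := t * I1 t * K0 t - I0 t * (t * K1 t)
noncomputable def n2 (t : ℝ) : ℝ := 2 * t^2 * nn t - 2 * (t * I1 t) * (t * K1 t)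
noncomputable def n3 (t : ℝ) : ℝ := 4 * t^2 * (nn t + n1 t)
noncomputable def n4 (t : ℝ) : ℝ := 8 * t^2 * (nn t + n1 t) + 4 * t^2 * (n1 t + n2 t)

lemma nn_d {t : ℝ} (ht : 0 < t) : HasDerivAt nn (n1 t / t) t := by
  refine ((I0_deriv t).fun_mul (K0_deriv ht)).congr_deriv ?_
  unfold n1; field_simp; ring

lemma n1_d {t : ℝ} (ht : 0 < t) : HasDerivAt n1 (n2 t / t) t := by
  refine (((tI1_deriv t).fun_mul (K0_deriv ht)).fun_sub ((I0_deriv t).fun_mul (tK1_deriv ht))).congr_deriv ?_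
  unfold n2 nn; field_simp; ring

lemma n2_d {t : ℝ} (ht : 0 < t) : HasDerivAt n2 (n3 t / t) t := by
  have h1 := (((hasDerivAt_pow 2 t).const_mul 2).fun_mul (nn_d ht)).fun_sub
    ((((tI1_deriv t).const_mul 2)).fun_mul (tK1_deriv ht))
  refine h1.congr_deriv ?_
  unfold n3 n1 nn; field_simp; ring

lemma n3_d {t : ℝ} (ht : 0 < t) : HasDerivAt n3 (n4 t / t) t := by
  have h1 := (((hasDerivAt_pow 2 t).const_mul 4).fun_mul ((nn_d ht).fun_add (n1_d ht)))
  refine h1.congr_deriv ?_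
  unfold n4; field_simp; ring

noncomputable def k1 (s : ℝ) : ℝ := -(s * K1 s)
noncomputable def k2 (s : ℝ) : ℝ := s^2 * K0 s
noncomputable def k3 (s : ℝ) : ℝ := 2 * s^2 * K0 s - s^2 * (s * K1 s)

lemma k0_d {s : ℝ} (hs : 0 < s) : HasDerivAt K0 (k1 s / s) s :=
  (K0_deriv hs).congr_deriv (by unfold k1; field_simp)
lemma k1_d {s : ℝ} (hs : 0 < s) : HasDerivAt k1 (k2 s / s) s :=
  ((tK1_deriv hs).fun_neg).congr_deriv (by unfold k2; field_simp)
lemma k2_d {s : ℝ} (hs : 0 < s) : HasDerivAt k2 (k3 s / s) s :=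
  ((hasDerivAt_pow 2 s).fun_mul (K0_deriv hs)).congr_deriv (by unfold k3; field_simp; ring)

lemma k3_c : ContinuousOn k3 (Ioi 0) := by
  intro s hs
  have h1 := (K0_deriv hs).continuousAt
  have h2 := (tK1_deriv hs).continuousAt
  refine ContinuousAt.continuousWithinAt ?_
  unfold k3
  exact (by fun_prop : ContinuousAt (fun s : ℝ => 2 * s^2) s).mul h1 |>.sub ((by fun_prop : ContinuousAt (fun s : ℝ => s^2) s).mul h2)

set_option maxHeartbeats 1000000 in
lemma k_bounds : ∃ C : ℝ, 0 < C ∧ ∀ s : ℝ, 0 < s → |K0 s| ≤ C * ej s ∧ |k1 s| ≤ C * ej s ∧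
    |k2 s| ≤ C * ej s ∧ |k3 s| ≤ C * ej s ∧ |k1 s| ≤ C ∧ |k2 s| ≤ C * s := by
  obtain ⟨C, hC, hK⟩ := K0_le
  refine ⟨6000 * C + 6000, by positivity, fun s hs => ?_⟩
  have hk0 := K0_pos hs
  obtain ⟨hl, hu⟩ := tK1_bounds hs
  have he := exp_pos (-s)
  have h3 := Real.pow_div_factorial_le_exp (s/4) (by positivity) 3
  have h2 := Real.pow_div_factorial_le_exp (s/4) (by positivity) 2
  have h1 := Real.pow_div_factorial_le_exp (s/4) (by positivity) 1
  have h0 := Real.pow_div_factorial_le_exp (s/4) (by positivity) 0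
  simp [Nat.factorial] at h3 h2 h1
  have hK' := hK s hs
  have ee : exp (-s/2) = exp (-(1/4)*s) * (exp (s/4))⁻¹ := by
    rw [← exp_neg, ← exp_add]; ring_nf
  have hq : K0 s * exp (s/4) ≤ C * ej s := by
    rw [ee] at hK'
    calc K0 s * exp (s/4) ≤ C * (exp (-(1/4)*s) * (exp (s/4))⁻¹) * s ^ (-(1/8):ℝ) * exp (s/4) := by gcongr
      _ = C * ej s := by unfold ej; field_simp
  have hej := ej_pos hs
  have g0 : K0 s ≤ C * ej s := by
    have : 1 ≤ exp (s/4) := one_le_exp (by positivity)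
    nlinarith
  have g1 : s * K0 s ≤ 4 * C * ej s := by nlinarith
  have g2 : s^2 * K0 s ≤ 32 * C * ej s := by nlinarith
  have g3 : s^3 * K0 s ≤ 384 * C * ej s := by nlinarith
  have x0 : exp (-(3*s/4)) ≤ 2 * s ^ (-(1/8):ℝ) := by
    have := exp_neg_le_rpow (x := 3*s/4) (e := 1/8) (by positivity) (by norm_num) (by norm_num)
    have h4 : (3*s/4) ^ (-(1/8):ℝ) ≤ (s/256) ^ (-(1/8):ℝ) := rpow_le_rpow_of_nonpos (by positivity) (by linarith) (by norm_num)
    have h5 : (s/256) ^ (-(1/8):ℝ) = 2 * s ^ (-(1/8):ℝ) := by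
      rw [div_rpow hs.le (by norm_num), show (256:ℝ) = 2 ^ (8:ℝ) by norm_num, ← rpow_mul (by norm_num)]
      norm_num [rpow_neg_one]; ring
    linarith
  have x1 : exp (-s) ≤ 2 * ej s := by
    have : exp (-s) = exp (-(3*s/4)) * exp (-(1/4)*s) := by rw [← exp_add]; ring_nf
    rw [this]; unfold ej
    nlinarith [exp_pos (-(1/4)*s)]
  have x2 : s^2 * exp (-s) ≤ 64 * 64 * ej s := by
    have h7 : s ^ (1/8:ℝ) ≤ 1 + s := by
      rcases le_total s 1 with h | h
      · have := rpow_le_one hs.le h (by norm_num : (0:ℝ) ≤ 1/8); linarith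
      · have := rpow_le_rpow_of_exponent_le h (by norm_num : (1/8:ℝ) ≤ 1)
        rw [rpow_one] at this; linarith
    have h8 : 1 = s ^ (1/8:ℝ) * s ^ (-(1/8):ℝ) := by rw [← rpow_add hs]; norm_num
    have e' : exp (-s) = exp (-(3*s/16)) * exp (-(3*s/16)) *(exp (-(3*s/16)) * exp (-(3*s/16))) * exp (-(1/4)*s) := by
      simp only [← exp_add]; ring_nf
    have h6' : s * exp (-(3*s/16)) ≤ 6 := by
      have := Real.add_one_le_exp (3*s/16)
      rw [exp_neg, ← div_eq_mul_inv, div_le_iff₀ (exp_pos _)]; linarith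
    set y := exp (-(3*s/16)) with hy
    have hy0 : 0 < y := exp_pos _
    have hy1 : y ≤ 1 := exp_le_one_iff.2 (by linarith)
    have h11 : s^2 * (y*y*(y*y)) * s ^ (1/8:ℝ) ≤ 64*64 := by
      have a1 : (s*y)*(s*y) ≤ 6*6 := by gcongr
      have a2 : (1+s)*y ≤ 7 := by nlinarith
      calc s^2 * (y*y*(y*y)) * s ^ (1/8:ℝ) ≤ s^2 * (y*y*(y*y)) * (1+s) := by gcongr
        _ = (s*y)*(s*y)*((1+s)*y)*y := by ring
        _ ≤ (6*6)*7*1 := by gcongr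
        _ ≤ _ := by norm_num
    calc s^2 * exp (-s) = s^2 * (y*y*(y*y)) * (s ^ (1/8:ℝ) * s ^ (-(1/8):ℝ)) * exp (-(1/4)*s) := by rw [e', ← h8]; ring
      _ = (s^2 * (y*y*(y*y)) * s ^ (1/8:ℝ)) * ej s := by unfold ej; ring
      _ ≤ _ := by gcongr
  have hkk : 0 < s * K1 s := he.trans_le hl
  have z1 : s * K1 s ≤ (2 + 4 * C) * ej s := by linarith
  have z2 : s^2 * (s * K1 s) ≤ (64*64 + 384 * C) * ej s := by nlinarith
  have hCe : 0 < C * ej s := by positivity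
  have w1 : s * K0 s ≤ 8 * C + 8 := by
    have hz : s * K0 s ≤ s * (C * exp (-s/2) * s ^ (-(1/8):ℝ)) := by gcongr
    have q1 : s * s ^ (-(1/8):ℝ) = s ^ (7/8:ℝ) := by
      nth_rewrite 1 [← rpow_one s]; rw [← rpow_add hs]; norm_num
    have q2 : s ^ (7/8:ℝ) ≤ 1 + s := by
      rcases le_total s 1 with h | h
      · have := rpow_le_one hs.le h (by norm_num : (0:ℝ) ≤ 7/8); linarith
      · have := rpow_le_rpow_of_exponent_le h (by norm_num : (7/8:ℝ) ≤ 1)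
        rw [rpow_one] at this; linarith
    have q3 : (1 + s) * exp (-s/2) ≤ 3 := by
      have := Real.add_one_le_exp (s/2)
      rw [show -s/2 = -(s/2) by ring, exp_neg, ← div_eq_mul_inv, div_le_iff₀ (exp_pos _)]; linarith
    have q4 : s ^ (7/8:ℝ) * exp (-s/2) ≤ 3 := le_trans (by gcongr) q3
    have : s * (C * exp (-s/2) * s ^ (-(1/8):ℝ)) = C * (s ^ (7/8:ℝ) * exp (-s/2)) := by rw [← q1]; ring
    nlinarith
  refine ⟨?_, ?_, ?_, ?_, ?_, ?_⟩
  · rw [abs_of_pos hk0]; linarith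
  · unfold k1; rw [abs_neg, abs_of_pos hkk]; linarith
  · unfold k2; rw [abs_of_pos (by positivity)]; linarith
  · unfold k3; rw [abs_le]
    have p1 := mul_pos (pow_pos hs 2) hkk
    have p2 := mul_pos (pow_pos hs 2) hk0
    constructor <;> linarith
  · unfold k1; rw [abs_neg, abs_of_pos hkk]
    have : exp (-s) ≤ 1 := exp_le_one_iff.2 (by linarith)
    nlinarith
  · unfold k2; rw [abs_of_pos (by positivity)]
    nlinarith

lemma nk_int {t : ℝ} (ht : 0 < t) :
    n1 t = (2/π) * (∫ θ in (0:ℝ)..(π/2), k1 (2 * t * sin θ)) ∧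
    n2 t = (2/π) * (∫ θ in (0:ℝ)..(π/2), k2 (2 * t * sin θ)) ∧
    n3 t = (2/π) * (∫ θ in (0:ℝ)..(π/2), k3 (2 * t * sin θ)) := by
  obtain ⟨C, hC, hb⟩ := k_bounds
  have key : ∀ (Ψ ψ N M : ℝ → ℝ), (∀ s, 0 < s → HasDerivAt Ψ (ψ s / s) s) → ContinuousOn ψ (Ioi 0) →
      (∀ s, 0 < s → |Ψ s| ≤ C * ej s) → (∀ s, 0 < s → |ψ s| ≤ C * ej s) →
      (∀ t, 0 < t → HasDerivAt N (M t / t) t) → (∀ t, 0 < t → N t = (2/π) * ∫ θ in (0:ℝ)..(π/2), Ψ (2 * t * sin θ)) →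
      ∀ t, 0 < t → M t = (2/π) * ∫ θ in (0:ℝ)..(π/2), ψ (2 * t * sin θ) := by
    intro Ψ ψ N M h1 h2 h3 h4 h5 h6 t ht
    have hm : ∀ s, 0 < s → C * ej s ≤ C * mj s := fun s hs => mul_le_mul_of_nonneg_left (e4_le hs) hC.le
    have d1 := (lemD ht hC.le h1 h2 (fun s hs => (h3 s hs).trans (hm s hs)) (fun s hs => (h4 s hs).trans (hm s hs))).const_mul (2/π)
    have d2 := h5 t ht
    have d3 := d1.congr_of_eventuallyEq (f₁ := N) (by
      filter_upwards [Ioi_mem_nhds ht] with x hx using h6 x hx)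
    have := d2.unique d3
    rw [← mul_div_assoc] at this
    exact (div_left_inj' ht.ne').1 this
  have c1 : ContinuousOn k1 (Ioi 0) := fun s hs => (k1_d hs).continuousAt.continuousWithinAt
  have c2 : ContinuousOn k2 (Ioi 0) := fun s hs => (k2_d hs).continuousAt.continuousWithinAt
  have r1 := key K0 k1 nn n1 (fun s hs => k0_d hs) c1 (fun s hs => (hb s hs).1) (fun s hs => (hb s hs).2.1)
    (fun t ht => nn_d ht) (fun t ht => nn_formula ht)
  have r2 := key k1 k2 n1 n2 (fun s hs => k1_d hs) c2 (fun s hs => (hb s hs).2.1) (fun s hs => (hb s hs).2.2.1)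
    (fun t ht => n1_d ht) r1
  have r3 := key k2 k3 n2 n3 (fun s hs => k2_d hs) k3_c (fun s hs => (hb s hs).2.2.1) (fun s hs => (hb s hs).2.2.2.1)
    (fun t ht => n2_d ht) r2
  exact ⟨r1 t ht, r2 t ht, r3 t ht⟩

lemma n_bounds : ∃ C : ℝ, 0 < C ∧ ∀ t : ℝ, 0 < t →
    |nn t| ≤ C / t ∧ |n1 t| ≤ C / t ∧ |n2 t| ≤ C / t ∧
    |nn t + n1 t| ≤ C / t^3 ∧ |n1 t + n2 t| ≤ C / t^3 ∧ |n2 t + n3 t| ≤ C / t^3 ∧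
    |nn t| ≤ C * t ^ (-(1/8):ℝ) ∧ |n1 t| ≤ C ∧ |n2 t| ≤ C * t := by
  obtain ⟨C, hC, hb⟩ := k_bounds
  obtain ⟨D, hD, hK⟩ := K0_le
  have hmA := mA_nonneg
  have hpi := pi_pos
  have hp : 0 ≤ π/2 := by positivity
  have hpi2 : 2/π ≤ 1 := by rw [div_le_one hpi]; exact two_le_pi
  set E := C * (52 + 64 * mA) + C * mA + 2 * C + D * 3 with hE
  have hE1 : C * (52 + 64 * mA) ≤ E := by have : 0 ≤ C * mA := by positivity
                                          linarith
  have hE2 : C * mA ≤ E := by have : 0 ≤ C * (52 + 64 * mA) := by positivity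
                              linarith
  have hE3 : 2 * C ≤ E := by have : 0 ≤ C * (52 + 64 * mA) := by positivity
                             have : 0 ≤ C * mA := by positivity
                             linarith
  have hE4 : D * 3 ≤ E := by have : 0 ≤ C * (52 + 64 * mA) := by positivity
                             have : 0 ≤ C * mA := by positivity
                             linarith
  have hEp : 0 < E := by linarith
  have c0 : ContinuousOn K0 (Ioi 0) := fun s hs => (k0_d hs).continuousAt.continuousWithinAt
  have c1 : ContinuousOn k1 (Ioi 0) := fun s hs => (k1_d hs).continuousAt.continuousWithinAt
  have c2 : ContinuousOn k2 (Ioi 0) := fun s hs => (k2_d hs).continuousAt.continuousWithinAt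
  have hm : ∀ s, 0 < s → C * ej s ≤ C * mj s := fun s hs => mul_le_mul_of_nonneg_left (e4_le hs) hC.le
  refine ⟨E, hEp, fun t ht => ?_⟩
  obtain ⟨i1, i2, i3⟩ := nk_int ht
  have i0 := nn_formula ht
  have ab : ∀ x y : ℝ, |x| ≤ y → |2/π * x| ≤ y := by
    intro x y h
    rw [abs_mul, abs_of_pos (by positivity : 0 < 2/π)]
    nlinarith [abs_nonneg x]
  have pA : ∀ φ : ℝ → ℝ, (∀ s, 0 < s → |φ s| ≤ C * ej s) → |2/π * ∫ θ in (0:ℝ)..(π/2), φ (2 * t * sin θ)| ≤ E / t := by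
    intro φ h
    apply ab
    have := lemA ht (fun s hs => (h s hs).trans (hm s hs)) hC.le (w := fun _ => 1) (by simp)
    simp only [mul_one] at this
    exact this.trans (by gcongr)
  have pI : ∀ φ : ℝ → ℝ, ContinuousOn φ (Ioi 0) → (∀ s, 0 < s → |φ s| ≤ C * ej s) → IntervalIntegrable (fun θ => φ (2 * t * sin θ)) volume 0 (π/2) := by
    intro φ h1 h
    simpa using lemA_int ht h1 (fun s hs => (h s hs).trans (hm s hs)) hC.le (w := fun _ => 1) continuous_const (by simp)
  have pB : ∀ Ψ ψ : ℝ → ℝ, (∀ s, 0 < s → HasDerivAt Ψ (ψ s / s) s) → ContinuousOn ψ (Ioi 0) →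
      (∀ s, 0 < s → |Ψ s| ≤ C * ej s) → (∀ s, 0 < s → |ψ s| ≤ C * ej s) →
      |2/π * (∫ θ in (0:ℝ)..(π/2), Ψ (2 * t * sin θ)) + 2/π * (∫ θ in (0:ℝ)..(π/2), ψ (2 * t * sin θ))| ≤ E / t^3 := by
    intro Ψ ψ h1 h2 h3 h4
    rw [← mul_add, ← intervalIntegral.integral_add (pI _ (fun s hs => (h1 s hs).continuousAt.continuousWithinAt) h3) (pI _ h2 h4)]
    apply ab
    exact (lemB ht hC.le h1 h2 h3 h4).trans (by gcongr)
  have hn := pA K0 (fun s hs => (hb s hs).1)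
  rw [← i0] at hn
  refine ⟨hn, ?_, ?_, ?_, ?_, ?_, ?_, ?_, ?_⟩
  · rw [i1]; exact pA k1 (fun s hs => (hb s hs).2.1)
  · rw [i2]; exact pA k2 (fun s hs => (hb s hs).2.2.1)
  · rw [i0, i1]; exact pB _ _ (fun s hs => k0_d hs) c1 (fun s hs => (hb s hs).1) (fun s hs => (hb s hs).2.1)
  · rw [i1, i2]; exact pB _ _ (fun s hs => k1_d hs) c2 (fun s hs => (hb s hs).2.1) (fun s hs => (hb s hs).2.2.1)
  · rw [i2, i3]; exact pB _ _ (fun s hs => k2_d hs) k3_c (fun s hs => (hb s hs).2.2.1) (fun s hs => (hb s hs).2.2.2.1)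
  · rcases le_total t 1 with h | h
    · have h0 := K0_pos ht
      have h1 := I0_pos t
      have h2 := I0_le ht.le
      have h3 := hK t ht
      have h4 : exp t * exp (-t/2) ≤ 3 := by
        rw [← exp_add]
        have : exp (t + -t/2) ≤ exp 1 := exp_le_exp.2 (by linarith)
        linarith [exp_one_lt_d9]
      unfold nn
      rw [abs_of_pos (by positivity)]
      calc I0 t * K0 t ≤ exp t * (D * exp (-t/2) * t ^ (-(1/8):ℝ)) := by gcongr
        _ = D * (exp t * exp (-t/2)) * t ^ (-(1/8):ℝ) := by ring
        _ ≤ E * t ^ (-(1/8):ℝ) := by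
          have : D * (exp t * exp (-t/2)) ≤ E := le_trans (by gcongr) hE4
          gcongr
    · refine hn.trans ?_
      rw [div_eq_mul_inv, ← rpow_neg_one t]
      have : t ^ (-1:ℝ) ≤ t ^ (-(1/8):ℝ) := rpow_le_rpow_of_exponent_le h (by norm_num)
      gcongr
  · rw [i1]
    rw [abs_mul, abs_of_pos (by positivity : 0 < 2/π)]
    have := intervalIntegral.norm_integral_le_of_norm_le_const (a := 0) (b := π/2) (C := C) (f := fun θ => k1 (2 * t * sin θ)) (by
      intro θ hθ
      rw [uIoc_of_le hp] at hθ
      exact (hb _ ((sin_lower ht hθ).1.trans_le (sin_lower ht hθ).2)).2.2.2.2.1)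
    rw [Real.norm_eq_abs, sub_zero, abs_of_nonneg hp] at this
    calc _ ≤ 2/π * (C * (π/2)) := by gcongr
      _ = C := by field_simp
      _ ≤ E := by linarith
  · rw [i2]
    rw [abs_mul, abs_of_pos (by positivity : 0 < 2/π)]
    have := intervalIntegral.norm_integral_le_of_norm_le_const (a := 0) (b := π/2) (C := 2 * C * t) (f := fun θ => k2 (2 * t * sin θ)) (by
      intro θ hθ
      rw [uIoc_of_le hp] at hθ
      refine (hb _ ((sin_lower ht hθ).1.trans_le (sin_lower ht hθ).2)).2.2.2.2.2.trans ?_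
      have := sin_le_one θ
      nlinarith [mul_pos hC ht])
    rw [Real.norm_eq_abs, sub_zero, abs_of_nonneg hp] at this
    calc _ ≤ 2/π * (2 * C * t * (π/2)) := by gcongr
      _ = 2 * C * t := by field_simp
      _ ≤ E * t := by gcongr

end BL

namespace BL

lemma const_of {S : Set ℝ} (hS : IsOpen S) (hp : IsPreconnected S) {f : ℝ → ℝ} {c : ℝ}
    (h : ∀ x ∈ S, HasDerivAt f 0 x) {l : Filter ℝ} [l.NeBot] (hl : S ∈ l)
    (hc : Filter.Tendsto f l (nhds c)) : ∀ x ∈ S, f x = c := by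
  intro x hx
  have hcst : ∀ y ∈ S, f y = f x := fun y hy =>
    hS.is_const_of_deriv_eq_zero hp (fun z hz => (h z hz).differentiableAt.differentiableWithinAt)
      (fun z hz => (h z hz).deriv) hy hx
  have : Filter.Tendsto f l (nhds (f x)) :=
    tendsto_const_nhds.congr' (by filter_upwards [hl] with y hy using (hcst y hy).symm)
  exact tendsto_nhds_unique this hc

lemma ftc_Ioi {f f' : ℝ → ℝ} {a b : ℝ} (hd : ∀ x ∈ Ioi (0:ℝ), HasDerivAt f (f' x) x)
    (hi : IntegrableOn f' (Ioi 0)) (h0 : Filter.Tendsto f (nhdsWithin 0 (Ioi 0)) (nhds a))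
    (h1 : Filter.Tendsto f Filter.atTop (nhds b)) : ∫ x in Ioi (0:ℝ), f' x = b - a := by
  have := integral_Ioi_deriv_mul_eq_sub (a := (0:ℝ)) (u := f) (v := fun _ => 1) (u' := f') (v' := fun _ => 0) (a' := a) (b' := b)
    hd (fun x _ => hasDerivAt_const x 1) (by simpa [Pi.mul_def, Pi.add_def] using hi) (by simpa [Pi.mul_def] using h0) (by simpa [Pi.mul_def] using h1)
  simpa using this

lemma int_pw {f : ℝ → ℝ} {C a b : ℝ} (hc : AEStronglyMeasurable f (volume.restrict (Ioi 0))) (ha : a < 1) (hb : 1 < b)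
    (h0 : ∀ t ∈ Ioc (0:ℝ) 1, |f t| ≤ C * t ^ (-a)) (h1 : ∀ t, 1 ≤ t → |f t| ≤ C * t ^ (-b)) :
    IntegrableOn f (Ioi 0) := by
  rw [← Ioc_union_Ioi_eq_Ioi (zero_le_one (α := ℝ))]
  refine IntegrableOn.union ?_ ?_
  · have : IntegrableOn (fun t : ℝ => C * t ^ (-a)) (Ioc 0 1) := by
      refine Integrable.const_mul ?_ C
      have := intervalIntegral.intervalIntegrable_rpow' (a := 0) (b := 1) (r := -a) (by linarith)
      rwa [intervalIntegrable_iff_integrableOn_Ioc_of_le zero_le_one] at this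
    refine this.mono' (hc.mono_measure (Measure.restrict_mono Ioc_subset_Ioi_self le_rfl)) ?_
    exact (ae_restrict_mem measurableSet_Ioc).mono fun t ht => h0 t ht
  · have : IntegrableOn (fun t : ℝ => C * t ^ (-b)) (Ioi 1) :=
      (integrableOn_Ioi_rpow_of_lt (by linarith) one_pos).const_mul C
    refine this.mono' (hc.mono_measure (Measure.restrict_mono (Ioi_subset_Ioi zero_le_one) le_rfl)) ?_
    exact (ae_restrict_mem measurableSet_Ioi).mono fun t ht => h1 t (le_of_lt ht)

lemma ct_meas {f : ℝ → ℝ} (h : ∀ t, 0 < t → ContinuousAt f t) : AEStronglyMeasurable f (volume.restrict (Ioi 0)) :=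
  ContinuousOn.aestronglyMeasurable (fun t ht => (h t ht).continuousWithinAt) measurableSet_Ioi

lemma tend0_pw {f : ℝ → ℝ} {C a : ℝ} (ha : 0 < a) (h0 : ∀ t ∈ Ioc (0:ℝ) 1, |f t| ≤ C * t ^ a) :
    Filter.Tendsto f (nhdsWithin 0 (Ioi 0)) (nhds 0) := by
  have h : Filter.Tendsto (fun t : ℝ => C * t ^ a) (nhdsWithin 0 (Ioi 0)) (nhds 0) := by
    have : ContinuousAt (fun t : ℝ => C * t ^ a) 0 :=
      continuousAt_const.mul (continuousAt_id.rpow_const (Or.inr ha.le))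
    have := this.tendsto.mono_left (nhdsWithin_le_nhds (s := Ioi 0))
    simpa [zero_rpow ha.ne'] using this
  refine squeeze_zero_norm' ?_ h
  filter_upwards [Ioc_mem_nhdsGT (zero_lt_one (α := ℝ))] with t ht using h0 t ht

lemma tendtop_pw {f : ℝ → ℝ} {C b : ℝ} (hb : 0 < b) (h1 : ∀ t, 1 ≤ t → |f t| ≤ C * t ^ (-b)) :
    Filter.Tendsto f Filter.atTop (nhds 0) := by
  have h : Filter.Tendsto (fun t : ℝ => C * t ^ (-b)) Filter.atTop (nhds 0) := by
    have := (tendsto_rpow_neg_atTop hb).const_mul C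
    simpa using this
  refine squeeze_zero_norm' ?_ h
  filter_upwards [Filter.eventually_ge_atTop 1] with t ht using h1 t ht

lemma tK0_lim : Filter.Tendsto (fun t => t * K0 t) (nhdsWithin 0 (Ioi 0)) (nhds 0) := by
  obtain ⟨C, hC, hb⟩ := K0_le
  refine tend0_pw (a := 7/8) (C := C) (by norm_num) fun t ht => ?_
  have h0 := K0_pos ht.1
  have ht0 := ht.1
  have h2 := hb t ht.1
  have h1 : exp (-t/2) ≤ 1 := exp_le_one_iff.2 (by linarith)
  rw [abs_of_pos (by positivity)]
  have e : t ^ (7/8:ℝ) = t * t ^ (-(1/8):ℝ) := by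
    nth_rewrite 2 [← rpow_one t]
    rw [← rpow_add ht.1]; norm_num
  calc t * K0 t ≤ t * (C * exp (-t/2) * t ^ (-(1/8):ℝ)) := by gcongr
    _ ≤ t * (C * 1 * t ^ (-(1/8):ℝ)) := by gcongr
    _ = _ := by rw [e]; ring

lemma tK1_lim : Filter.Tendsto (fun t => t * K1 t) (nhdsWithin 0 (Ioi 0)) (nhds 1) := by
  have he : Filter.Tendsto (fun t : ℝ => exp (-t)) (nhdsWithin 0 (Ioi 0)) (nhds 1) := by
    have : ContinuousAt (fun t : ℝ => exp (-t)) 0 := by fun_prop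
    simpa using this.tendsto.mono_left (nhdsWithin_le_nhds (s := Ioi 0))
  have h2 := he.add tK0_lim
  rw [add_zero] at h2
  refine tendsto_of_tendsto_of_tendsto_of_le_of_le' he h2 ?_ ?_
  · filter_upwards [self_mem_nhdsWithin] with t ht using (tK1_bounds ht).1
  · filter_upwards [self_mem_nhdsWithin] with t ht using (tK1_bounds ht).2

lemma wronsk {t : ℝ} (ht : 0 < t) : I0 t * (t * K1 t) + t * I1 t * K0 t = 1 := by
  refine const_of isOpen_Ioi isPreconnected_Ioi (f := fun t => I0 t * (t * K1 t) + t * I1 t * K0 t) ?_ (l := nhdsWithin 0 (Ioi 0)) self_mem_nhdsWithin ?_ t ht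
  · intro x hx
    refine (((I0_deriv x).fun_mul (tK1_deriv hx)).fun_add ((tI1_deriv x).fun_mul (K0_deriv hx))).congr_deriv ?_
    ring
  · have h1 : Filter.Tendsto I0 (nhdsWithin 0 (Ioi 0)) (nhds 1) := by
      have := (I0_deriv 0).continuousAt.tendsto.mono_left (nhdsWithin_le_nhds (s := Ioi 0))
      rwa [I0_zero] at this
    have h2 : Filter.Tendsto I1 (nhdsWithin 0 (Ioi 0)) (nhds (I1 0)) :=
      (I1_deriv' 0).continuousAt.tendsto.mono_left (nhdsWithin_le_nhds (s := Ioi 0))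
    have := (h1.mul tK1_lim).add (h2.mul tK0_lim)
    simp only [mul_zero, add_zero, mul_one] at this
    exact this.congr fun t => by ring

lemma t2n2_lim : Filter.Tendsto (fun t => t^2 * nn t ^ 2) Filter.atTop (nhds (1/4)) := by
  obtain ⟨C, hC, hb⟩ := n_bounds
  have h1 : Filter.Tendsto n1 Filter.atTop (nhds 0) := by
    refine tendtop_pw (b := 1) (C := C) one_pos fun t ht => ?_
    rw [rpow_neg_one, ← div_eq_mul_inv]
    exact (hb t (by linarith)).2.1
  have h2 : Filter.Tendsto n2 Filter.atTop (nhds 0) := by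
    refine tendtop_pw (b := 1) (C := C) one_pos fun t ht => ?_
    rw [rpow_neg_one, ← div_eq_mul_inv]
    exact (hb t (by linarith)).2.2.1
  have h0 : Filter.Tendsto nn Filter.atTop (nhds 0) := by
    refine tendtop_pw (b := 1) (C := C) one_pos fun t ht => ?_
    rw [rpow_neg_one, ← div_eq_mul_inv]
    exact (hb t (by linarith)).1
  have h3 : Filter.Tendsto (fun t => (1 - n1 t * n1 t)/4 + nn t * n2 t / 2) Filter.atTop (nhds ((1 - 0 * 0)/4 + 0 * 0 / 2)) :=
    ((tendsto_const_nhds.sub (h1.mul h1)).div_const 4).add ((h0.mul h2).div_const 2)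
  norm_num at h3
  refine (by simpa using h3 : Filter.Tendsto _ _ (nhds (1/4:ℝ))).congr' ?_
  filter_upwards [Filter.eventually_gt_atTop 0] with t ht
  have hw := wronsk ht
  unfold n1 n2 nn
  generalize t * K1 t = q at *
  generalize t * I1 t = p at *
  generalize I0 t = a at *
  generalize K0 t = b at *
  have : (1 - (p * b - a * q) * (p*b - a*q)) = 4 * (a * q) * (p * b) := by
    have e : (1:ℝ) = (a*q+p*b)^2 := by rw [hw]; norm_num
    rw [e]; ring
  rw [this]; ring

/-- Step one: the reduced integrand -/
noncomputable def P3 (t : ℝ) : ℝ :=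
  13/2 * (2 * K0 t ^ 2 * nn t * (2 * K0 t * k1 t) + (K0 t ^ 2)^2 * n1 t)
   + 10 * (nn t * (2 * K0 t * k1 t)^2 + 2 * K0 t ^ 2 * (2 * K0 t * k1 t) * n1 t)

lemma mono5 {a b c d e f A E : ℝ} (hE : 0 ≤ E) (hf : |f| ≤ E) (ha : |a| ≤ A) (hb : |b| ≤ A) (hc : |c| ≤ A) (hd : |d| ≤ A) (he : |e| ≤ A) :
    |f * (a * b * c * d * e)| ≤ E * A ^ 5 := by
  have hA : 0 ≤ A := (abs_nonneg _).trans ha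
  simp only [abs_mul]
  calc |f| * (|a| * |b| * |c| * |d| * |e|) ≤ E * (A * A * A * A * A) := by gcongr
    _ = _ := by ring

lemma step1_bd : ∃ M : ℝ, 0 < M ∧ ∀ t : ℝ, 0 < t → ∀ y ∈ ({I0 t * K0 t ^ 5, t * I1 t * K0 t ^ 5, I0 t * K0 t ^ 4 * k1 t,
      t * I1 t * K0 t ^ 4 * k1 t, I0 t * K0 t ^ 3 * k1 t ^ 2} : Set ℝ),
    (t ≤ 1 → |y| ≤ M * t ^ (-(5/8):ℝ)) ∧ (1 ≤ t → |y| ≤ M * t ^ (-5:ℝ)) := by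
  obtain ⟨C, hC, hb⟩ := k_bounds
  refine ⟨C ^ 5 * (2 * 5040 * 4^7), by positivity, fun t ht y hy => ?_⟩
  obtain ⟨b0, b1, -⟩ := hb t ht
  have hI : |I0 t| ≤ (1 + t^2) * exp t := by
    rw [abs_of_pos (I0_pos t)]
    have := I0_le ht.le
    nlinarith [exp_pos t, sq_nonneg t]
  have hI1 : |t * I1 t| ≤ (1 + t^2) * exp t := by
    rw [abs_mul, abs_of_pos ht]
    have := I1_abs_le ht.le
    nlinarith [exp_pos t, sq_nonneg t]
  have hE : 0 ≤ (1 + t^2) * exp t := by positivity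
  have key : |y| ≤ (1 + t^2) * exp t * (C * ej t) ^ 5 := by
    simp only [mem_insert_iff, mem_singleton_iff] at hy
    rcases hy with h | h | h | h | h
    · have := mono5 hE hI b0 b0 b0 b0 b0; rw [h]; convert this using 2; ring
    · have := mono5 hE hI1 b0 b0 b0 b0 b0; rw [h]; convert this using 2; ring
    · have := mono5 hE hI b0 b0 b0 b0 b1; rw [h]; convert this using 2; ring
    · have := mono5 hE hI1 b0 b0 b0 b0 b1; rw [h]; convert this using 2; ring
    · have := mono5 hE hI b0 b0 b0 b1 b1; rw [h]; convert this using 2; ring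
  have e5 : (1 + t^2) * exp t * (C * ej t) ^ 5 = C ^ 5 * ((1 + t^2) * (t ^ (-(5/8):ℝ) * exp (-(t/4)))) := by
    have e1 : (t ^ (-(1/8):ℝ))^5 = t ^ (-(5/8):ℝ) := by
      rw [← rpow_natCast, ← rpow_mul ht.le]; norm_num
    have e2 : exp t * (exp (-(1/4)*t))^5 = exp (-(t/4)) := by
      rw [← exp_nat_mul, ← exp_add]; congr 1; push_cast; ring
    unfold ej
    rw [← e1, ← e2]; ring
  rw [e5] at key
  have hC5 : 0 < C^5 := by positivity
  constructor
  · intro h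
    refine key.trans ?_
    rw [mul_assoc (C^5)]
    refine mul_le_mul_of_nonneg_left ?_ hC5.le
    have h1 : exp (-(t/4)) ≤ 1 := exp_le_one_iff.2 (by linarith)
    have h2 : 1 + t^2 ≤ 2 := by nlinarith
    have h3 : 0 < t ^ (-(5/8):ℝ) := by positivity
    calc (1 + t^2) * (t ^ (-(5/8):ℝ) * exp (-(t/4))) ≤ 2 * (t ^ (-(5/8):ℝ) * 1) := by gcongr
      _ ≤ _ := by nlinarith
  · intro h
    refine key.trans ?_
    rw [mul_assoc (C^5)]
    refine mul_le_mul_of_nonneg_left ?_ hC5.le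
    have h1 : t ^ (-(5/8):ℝ) ≤ 1 := rpow_le_one_of_one_le_of_nonpos h (by norm_num)
    have h2 : 1 + t^2 ≤ 2 * t^2 := by nlinarith
    have h3 := Real.pow_div_factorial_le_exp (t/4) (by positivity) 7
    have h4 : t^7 * exp (-(t/4)) ≤ 5040 * 4^7 := by
      rw [exp_neg, ← div_eq_mul_inv, div_le_iff₀ (exp_pos _)]
      simp [Nat.factorial] at h3
      linarith
    have h5 : t ^ (-5:ℝ) = (t^5)⁻¹ := by rw [rpow_neg ht.le]; norm_cast
    rw [h5, ← div_eq_mul_inv, le_div_iff₀ (by positivity)]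
    calc (1 + t^2) * (t ^ (-(5/8):ℝ) * exp (-(t/4))) * t^5 ≤ 2 * t^2 * (1 * exp (-(t/4))) * t^5 := by gcongr
      _ = 2 * (t^7 * exp (-(t/4))) := by ring
      _ ≤ _ := by linarith

lemma K0_ca {t : ℝ} (ht : 0 < t) : ContinuousAt K0 t := (K0_deriv ht).continuousAt
lemma k1_ca {t : ℝ} (ht : 0 < t) : ContinuousAt k1 t := (k1_d ht).continuousAt
lemma I0_c : Continuous I0 := continuous_iff_continuousAt.2 fun t => (I0_deriv t).continuousAt
lemma I1_c : Continuous I1 := continuous_iff_continuousAt.2 fun t => (I1_deriv' t).continuousAt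

theorem step1 : IntegrableOn (fun t => t * P3 t) (Ioi 0) ∧
    (∫ t in Ioi (0:ℝ), I0 t * (K0 t)^5 * t * (1 - 8*t^2)) = (1/3) * ∫ t in Ioi (0:ℝ), t * P3 t := by
  obtain ⟨M, hM, hb⟩ := step1_bd
  have hI0 := I0_c
  have hI1 := I1_c
  set Φ : ℝ → ℝ := fun t => 1/2 * (t^2 * (I0 t * K0 t ^ 5)) - 4/3 * (t^2 * (t * I1 t * K0 t ^ 5 + 5 * (I0 t * K0 t ^ 4 * k1 t))) with hΦ
  have hP : ∀ t, P3 t = 13/2 * (t * I1 t * K0 t ^ 5 + 5 * (I0 t * K0 t ^ 4 * k1 t)) + 10 * (8 * (I0 t * K0 t ^ 3 * k1 t ^ 2) + 4 * (t * I1 t * K0 t ^ 4 * k1 t)) := by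
    intro t; unfold P3 n1 nn k1; ring
  have hd : ∀ t ∈ Ioi (0:ℝ), HasDerivAt Φ (I0 t * (K0 t)^5 * t * (1 - 8*t^2) - 1/3 * (t * P3 t)) t := by
    intro t ht
    have ht' : 0 < t := ht
    have a1 := (hasDerivAt_pow 2 t)
    have a2 := (K0_deriv ht).fun_pow 5
    have a3 := (K0_deriv ht).fun_pow 4
    refine (((a1.fun_mul ((I0_deriv t).fun_mul a2)).const_mul (1/2)).fun_sub
      ((a1.fun_mul (((tI1_deriv t).fun_mul a2).fun_add ((((I0_deriv t).fun_mul a3).fun_mul (k1_d ht)).const_mul 5))).const_mul (4/3))).congr_deriv ?_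
    rw [hP]; unfold k2 k1
    field_simp
    ring
  have i1 : IntegrableOn (fun t => I0 t * (K0 t)^5 * t * (1 - 8*t^2)) (Ioi 0) := by
    refine int_pw (C := 9 * M) (a := 5/8) (b := 2) (ct_meas fun t ht => ?_) (by norm_num) (by norm_num) ?_ ?_
    · have := K0_ca ht
      fun_prop
    · intro t ht
      have h := (hb t ht.1 (I0 t * K0 t ^ 5) (by simp)).1 ht.2
      have h3 : |t * (1 - 8*t^2)| ≤ 9 := by
        rw [abs_le]; constructor <;> nlinarith [ht.1, ht.2, mul_pos ht.1 ht.1, mul_nonneg ht.1.le (sub_nonneg.2 ht.2), mul_nonneg (mul_pos ht.1 ht.1).le (sub_nonneg.2 ht.2)]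
      rw [mul_assoc, abs_mul, mul_assoc, mul_comm]
      gcongr
    · intro t ht
      have h := (hb t (by linarith) (I0 t * K0 t ^ 5) (by simp)).2 ht
      have h3 : |t * (1 - 8*t^2)| ≤ 9 * t^3 := by
        rw [abs_le]; constructor <;> nlinarith [mul_self_nonneg t, mul_nonneg (sub_nonneg.2 ht) (mul_self_nonneg t)]
      rw [mul_assoc, abs_mul, mul_comm]
      calc _ ≤ 9 * t^3 * (M * t ^ (-5:ℝ)) := by gcongr
        _ = 9 * M * (t ^ (3:ℝ) * t ^ (-5:ℝ)) := by rw [← rpow_natCast t 3]; push_cast; ring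
        _ = _ := by rw [← rpow_add (by linarith)]; norm_num
  have i2 : IntegrableOn (fun t => t * P3 t) (Ioi 0) := by
    refine int_pw (C := 200 * M) (a := 5/8) (b := 4) (ct_meas fun t ht => ?_) (by norm_num) (by norm_num) ?_ ?_
    · have := K0_ca ht
      have := k1_ca ht
      simp only [hP]
      fun_prop
    · intro t ht
      have h := fun y hy => abs_le.1 ((hb t ht.1 y hy).1 ht.2)
      have g2 := h (t * I1 t * K0 t ^ 5) (by simp)
      have g3 := h (I0 t * K0 t ^ 4 * k1 t) (by simp)
      have g4 := h (t * I1 t * K0 t ^ 4 * k1 t) (by simp)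
      have g5 := h (I0 t * K0 t ^ 3 * k1 t ^ 2) (by simp)
      have hp : |P3 t| ≤ 200 * (M * t ^ (-(5/8):ℝ)) := by
        rw [hP, abs_le]; constructor <;> linarith
      rw [abs_mul, abs_of_pos ht.1]
      have : 0 < M * t ^ (-(5/8):ℝ) := by have := ht.1; positivity
      nlinarith [ht.2, ht.1, abs_nonneg (P3 t)]
    · intro t ht
      have h := fun y hy => abs_le.1 ((hb t (by linarith) y hy).2 ht)
      have g2 := h (t * I1 t * K0 t ^ 5) (by simp)
      have g3 := h (I0 t * K0 t ^ 4 * k1 t) (by simp)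
      have g4 := h (t * I1 t * K0 t ^ 4 * k1 t) (by simp)
      have g5 := h (I0 t * K0 t ^ 3 * k1 t ^ 2) (by simp)
      have hp : |P3 t| ≤ 200 * (M * t ^ (-5:ℝ)) := by
        rw [hP, abs_le]; constructor <;> linarith
      have ht0 : 0 < t := by linarith
      rw [abs_mul, abs_of_pos ht0]
      calc t * |P3 t| ≤ t * (200 * (M * t ^ (-5:ℝ))) := by gcongr
        _ = 200 * M * (t ^ (1:ℝ) * t ^ (-5:ℝ)) := by rw [rpow_one]; ring
        _ = _ := by rw [← rpow_add ht0]; norm_num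
  refine ⟨i2, ?_⟩
  have hf := ftc_Ioi hd (i1.sub (i2.const_mul (1/3))) (a := 0) (b := 0) ?_ ?_
  · rw [integral_sub i1 (i2.const_mul (1/3)), integral_const_mul] at hf
    linarith
  · refine tend0_pw (C := 9 * M) (a := 2 - 5/8) (by norm_num) fun t ht => ?_
    have h := fun y hy => abs_le.1 ((hb t ht.1 y hy).1 ht.2)
    have g1 := h (I0 t * K0 t ^ 5) (by simp)
    have g2 := h (t * I1 t * K0 t ^ 5) (by simp)
    have g3 := h (I0 t * K0 t ^ 4 * k1 t) (by simp)
    have e : Φ t = t^2 * (1/2 * (I0 t * K0 t ^ 5) - 4/3 * (t * I1 t * K0 t ^ 5 + 5 * (I0 t * K0 t ^ 4 * k1 t))) := by simp only [hΦ]; ring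
    rw [e, abs_mul, abs_of_nonneg (sq_nonneg t), show (2 - 5/8:ℝ) = 2 + -(5/8) by norm_num, rpow_add ht.1]
    have ht0 := ht.1
    have : |1/2 * (I0 t * K0 t ^ 5) - 4/3 * (t * I1 t * K0 t ^ 5 + 5 * (I0 t * K0 t ^ 4 * k1 t))| ≤ 9 * (M * t ^ (-(5/8):ℝ)) := by
      rw [abs_le]; constructor <;> linarith
    calc _ ≤ t^2 * (9 * (M * t ^ (-(5/8):ℝ))) := by gcongr
      _ = _ := by rw [← rpow_natCast t 2]; push_cast; ring
  · refine tendtop_pw (C := 9 * M) (b := 3) (by norm_num) fun t ht => ?_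
    have ht0 : 0 < t := by linarith
    have h := fun y hy => abs_le.1 ((hb t ht0 y hy).2 ht)
    have g1 := h (I0 t * K0 t ^ 5) (by simp)
    have g2 := h (t * I1 t * K0 t ^ 5) (by simp)
    have g3 := h (I0 t * K0 t ^ 4 * k1 t) (by simp)
    have e : Φ t = t^2 * (1/2 * (I0 t * K0 t ^ 5) - 4/3 * (t * I1 t * K0 t ^ 5 + 5 * (I0 t * K0 t ^ 4 * k1 t))) := by simp only [hΦ]; ring
    rw [e, abs_mul, abs_of_nonneg (sq_nonneg t)]
    have : |1/2 * (I0 t * K0 t ^ 5) - 4/3 * (t * I1 t * K0 t ^ 5 + 5 * (I0 t * K0 t ^ 4 * k1 t))| ≤ 9 * (M * t ^ (-5:ℝ)) := by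
      rw [abs_le]; constructor <;> linarith
    calc _ ≤ t^2 * (9 * (M * t ^ (-5:ℝ))) := by gcongr
      _ = 9 * M * (t ^ (2:ℝ) * t ^ (-5:ℝ)) := by rw [← rpow_natCast t 2]; push_cast; ring
      _ = _ := by rw [← rpow_add ht0]; norm_num

end BL

namespace BL

noncomputable def Hh (s : ℂ) : ℂ := Complex.exp (-(Complex.log (2 + s)) / 2)
noncomputable def MM (β : ℝ) (ζ : ℂ) : ℂ :=
  ∫ w in Ioi (0:ℝ), ((exp (-w) * w ^ β : ℝ) : ℂ) * Hh (w * Complex.exp (-ζ))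

lemma Hh_norm {s : ℂ} (hs : 2 + s ≠ 0) : ‖Hh s‖ = ‖2 + s‖ ^ (-(1/2) : ℝ) := by
  have h : 0 < ‖2 + s‖ := norm_pos_iff.2 hs
  unfold Hh
  rw [Complex.norm_exp, rpow_def_of_pos h]
  congr 1
  have : (-(Complex.log (2 + s)) / 2).re = -(Complex.log (2+s)).re / 2 := by
    simp [Complex.div_re]
  rw [this, Complex.log_re]; ring

lemma Hh_meas : Measurable Hh := by
  unfold Hh
  fun_prop

lemma MM_meas (β : ℝ) (ζ : ℂ) : Measurable (fun w : ℝ => ((exp (-w) * w ^ β : ℝ) : ℂ) * Hh (w * Complex.exp (-ζ))) := by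
  have := Hh_meas
  have h2 : Measurable (fun w : ℝ => exp (-w) * w ^ β) := by fun_prop
  have h3 : Measurable (fun w : ℝ => (w:ℂ) * Complex.exp (-ζ)) := by fun_prop
  exact (Complex.measurable_ofReal.comp h2).mul (this.comp h3)

lemma wt_int {β : ℝ} (hβ : -1 < β) : IntegrableOn (fun w : ℝ => exp (-w) * w ^ β) (Ioi 0) := by
  have := Real.GammaIntegral_convergent (s := β + 1) (by linarith)
  simpa using this

lemma se (w : ℝ) (ζ : ℂ) : (w:ℂ) * Complex.exp (-ζ) = ((w * exp (-ζ.re) * cos ζ.im : ℝ) : ℂ) - ((w * exp (-ζ.re) * sin ζ.im : ℝ):ℂ) * Complex.I := by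
  rw [Complex.exp_eq_exp_re_mul_sin_add_cos]
  push_cast
  simp [Complex.ofReal_exp]
  ring

lemma nsq (w : ℝ) (ζ : ℂ) : ‖2 + (w:ℂ) * Complex.exp (-ζ)‖ ^ 2 =
    4 + 4 * (w * exp (-ζ.re)) * cos ζ.im + (w * exp (-ζ.re))^2 := by
  rw [se, ← Complex.normSq_eq_norm_sq, Complex.normSq_apply]
  simp only [Complex.add_re, Complex.add_im, Complex.sub_re, Complex.sub_im, Complex.ofReal_re, Complex.ofReal_im, Complex.mul_re, Complex.mul_im, Complex.I_re, Complex.I_im, Complex.re_ofNat, Complex.im_ofNat]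
  linear_combination (w*exp (-ζ.re))^2 * sin_sq_add_cos_sq ζ.im

lemma sl_mem {w : ℝ} (hw : 0 < w) {ζ : ℂ} (h : |ζ.im| < π) : 2 + (w:ℂ) * Complex.exp (-ζ) ∈ Complex.slitPlane := by
  rw [se, Complex.mem_slitPlane_iff]
  simp only [Complex.add_re, Complex.add_im, Complex.sub_re, Complex.sub_im, Complex.ofReal_re, Complex.ofReal_im, Complex.mul_re, Complex.mul_im, Complex.I_re, Complex.I_im]
  by_cases h0 : sin ζ.im = 0
  · left
    have := (sin_eq_zero_iff_of_lt_of_lt (abs_lt.1 h).1 (abs_lt.1 h).2).1 h0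
    rw [this]; simp
    positivity
  · right
    simp
    exact ⟨hw.ne', h0⟩

lemma cos_gt {y : ℝ} (h : |y| < π) : -1 < cos y := by
  rcases (neg_one_le_cos y).lt_or_eq with h1 | h1
  · exact h1
  · have h2 := Real.cos_sq' y
    rw [← h1] at h2
    have h3 : sin y = 0 := by nlinarith
    have := (sin_eq_zero_iff_of_lt_of_lt (abs_lt.1 h).1 (abs_lt.1 h).2).1 h3
    rw [this] at h1; norm_num at h1

lemma lowb {w : ℝ} (hw : 0 < w) {ζ : ℂ} {η : ℝ} (hη : 0 < η) (hη1 : η ≤ 1) (h : -1 + η ≤ cos ζ.im) :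
    η * (4 + (w * exp (-ζ.re))^2) ≤ ‖2 + (w:ℂ) * Complex.exp (-ζ)‖ ^ 2 := by
  rw [nsq]
  have : 0 < w * exp (-ζ.re) := by positivity
  generalize w * exp (-ζ.re) = ρ at *
  have h1 := cos_le_one ζ.im
  nlinarith [mul_nonneg (sub_nonneg.2 hη1) (sq_nonneg (ρ - 2)), mul_nonneg this.le (sub_nonneg.2 h)]

lemma s_norm {w : ℝ} (hw : 0 < w) (ζ : ℂ) : ‖(w:ℂ) * Complex.exp (-ζ)‖ = w * exp (-ζ.re) := by
  rw [norm_mul, Complex.norm_exp, Complex.norm_real, Real.norm_eq_abs, abs_of_pos hw, Complex.neg_re]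

lemma Hh_bd {w : ℝ} (hw : 0 < w) {ζ : ℂ} {η : ℝ} (hη : 0 < η) (hη1 : η ≤ 1) (h : -1 + η ≤ cos ζ.im) :
    ‖Hh (w * Complex.exp (-ζ))‖ ≤ (2 * √η) ^ (-(1/2):ℝ) ∧
    ‖(w:ℂ) * Complex.exp (-ζ)‖ / ‖2 + (w:ℂ) * Complex.exp (-ζ)‖ ≤ 1 / √η := by
  have hl := lowb hw hη hη1 h
  have hs := s_norm hw ζ
  have hρ : 0 < w * exp (-ζ.re) := by positivity
  rw [← hs] at hl hρ
  generalize (w:ℂ) * Complex.exp (-ζ) = s at *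
  have hsq : √η ^ 2 = η := Real.sq_sqrt hη.le
  have hse : 0 < √η := Real.sqrt_pos.2 hη
  have h1 : 2 * √η ≤ ‖2 + s‖ := by
    refine abs_le_of_sq_le_sq' ?_ (norm_nonneg _) |>.2
    nlinarith [sq_nonneg ‖s‖]
  have h2 : √η * ‖s‖ ≤ ‖2 + s‖ := by
    refine abs_le_of_sq_le_sq' ?_ (norm_nonneg _) |>.2
    nlinarith [sq_nonneg ‖s‖]
  have hp : 0 < ‖2 + s‖ := lt_of_lt_of_le (by positivity) h1
  refine ⟨?_, ?_⟩
  · rw [Hh_norm (norm_pos_iff.1 hp)]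
    exact rpow_le_rpow_of_nonpos (by positivity) h1 (by norm_num)
  · rw [div_le_div_iff₀ hp hse]; linarith

lemma Hh_d {w : ℝ} (hw : 0 < w) {ζ : ℂ} (h : |ζ.im| < π) :
    HasDerivAt (fun ζ : ℂ => Hh (w * Complex.exp (-ζ)))
      (Hh (w * Complex.exp (-ζ)) * ((w * Complex.exp (-ζ)) / (2 + w * Complex.exp (-ζ)) / 2)) ζ := by
  have h1 : HasDerivAt (fun ζ : ℂ => 2 + (w:ℂ) * Complex.exp (-ζ)) (-((w:ℂ) * Complex.exp (-ζ))) ζ := by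
    have := (((hasDerivAt_neg ζ).cexp).const_mul (w:ℂ)).const_add 2
    exact this.congr_deriv (by ring)
  have h2 := ((h1.clog (sl_mem hw h)).fun_neg.div_const 2).cexp
  refine h2.congr_deriv ?_
  unfold Hh
  ring

lemma MM_diff {β : ℝ} (hβ : -1 < β) {ζ : ℂ} (h : |ζ.im| < π) : DifferentiableAt ℂ (MM β) ζ := by
  have hc := cos_gt h
  set η := (1 + cos ζ.im) / 2 with hη
  have hη0 : 0 < η := by rw [hη]; linarith
  have hη1 : η ≤ 1 := by rw [hη]; linarith [cos_le_one ζ.im]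
  have hU : {ξ : ℂ | |ξ.im| < π ∧ -1 + η < cos ξ.im} ∈ nhds ζ := by
    refine IsOpen.mem_nhds ?_ ⟨h, by rw [hη]; linarith⟩
    exact (isOpen_lt (continuous_abs.comp Complex.continuous_im) continuous_const).inter (isOpen_lt continuous_const (Real.continuous_cos.comp Complex.continuous_im))
  refine (hasDerivAt_integral_of_dominated_loc_of_deriv_le
    (F := fun ζ w => ((exp (-w) * w ^ β : ℝ) : ℂ) * Hh (w * Complex.exp (-ζ)))
    (F' := fun ζ w => ((exp (-w) * w ^ β : ℝ) : ℂ) * (Hh (w * Complex.exp (-ζ)) * ((w * Complex.exp (-ζ)) / (2 + w * Complex.exp (-ζ)) / 2)))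
    (bound := fun w => exp (-w) * w ^ β * ((2 * √η) ^ (-(1/2):ℝ) * (1 / √η / 2))) hU ?_ ?_ ?_ ?_ ?_ ?_).2.differentiableAt
  · exact .of_forall fun ξ => (MM_meas β ξ).aestronglyMeasurable
  · refine ((wt_int hβ).mul_const ((2 * √η) ^ (-(1/2):ℝ))).mono' (MM_meas β ζ).aestronglyMeasurable ?_
    refine (ae_restrict_mem measurableSet_Ioi).mono fun w hw => ?_
    have hw' : 0 < w := hw
    rw [norm_mul, Complex.norm_real, Real.norm_eq_abs, abs_of_pos (by positivity)]
    gcongr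
    exact (Hh_bd hw hη0 hη1 (by rw [hη]; linarith)).1
  · have h1 := Hh_meas
    have h2 : Measurable (fun w : ℝ => ((exp (-w) * w ^ β : ℝ) : ℂ)) := Complex.measurable_ofReal.comp (by fun_prop)
    have h3 : Measurable (fun w : ℝ => (w:ℂ) * Complex.exp (-ζ)) := by fun_prop
    exact (h2.mul ((h1.comp h3).mul ((h3.div (h3.const_add 2)).div_const 2))).aestronglyMeasurable
  · refine (ae_restrict_mem measurableSet_Ioi).mono fun w hw ξ hξ => ?_
    have hw' : 0 < w := hw
    obtain ⟨b1, b2⟩ := Hh_bd hw hη0 hη1 hξ.2.le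
    rw [norm_mul, Complex.norm_real, Real.norm_eq_abs, abs_of_pos (by positivity), norm_mul, norm_div, norm_div, Complex.norm_two]
    gcongr
  · exact (wt_int hβ).mul_const _
  · refine (ae_restrict_mem measurableSet_Ioi).mono fun w hw ξ hξ => ?_
    exact (Hh_d hw hξ.1).const_mul _

/-- the scale-free majorant -/
noncomputable def qq (ε v : ℝ) : ℝ := v ^ (-(1/2) - ε) * |1 - v| ^ (-(1/2):ℝ)

lemma qq_meas (ε : ℝ) : Measurable (qq ε) := by unfold qq; fun_prop

lemma qq_int {ε : ℝ} (h0 : 0 < ε) (h1 : ε < 1/2) : IntegrableOn (qq ε) (Ioi 0) := by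
  have e : Ioi (0:ℝ) = (Ioc 0 (1/2) ∪ Ioc (1/2) 1) ∪ (Ioc 1 2 ∪ Ioi 2) := by
    rw [Ioc_union_Ioc_eq_Ioc (by norm_num) (by norm_num), Ioc_union_Ioi_eq_Ioi (by norm_num), Ioc_union_Ioi_eq_Ioi (by norm_num)]
  have hm := (qq_meas ε).aestronglyMeasurable (μ := volume)
  have cst : ∀ {C a : ℝ} (hC : 0 < C) (v : ℝ), C ≤ v → v ^ (-(1/2) - ε) ≤ C ^ (-(1/2) - ε) := fun hC v hv =>
    rpow_le_rpow_of_nonpos hC hv (by linarith)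
  rw [e]
  refine ((IntegrableOn.union ?_ ?_).union (IntegrableOn.union ?_ ?_))
  · have i := (intervalIntegral.intervalIntegrable_rpow' (a := 0) (b := 1/2) (r := -(1/2) - ε) (by linarith)).mul_const ((1/2) ^ (-(1/2):ℝ))
    rw [intervalIntegrable_iff_integrableOn_Ioc_of_le (by norm_num)] at i
    refine i.mono' hm.restrict ((ae_restrict_mem measurableSet_Ioc).mono fun v hv => ?_)
    have : |1 - v| ^ (-(1/2):ℝ) ≤ (1/2) ^ (-(1/2):ℝ) :=
      rpow_le_rpow_of_nonpos (by norm_num) (by rw [abs_of_nonneg] <;> linarith [hv.2]) (by norm_num)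
    have := hv.1
    unfold qq; rw [Real.norm_eq_abs, abs_of_nonneg (by positivity)]
    gcongr
  · have i := ((intervalIntegral.intervalIntegrable_rpow' (a := 0) (b := 1/2) (r := -(1/2)) (by norm_num)).comp_sub_left 1).symm.const_mul ((1/2) ^ (-(1/2) - ε:ℝ))
    norm_num only at i
    rw [intervalIntegrable_iff_integrableOn_Ioc_of_le (by norm_num)] at i
    refine i.mono' hm.restrict ((ae_restrict_mem measurableSet_Ioc).mono fun v hv => ?_)
    have h2 := cst (a := 0) (by norm_num : (0:ℝ) < 1/2) v hv.1.le
    have h3 : 0 < v := by linarith [hv.1]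
    unfold qq; rw [Real.norm_eq_abs, abs_of_nonneg (by positivity), abs_of_nonneg (by linarith [hv.2] : 0 ≤ 1 - v)]
    have : 0 ≤ (1 - v) ^ (-(1/2):ℝ) := by have := hv.2; exact rpow_nonneg (by linarith) _
    norm_num only at h2 this ⊢
    gcongr
  · have i := ((intervalIntegral.intervalIntegrable_rpow' (a := 0) (b := 1) (r := -(1/2)) (by norm_num)).comp_sub_right 1)
    norm_num only at i
    rw [intervalIntegrable_iff_integrableOn_Ioc_of_le (by norm_num)] at i
    refine i.mono' hm.restrict ((ae_restrict_mem measurableSet_Ioc).mono fun v hv => ?_)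
    have h2 := cst (a := 0) (by norm_num : (0:ℝ) < 1) v hv.1.le
    rw [one_rpow] at h2
    have h3 : 0 < v := by linarith [hv.1]
    unfold qq; rw [Real.norm_eq_abs, abs_of_nonneg (by positivity), abs_sub_comm, abs_of_nonneg (by linarith [hv.1] : 0 ≤ v - 1)]
    have : 0 ≤ (v - 1) ^ (-(1/2):ℝ) := by have := hv.1; exact rpow_nonneg (by linarith) _
    norm_num only at h2 this ⊢
    nlinarith
  · have i := (integrableOn_Ioi_rpow_of_lt (a := -(1/2) - ε - 1/2) (c := 2) (by linarith) (by norm_num)).mul_const ((1/2) ^ (-(1/2):ℝ))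
    refine i.mono' hm.restrict ((ae_restrict_mem measurableSet_Ioi).mono fun v hv => ?_)
    have hv : 2 < v := hv
    have h3 : 0 < v := by linarith
    have h4 : |1 - v| ^ (-(1/2):ℝ) ≤ (v * (1/2)) ^ (-(1/2):ℝ) :=
      rpow_le_rpow_of_nonpos (by positivity) (by rw [abs_sub_comm, abs_of_nonneg] <;> linarith) (by norm_num)
    unfold qq; rw [Real.norm_eq_abs, abs_of_nonneg (by positivity)]
    calc _ ≤ v ^ (-(1/2) - ε) * (v * (1/2)) ^ (-(1/2):ℝ) := by gcongr
      _ = _ := by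
        rw [mul_rpow h3.le (by norm_num), ← mul_assoc, ← rpow_add h3]
        congr 2

end BL

namespace BL

lemma Hh_gbd {w : ℝ} (hw : 0 < w) {ζ : ℂ} (h : w ≠ 2 * exp ζ.re) :
    2 + (w:ℂ) * Complex.exp (-ζ) ≠ 0 ∧
    ‖Hh (w * Complex.exp (-ζ))‖ ≤ |2 - w * exp (-ζ.re)| ^ (-(1/2):ℝ) := by
  have hs := s_norm hw ζ
  have h0 : 0 < |2 - w * exp (-ζ.re)| := by
    rw [abs_pos]
    intro h1
    apply h
    have : w * exp (-ζ.re) * exp ζ.re = w := by rw [mul_assoc, ← exp_add]; simp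
    rw [← this]; congr 1; linarith
  have h1 : |2 - w * exp (-ζ.re)| ≤ ‖2 + (w:ℂ) * Complex.exp (-ζ)‖ := by
    rw [← hs]
    have := abs_norm_sub_norm_le (2:ℂ) (-((w:ℂ) * Complex.exp (-ζ)))
    rwa [norm_neg, sub_neg_eq_add, Complex.norm_two] at this
  have h2 : 2 + (w:ℂ) * Complex.exp (-ζ) ≠ 0 := norm_pos_iff.1 (h0.trans_le h1)
  refine ⟨h2, ?_⟩
  rw [Hh_norm h2]
  exact rpow_le_rpow_of_nonpos h0 h1 (by norm_num)

noncomputable def dm (ε a w : ℝ) : ℝ :=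
  4 * ((2 * exp a) ^ (-(1/2) - ε) * 2 ^ (-(1/2):ℝ)) * qq ε ((2 * exp a)⁻¹ * w)

lemma dm_eq {ε a w : ℝ} (hw : 0 < w) : dm ε a w = 4 * w ^ (-(1/2) - ε) * |2 - w * exp (-a)| ^ (-(1/2):ℝ) := by
  unfold dm qq
  have h1 : 2 - w * exp (-a) = 2 * (1 - (2 * exp a)⁻¹ * w) := by
    rw [exp_neg]; have := (exp_pos a).ne'; field_simp
  have h2 : w ^ (-(1/2) - ε) = (2 * exp a) ^ (-(1/2) - ε) * ((2 * exp a)⁻¹ * w) ^ (-(1/2) - ε) := by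
    rw [← mul_rpow (by positivity) (by positivity)]
    congr 1; have := (exp_pos a).ne'; field_simp
  rw [h1, h2, abs_mul, mul_rpow (abs_nonneg _) (abs_nonneg _), abs_two]
  ring

lemma dm_int {ε : ℝ} (h0 : 0 < ε) (h1 : ε < 1/2) (a : ℝ) : IntegrableOn (dm ε a) (Ioi 0) ∧
    ∫ w in Ioi 0, dm ε a w = (4 * 2 ^ (-ε) * ∫ v in Ioi 0, qq ε v) * exp a ^ (1/2 - ε) := by
  have hp : 0 < (2 * exp a)⁻¹ := by positivity
  constructor
  · unfold dm
    refine Integrable.const_mul ?_ _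
    have := (integrableOn_Ioi_comp_mul_left_iff (qq ε) 0 hp).2 (by simpa using qq_int h0 h1)
    exact this
  · unfold dm
    rw [integral_const_mul, integral_comp_mul_left_Ioi (qq ε) 0 hp, mul_zero, inv_inv, smul_eq_mul]
    have e : (2 * exp a) ^ (-(1/2) - ε) * (2 * exp a) * 2 ^ (-(1/2):ℝ) = 2 ^ (-ε) * exp a ^ (1/2 - ε) := by
      rw [← rpow_add_one (by positivity), mul_rpow (by positivity) (by positivity), mul_right_comm, ← rpow_add (by norm_num)]
      ring_nf
    linear_combination (4 * ∫ v in Ioi 0, qq ε v) * e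

lemma dm_bd {β ε : ℝ} (hβ : β = -(1/2) ∨ β = 1/2) (h0 : 0 < ε) (h1 : ε < 1/2) {w : ℝ} (hw : 0 < w) {ζ : ℂ} (h : w ≠ 2 * exp ζ.re) :
    ‖((exp (-w) * w ^ β : ℝ) : ℂ) * Hh (w * Complex.exp (-ζ))‖ ≤ dm ε ζ.re w := by
  rw [dm_eq hw, norm_mul, Complex.norm_real, Real.norm_eq_abs, abs_of_pos (by positivity)]
  have hb : exp (-w) * w ^ β ≤ 4 * w ^ (-(1/2) - ε) := by
    rcases hβ with rfl | rfl
    · have := exp_neg_le_rpow hw h0 (by linarith)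
      rw [sub_eq_neg_add, rpow_add hw]
      have h2 : 0 < w ^ (-(1/2):ℝ) := by positivity
      have h3 : 0 < w ^ (-ε) := by positivity
      nlinarith
    · have h2 := exp_neg_le_rpow (x := w/2) (e := (1+ε)/2) (by positivity) (by linarith) (by linarith)
      have h3 : exp (-w) ≤ (w/2) ^ (-(1+ε)) := by
        have e1 : exp (-w) = exp (-(w/2)) ^ 2 := by rw [← exp_nat_mul]; congr 1; push_cast; ring
        have e2 : (w/2) ^ (-(1+ε)) = ((w/2) ^ (-((1+ε)/2))) ^ 2 := by
          rw [← rpow_natCast, ← rpow_mul (by positivity)]; congr 1; push_cast; ring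
        rw [e1, e2]; gcongr
      have h4 : (w/2) ^ (-(1+ε)) ≤ 4 * w ^ (-(1+ε)) := by
        rw [div_rpow hw.le (by norm_num), rpow_neg (by norm_num : (0:ℝ) ≤ 2), div_inv_eq_mul, mul_comm]
        gcongr
        calc (2:ℝ)^(1+ε) ≤ 2 ^ (2:ℝ) := rpow_le_rpow_of_exponent_le (by norm_num) (by linarith)
          _ = 4 := by norm_num
      calc _ ≤ (4 * w ^ (-(1+ε))) * w ^ (1/2:ℝ) := by gcongr; exact h3.trans h4
        _ = _ := by rw [mul_assoc, ← rpow_add hw]; ring_nf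
  gcongr
  exact (Hh_gbd hw h).2

lemma ae_ne (c : ℝ) : ∀ᵐ w ∂(volume.restrict (Ioi (0:ℝ))), 0 < w ∧ w ≠ c := by
  have h1 : ∀ᵐ w ∂(volume.restrict (Ioi (0:ℝ))), w ≠ c :=
    ae_restrict_of_ae (by simp [ae_iff])
  filter_upwards [ae_restrict_mem measurableSet_Ioi, h1] with w h2 h3 using ⟨h2, h3⟩

lemma MM_bd {β ε : ℝ} (hβ : β = -(1/2) ∨ β = 1/2) (h0 : 0 < ε) (h1 : ε < 1/2) (ζ : ℂ) :
    ‖MM β ζ‖ ≤ (4 * 2 ^ (-ε) * ∫ v in Ioi 0, qq ε v) * exp ζ.re ^ (1/2 - ε) := by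
  rw [← (dm_int h0 h1 ζ.re).2]
  refine norm_integral_le_of_norm_le (dm_int h0 h1 ζ.re).1 ?_
  filter_upwards [ae_ne (2 * exp ζ.re)] with w hw using dm_bd hβ h0 h1 hw.1 hw.2

noncomputable def NNc (ζ : ℂ) : ℂ :=
  Complex.I * Complex.exp (-ζ) * (MM (-(1/2)) ζ * MM (-(1/2)) (ζ - π * Complex.I))
noncomputable def N1c (ζ : ℂ) : ℂ :=
  -Complex.I * Complex.exp (-ζ) * (MM (-(1/2)) ζ * MM (1/2) (ζ - π * Complex.I) + MM (1/2) ζ * MM (-(1/2)) (ζ - π * Complex.I))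
noncomputable def FF (ζ : ℂ) : ℂ :=
  Complex.exp (2 * ζ) * (13/2 * NNc ζ ^ 2 * N1c ζ + 10 * NNc ζ * N1c ζ ^ 2)

lemma NNc_bd {ε : ℝ} (h0 : 0 < ε) (h1 : ε < 1/2) : ∃ C > 0, ∀ ζ : ℂ,
    ‖NNc ζ‖ ≤ C * exp (-(2*ε) * ζ.re) ∧ ‖N1c ζ‖ ≤ C * exp (-(2*ε) * ζ.re) := by
  obtain ⟨D, hD0, hD⟩ : ∃ D > 0, D = (4 * 2 ^ (-ε) * ∫ v in Ioi 0, qq ε v) + 1 := by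
    refine ⟨_, ?_, rfl⟩
    have : 0 ≤ ∫ v in Ioi 0, qq ε v := setIntegral_nonneg measurableSet_Ioi fun v hv => by
      have : (0:ℝ) < v := hv
      unfold qq; positivity
    positivity
  have hM : ∀ β, (β = -(1/2) ∨ β = 1/2) → ∀ ζ : ℂ, ‖MM β ζ‖ ≤ D * exp ((1/2 - ε) * ζ.re) := by
    intro β hβ ζ
    refine (MM_bd hβ h0 h1 ζ).trans ?_
    rw [← exp_mul, mul_comm ζ.re]
    gcongr; linarith
  have sh : ∀ ζ : ℂ, (ζ - π * Complex.I).re = ζ.re := fun ζ => by simp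
  have ee : ∀ a : ℝ, exp (-a) * (exp ((1/2 - ε) * a) * exp ((1/2 - ε) * a)) = exp (-(2*ε) * a) := fun a => by
    rw [← exp_add, ← exp_add]; congr 1; ring
  refine ⟨2 * D^2, by positivity, fun ζ => ⟨?_, ?_⟩⟩
  · unfold NNc
    have a1 := hM _ (.inl rfl) ζ
    have a2 := hM _ (.inl rfl) (ζ - π * Complex.I)
    rw [sh] at a2
    rw [norm_mul, norm_mul, norm_mul, Complex.norm_I, one_mul, Complex.norm_exp, Complex.neg_re]
    calc _ ≤ exp (-ζ.re) * ((D * exp ((1/2 - ε) * ζ.re)) * (D * exp ((1/2 - ε) * ζ.re))) := by gcongr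
      _ = D^2 * exp (-(2*ε) * ζ.re) := by rw [← ee]; ring
      _ ≤ _ := by gcongr; nlinarith [sq_nonneg D]
  · unfold N1c
    have a1 := hM _ (.inl rfl) ζ
    have a2 := hM _ (.inl rfl) (ζ - π * Complex.I)
    have b1 := hM _ (.inr rfl) ζ
    have b2 := hM _ (.inr rfl) (ζ - π * Complex.I)
    rw [sh] at a2 b2
    rw [norm_mul, norm_mul, norm_neg, Complex.norm_I, one_mul, Complex.norm_exp, Complex.neg_re]
    calc _ ≤ exp (-ζ.re) * ((D * exp ((1/2 - ε) * ζ.re)) * (D * exp ((1/2 - ε) * ζ.re)) + (D * exp ((1/2 - ε) * ζ.re)) * (D * exp ((1/2 - ε) * ζ.re))) := by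
          refine mul_le_mul_of_nonneg_left ((norm_add_le _ _).trans ?_) (exp_pos _).le
          rw [norm_mul, norm_mul]
          gcongr
      _ = _ := by rw [← ee]; ring

lemma FF_bd : ∃ C > 0, ∀ ζ : ℂ, ‖FF ζ‖ ≤ C * exp (-(1/4) * |ζ.re|) := by
  obtain ⟨C, hC, h⟩ := NNc_bd (ε := 1/8) (by norm_num) (by norm_num)
  obtain ⟨D, hD, g⟩ := NNc_bd (ε := 3/8) (by norm_num) (by norm_num)
  have key : ∀ ζ : ℂ, ∀ B E : ℝ, 0 < B → 0 < E → ‖NNc ζ‖ ≤ B * E → ‖N1c ζ‖ ≤ B * E →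
      ‖FF ζ‖ ≤ exp (2 * ζ.re) * (33/2 * B^3 * E^3) := by
    intro ζ B E hB hE h1 h2
    unfold FF
    rw [norm_mul, Complex.norm_exp]
    have : (2 * ζ).re = 2 * ζ.re := by simp
    rw [this]
    gcongr
    refine (norm_add_le _ _).trans ?_
    simp only [norm_mul, norm_pow, norm_div, Complex.norm_ofNat]
    calc _ ≤ 13/2 * (B*E)^2 * (B*E) + 10 * (B*E) * (B*E)^2 := by gcongr
      _ = _ := by ring
  refine ⟨33/2 * C^3 + 33/2 * D^3, by positivity, fun ζ => ?_⟩
  rcases le_total 0 ζ.re with h0 | h0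
  · refine (key ζ D _ hD (exp_pos _) (g ζ).1 (g ζ).2).trans ?_
    rw [abs_of_nonneg h0]
    have : exp (2 * ζ.re) * exp (-(2*(3/8)) * ζ.re) ^ 3 = exp (-(1/4) * ζ.re) := by
      rw [← exp_nat_mul, ← exp_add]; congr 1; push_cast; ring
    calc _ = (33/2 * D^3) * exp (-(1/4) * ζ.re) := by rw [← this]; ring
      _ ≤ _ := by
        gcongr
        have : 0 < C^3 := by positivity
        linarith
  · refine (key ζ C _ hC (exp_pos _) (h ζ).1 (h ζ).2).trans ?_
    rw [abs_of_nonpos h0]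
    have : exp (2 * ζ.re) * exp (-(2*(1/8)) * ζ.re) ^ 3 ≤ exp (-(1/4) * -ζ.re) := by
      rw [← exp_nat_mul, ← exp_add]; apply exp_le_exp.2; push_cast; linarith
    calc _ = (33/2 * C^3) * (exp (2 * ζ.re) * exp (-(2*(1/8)) * ζ.re) ^ 3) := by ring
      _ ≤ (33/2 * C^3 + 33/2 * D^3) * exp (-(1/4) * -ζ.re) := by
        gcongr
        have : 0 < D^3 := by positivity
        linarith

lemma expabs_int : Integrable (fun a : ℝ => exp (-(1/4) * |a|)) := by
  have h1 : IntegrableOn (fun a : ℝ => exp (-(1/4) * |a|)) (Ioi 0) := by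
    refine (exp_neg_integrableOn_Ioi 0 (b := 1/4) (by norm_num)).congr_fun (fun a ha => ?_) measurableSet_Ioi
    simp only [abs_of_pos (show 0 < a from ha)]
  rw [← integrableOn_univ, ← Iic_union_Ioi (a := (0:ℝ))]
  refine IntegrableOn.union ?_ h1
  refine (integrableOn_exp_mul_Iic (a := 1/4) (by norm_num) 0).congr_fun (fun a ha => ?_) measurableSet_Iic
  simp only [abs_of_nonpos (show a ≤ 0 from ha)]
  congr 1; ring

end BL

section
open Filter Topology

namespace BL

lemma FF_diff {ζ : ℂ} (h0 : 0 < ζ.im) (h1 : ζ.im < π) : DifferentiableAt ℂ FF ζ := by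
  have im2 : (ζ - π * Complex.I).im = ζ.im - π := by simp
  have d1 : ∀ β, -1 < β → DifferentiableAt ℂ (MM β) ζ := fun β hβ =>
    MM_diff hβ (by rw [abs_of_pos h0]; exact h1)
  have d2 : ∀ β, -1 < β → DifferentiableAt ℂ (fun ζ => MM β (ζ - π * Complex.I)) ζ := fun β hβ => by
    have hd : DifferentiableAt ℂ (MM β) (ζ - π * Complex.I) :=
      MM_diff hβ (by rw [im2, abs_lt]; constructor <;> linarith)
    exact DifferentiableAt.comp (g := MM β) (f := fun ζ => ζ - π * Complex.I) ζ hd (by fun_prop)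
  have a1 := d1 (-(1/2)) (by norm_num)
  have a2 := d1 (1/2) (by norm_num)
  have b1 := d2 (-(1/2)) (by norm_num)
  have b2 := d2 (1/2) (by norm_num)
  have c1 : DifferentiableAt ℂ NNc ζ := by unfold NNc; fun_prop
  have c2 : DifferentiableAt ℂ N1c ζ := by unfold N1c; fun_prop
  unfold FF; fun_prop

lemma line_re (a y : ℝ) : ((a:ℂ) + y * Complex.I).re = a := by simp
lemma line_im (a y : ℝ) : ((a:ℂ) + y * Complex.I).im = y := by simp

lemma FF_line_cont {y : ℝ} (h0 : 0 < y) (h1 : y < π) : Continuous (fun a : ℝ => FF (a + y * Complex.I)) := by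
  refine continuous_iff_continuousAt.2 fun a => ?_
  have h : ContinuousAt FF ((a:ℂ) + y * Complex.I) := (FF_diff (by rwa [line_im]) (by rwa [line_im])).continuousAt
  exact ContinuousAt.comp (f := fun a : ℝ => (a:ℂ) + y * Complex.I) (g := FF) h (by fun_prop)

lemma FF_line_int {y : ℝ} (h0 : 0 < y) (h1 : y < π) : Integrable (fun a : ℝ => FF (a + y * Complex.I)) := by
  obtain ⟨C, hC, h⟩ := FF_bd
  refine (expabs_int.const_mul C).mono' (FF_line_cont h0 h1).aestronglyMeasurable (.of_forall fun a => ?_)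
  have := h (a + y * Complex.I)
  rwa [line_re] at this

lemma FF_lines {y : ℝ} (h0 : 0 < y) (h1 : y < π / 2) :
    ∫ a : ℝ, FF (a + y * Complex.I) = ∫ a : ℝ, FF (a + (π/2 : ℝ) * Complex.I) := by
  have hp := pi_pos
  obtain ⟨C, hC, hb⟩ := FF_bd
  have rect : ∀ R : ℝ, ((∫ x in (-R)..R, FF (x + y * Complex.I)) - ∫ x in (-R)..R, FF (x + (π/2:ℝ) * Complex.I))
      = -(Complex.I * (∫ v in y..(π/2), FF (R + v * Complex.I)) - Complex.I * ∫ v in y..(π/2), FF ((-R:ℝ) + v * Complex.I)) := by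
    intro R
    have := Complex.integral_boundary_rect_eq_zero_of_differentiableOn FF ((-R:ℝ) + y * Complex.I) (R + (π/2:ℝ) * Complex.I) ?_
    · simp only [line_re, line_im, smul_eq_mul] at this
      linear_combination this
    · intro z hz
      rw [Complex.mem_reProdIm, line_re, line_re, line_im, line_im, uIcc_of_le h1.le] at hz
      exact (FF_diff (by linarith [hz.2.1]) (by linarith [hz.2.2])).differentiableWithinAt
  have side : ∀ s : ℝ → ℝ, (∀ R, |s R| = |R|) → Tendsto (fun R => ∫ v in y..(π/2), FF (s R + v * Complex.I)) atTop (𝓝 0) := by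
    intro s hs
    have hz : Tendsto (fun R : ℝ => C * exp (-(1/4) * |R|) * |π/2 - y|) atTop (𝓝 0) := by
      have h1 : Tendsto (fun R : ℝ => exp (-(1/4) * |R|)) atTop (𝓝 0) := by
        refine tendsto_exp_atBot.comp ?_
        exact (tendsto_abs_atTop_atTop).const_mul_atTop_of_neg (by norm_num)
      simpa using (h1.const_mul C).mul_const (|π/2 - y|)
    refine squeeze_zero_norm (fun R => ?_) hz
    refine intervalIntegral.norm_integral_le_of_norm_le_const fun v hv => ?_
    have := hb (s R + v * Complex.I)
    rwa [line_re, hs] at this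
  have lim : ∀ y, 0 < y → y < π → Tendsto (fun R : ℝ => ∫ x in (-R)..R, FF (x + y * Complex.I)) atTop (𝓝 (∫ a : ℝ, FF (a + y * Complex.I))) := fun y h0 h1 =>
    intervalIntegral_tendsto_integral (FF_line_int h0 h1) tendsto_neg_atTop_atBot tendsto_id
  have L := (lim y h0 (by linarith)).sub (lim (π/2) (by linarith) (by linarith))
  have R := (((side (fun R => R) (fun R => rfl)).const_mul Complex.I).sub ((side (fun R => -R) (fun R => abs_neg R)).const_mul Complex.I)).neg
  have := tendsto_nhds_unique L (R.congr fun t => (rect t).symm)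
  simp only [mul_zero, sub_zero, neg_zero] at this
  exact sub_eq_zero.1 this

lemma MM_lim {β : ℝ} (hβ : β = -(1/2) ∨ β = 1/2) (a : ℝ) :
    Tendsto (fun y : ℝ => MM β (a + y * Complex.I - π * Complex.I)) (𝓝[>] 0) (𝓝 (MM β (a - π * Complex.I))) := by
  unfold MM
  have re1 : ∀ y : ℝ, ((a:ℂ) + y * Complex.I - π * Complex.I).re = a := fun y => by simp
  refine tendsto_integral_filter_of_dominated_convergence (dm (1/8) a) ?_ ?_ (dm_int (by norm_num) (by norm_num) a).1 ?_
  · exact .of_forall fun y => (MM_meas _ _).aestronglyMeasurable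
  · refine .of_forall fun y => ?_
    filter_upwards [ae_ne (2 * exp a)] with w hw
    have := dm_bd (ε := 1/8) hβ (by norm_num) (by norm_num) hw.1 (ζ := a + y * Complex.I - π * Complex.I) (by rw [re1]; exact hw.2)
    rwa [re1] at this
  · filter_upwards [ae_ne (2 * exp a)] with w hw
    refine Tendsto.const_mul _ ?_
    have hw0 := hw.1
    have val : ∀ y : ℝ, (w:ℂ) * Complex.exp (-(a + y * Complex.I - π * Complex.I)) = ((-(w * exp (-a) * cos y) : ℝ):ℂ) + ((w * exp (-a) * sin y : ℝ) : ℂ) * Complex.I := by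
      intro y
      rw [se]
      have e1 : ((a:ℂ) + y * Complex.I - π * Complex.I).im = y - π := by simp
      rw [e1, re1, cos_sub_pi, sin_sub_pi]
      push_cast; ring
    have val0 : (w:ℂ) * Complex.exp (-(a - π * Complex.I)) = ((-(w * exp (-a)) : ℝ):ℂ) := by
      have := val 0
      simp only [cos_zero, sin_zero] at this
      simpa using this
    have hlog : Tendsto (fun y : ℝ => Complex.log (2 + w * Complex.exp (-(a + y * Complex.I - π * Complex.I)))) (𝓝[>] 0)
        (𝓝 (Complex.log (2 + w * Complex.exp (-(a - π * Complex.I))))) := by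
      have hc : Tendsto (fun y : ℝ => 2 + w * Complex.exp (-(a + y * Complex.I - π * Complex.I))) (𝓝[>] 0) (𝓝 (2 + w * Complex.exp (-(a - π * Complex.I)))) := by
        have : Continuous (fun y : ℝ => 2 + w * Complex.exp (-(a + y * Complex.I - π * Complex.I))) := by fun_prop
        have h := this.tendsto 0
        simp only [Complex.ofReal_zero, zero_mul, add_zero] at h
        exact h.mono_left nhdsWithin_le_nhds
      rcases lt_or_gt_of_ne hw.2 with hlt | hgt
      · have hs : 2 + w * Complex.exp (-(a - π * Complex.I)) ∈ Complex.slitPlane := by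
          rw [val0, Complex.mem_slitPlane_iff]
          left
          simp only [Complex.add_re, Complex.ofReal_re, Complex.re_ofNat]
          have : w * exp (-a) < 2 := by rw [exp_neg, ← div_eq_mul_inv, div_lt_iff₀ (exp_pos _)]; exact hlt
          linarith
        exact (continuousAt_clog hs).tendsto.comp hc
      · have hn : w * exp (-a) > 2 := by rw [exp_neg, ← div_eq_mul_inv, gt_iff_lt, lt_div_iff₀ (exp_pos _)]; exact hgt
        have hcw := Complex.continuousWithinAt_log_of_re_neg_of_im_zero (z := 2 + w * Complex.exp (-(a - π * Complex.I)))
          (by rw [val0]; simp only [Complex.add_re, Complex.ofReal_re, Complex.re_ofNat]; linarith)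
          (by rw [val0]; simp only [Complex.add_im, Complex.ofReal_im, Complex.im_ofNat]; norm_num)
        refine hcw.tendsto.comp (tendsto_nhdsWithin_iff.2 ⟨hc, ?_⟩)
        have : ∀ᶠ y : ℝ in 𝓝[>] 0, y ∈ Ioo 0 π := Ioo_mem_nhdsGT pi_pos
        filter_upwards [this] with y hy
        rw [val]
        simp only [mem_setOf_eq, Complex.add_im, Complex.ofReal_im, Complex.im_ofNat, Complex.mul_im, Complex.ofReal_re, Complex.I_re, Complex.I_im]
        have := sin_pos_of_pos_of_lt_pi hy.1 hy.2
        have : 0 < w * exp (-a) * sin y := by positivity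
        linarith
    unfold Hh
    exact (Complex.continuous_exp.tendsto _).comp ((hlog.neg).div_const 2)

lemma FF_lim (a : ℝ) : Tendsto (fun y : ℝ => FF (a + y * Complex.I)) (𝓝[>] 0) (𝓝 (FF a)) := by
  have l1 : ∀ β, -1 < β → Tendsto (fun y : ℝ => MM β (a + y * Complex.I)) (𝓝[>] 0) (𝓝 (MM β a)) := by
    intro β hβ
    have h : ContinuousAt (MM β) (a:ℂ) := (MM_diff hβ (by simp [pi_pos])).continuousAt
    have hc : Tendsto (fun y : ℝ => (a:ℂ) + y * Complex.I) (𝓝[>] 0) (𝓝 (a:ℂ)) := by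
      have : Continuous (fun y : ℝ => (a:ℂ) + y * Complex.I) := by fun_prop
      have h := this.tendsto 0
      simp only [Complex.ofReal_zero, zero_mul, add_zero] at h
      exact h.mono_left nhdsWithin_le_nhds
    exact h.tendsto.comp hc
  have le : ∀ k : ℂ, Tendsto (fun y : ℝ => Complex.exp (k * (a + y * Complex.I))) (𝓝[>] 0) (𝓝 (Complex.exp (k * a))) := by
    intro k
    have : Continuous (fun y : ℝ => Complex.exp (k * (a + y * Complex.I))) := by fun_prop
    have h := this.tendsto 0
    simp only [Complex.ofReal_zero, zero_mul, add_zero] at h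
    exact h.mono_left nhdsWithin_le_nhds
  have a1 := l1 (-(1/2)) (by norm_num)
  have a2 := l1 (1/2) (by norm_num)
  have b1 := MM_lim (.inl rfl) a
  have b2 := MM_lim (.inr rfl) a
  have e1 := le (-1)
  simp only [neg_one_mul] at e1
  have c1 : Tendsto (fun y : ℝ => NNc (a + y * Complex.I)) (𝓝[>] 0) (𝓝 (NNc a)) := by
    unfold NNc
    exact (e1.const_mul _).mul (a1.mul b1)
  have c2 : Tendsto (fun y : ℝ => N1c (a + y * Complex.I)) (𝓝[>] 0) (𝓝 (N1c a)) := by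
    unfold N1c
    exact (e1.const_mul _).mul ((a1.mul b2).add (a2.mul b1))
  unfold FF
  exact (le 2).mul ((((c1.pow 2).const_mul _).mul c2).add ((c1.const_mul _).mul (c2.pow 2)))

lemma FF_real_eq : ∫ a : ℝ, FF a = ∫ a : ℝ, FF (a + (π/2 : ℝ) * Complex.I) := by
  obtain ⟨C, hC, hb⟩ := FF_bd
  have hp := pi_pos
  have ev : ∀ᶠ y : ℝ in 𝓝[>] 0, y ∈ Ioo 0 (π/2) := Ioo_mem_nhdsGT (by positivity)
  have h := tendsto_integral_filter_of_dominated_convergence (μ := volume) (l := 𝓝[>] (0:ℝ)) (F := fun y a => FF ((a:ℝ) + y * Complex.I)) (f := fun a : ℝ => FF a)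
    (fun a => C * exp (-(1/4) * |a|)) ?_ ?_ (expabs_int.const_mul C) (.of_forall fun a => FF_lim a)
  · refine tendsto_nhds_unique h (Tendsto.congr' ?_ tendsto_const_nhds)
    filter_upwards [ev] with y hy using (FF_lines hy.1 hy.2).symm
  · filter_upwards [ev] with y hy using (FF_line_cont hy.1 (by linarith [hy.2])).aestronglyMeasurable
  · refine .of_forall fun y => .of_forall fun a => ?_
    have := hb (a + y * Complex.I)
    rwa [line_re] at this

lemma MM_conj {β : ℝ} {ζ : ℂ} (h : |ζ.im| < π) : MM β (starRingEnd ℂ ζ) = starRingEnd ℂ (MM β ζ) := by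
  unfold MM
  rw [← integral_conj]
  refine setIntegral_congr_fun measurableSet_Ioi fun w hw => ?_
  have hs := sl_mem hw h
  simp only [map_mul, Complex.conj_ofReal]
  congr 1
  unfold Hh
  rw [← Complex.exp_conj]
  congr 1
  have : 2 + (w:ℂ) * Complex.exp (-(starRingEnd ℂ ζ)) = starRingEnd ℂ (2 + (w:ℂ) * Complex.exp (-ζ)) := by
    rw [map_add, map_mul, Complex.conj_ofReal, ← Complex.exp_conj, map_neg, map_ofNat]
  rw [this, Complex.log_conj _ (Complex.slitPlane_arg_ne_pi hs), map_div₀, map_neg, map_ofNat]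

lemma FF_mid_im (a : ℝ) : (FF (a + (π/2 : ℝ) * Complex.I)).im = 0 := by
  set ζ : ℂ := a + (π/2 : ℝ) * Complex.I with hζ
  have hc : ζ - π * Complex.I = starRingEnd ℂ ζ := by
    rw [hζ, map_add, map_mul, Complex.conj_ofReal, Complex.conj_ofReal, Complex.conj_I]; push_cast; ring
  have hm : |ζ.im| < π := by rw [hζ, line_im, abs_of_pos (by positivity)]; linarith [pi_pos]
  have he : Complex.I * Complex.exp (-ζ) = ((exp (-a) : ℝ) : ℂ) := by
    rw [hζ, neg_add, Complex.exp_add, ← neg_mul, Complex.exp_mul_I]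
    push_cast
    rw [Complex.cos_neg, Complex.sin_neg, Complex.cos_pi_div_two, Complex.sin_pi_div_two]
    linear_combination (-Complex.exp (-a)) * Complex.I_sq
  have he2 : Complex.exp (2 * ζ) = ((-exp (2 * a) : ℝ) : ℂ) := by
    rw [hζ, mul_add, Complex.exp_add]
    have : (2:ℂ) * ((π/2:ℝ) * Complex.I) = π * Complex.I := by push_cast; ring
    rw [this, Complex.exp_pi_mul_I]; push_cast; ring
  have n0 : ∃ x : ℝ, NNc ζ = x := by
    unfold NNc
    rw [hc, MM_conj hm, he, Complex.mul_conj]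
    exact ⟨_, (Complex.ofReal_mul _ _).symm⟩
  have n1 : ∃ x : ℝ, N1c ζ = x := by
    unfold N1c
    rw [hc, MM_conj hm, MM_conj hm, neg_mul, he]
    refine ⟨-exp (-a) * (2 * (MM (-(1/2)) ζ * starRingEnd ℂ (MM (1/2) ζ)).re), ?_⟩
    have := Complex.add_conj (MM (-(1/2)) ζ * starRingEnd ℂ (MM (1/2) ζ))
    rw [map_mul, Complex.conj_conj] at this
    push_cast
    push_cast at this
    rw [← this]; ring
  obtain ⟨x, hx⟩ := n0
  obtain ⟨y, hy⟩ := n1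
  unfold FF
  rw [hx, hy, he2]
  have : ((-exp (2 * a) : ℝ) : ℂ) * (13/2 * (x:ℂ)^2 * y + 10 * x * y^2) = ((-exp (2*a) * (13/2*x^2*y + 10*x*y^2) : ℝ) : ℂ) := by push_cast; ring
  rw [this, Complex.ofReal_im]

lemma FF_im_zero : (∫ a : ℝ, FF a).im = 0 := by
  rw [FF_real_eq]
  have := integral_im (𝕜 := ℂ) (FF_line_int (y := π/2) (by positivity) (by linarith [pi_pos]))
  simp only [RCLike.im_eq_complex_im] at this
  rw [← this]
  simp only [FF_mid_im, integral_zero]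

end BL

end

namespace BL

lemma sub_cosh {t : ℝ} (ht : 0 < t) (c : ℝ) (g : ℝ → ℂ) :
    ∫ w in Ioi (t * (1 + c)), g w = ∫ u in Ioi (0:ℝ), ((t * sinh u : ℝ) : ℂ) * g (t * (cosh u + c)) := by
  have im : (fun u => t * (cosh u + c)) '' Ioi 0 = Ioi (t * (1 + c)) := by
    ext w
    simp only [mem_image, mem_Ioi]
    constructor
    · rintro ⟨u, hu, rfl⟩
      have := one_lt_cosh.2 hu.ne'
      gcongr
    · intro h
      have h1 : 1 < w / t - c := by
        rw [lt_sub_iff_add_lt, lt_div_iff₀ ht]; linarith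
      refine ⟨arcosh (w / t - c), arcosh_pos h1, ?_⟩
      rw [cosh_arcosh h1.le]; field_simp; ring
  rw [← im, integral_image_eq_integral_deriv_smul_of_monotoneOn (f' := fun u => t * sinh u) measurableSet_Ioi]
  · simp only [Complex.real_smul]
  · intro u hu
    exact (((hasDerivAt_cosh u).add_const c).const_mul t).hasDerivWithinAt
  · intro u hu v hv h
    have : cosh u ≤ cosh v := cosh_le_cosh.2 (by rwa [abs_of_pos hu, abs_of_pos hv])
    simp only; gcongr

lemma sub_cos {t : ℝ} (ht : 0 < t) (g : ℝ → ℂ) :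
    ∫ w in Ioo 0 (2 * t), g w = ∫ u in Ioo (0:ℝ) π, ((t * sin u : ℝ) : ℂ) * g (t * (1 - cos u)) := by
  have im : (fun u => t * (1 - cos u)) '' Ioo 0 π = Ioo 0 (2 * t) := by
    ext w
    simp only [mem_image, mem_Ioo]
    constructor
    · rintro ⟨u, hu, rfl⟩
      have h1 : cos u < cos 0 := strictAntiOn_cos ⟨le_rfl, pi_pos.le⟩ ⟨hu.1.le, hu.2.le⟩ hu.1
      have h2 : cos π < cos u := strictAntiOn_cos ⟨hu.1.le, hu.2.le⟩ ⟨pi_pos.le, le_rfl⟩ hu.2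
      rw [cos_zero] at h1
      rw [cos_pi] at h2
      constructor <;> nlinarith
    · intro h
      have h1 : 1 - w / t < 1 := by have := div_pos h.1 ht; linarith
      have h2 : -1 < 1 - w / t := by have : w / t < 2 := by { rw [div_lt_iff₀ ht]; exact h.2 }
                                     linarith
      refine ⟨arccos (1 - w / t), ⟨arccos_pos.2 h1, arccos_lt_pi.2 h2⟩, ?_⟩
      rw [cos_arccos h2.le h1.le]; field_simp; ring
  rw [← im, integral_image_eq_integral_deriv_smul_of_monotoneOn (f' := fun u => t * sin u) measurableSet_Ioo]
  · simp only [Complex.real_smul]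
  · intro u hu
    have := (((hasDerivAt_cos u).const_sub 1).const_mul t).hasDerivWithinAt (s := Ioo 0 π)
    exact this.congr_deriv (by ring)
  · intro u hu v hv h
    have : cos v ≤ cos u := strictAntiOn_cos.antitoneOn ⟨hu.1.le, hu.2.le⟩ ⟨hv.1.le, hv.2.le⟩ h
    simp only; gcongr

lemma wpow {w : ℝ} (hw : 0 < w) (b : Bool) : w ^ (cond b (1/2) (-(1/2)) : ℝ) = (cond b w 1) * w ^ (-(1/2):ℝ) := by
  cases b
  · simp
  · simp only [cond_true]
    rw [← rpow_one_add' hw.le (by norm_num)]; norm_num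

lemma Hh_pos {s : ℝ} (h : 0 < 2 + s) : Hh s = (((2 + s) ^ (-(1/2):ℝ) : ℝ) : ℂ) := by
  unfold Hh
  have : (2:ℂ) + s = ((2 + s : ℝ) : ℂ) := by push_cast; ring
  rw [this, ← Complex.ofReal_log h.le, rpow_def_of_pos h, Complex.ofReal_exp]
  congr 1; push_cast; ring

lemma Hh_neg {s : ℝ} (h : 2 + s < 0) : Hh s = (((-(2 + s)) ^ (-(1/2):ℝ) : ℝ) : ℂ) * (-Complex.I) := by
  unfold Hh
  have h' : 0 < -(2 + s) := by linarith
  have : (2:ℂ) + s = -((-(2 + s) : ℝ) : ℂ) := by push_cast; ring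
  rw [this, show -((-(2 + s) : ℝ) : ℂ) = ((-(2 + s) : ℝ) : ℂ) * (-1) by ring, Complex.log_ofReal_mul h' (by norm_num), Complex.log_neg_one, rpow_def_of_pos h', Complex.ofReal_exp,
    neg_add, add_div, Complex.exp_add]
  have : -(π * Complex.I) / 2 = ((-(π/2) : ℝ):ℂ) * Complex.I := by push_cast; ring
  rw [this, Complex.exp_mul_I]
  push_cast
  rw [Complex.cos_neg, Complex.sin_neg, Complex.cos_pi_div_two, Complex.sin_pi_div_two]
  have : -(log (-(2 + s)) : ℂ) / 2 = (log (-(2 + s)) : ℂ) * -(1/2) := by ring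
  rw [this]; ring

/-- the common algebra: `t·σ·(t p)^(-1/2)·q^(-1/2) = √t` if `σ² = p q`. -/
lemma alg_rt {t p q σ : ℝ} (ht : 0 < t) (hp : 0 < p) (hq : 0 < q) (hσ : 0 < σ) (h : σ^2 = p * q) :
    t * σ * ((t * p) ^ (-(1/2):ℝ) * q ^ (-(1/2):ℝ)) = √t := by
  have hσ' : σ = √p * √q := by
    rw [← sqrt_mul hp.le, ← h, sqrt_sq hσ.le]
  rw [rpow_neg (by positivity), rpow_neg hq.le, ← sqrt_eq_rpow, ← sqrt_eq_rpow, sqrt_mul ht.le, hσ']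
  have := sqrt_pos.2 ht
  have := sqrt_pos.2 hp
  have := sqrt_pos.2 hq
  field_simp
  rw [sq_sqrt ht.le]

noncomputable abbrev be (b : Bool) : ℝ := cond b (1/2) (-(1/2))

lemma MM_re (b : Bool) (a : ℝ) : MM (be b) a =
    ((√(exp a) * exp (exp a) * ∫ u in Ioi (0:ℝ), (cond b (exp a * (cosh u - 1)) 1) * exp (-(exp a * cosh u)) : ℝ) : ℂ) := by
  unfold MM
  have ht := exp_pos a
  have h0 := sub_cosh ht (-1) (fun w => ((exp (-w) * w ^ (be b) : ℝ) : ℂ) * Hh (w * Complex.exp (-(a:ℂ))))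
  rw [add_neg_cancel, mul_zero] at h0
  rw [h0, ← integral_const_mul, ← integral_complex_ofReal]
  refine setIntegral_congr_fun measurableSet_Ioi fun u hu => ?_
  have hc := one_lt_cosh.2 (show 0 < u from hu).ne'
  have hs := sinh_pos_iff.2 (show 0 < u from hu)
  have h1 : 0 < cosh u - 1 := by linarith
  have e1 : ((exp a * (cosh u + -1) : ℝ) : ℂ) * Complex.exp (-(a:ℂ)) = ((cosh u - 1 : ℝ) : ℂ) := by
    rw [← Complex.ofReal_neg, ← Complex.ofReal_exp, ← Complex.ofReal_mul, exp_neg]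
    congr 1; field_simp; ring
  rw [e1, Hh_pos (by linarith), ← sub_eq_add_neg, wpow (by positivity), ← Complex.ofReal_mul, ← Complex.ofReal_mul]
  congr 1
  have := alg_rt (σ := sinh u) ht h1 (q := 2 + (cosh u - 1)) (by linarith) hs (by rw [sinh_sq]; ring)
  have e2 : exp (-(exp a * (cosh u - 1))) = exp (exp a) * exp (-(exp a * cosh u)) := by rw [← exp_add]; congr 1; ring
  rw [e2, ← this]; ring

lemma MM_integrable {β : ℝ} (hβ : β = -(1/2) ∨ β = 1/2) (ζ : ℂ) :
    IntegrableOn (fun w : ℝ => ((exp (-w) * w ^ β : ℝ) : ℂ) * Hh (w * Complex.exp (-ζ))) (Ioi 0) := by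
  refine (dm_int (ε := 1/8) (by norm_num) (by norm_num) ζ.re).1.mono' (MM_meas β ζ).aestronglyMeasurable ?_
  filter_upwards [ae_ne (2 * exp ζ.re)] with w hw using dm_bd hβ (by norm_num) (by norm_num) hw.1 hw.2

lemma MM_im (b : Bool) (a : ℝ) : MM (be b) (a - π * Complex.I) =
    ((√(exp a) * exp (-exp a) * ∫ u in Ioo (0:ℝ) π, (cond b (exp a * (1 - cos u)) 1) * exp (exp a * cos u) : ℝ) : ℂ)
    - ((√(exp a) * exp (-exp a) * ∫ u in Ioi (0:ℝ), (cond b (exp a * (cosh u + 1)) 1) * exp (-(exp a * cosh u)) : ℝ) : ℂ) * Complex.I := by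
  have ht := exp_pos a
  have hb : be b = -(1/2) ∨ be b = 1/2 := by cases b <;> simp
  have hi := MM_integrable hb (a - π * Complex.I)
  have hex : Complex.exp (-((a:ℂ) - π * Complex.I)) = ((-exp (-a) : ℝ) : ℂ) := by
    rw [neg_sub, sub_eq_add_neg, Complex.exp_add, Complex.exp_pi_mul_I]; push_cast; ring
  unfold MM
  rw [hex] at hi ⊢
  have hsplit : Ioi (0:ℝ) = Ioc 0 (2 * exp a) ∪ Ioi (2 * exp a) := (Ioc_union_Ioi_eq_Ioi (by positivity)).symm
  rw [hsplit] at hi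
  rw [hsplit, setIntegral_union (Ioc_disjoint_Ioi le_rfl) measurableSet_Ioi (hi.mono_set subset_union_left) (hi.mono_set subset_union_right),
    integral_Ioc_eq_integral_Ioo, ← hsplit, sub_cos ht, sub_eq_add_neg]
  have h2 : 2 * exp a = exp a * (1 + 1) := by ring
  congr 1
  · rw [← integral_const_mul, ← integral_complex_ofReal]
    refine setIntegral_congr_fun measurableSet_Ioo fun u hu => ?_
    have h1 : cos u < 1 := by
      have := strictAntiOn_cos ⟨le_rfl, pi_pos.le⟩ ⟨hu.1.le, hu.2.le⟩ hu.1
      rwa [cos_zero] at this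
    have h2 : -1 < cos u := by
      have := strictAntiOn_cos ⟨hu.1.le, hu.2.le⟩ ⟨pi_pos.le, le_rfl⟩ hu.2
      rwa [cos_pi] at this
    have hs := sin_pos_of_pos_of_lt_pi hu.1 hu.2
    have e1 : ((exp a * (1 - cos u) : ℝ) : ℂ) * ((-exp (-a) : ℝ) : ℂ) = ((-(1 - cos u) : ℝ) : ℂ) := by
      rw [← Complex.ofReal_mul, exp_neg]
      congr 1; field_simp
    rw [e1, Hh_pos (by linarith), wpow (mul_pos ht (by linarith)), ← Complex.ofReal_mul, ← Complex.ofReal_mul]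
    congr 1
    have := alg_rt (σ := sin u) ht (p := 1 - cos u) (by linarith) (q := 2 + -(1 - cos u)) (by linarith) hs (by rw [sin_sq]; ring)
    have e2 : exp (-(exp a * (1 - cos u))) = exp (-exp a) * exp (exp a * cos u) := by rw [← exp_add]; congr 1; ring
    rw [e2, ← this]; ring
  · rw [h2, sub_cosh ht 1, ← mul_neg, ← integral_const_mul, ← integral_complex_ofReal, ← integral_mul_const]
    refine setIntegral_congr_fun measurableSet_Ioi fun u hu => ?_
    have hc := one_lt_cosh.2 (show 0 < u from hu).ne'
    have hs := sinh_pos_iff.2 (show 0 < u from hu)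
    have e1 : ((exp a * (cosh u + 1) : ℝ) : ℂ) * ((-exp (-a) : ℝ) : ℂ) = ((-(cosh u + 1) : ℝ) : ℂ) := by
      rw [← Complex.ofReal_mul, exp_neg]
      congr 1; field_simp
    rw [e1, Hh_neg (by linarith), wpow (by positivity), ← mul_assoc, ← mul_assoc, ← Complex.ofReal_mul, ← Complex.ofReal_mul]
    congr 2
    have := alg_rt (σ := sinh u) ht (p := cosh u + 1) (by linarith) (q := -(2 + -(cosh u + 1))) (by linarith) hs (by rw [sinh_sq]; ring)
    have e2 : exp (-(exp a * (cosh u + 1))) = exp (-exp a) * exp (-(exp a * cosh u)) := by rw [← exp_add]; congr 1; ring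
    rw [e2, ← this]; ring

lemma NNc_re (a : ℝ) : NNc a = ((K0 (exp a) ^ 2 : ℝ) : ℂ) + ((π * nn (exp a) : ℝ) : ℂ) * Complex.I ∧
    N1c a = ((2 * K0 (exp a) * k1 (exp a) : ℝ) : ℂ) + ((π * n1 (exp a) : ℝ) : ℂ) * Complex.I := by
  have ht := exp_pos a
  have r0 := MM_re false a
  have r1 := MM_re true a
  have j0 := MM_im false a
  have j1 := MM_im true a
  simp only [be, cond_true, cond_false, one_mul] at r0 r1 j0 j1
  have hex : Complex.exp (-(a:ℂ)) = (((exp a)⁻¹ : ℝ) : ℂ) := by rw [← exp_neg]; push_cast; rfl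
  have q0 := kInt 0 ht
  have q1 := kInt 1 ht
  simp only [pow_zero, one_mul, pow_one] at q0 q1
  have K1e : K1 (exp a) = ∫ u in Ioi (0:ℝ), cosh u * exp (-(exp a * cosh u)) := by unfold K1 Kk; simp only [pow_one]
  have v1 : ∫ u in Ioi (0:ℝ), exp a * (cosh u - 1) * exp (-(exp a * cosh u)) = exp a * (K1 (exp a) - K0 (exp a)) := by
    rw [K1e, K0, ← integral_sub q1 q0, ← integral_const_mul]
    congr 1; ext u; ring
  have v2 : ∫ u in Ioi (0:ℝ), exp a * (cosh u + 1) * exp (-(exp a * cosh u)) = exp a * (K1 (exp a) + K0 (exp a)) := by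
    rw [K1e, K0, ← integral_add q1 q0, ← integral_const_mul]
    congr 1; ext u; ring
  have v3 : ∫ u in Ioo (0:ℝ) π, exp (exp a * cos u) = π * I0 (exp a) := by
    unfold I0
    rw [intervalIntegral.integral_of_le pi_pos.le, integral_Ioc_eq_integral_Ioo]
    field_simp
  have v4 : ∫ u in Ioo (0:ℝ) π, exp a * (1 - cos u) * exp (exp a * cos u) = exp a * (π * I0 (exp a) - π * I1 (exp a)) := by
    have hI : π * I1 (exp a) = ∫ u in Ioo (0:ℝ) π, cos u * exp (exp a * cos u) := by
      unfold I1
      rw [intervalIntegral.integral_of_le pi_pos.le, integral_Ioc_eq_integral_Ioo]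
      rw [← mul_assoc, mul_one_div_cancel pi_ne_zero, one_mul]
    rw [hI, ← v3, ← integral_sub, ← integral_const_mul]
    · congr 1; ext u; ring
    · exact (Continuous.integrableOn_Icc (by fun_prop)).mono_set Ioo_subset_Icc_self
    · exact (Continuous.integrableOn_Icc (by fun_prop)).mono_set Ioo_subset_Icc_self
  have v5 : ∫ u in Ioi (0:ℝ), exp (-(exp a * cosh u)) = K0 (exp a) := rfl
  rw [v5] at r0 j0
  rw [v1] at r1
  rw [v2, v4] at j1
  rw [v3] at j0
  have hs : √(exp a) * √(exp a) = exp a := mul_self_sqrt ht.le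
  have he : exp (exp a) * exp (-exp a) = 1 := by rw [← exp_add]; simp
  have key : (((√(exp a) : ℝ) : ℂ) * ((√(exp a) : ℝ):ℂ)) * (((exp (exp a) : ℝ) : ℂ) * ((exp (-exp a) : ℝ):ℂ)) * (((exp a)⁻¹ : ℝ) : ℂ) = 1 := by
    rw [← Complex.ofReal_mul, ← Complex.ofReal_mul, ← Complex.ofReal_mul, ← Complex.ofReal_mul, hs, he, mul_one, mul_inv_cancel₀ ht.ne']; simp
  have I2 := Complex.I_sq
  unfold NNc N1c
  rw [r0, r1, j0, j1, hex]
  unfold nn n1 k1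
  generalize exp (exp a) = E1 at *
  generalize exp (-exp a) = E2 at *
  generalize √(exp a) = q at *
  generalize (exp a)⁻¹ = ti at *
  generalize exp a = t at *
  generalize K0 t = k at *
  generalize K1 t = l at *
  generalize I0 t = i at *
  generalize I1 t = j at *
  push_cast at *
  generalize Complex.I = I at *
  constructor
  · linear_combination (I * k * π * i - I^2 * k^2) * key - k^2 * I2
  · linear_combination (-I * (k * (t * (π * i - π * j) - t * (l + k) * I) + t * (l - k) * (π * i - k * I))) * key + 2 * k * t * l * I2

theorem step2 : (∫ t in Ioi (0:ℝ), t * P3 t) = π^2 * ∫ t in Ioi (0:ℝ), t * (13/2 * nn t ^ 2 * n1 t + 10 * nn t * n1 t ^ 2) := by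
  obtain ⟨C, hC, hb⟩ := n_bounds
  have i2 : IntegrableOn (fun t => t * (13/2 * nn t ^ 2 * n1 t + 10 * nn t * n1 t ^ 2)) (Ioi 0) := by
    refine int_pw (C := 17 * C^3) (a := 1/4) (b := 2) (ct_meas fun t ht => ?_) (by norm_num) (by norm_num) ?_ ?_
    · have := (nn_d ht).continuousAt
      have := (n1_d ht).continuousAt
      fun_prop
    · intro t ht
      have ht0 := ht.1
      obtain ⟨-, -, -, -, -, -, b1, b2, -⟩ := hb t ht.1
      set p := t ^ (-(1/8):ℝ) with hp
      have hp1 : 1 ≤ p := one_le_rpow_of_pos_of_le_one_of_nonpos ht.1 ht.2 (by norm_num)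
      have e : t ^ (-(1/4):ℝ) = p^2 := by rw [hp, ← rpow_natCast, ← rpow_mul ht.1.le]; norm_num
      rw [e, abs_mul, abs_of_pos ht.1]
      calc _ ≤ 1 * (|13/2 * nn t ^ 2 * n1 t| + |10 * nn t * n1 t ^ 2|) := by
            gcongr
            · exact ht.2
            · exact abs_add_le _ _
        _ = 13/2 * |nn t|^2 * |n1 t| + 10 * |nn t| * |n1 t|^2 := by simp only [abs_mul, abs_pow]; norm_num
        _ ≤ 13/2 * (C * p)^2 * C + 10 * (C*p) * C^2 := by gcongr
        _ ≤ _ := by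
          have : p ≤ p^2 := by nlinarith
          have : 0 < C^3 := by positivity
          nlinarith
    · intro t ht
      have ht0 : 0 < t := by linarith
      obtain ⟨b1, b2, -⟩ := hb t ht0
      rw [abs_mul, abs_of_pos ht0]
      calc _ ≤ t * (|13/2 * nn t ^ 2 * n1 t| + |10 * nn t * n1 t ^ 2|) := by
            gcongr
            exact abs_add_le _ _
        _ = t * (13/2 * |nn t|^2 * |n1 t| + 10 * |nn t| * |n1 t|^2) := by simp only [abs_mul, abs_pow]; norm_num
        _ ≤ t * (13/2 * (C/t)^2 * (C/t) + 10 * (C/t) * (C/t)^2) := by gcongr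
        _ = 33/2 * C^3 * (t^2)⁻¹ := by field_simp; norm_num
        _ ≤ 17 * C^3 * (t^2)⁻¹ := by gcongr; norm_num
        _ = _ := by rw [rpow_neg ht0.le]; norm_cast
  have i1 := step1.1
  have h0 := FF_im_zero
  have hint : Integrable (fun a : ℝ => FF a) := by
    obtain ⟨C, hC, h⟩ := FF_bd
    refine (expabs_int.const_mul C).mono' ?_ (.of_forall fun a => by simpa using h a)
    have hl : ∀ n : ℕ, Continuous fun a : ℝ => FF (a + (1 / ((n:ℝ) + 1) : ℝ) * Complex.I) := fun n =>
      FF_line_cont (by positivity) (lt_of_le_of_lt (by rw [div_le_one (by positivity)]; linarith [n.cast_nonneg (α := ℝ)]) (by linarith [pi_gt_three]))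
    refine (aestronglyMeasurable_of_tendsto_ae Filter.atTop (fun n => (hl n).aestronglyMeasurable) (.of_forall fun a => ?_))
    refine (FF_lim a).comp (tendsto_nhdsWithin_iff.2 ⟨tendsto_one_div_add_atTop_nhds_zero_nat, .of_forall fun n => ?_⟩)
    exact mem_Ioi.2 (by positivity)
  have h1 := integral_im (𝕜 := ℂ) hint
  simp only [RCLike.im_eq_complex_im] at h1
  rw [h0] at h1
  have h2 : ∫ t in Ioi (0:ℝ), (π * (t * P3 t) - π^3 * (t * (13/2 * nn t ^ 2 * n1 t + 10 * nn t * n1 t ^ 2))) = 0 := by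
    refine Eq.trans ?_ h1
    have im : exp '' univ = Ioi (0:ℝ) := by rw [image_univ, range_exp]
    rw [← im, integral_image_eq_integral_deriv_smul_of_monotoneOn (f' := exp) MeasurableSet.univ (fun x _ => (hasDerivAt_exp x).hasDerivWithinAt) (exp_monotone.monotoneOn _),
      setIntegral_univ]
    congr 1; ext a
    obtain ⟨e1, e2⟩ := NNc_re a
    unfold FF
    rw [e1, e2]
    have e3 : Complex.exp (2 * a) = ((exp a ^ 2 : ℝ) : ℂ) := by
      rw [two_mul, Complex.exp_add, ← Complex.ofReal_exp]; push_cast; ring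
    rw [e3, smul_eq_mul]
    unfold P3
    generalize exp a = t at *
    generalize nn t = n at *
    generalize n1 t = m at *
    generalize K0 t = k at *
    generalize k1 t = l at *
    have e4 : ((t^2 : ℝ):ℂ) * (13/2 * (((k^2 : ℝ):ℂ) + ((π * n : ℝ) : ℂ) * Complex.I)^2 * (((2*k*l:ℝ):ℂ) + ((π * m:ℝ):ℂ) * Complex.I)
        + 10 * (((k^2 : ℝ):ℂ) + ((π * n : ℝ) : ℂ) * Complex.I) * (((2*k*l:ℝ):ℂ) + ((π * m:ℝ):ℂ) * Complex.I)^2) =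
        ((t^2 * (13/2 * ((k^4 - π^2*n^2)*(2*k*l) - 2*k^2*π*n*(π*m)) + 10 * (k^2 * ((2*k*l)^2 - (π*m)^2) - π*n*(2*(2*k*l)*(π*m)))) : ℝ) : ℂ)
        + ((t^2 * (13/2 * (2*k^2*(π*n)*(2*k*l) + (k^4 - π^2*n^2) * (π * m)) + 10 * (π*n*((2*k*l)^2 - (π*m)^2) + k^2*(2*(2*k*l)*(π*m)))) : ℝ):ℂ) * Complex.I := by
      have I2 := Complex.I_sq
      push_cast
      generalize Complex.I = I at *
      have I3 : I^3 = -I := by linear_combination I * I2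
      ring_nf
      simp only [I2, I3]
      ring
    rw [e4]
    simp only [Complex.add_im, Complex.ofReal_im, Complex.mul_im, Complex.ofReal_re, Complex.I_re, Complex.I_im]
    ring
  rw [integral_sub (i1.const_mul _) (i2.const_mul _), integral_const_mul, integral_const_mul] at h2
  have := pi_pos.ne'
  have h3 : π * ((∫ t in Ioi (0:ℝ), t * P3 t) - π^2 * ∫ t in Ioi (0:ℝ), t * (13/2 * nn t ^ 2 * n1 t + 10 * nn t * n1 t ^ 2)) = 0 := by linear_combination h2
  rcases mul_eq_zero.1 h3 with h | h
  · exact absurd h this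
  · linarith

end BL

namespace BL

noncomputable def JJ (s : ℝ) : ℝ := (2/π) * ∫ θ in (0:ℝ)..(π/2), cos (s * sin θ)
noncomputable def jd (s : ℝ) : ℝ := (2/π) * ∫ θ in (0:ℝ)..(π/2), -(sin θ * sin (s * sin θ))

lemma JJ_d (s : ℝ) : HasDerivAt JJ (jd s) s := by
  unfold JJ jd
  refine HasDerivAt.const_mul _ ?_
  refine pderiv (by positivity) (f := fun s θ => cos (s * sin θ))
    (f' := fun s θ => -(sin θ * sin (s * sin θ))) isOpen_univ (mem_univ _) ?_ ?_ ?_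
  · intro x _; fun_prop
  · fun_prop
  · intro x _ y _
    exact ((hasDerivAt_id x).mul_const (sin y)).cos.congr_deriv (by simp [mul_comm])

lemma jd_d (s : ℝ) : HasDerivAt jd ((2/π) * ∫ θ in (0:ℝ)..(π/2), -(sin θ ^ 2 * cos (s * sin θ))) s := by
  unfold jd
  refine HasDerivAt.const_mul _ ?_
  refine pderiv (by positivity) (f := fun s θ => -(sin θ * sin (s * sin θ)))
    (f' := fun s θ => -(sin θ ^ 2 * cos (s * sin θ))) isOpen_univ (mem_univ _) ?_ ?_ ?_
  · intro x _; fun_prop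
  · fun_prop
  · intro x _ y _
    exact ((((hasDerivAt_id x).mul_const (sin y)).sin).const_mul (sin y)).fun_neg.congr_deriv (by simp; ring)

lemma sjd_d (s : ℝ) : HasDerivAt (fun s => s * jd s) (-(s * JJ s)) s := by
  refine ((hasDerivAt_id s).mul (jd_d s)).congr_deriv ?_
  have hF : ∫ θ in (0:ℝ)..(π/2), (s * (cos θ ^ 2 * cos (s * sin θ)) - sin θ * sin (s * sin θ)) = 0 := by
    rw [intervalIntegral.integral_eq_sub_of_hasDerivAt (f := fun θ => cos θ * sin (s * sin θ))]
    · simp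
    · intro x _
      exact ((hasDerivAt_cos x).fun_mul (((hasDerivAt_sin x).const_mul s).sin)).congr_deriv (by ring)
    · exact Continuous.intervalIntegrable (by fun_prop) _ _
  unfold jd JJ
  simp only [id_eq, one_mul]
  rw [← mul_left_comm (2/π) s, ← mul_add, ← mul_left_comm (2/π) s, ← mul_neg]
  congr 1
  rw [← intervalIntegral.integral_const_mul, ← intervalIntegral.integral_const_mul, ← intervalIntegral.integral_neg,
    ← intervalIntegral.integral_add (Continuous.intervalIntegrable (by fun_prop) _ _) (Continuous.intervalIntegrable (by fun_prop) _ _),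
    ← sub_eq_zero, ← intervalIntegral.integral_sub (Continuous.intervalIntegrable (by fun_prop) _ _) (Continuous.intervalIntegrable (by fun_prop) _ _), ← hF]
  congr 1; ext θ
  rw [cos_sq']; ring

lemma JJ_c : Continuous JJ := continuous_iff_continuousAt.2 fun s => (JJ_d s).continuousAt
lemma jd_c : Continuous jd := continuous_iff_continuousAt.2 fun s => (jd_d s).continuousAt

lemma avg_le {f : ℝ → ℝ} (h : ∀ θ, |f θ| ≤ 1) : |(2/π) * ∫ θ in (0:ℝ)..(π/2), f θ| ≤ 1 := by
  have := intervalIntegral.norm_integral_le_of_norm_le_const (a := 0) (b := π/2) (f := f) (C := 1) fun x _ => h x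
  rw [Real.norm_eq_abs, sub_zero, one_mul, abs_of_pos (by positivity : 0 < π/2)] at this
  rw [abs_mul, abs_of_pos (by positivity)]
  calc _ ≤ 2/π * (π/2) := by gcongr
    _ = 1 := by field_simp

lemma JJ_le (s : ℝ) : |JJ s| ≤ 1 := avg_le fun θ => abs_cos_le_one _
lemma jd_le (s : ℝ) : |jd s| ≤ 1 := avg_le fun θ => by
  rw [abs_neg, abs_mul]
  exact mul_le_one₀ (abs_sin_le_one _) (abs_nonneg _) (abs_sin_le_one _)
lemma JJ_zero : JJ 0 = 1 := by
  unfold JJ; simp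

lemma JJ_decay {s : ℝ} (hs : 0 < s) : |JJ s| ≤ 5 * s ^ (-(1/2):ℝ) := by
  have hp := pi_gt_three
  have hp4 := pi_le_four
  rcases le_total s 1 with h1 | h1
  · have : 1 ≤ s ^ (-(1/2):ℝ) := one_le_rpow_of_pos_of_le_one_of_nonpos hs h1 (by norm_num)
    linarith [JJ_le s]
  set η := s ^ (-(1/2):ℝ) with hη
  have hη0 : 0 < η := by positivity
  have hη1 : η ≤ 1 := rpow_le_one_of_one_le_of_nonpos h1 (by norm_num)
  have hsη : s * η = η⁻¹ := by
    have : s * η * η = 1 := by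
      rw [mul_assoc, hη, ← rpow_add hs]; norm_num [rpow_neg_one]
      field_simp
    field_simp; linarith
  set c := π/2 - η with hc
  have hc0 : 0 ≤ c := by rw [hc]; linarith
  have hcos : ∀ θ ∈ Icc 0 c, 0 < cos θ := fun θ h => cos_pos_of_mem_Ioo ⟨by linarith [h.1], by linarith [h.2]⟩
  have hcc : 2/π * η ≤ cos c := by
    rw [hc, cos_pi_div_two_sub]; exact mul_le_sin hη0.le (by linarith)
  have hcc0 : 0 < cos c := hcos c ⟨hc0, le_rfl⟩
  have hint : ∀ f : ℝ → ℝ, Continuous f → ∀ a b, IntervalIntegrable f volume a b := fun f hf a b => hf.intervalIntegrable a b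
  have q1 : ContinuousOn (fun θ => sin θ / cos θ ^ 2) (uIcc 0 c) := by
    refine ContinuousOn.div (by fun_prop) (by fun_prop) fun θ hθ => ?_
    rw [uIcc_of_le hc0] at hθ
    exact pow_ne_zero _ (hcos θ hθ).ne'
  have i1 : IntervalIntegrable (fun θ => sin θ / cos θ ^ 2) volume 0 c := q1.intervalIntegrable
  have i2 : IntervalIntegrable (fun θ => sin (s * sin θ) * (sin θ / cos θ ^ 2)) volume 0 c :=
    ContinuousOn.intervalIntegrable (ContinuousOn.mul (by fun_prop) q1)
  have e1 : ∫ θ in (0:ℝ)..c, (s * cos (s * sin θ) + sin (s * sin θ) * (sin θ / cos θ ^ 2)) = sin (s * sin c) / cos c := by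
    rw [intervalIntegral.integral_eq_sub_of_hasDerivAt (f := fun θ => sin (s * sin θ) / cos θ)]
    · simp
    · intro θ hθ
      rw [uIcc_of_le hc0] at hθ
      have := (hcos θ hθ).ne'
      refine ((((hasDerivAt_sin θ).const_mul s).sin).fun_div (hasDerivAt_cos θ) this).congr_deriv ?_
      field_simp; ring
    · exact (hint _ (by fun_prop) _ _).add i2
  have e2 : ∫ θ in (0:ℝ)..c, (sin θ / cos θ ^ 2) = 1 / cos c - 1 := by
    rw [intervalIntegral.integral_eq_sub_of_hasDerivAt (f := fun θ => 1 / cos θ) _ i1]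
    · simp
    · intro θ hθ
      rw [uIcc_of_le hc0] at hθ
      have := (hcos θ hθ).ne'
      refine ((hasDerivAt_const θ (1:ℝ)).fun_div (hasDerivAt_cos θ) this).congr_deriv ?_
      field_simp; ring
  have b1 : |∫ θ in (0:ℝ)..c, sin (s * sin θ) * (sin θ / cos θ ^ 2)| ≤ 1 / cos c - 1 := by
    rw [← e2, ← Real.norm_eq_abs]
    refine intervalIntegral.norm_integral_le_of_norm_le hc0 (.of_forall fun θ hθ => ?_) i1
    have := hcos θ ⟨hθ.1.le, hθ.2⟩
    have hsn := sin_nonneg_of_nonneg_of_le_pi hθ.1.le (by linarith [hθ.2] : θ ≤ π)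
    rw [Real.norm_eq_abs, abs_mul, abs_of_nonneg (by positivity : 0 ≤ sin θ / cos θ ^ 2)]
    exact mul_le_of_le_one_left (by positivity) (abs_sin_le_one _)
  rw [intervalIntegral.integral_add (hint _ (by fun_prop) _ _) i2, intervalIntegral.integral_const_mul] at e1
  have b2 : |sin (s * sin c) / cos c| ≤ 1 / cos c := by
    rw [abs_div, abs_of_pos hcc0]; gcongr; exact abs_sin_le_one _
  have b3 : |∫ θ in c..(π/2), cos (s * sin θ)| ≤ η := by
    have := intervalIntegral.norm_integral_le_of_norm_le_const (a := c) (b := π/2) (f := fun θ => cos (s * sin θ)) (C := 1) fun x _ => abs_cos_le_one _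
    rwa [Real.norm_eq_abs, one_mul, hc, sub_sub_cancel, abs_of_pos hη0] at this
  have b4 : 1 / cos c ≤ π / 2 * η⁻¹ := by
    rw [div_le_iff₀ hcc0]
    calc 1 = π / 2 * η⁻¹ * (2/π*η) := by field_simp
      _ ≤ _ := by gcongr
  have b5 : |s * ∫ θ in (0:ℝ)..c, cos (s * sin θ)| ≤ π * (s * η) := by
    rw [hsη]
    rw [abs_le] at b1 b2 ⊢
    constructor <;> linarith
  rw [abs_mul, abs_of_pos hs] at b5
  have b6 : |∫ θ in (0:ℝ)..c, cos (s * sin θ)| ≤ π * η := by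
    refine le_of_mul_le_mul_left ?_ hs; linarith
  unfold JJ
  rw [← intervalIntegral.integral_add_adjacent_intervals (hint _ (by fun_prop) 0 c) (hint _ (by fun_prop) c (π/2)), abs_mul, abs_of_pos (by positivity)]
  calc _ ≤ 2/π * (π * η + η) := by gcongr; exact (abs_add_le _ _).trans (add_le_add b6 b3)
    _ = 2 * η + 2 * η * (1/π) := by field_simp
    _ ≤ 2 * η + 2 * η * 1 := by gcongr; rw [div_le_one (by positivity)]; linarith
    _ ≤ 5 * η := by linarith

lemma gauss_cos {τ : ℝ} (hτ : 0 < τ) (y : ℝ) : ∫ x : ℝ, cos (x * y) * exp (-τ * x^2) = √(π/τ) * exp (-y^2/(4*τ)) := by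
  have h := fourierIntegral_gaussian (b := τ) (by simpa using hτ) (y:ℂ)
  have hi : Integrable (fun x : ℝ => Complex.exp (Complex.I * y * x) * Complex.exp (-τ * x^2)) := by
    refine (integrable_exp_neg_mul_sq hτ).mono' (Continuous.aestronglyMeasurable (by fun_prop)) (.of_forall fun x => ?_)
    rw [norm_mul, Complex.norm_exp, Complex.norm_exp]
    have e1 : (Complex.I * y * x).re = 0 := by simp
    have e2 : (-(τ:ℂ) * x^2).re = -τ * x^2 := by rw [← Complex.ofReal_pow, ← Complex.ofReal_neg, ← Complex.ofReal_mul, Complex.ofReal_re]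
    rw [e1, e2, exp_zero, one_mul]
  have h2 := integral_re (𝕜 := ℂ) hi
  simp only [RCLike.re_eq_complex_re] at h2
  rw [h] at h2
  have e3 : ((π:ℂ) / τ) ^ (1/2:ℂ) * Complex.exp (-(y:ℂ)^2 / (4 * τ)) = ((√(π/τ) * exp (-y^2/(4*τ)) : ℝ) : ℂ) := by
    rw [sqrt_eq_rpow]
    push_cast
    rw [Complex.ofReal_cpow (by positivity)]
    push_cast; rfl
  rw [e3, Complex.ofReal_re] at h2
  rw [← h2]
  congr 1; ext x
  have e4 : Complex.exp (Complex.I * y * x) * Complex.exp (-τ * x^2) = ((exp (-τ * x^2) : ℝ) : ℂ) * Complex.exp (((x * y : ℝ) : ℂ) * Complex.I) := by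
    push_cast; rw [mul_comm]; congr 2; ring
  rw [e4, Complex.re_ofReal_mul, Complex.exp_ofReal_mul_I_re]; ring

lemma bessel_tau {y : ℝ} (hy : 0 < y) : ∫ τ in Ioi (0:ℝ), exp (-4 * τ) * exp (-y^2/(4*τ)) = y/2 * K1 (2*y) := by
  set q : ℝ → ℝ := fun u => exp (-(2 * y * cosh u)) with hq
  have hqe : ∀ u, q (-u) = q u := fun u => by simp [hq]
  have hk : IntegrableOn (fun u => cosh u * q u) (Ioi 0) := by
    have := kInt 1 (t := 2*y) (by positivity)
    simpa only [pow_one] using this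
  have hk2 : Integrable (fun u => cosh u * q u) := by
    rw [← integrableOn_univ, ← Iic_union_Ioi (a := (0:ℝ))]
    refine IntegrableOn.union ?_ hk
    rw [integrableOn_Iic_iff_integrableOn_Iio]
    have h3 : IntegrableOn (fun u => cosh u * q u) (Ioi (-0)) := by rwa [neg_zero]
    have h4 := h3.comp_neg_Iio
    simpa only [hqe, cosh_neg] using h4
  have hG : Integrable (fun u => exp u * q u) := by
    refine (hk2.const_mul 2).mono' (Continuous.aestronglyMeasurable (by fun_prop)) (.of_forall fun u => ?_)
    rw [Real.norm_eq_abs, abs_of_pos (by positivity), cosh_eq]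
    have := exp_pos (-u)
    have := exp_pos (-(2 * y * cosh u))
    simp only [hq]
    nlinarith
  have im : (fun u => y/4 * exp u) '' univ = Ioi (0:ℝ) := by
    ext τ
    simp only [image_univ, mem_range, mem_Ioi]
    constructor
    · rintro ⟨u, rfl⟩; positivity
    · intro h
      refine ⟨log (τ / (y/4)), ?_⟩
      rw [exp_log (by positivity)]; field_simp
  rw [← im, integral_image_eq_integral_deriv_smul_of_monotoneOn (f' := fun u => y/4 * exp u) MeasurableSet.univ (fun x _ => ((hasDerivAt_exp x).const_mul _).hasDerivWithinAt)
    (fun a _ b _ h => mul_le_mul_of_nonneg_left (exp_le_exp.2 h) (by positivity)), setIntegral_univ]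
  have e1 : ∀ u, (y/4 * exp u) • (exp (-4 * (y/4 * exp u)) * exp (-y^2/(4*(y/4*exp u)))) = y/4 * (exp u * q u) := by
    intro u
    have : exp (-4 * (y/4 * exp u)) * exp (-y^2/(4*(y/4*exp u))) = q u := by
      rw [← exp_add]
      simp only [hq]
      congr 1
      rw [cosh_eq, exp_neg]
      have := exp_pos u
      field_simp; ring
    rw [this, smul_eq_mul]; ring
  simp only [e1]
  rw [integral_const_mul]
  have e2 : ∫ u, exp u * q u = ∫ u, cosh u * q u := by
    have h1 : ∫ u, exp (-u) * q u = ∫ u, exp u * q u := by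
      rw [← integral_neg_eq_self]
      simp only [neg_neg, hqe]
    have h2 : Integrable (fun u => exp (-u) * q u) := by
      have := hG.comp_neg
      simpa only [hqe] using this
    have h3 : ∫ u, cosh u * q u = ∫ u, (1/2) * (exp u * q u + exp (-u) * q u) := by
      congr 1; ext u; rw [cosh_eq]; ring
    rw [h3, integral_const_mul, integral_add hG h2, h1]; ring
  have e3 : ∫ u, cosh u * q u = 2 * ∫ u in Ioi (0:ℝ), cosh u * q u := by
    rw [← integral_comp_abs]
    congr 1; ext u; simp [hq, cosh_abs]
  rw [e2, e3]
  unfold K1 Kk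
  simp only [pow_one, hq]
  ring

end BL

namespace BL

lemma w_pos (x : ℝ) : 0 < (4 + x^2) ^ (-(3/2):ℝ) := by positivity
lemma w_c : Continuous fun x : ℝ => (4 + x^2) ^ (-(3/2):ℝ) :=
  Continuous.rpow_const (by fun_prop) fun x => Or.inl (by positivity)
lemma w_le1 (x : ℝ) : (4 + x^2) ^ (-(3/2):ℝ) ≤ 1 :=
  rpow_le_one_of_one_le_of_nonpos (by nlinarith [sq_nonneg x]) (by norm_num)
lemma w_le3 {x : ℝ} (hx : 0 < x) : (4 + x^2) ^ (-(3/2):ℝ) ≤ x ^ (-3:ℝ) := by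
  calc _ ≤ (x^2) ^ (-(3/2):ℝ) := rpow_le_rpow_of_nonpos (by positivity) (by linarith) (by norm_num)
    _ = _ := by rw [← rpow_natCast, ← rpow_mul hx.le]; norm_num
lemma w_int : IntegrableOn (fun x : ℝ => (4 + x^2) ^ (-(3/2):ℝ)) (Ioi 0) := by
  refine int_pw (C := 1) (a := 0) (b := 3) w_c.aestronglyMeasurable (by norm_num) (by norm_num) (fun t ht => ?_) (fun t ht => ?_)
  · rw [abs_of_pos (w_pos t)]; simpa using w_le1 t
  · rw [abs_of_pos (w_pos t), one_mul]; exact w_le3 (by linarith)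

lemma cos_K1 {y : ℝ} (hy : 0 < y) : ∫ x in Ioi (0:ℝ), cos (x * y) * (4 + x^2) ^ (-(3/2):ℝ) = y/2 * K1 (2*y) := by
  set f : ℝ → ℝ → ℝ := fun x τ => cos (x * y) * (τ ^ (1/2:ℝ) * exp (-((4 + x^2) * τ))) with hf
  have ee : ∀ x τ : ℝ, exp (-((4 + x^2) * τ)) = exp (-4*τ) * exp (-τ * x^2) := by
    intro x τ; rw [← exp_add]; congr 1; ring
  have hg : Integrable (Function.uncurry fun x τ : ℝ => τ ^ (1/2:ℝ) * exp (-((4 + x^2) * τ))) (volume.prod (volume.restrict (Ioi 0))) := by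
    have hc : Continuous (Function.uncurry fun x τ : ℝ => τ ^ (1/2:ℝ) * exp (-((4 + x^2) * τ))) := by
      refine Continuous.mul (Continuous.rpow_const (by fun_prop) fun x => Or.inr (by norm_num)) (by fun_prop)
    rw [integrable_prod_iff' hc.aestronglyMeasurable]
    constructor
    · filter_upwards [ae_restrict_mem measurableSet_Ioi] with τ hτ
      simp only [Function.uncurry, ee]
      exact ((integrable_exp_neg_mul_sq hτ).const_mul _).const_mul _
    · refine ((exp_neg_integrableOn_Ioi 0 (b := 4) (by norm_num)).const_mul (√π)).congr ?_
      filter_upwards [ae_restrict_mem measurableSet_Ioi] with τ hτ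
      have hτ' : 0 < τ := hτ
      simp only [Function.uncurry, ee]
      have : ∀ x, ‖τ ^ (1/2:ℝ) * (exp (-4*τ) * exp (-τ * x^2))‖ = τ ^ (1/2:ℝ) * exp (-4*τ) * exp (-τ * x^2) := by
        intro x; rw [Real.norm_of_nonneg (by positivity)]; ring
      simp only [this]
      rw [integral_const_mul, integral_gaussian, ← sqrt_eq_rpow, sqrt_div (by positivity)]
      field_simp
  have hi : Integrable (Function.uncurry f) (volume.prod (volume.restrict (Ioi 0))) := by
    have hc : Continuous (Function.uncurry f) := by
      refine Continuous.mul (by fun_prop) (Continuous.mul (Continuous.rpow_const (by fun_prop) fun x => Or.inr (by norm_num)) (by fun_prop))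
    refine hg.norm.mono' hc.aestronglyMeasurable (.of_forall fun p => ?_)
    simp only [Function.uncurry, hf]
    rw [norm_mul]
    exact mul_le_of_le_one_left (norm_nonneg _) (abs_cos_le_one _)
  have hs := integral_integral_swap hi
  have e1 : ∀ x, ∫ τ in Ioi (0:ℝ), f x τ = √π / 2 * (cos (x * y) * (4 + x^2) ^ (-(3/2):ℝ)) := by
    intro x
    simp only [hf]
    have h4 : 0 < 4 + x^2 := by positivity
    have := integral_rpow_mul_exp_neg_mul_Ioi (a := 3/2) (r := 4 + x^2) (by norm_num) h4
    norm_num at this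
    rw [integral_const_mul, this]
    have hG : Gamma (3/2) = √π / 2 := by
      rw [show (3/2:ℝ) = 1/2 + 1 by norm_num, Gamma_add_one (by norm_num), Gamma_one_half_eq]; ring
    rw [hG, rpow_neg h4.le, inv_rpow h4.le]; ring
  have e2 : ∫ τ in Ioi (0:ℝ), ∫ x, f x τ = √π * (y/2 * K1 (2*y)) := by
    rw [← bessel_tau hy, ← integral_const_mul]
    refine setIntegral_congr_fun measurableSet_Ioi fun τ hτ => ?_
    have hτ' : 0 < τ := hτ
    simp only [hf, ee]
    have : ∀ x, cos (x * y) * (τ ^ (1/2:ℝ) * (exp (-4*τ) * exp (-τ * x^2))) = τ ^ (1/2:ℝ) * exp (-4*τ) * (cos (x*y) * exp (-τ * x^2)) := by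
      intro x; ring
    simp only [this]
    rw [integral_const_mul, gauss_cos hτ', ← sqrt_eq_rpow, sqrt_div (by positivity)]
    field_simp
  simp only [e1] at hs
  rw [e2, integral_const_mul] at hs
  have e3 : ∫ x, cos (x * y) * (4 + x^2) ^ (-(3/2):ℝ) = 2 * ∫ x in Ioi (0:ℝ), cos (x * y) * (4 + x^2) ^ (-(3/2):ℝ) := by
    rw [← integral_comp_abs (f := fun x => cos (x * y) * (4 + x^2) ^ (-(3/2):ℝ))]
    congr 1; ext x
    rw [sq_abs]
    rcases abs_cases x with h | h <;> rw [h.1]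
    rw [neg_mul, cos_neg]
  rw [e3] at hs
  have : √π ≠ 0 := by positivity
  field_simp at hs
  linarith

lemma n1_fourier {t : ℝ} (ht : 0 < t) : n1 t = -4 * ∫ x in Ioi (0:ℝ), JJ (x * t) * (4 + x^2) ^ (-(3/2):ℝ) := by
  rw [(nk_int ht).1]
  have h0 : (0:ℝ) ≤ π/2 := by positivity
  have e1 : ∫ θ in (0:ℝ)..(π/2), k1 (2 * t * sin θ) = ∫ θ in Ioc (0:ℝ) (π/2), -4 * ∫ x in Ioi (0:ℝ), cos (x * (t * sin θ)) * (4 + x^2) ^ (-(3/2):ℝ) := by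
    rw [intervalIntegral.integral_of_le h0]
    refine setIntegral_congr_fun measurableSet_Ioc fun θ hθ => ?_
    have hs : 0 < sin θ := sin_pos_of_pos_of_lt_pi hθ.1 (by linarith [hθ.2, pi_pos])
    beta_reduce
    rw [cos_K1 (by positivity)]
    unfold k1; rw [← mul_assoc 2 t]; ring
  have hi : Integrable (Function.uncurry fun θ x : ℝ => cos (x * (t * sin θ)) * (4 + x^2) ^ (-(3/2):ℝ)) ((volume.restrict (Ioc 0 (π/2))).prod (volume.restrict (Ioi 0))) := by
    have h1 : Integrable (fun p : ℝ × ℝ => (1:ℝ) * (4 + p.2^2) ^ (-(3/2):ℝ)) ((volume.restrict (Ioc 0 (π/2))).prod (volume.restrict (Ioi 0))) :=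
      Integrable.mul_prod (f := fun _ => (1:ℝ)) (g := fun x : ℝ => (4 + x^2) ^ (-(3/2):ℝ)) (integrable_const _) w_int
    have hc : Continuous (Function.uncurry fun θ x : ℝ => cos (x * (t * sin θ)) * (4 + x^2) ^ (-(3/2):ℝ)) :=
      Continuous.mul (by fun_prop) (w_c.comp continuous_snd)
    refine h1.mono' hc.aestronglyMeasurable (.of_forall fun p => ?_)
    simp only [Function.uncurry]
    rw [norm_mul, Real.norm_of_nonneg (w_pos _).le]
    exact mul_le_mul_of_nonneg_right (abs_cos_le_one _) (w_pos _).le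
  rw [e1, integral_const_mul, integral_integral_swap hi, ← mul_assoc, mul_comm (2/π), mul_assoc, ← integral_const_mul]
  congr 2; ext x
  rw [integral_mul_const, ← mul_assoc]
  unfold JJ
  rw [intervalIntegral.integral_of_le h0]
  simp only [mul_assoc]

end BL

namespace BL

noncomputable def m1 (t : ℝ) : ℝ := min (1/t) (t ^ (-(1/4):ℝ))
lemma m1_pos {t : ℝ} (ht : 0 < t) : 0 < m1 t := lt_min (by positivity) (by positivity)
lemma m1_le {t : ℝ} (ht : 0 < t) : (t ≤ 1 → m1 t = t ^ (-(1/4):ℝ)) ∧ (1 ≤ t → m1 t = 1/t) := by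
  have e : 1/t = t ^ (-1:ℝ) := by rw [rpow_neg_one, one_div]
  refine ⟨fun h => min_eq_right ?_, fun h => min_eq_left ?_⟩ <;> rw [e]
  · exact rpow_le_rpow_of_exponent_ge ht h (by norm_num)
  · exact rpow_le_rpow_of_exponent_le h (by norm_num)
lemma m1_div {s x : ℝ} (hs : 0 < s) (hx : 0 < x) : m1 (s/x) ≤ (1+x) * m1 s := by
  unfold m1
  rw [mul_min_of_nonneg _ _ (by linarith)]
  refine min_le_min ?_ ?_
  · rw [one_div_div, mul_one_div]; gcongr; linarith
  · rw [div_rpow hs.le hx.le, div_eq_inv_mul, ← rpow_neg hx.le]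
    gcongr
    rw [neg_neg]
    rcases le_total x 1 with h | h
    · have := rpow_le_one hx.le h (by norm_num : (0:ℝ) ≤ 1/4); linarith
    · have := rpow_le_rpow_of_exponent_le h (by norm_num : (1/4:ℝ) ≤ 1); rw [rpow_one] at this; linarith

def GA (f : ℝ → ℝ) : Prop := (∀ t, 0 < t → ContinuousAt f t) ∧ ∃ C, 0 ≤ C ∧ ∀ t, 0 < t → |f t| ≤ C * m1 t
def GB (f : ℝ → ℝ) : Prop := (∀ t, 0 < t → ContinuousAt f t) ∧ ∃ C, 0 ≤ C ∧ ∀ t, 0 < t → |f t| ≤ C * m1 t ^ 2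

lemma GA.mul {f g : ℝ → ℝ} (hf : GA f) (hg : GA g) : GB (fun t => f t * g t) := by
  obtain ⟨cf, C, hC, bf⟩ := hf
  obtain ⟨cg, D, hD, bg⟩ := hg
  refine ⟨fun t ht => (cf t ht).mul (cg t ht), C * D, by positivity, fun t ht => ?_⟩
  rw [abs_mul]
  have := m1_pos ht
  calc _ ≤ (C * m1 t) * (D * m1 t) := by gcongr; exacts [bf t ht, bg t ht]
    _ = _ := by ring
lemma GB.add {f g : ℝ → ℝ} (hf : GB f) (hg : GB g) : GB (fun t => f t + g t) := by
  obtain ⟨cf, C, hC, bf⟩ := hf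
  obtain ⟨cg, D, hD, bg⟩ := hg
  refine ⟨fun t ht => (cf t ht).add (cg t ht), C + D, by positivity, fun t ht => ?_⟩
  rw [add_mul]
  exact (abs_add_le _ _).trans (add_le_add (bf t ht) (bg t ht))
lemma GB.cm {f : ℝ → ℝ} (hf : GB f) (c : ℝ) : GB (fun t => c * f t) := by
  obtain ⟨cf, C, hC, bf⟩ := hf
  refine ⟨fun t ht => continuousAt_const.mul (cf t ht), |c| * C, by positivity, fun t ht => ?_⟩
  rw [abs_mul, mul_assoc]
  exact mul_le_mul_of_nonneg_left (bf t ht) (abs_nonneg _)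

lemma ms_int : IntegrableOn (fun s : ℝ => s ^ (1/2:ℝ) * m1 s ^ 2) (Ioi 0) := by
  refine int_pw (C := 1) (a := 0) (b := 3/2) ?_ (by norm_num) (by norm_num) (fun t ht => ?_) (fun t ht => ?_)
  · refine ct_meas fun t ht => ?_
    unfold m1
    have : ContinuousAt (fun s : ℝ => s ^ (1/2:ℝ)) t := continuousAt_rpow_const _ _ (Or.inl ht.ne')
    have : ContinuousAt (fun s : ℝ => s ^ (-(1/4):ℝ)) t := continuousAt_rpow_const _ _ (Or.inl ht.ne')
    have : ContinuousAt (fun s : ℝ => 1/s) t := continuousAt_const.div continuousAt_id ht.ne'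
    fun_prop
  · have := ht.1
    rw [abs_of_nonneg (by positivity), (m1_le this).1 ht.2, ← rpow_natCast, ← rpow_mul this.le, ← rpow_add this]
    norm_num
  · have : 0 < t := by linarith
    rw [abs_of_nonneg (by positivity), (m1_le this).2 ht, show (1/t)^2 = t ^ (-2:ℝ) by rw [rpow_neg this.le, one_div, inv_pow]; norm_cast, ← rpow_add this]
    norm_num

noncomputable def Hk (f : ℝ → ℝ) (x : ℝ) : ℝ := ∫ t in Ioi (0:ℝ), JJ (x * t) * (f t * t)

lemma Jt_bd {x t : ℝ} (hx : 0 < x) (ht : 0 < t) : |JJ (x * t)| * t ≤ 5 * x ^ (-(1/2):ℝ) * t ^ (1/2:ℝ) := by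
  have h := JJ_decay (mul_pos hx ht)
  rw [mul_rpow hx.le ht.le] at h
  calc _ ≤ 5 * (x ^ (-(1/2):ℝ) * t ^ (-(1/2):ℝ)) * t := by gcongr
    _ = 5 * x ^ (-(1/2):ℝ) * (t ^ (-(1/2):ℝ) * t ^ (1:ℝ)) := by rw [rpow_one]; ring
    _ = _ := by rw [← rpow_add ht]; norm_num

lemma Hk_ptbd {f : ℝ → ℝ} {C x t : ℝ} (hC : 0 ≤ C) (hf : |f t| ≤ C * m1 t ^ 2) (hx : 0 < x) (ht : 0 < t) :
    ‖JJ (x * t) * (f t * t)‖ ≤ C * 5 * x ^ (-(1/2):ℝ) * (t ^ (1/2:ℝ) * m1 t ^ 2) := by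
  rw [Real.norm_eq_abs, abs_mul, abs_mul, abs_of_pos ht]
  calc _ = (|JJ (x * t)| * t) * |f t| := by ring
    _ ≤ (5 * x ^ (-(1/2):ℝ) * t ^ (1/2:ℝ)) * (C * m1 t ^ 2) := mul_le_mul (Jt_bd hx ht) hf (abs_nonneg _) (by positivity)
    _ = _ := by ring

lemma Hk_meas {f : ℝ → ℝ} (hf : GB f) (x : ℝ) : AEStronglyMeasurable (fun t => JJ (x * t) * (f t * t)) (volume.restrict (Ioi 0)) :=
  ct_meas fun t ht => by
    have := hf.1 t ht
    have := JJ_c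
    fun_prop

lemma Hk_int {f : ℝ → ℝ} (hf : GB f) {x : ℝ} (hx : 0 < x) : IntegrableOn (fun t => JJ (x * t) * (f t * t)) (Ioi 0) := by
  obtain ⟨C, hC, hb⟩ := hf.2
  refine (ms_int.const_mul (C * 5 * x ^ (-(1/2):ℝ))).mono' (Hk_meas hf x) ?_
  filter_upwards [ae_restrict_mem measurableSet_Ioi] with t ht
  exact Hk_ptbd hC (hb t ht) hx ht

lemma Hk_bd {f : ℝ → ℝ} (hf : GB f) : ∃ M, 0 ≤ M ∧ ∀ x, 0 < x → |Hk f x| ≤ M * x ^ (-(1/2):ℝ) := by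
  obtain ⟨C, hC, hb⟩ := hf.2
  refine ⟨C * 5 * ∫ t in Ioi (0:ℝ), t ^ (1/2:ℝ) * m1 t ^ 2, ?_, fun x hx => ?_⟩
  · refine mul_nonneg (by positivity) (setIntegral_nonneg measurableSet_Ioi fun t ht => ?_)
    have : 0 < t := ht
    positivity
  · have := norm_integral_le_of_norm_le (ms_int.const_mul (C * 5 * x ^ (-(1/2):ℝ))) (f := fun t => JJ (x * t) * (f t * t))
      (by filter_upwards [ae_restrict_mem measurableSet_Ioi] with t ht using Hk_ptbd hC (hb t ht) hx ht)
    rw [integral_const_mul] at this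
    refine this.trans (le_of_eq (by ring))

lemma Hk_sub (f : ℝ → ℝ) {x : ℝ} (hx : 0 < x) : Hk f x = (x^2)⁻¹ * ∫ s in Ioi (0:ℝ), JJ (1 * s) * (f (s/x) * s) := by
  have h := integral_comp_mul_left_Ioi (fun s => JJ (1 * s) * (f (s/x) * s)) 0 hx
  rw [mul_zero, smul_eq_mul] at h
  rw [show ((x^2)⁻¹ : ℝ) = x⁻¹ * x⁻¹ by rw [← mul_inv, sq], mul_assoc, ← h, ← integral_const_mul]
  unfold Hk
  congr 1; ext t
  rw [mul_div_cancel_left₀ _ hx.ne']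
  field_simp

lemma Hk_add {f g : ℝ → ℝ} (hf : GB f) (hg : GB g) {x : ℝ} (hx : 0 < x) (a b : ℝ) :
    Hk (fun t => a * f t + b * g t) x = a * Hk f x + b * Hk g x := by
  unfold Hk
  rw [← integral_const_mul, ← integral_const_mul, ← integral_add ((Hk_int hf hx).const_mul a) ((Hk_int hg hx).const_mul b)]
  congr 1; ext t; ring

lemma Hk_d {f h : ℝ → ℝ} (hf : GB f) (hh : GB h) (hd : ∀ t, 0 < t → HasDerivAt f (h t / t) t) {x : ℝ} (hx : 0 < x) :
    HasDerivAt (Hk f) (-(Hk h x + 2 * Hk f x) / x) x := by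
  obtain ⟨C, hC, hb⟩ := hh.2
  have sc : ∀ {g : ℝ → ℝ}, GB g → ∀ y, 0 < y → GB fun s => g (s/y) := by
    intro g hg y hy
    obtain ⟨D, hD, hg2⟩ := hg.2
    refine ⟨fun t ht => ContinuousAt.comp (f := fun s => s/y) (hg.1 _ (by positivity)) (by fun_prop), D * (1+y)^2, by positivity, fun t ht => (hg2 _ (by positivity)).trans ?_⟩
    have := m1_div ht hy
    have := m1_pos (div_pos ht hy)
    calc _ ≤ D * ((1+y) * m1 t)^2 := by gcongr
      _ = _ := by ring
  have key := hasDerivAt_integral_of_dominated_loc_of_deriv_le (μ := volume.restrict (Ioi 0)) (𝕜 := ℝ) (x₀ := x) (s := Ioo (x/2) (2*x))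
    (F := fun y s => JJ (1 * s) * (f (s/y) * s)) (F' := fun y s => JJ (1 * s) * (-(h (s/y) / y) * s))
    (bound := fun s => (2/x) * (C * (1+2*x)^2 * 5 * (1:ℝ) ^ (-(1/2):ℝ) * (s ^ (1/2:ℝ) * m1 s ^ 2)))
    (Ioo_mem_nhds (by linarith) (by linarith)) ?_ (Hk_int (sc hf x hx) one_pos) ?_ ?_ ?_ ?_
  · have h2 := (((hasDerivAt_pow 2 x).fun_inv (by positivity)).fun_mul key.2).congr_of_eventuallyEq (f₁ := Hk f) (by
      filter_upwards [Ioi_mem_nhds hx] with y hy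
      exact Hk_sub f hy)
    refine h2.congr_deriv ?_
    have e1 : ∫ s in Ioi (0:ℝ), JJ (1 * s) * (-(h (s/x) / x) * s) = -(1/x) * (x^2 * Hk h x) := by
      rw [Hk_sub h hx, ← mul_assoc (x^2), mul_inv_cancel₀ (by positivity), one_mul, ← integral_const_mul]
      congr 1; ext s; ring
    have e2 : ∫ s in Ioi (0:ℝ), JJ (1 * s) * (f (s/x) * s) = x^2 * Hk f x := by
      rw [Hk_sub f hx, ← mul_assoc (x^2), mul_inv_cancel₀ (by positivity), one_mul]
    rw [e1, e2]
    generalize Hk h x = A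
    generalize Hk f x = B
    field_simp
    ring
  · filter_upwards [Ioi_mem_nhds hx] with y hy
    exact Hk_meas (sc hf y hy) 1
  · refine ct_meas fun s hs => ?_
    have := (sc hh x hx).1 s hs
    have hJ : ContinuousAt (fun s => JJ (1 * s)) s := (JJ_c.comp (by fun_prop)).continuousAt
    exact hJ.mul ((this.div_const x).neg.mul continuousAt_id)
  · filter_upwards [ae_restrict_mem measurableSet_Ioi] with s hs y hy
    have hy0 : 0 < y := by linarith [hy.1]
    have hs' : 0 < s := hs
    have b1 : |h (s/y)| ≤ C * (1+2*x)^2 * m1 s ^ 2 := by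
      refine (hb _ (by positivity)).trans ?_
      have := m1_div hs hy0
      have := m1_pos (div_pos hs' hy0)
      have := m1_pos hs'
      calc _ ≤ C * ((1+y) * m1 s)^2 := by gcongr
        _ ≤ C * ((1+2*x) * m1 s)^2 := by gcongr; exact hy.2.le
        _ = _ := by ring
    have b2 := Hk_ptbd (f := fun s => h (s/y)) (by positivity) b1 one_pos hs'
    have e : JJ (1 * s) * (-(h (s/y) / y) * s) = -(1/y) * (JJ (1 * s) * (h (s/y) * s)) := by ring
    rw [e, norm_mul, norm_neg, Real.norm_of_nonneg (by positivity)]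
    refine mul_le_mul ?_ b2 (norm_nonneg _) (by positivity)
    rw [div_le_div_iff₀ hy0 hx]; linarith [hy.1]
  · exact (ms_int.const_mul _).const_mul _
  · filter_upwards [ae_restrict_mem measurableSet_Ioi] with s hs y hy
    have hy0 : 0 < y := by linarith [hy.1]
    have hs' : 0 < s := hs
    have h1 := (hd (s/y) (by positivity)).comp y (((hasDerivAt_const y s).fun_div (hasDerivAt_id y) hy0.ne'))
    refine ((h1.mul_const s).const_mul (JJ (1*s))).congr_deriv ?_
    field_simp
    ring

end BL

namespace BL

lemma GA_of {f : ℝ → ℝ} {C : ℝ} (hC : 0 ≤ C) (hc : ∀ t, 0 < t → ContinuousAt f t)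
    (h0 : ∀ t, 0 < t → t ≤ 1 → |f t| ≤ C * t ^ (-(1/4):ℝ)) (h1 : ∀ t, 1 ≤ t → |f t| ≤ C / t) : GA f := by
  refine ⟨hc, C, hC, fun t ht => ?_⟩
  rcases le_total t 1 with h | h
  · rw [(m1_le ht).1 h]; exact h0 t ht h
  · rw [(m1_le ht).2 h, mul_one_div]; exact h1 t h

lemma nn_ca {t : ℝ} (ht : 0 < t) : ContinuousAt nn t := (nn_d ht).continuousAt
lemma n1_ca {t : ℝ} (ht : 0 < t) : ContinuousAt n1 t := (n1_d ht).continuousAt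
lemma n2_ca {t : ℝ} (ht : 0 < t) : ContinuousAt n2 t := (n2_d ht).continuousAt
lemma n4_d {t : ℝ} (ht : 0 < t) : HasDerivAt n4 ((16*t^2*(nn t+n1 t)+16*t^2*(n1 t+n2 t)+4*t^2*(n2 t+n3 t))/t) t := by
  refine ((((hasDerivAt_pow 2 t).const_mul 8).fun_mul ((nn_d ht).fun_add (n1_d ht))).fun_add
    (((hasDerivAt_pow 2 t).const_mul 4).fun_mul ((n1_d ht).fun_add (n2_d ht)))).congr_deriv ?_
  simp
  field_simp
  ring

lemma GAs : GA nn ∧ GA n1 ∧ GA n2 ∧ GA n3 ∧ GA n4 := by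
  obtain ⟨C, hC, hb⟩ := n_bounds
  have r1 : ∀ t : ℝ, 0 < t → t ≤ 1 → 1 ≤ t ^ (-(1/4):ℝ) ∧ t ^ (-(1/8):ℝ) ≤ t ^ (-(1/4):ℝ) := fun t h0 h1 =>
    ⟨one_le_rpow_of_pos_of_le_one_of_nonpos h0 h1 (by norm_num), rpow_le_rpow_of_exponent_ge h0 h1 (by norm_num)⟩
  have sm : ∀ t : ℝ, 0 < t → t ≤ 1 → |nn t| ≤ C * t ^ (-(1/4):ℝ) ∧ |n1 t| ≤ C * t ^ (-(1/4):ℝ) ∧ |n2 t| ≤ C * t ^ (-(1/4):ℝ) := by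
    intro t h0 h1
    obtain ⟨-, -, -, -, -, -, b7, b8, b9⟩ := hb t h0
    obtain ⟨r2, r3⟩ := r1 t h0 h1
    exact ⟨b7.trans (by gcongr), b8.trans (by nlinarith), b9.trans (by gcongr; linarith)⟩
  have sq1 : ∀ t : ℝ, 0 < t → t ≤ 1 → t^2 ≤ 1 := fun t h0 h1 => by nlinarith
  have sq2 : ∀ {a b K t : ℝ}, 0 < t → t^2 ≤ 1 → |a| ≤ K → |b| ≤ K → |t^2 * (a + b)| ≤ 2 * K := by
    intro a b K t ht h2 ha hb
    rw [abs_mul, abs_of_pos (by positivity)]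
    have := abs_add_le a b
    nlinarith [abs_nonneg (a+b)]
  have lg : ∀ {a t : ℝ}, 1 ≤ t → |a| ≤ C / t^3 → |t^2 * a| ≤ C / t := by
    intro a t ht ha
    have : 0 < t := by linarith
    rw [abs_mul, abs_of_pos (by positivity)]
    calc _ ≤ t^2 * (C / t^3) := by gcongr
      _ = _ := by field_simp
  refine ⟨GA_of hC.le (fun t ht => nn_ca ht) (fun t h0 h1 => (sm t h0 h1).1) fun t h => (hb t (by linarith)).1,
    GA_of hC.le (fun t ht => n1_ca ht) (fun t h0 h1 => (sm t h0 h1).2.1) fun t h => (hb t (by linarith)).2.1,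
    GA_of hC.le (fun t ht => n2_ca ht) (fun t h0 h1 => (sm t h0 h1).2.2) fun t h => (hb t (by linarith)).2.2.1,
    GA_of (C := 24*C) (by positivity) (fun t ht => (n3_d ht).continuousAt) (fun t h0 h1 => ?_) fun t h => ?_,
    GA_of (C := 24*C) (by positivity) (fun t ht => (n4_d ht).continuousAt) (fun t h0 h1 => ?_) fun t h => ?_⟩
  · obtain ⟨a, b, c⟩ := sm t h0 h1
    have := sq2 h0 (sq1 t h0 h1) a b
    have e : n3 t = 4 * (t^2 * (nn t + n1 t)) := by unfold n3; ring
    have : 0 < C * t ^ (-(1/4):ℝ) := by positivity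
    rw [e, abs_mul, abs_of_pos (by norm_num : (0:ℝ) < 4)]; linarith
  · obtain ⟨-, -, -, b4, -⟩ := hb t (by linarith)
    have := lg h b4
    have : 0 < C / t := by have : 0 < t := by linarith
                           positivity
    have e : n3 t = 4 * (t^2 * (nn t + n1 t)) := by unfold n3; ring
    rw [e, abs_mul, abs_of_pos (by norm_num : (0:ℝ) < 4), mul_div_assoc]; linarith
  · obtain ⟨a, b, c⟩ := sm t h0 h1
    have g1 := abs_le.1 (sq2 h0 (sq1 t h0 h1) a b)
    have g2 := abs_le.1 (sq2 h0 (sq1 t h0 h1) b c)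
    have e : n4 t = 8 * (t^2 * (nn t + n1 t)) + 4 * (t^2 * (n1 t + n2 t)) := by unfold n4; ring
    rw [e, abs_le]; constructor <;> linarith
  · obtain ⟨-, -, -, b4, b5, -⟩ := hb t (by linarith)
    have g1 := abs_le.1 (lg h b4)
    have g2 := abs_le.1 (lg h b5)
    have : 0 < C / t := by have : 0 < t := by linarith
                           positivity
    have e : n4 t = 8 * (t^2 * (nn t + n1 t)) + 4 * (t^2 * (n1 t + n2 t)) := by unfold n4; ring
    rw [e, abs_le, mul_div_assoc]; constructor <;> linarith

noncomputable def q0 (t : ℝ) : ℝ := nn t ^ 2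
noncomputable def q1 (t : ℝ) : ℝ := 2 * (nn t * n1 t)
noncomputable def q2 (t : ℝ) : ℝ := 2 * (nn t * n2 t) + 2 * (n1 t * n1 t)
noncomputable def q3 (t : ℝ) : ℝ := 2 * (nn t * n3 t) + 6 * (n1 t * n2 t)
noncomputable def q4 (t : ℝ) : ℝ := 2 * (nn t * n4 t) + 8 * (n1 t * n3 t) + 6 * (n2 t * n2 t)

lemma GBs : GB q0 ∧ GB q1 ∧ GB q2 ∧ GB q3 ∧ GB q4 := by
  obtain ⟨h0, h1, h2, h3, h4⟩ := GAs
  refine ⟨?_, (h0.mul h1).cm 2, ((h0.mul h2).cm 2).add ((h1.mul h1).cm 2), ((h0.mul h3).cm 2).add ((h1.mul h2).cm 6),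
    (((h0.mul h4).cm 2).add ((h1.mul h3).cm 8)).add ((h2.mul h2).cm 6)⟩
  have := h0.mul h0
  simp only [← sq] at this
  exact this

lemma q0_d {t : ℝ} (ht : 0 < t) : HasDerivAt q0 (q1 t / t) t :=
  ((nn_d ht).fun_pow 2).congr_deriv (by unfold q1; push_cast; ring)
lemma q1_d {t : ℝ} (ht : 0 < t) : HasDerivAt q1 (q2 t / t) t :=
  (((nn_d ht).fun_mul (n1_d ht)).const_mul 2).congr_deriv (by unfold q2; ring)
lemma q2_d {t : ℝ} (ht : 0 < t) : HasDerivAt q2 (q3 t / t) t :=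
  ((((nn_d ht).fun_mul (n2_d ht)).const_mul 2).fun_add (((n1_d ht).fun_mul (n1_d ht)).const_mul 2)).congr_deriv (by unfold q3; ring)
lemma q3_d {t : ℝ} (ht : 0 < t) : HasDerivAt q3 (q4 t / t) t :=
  ((((nn_d ht).fun_mul (n3_d ht)).const_mul 2).fun_add (((n1_d ht).fun_mul (n2_d ht)).const_mul 6)).congr_deriv (by unfold q4; ring)
lemma q4_d {t : ℝ} (ht : 0 < t) : HasDerivAt q4 ((t^2 * (20 * q3 t + 60 * q2 t + 72 * q1 t + 32 * q0 t) - 64 * t^4 * (q1 t + 2 * q0 t)) / t) t := by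
  refine (((((nn_d ht).fun_mul (n4_d ht)).const_mul 2).fun_add (((n1_d ht).fun_mul (n3_d ht)).const_mul 8)).fun_add (((n2_d ht).fun_mul (n2_d ht)).const_mul 6)).congr_deriv ?_
  unfold q0 q1 q2 q3 n4 n3
  field_simp
  ring

lemma q_fin : ∃ C, 0 ≤ C ∧ ∀ t, 0 < t → (t ≤ 1 → |q4 t| ≤ C * t ^ (1/2:ℝ) ∧ |q3 t| ≤ C * t ^ (1/2:ℝ)) ∧
    (1 ≤ t → |q1 t + 2 * q0 t| ≤ C * t ^ (-4:ℝ) ∧ |q2 t + 4 * q1 t + 4 * q0 t| ≤ C * t ^ (-4:ℝ)) := by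
  obtain ⟨C, hC, hb⟩ := n_bounds
  refine ⟨400 * C^2, by positivity, fun t ht => ⟨fun h => ?_, fun h => ?_⟩⟩
  · obtain ⟨-, -, -, -, -, -, b7, b8, b9⟩ := hb t ht
    set v := t ^ (1/4:ℝ) with hv
    have v0 : 0 < v := by positivity
    have v1 : v ≤ 1 := rpow_le_one ht.le h (by norm_num)
    have ev : t = v^4 := by rw [hv, ← rpow_natCast, ← rpow_mul ht.le]; norm_num
    have ew : t ^ (1/2:ℝ) = v^2 := by rw [hv, ← rpow_natCast, ← rpow_mul ht.le]; norm_num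
    have b7' : |nn t| ≤ C / v := b7.trans (by
      rw [hv, div_eq_mul_inv C, ← rpow_neg ht.le]; gcongr 1
      exact rpow_le_rpow_of_exponent_ge ht h (by norm_num))
    have hvC : C ≤ C / v := by rw [le_div_iff₀ v0]; nlinarith
    have b8' : |n1 t| ≤ C / v := b8.trans hvC
    have b9' : |n2 t| ≤ C * v^4 := by rwa [← ev]
    have v41 : v^4 ≤ 1 := pow_le_one₀ v0.le v1
    have b9'' : |n2 t| ≤ C / v := b9'.trans (by nlinarith)
    have hx : ∀ a b : ℝ, |a| ≤ C / v → |b| ≤ C / v → |t^2 * (a + b)| ≤ 2 * C * v^7 := by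
      intro a b ha hb
      rw [abs_mul, abs_of_pos (by positivity), ev]
      calc _ ≤ (v^4)^2 * (C/v + C/v) := by gcongr; exact (abs_add_le a b).trans (add_le_add ha hb)
        _ = _ := by field_simp; ring
    have g1 := hx _ _ b7' b8'
    have g2 := hx _ _ b8' b9''
    have m3 : |n3 t| ≤ 24 * C * v^7 := by
      have e : n3 t = 4 * (t^2 * (nn t + n1 t)) := by unfold n3; ring
      have : 0 < C * v^7 := by positivity
      rw [e, abs_mul, abs_of_pos (by norm_num : (0:ℝ) < 4)]; linarith
    have m4 : |n4 t| ≤ 24 * C * v^7 := by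
      have e : n4 t = 8 * (t^2 * (nn t + n1 t)) + 4 * (t^2 * (n1 t + n2 t)) := by unfold n4; ring
      have g1 := abs_le.1 g1
      have g2 := abs_le.1 g2
      rw [e, abs_le]; constructor <;> linarith
    have pr : ∀ a b p q : ℝ, |a| ≤ p → |b| ≤ q → p * q ≤ 24 * C^2 * v^2 → |a * b| ≤ 24 * C^2 * v^2 := by
      intro a b p q ha hb hpq
      rw [abs_mul]
      exact (mul_le_mul ha hb (abs_nonneg _) ((abs_nonneg _).trans ha)).trans hpq
    have v62 : v^6 ≤ v^2 := pow_le_pow_of_le_one v0.le v1 (by norm_num)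
    have v42 : v^4 ≤ v^2 := pow_le_pow_of_le_one v0.le v1 (by norm_num)
    have v32 : v^3 ≤ v^2 := pow_le_pow_of_le_one v0.le v1 (by norm_num)
    have hq : C / v * (24 * C * v^7) ≤ 24 * C^2 * v^2 := by
      rw [show C / v * (24 * C * v^7) = 24 * C^2 * v^6 by field_simp]; gcongr
    have hq2 : C / v * (C * v^4) ≤ 24 * C^2 * v^2 := by
      rw [show C / v * (C * v^4) = C^2 * v^3 by field_simp]; nlinarith [sq_nonneg C, sq_nonneg (C * v), mul_le_mul_of_nonneg_left v32 (sq_nonneg C)]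
    have hq3 : C * v^4 * (C * v^4) ≤ 24 * C^2 * v^2 := by
      have : v^4 * v^4 ≤ 1 * v^2 := mul_le_mul v41 v42 (by positivity) (by norm_num)
      nlinarith [sq_nonneg (C * v), mul_le_mul_of_nonneg_left this (sq_nonneg C)]
    have p1 := abs_le.1 (pr _ _ _ _ b7' m4 hq)
    have p2 := abs_le.1 (pr _ _ _ _ b8' m3 hq)
    have p3 := abs_le.1 (pr _ _ _ _ b9' b9' hq3)
    have p4 := abs_le.1 (pr _ _ _ _ b7' m3 hq)
    have p5 := abs_le.1 (pr _ _ _ _ b8' b9' hq2)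
    have : 0 < C^2 * v^2 := by positivity
    rw [ew]
    unfold q4 q3
    constructor
    all_goals
      rw [abs_le]; constructor <;> linarith
  · obtain ⟨b1, b2, -, b4, b5, -⟩ := hb t ht
    have e4 : t ^ (-4:ℝ) = 1 / t * (1 / t^3) := by
      rw [rpow_neg ht.le, show (4:ℝ) = ((4:ℕ):ℝ) by norm_num, rpow_natCast]; field_simp
    have pr : ∀ a b : ℝ, |a| ≤ C / t → |b| ≤ C / t^3 → |a * b| ≤ C^2 * t ^ (-4:ℝ) := by
      intro a b ha hb
      rw [abs_mul, e4]
      exact (mul_le_mul ha hb (abs_nonneg _) ((abs_nonneg _).trans ha)).trans (le_of_eq (by ring))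
    have p1 := abs_le.1 (pr _ _ b1 b4)
    have p2 := abs_le.1 (pr _ _ b2 b4)
    have p3 := abs_le.1 (pr _ _ b1 b5)
    have : 0 < C^2 * t ^ (-4:ℝ) := by positivity
    have e1 : q1 t + 2 * q0 t = 2 * (nn t * (nn t + n1 t)) := by unfold q1 q0; ring
    have e2 : q2 t + 4 * q1 t + 4 * q0 t = 2 * (n1 t * (nn t + n1 t)) + 2 * (nn t * (n1 t + n2 t)) + 4 * (nn t * (nn t + n1 t)) := by
      unfold q2 q1 q0; ring
    rw [e1, e2]
    constructor
    all_goals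
      rw [abs_le]; constructor <;> linarith

end BL

namespace BL

lemma xh_le1 {x : ℝ} (hx : 1 ≤ x) : x ^ (-(1/2):ℝ) ≤ 1 := rpow_le_one_of_one_le_of_nonpos hx (by norm_num)

lemma wH_int {H : ℝ → ℝ} {M : ℝ} (hc : ∀ x, 0 < x → ContinuousAt H x) (hM : ∀ x, 0 < x → |H x| ≤ M * x ^ (-(1/2):ℝ)) :
    IntegrableOn (fun x => (4 + x^2) ^ (-(3/2):ℝ) * H x) (Ioi 0) := by
  have hM0 : 0 ≤ M := by have := (abs_nonneg _).trans (hM 1 one_pos); simpa using this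
  refine int_pw (C := M) (a := 1/2) (b := 3) (ct_meas fun t ht => w_c.continuousAt.mul (hc t ht)) (by norm_num) (by norm_num) (fun t ht => ?_) (fun t ht => ?_)
  · rw [abs_mul, abs_of_pos (w_pos t)]
    exact (mul_le_of_le_one_left (abs_nonneg _) (w_le1 t)).trans (hM t ht.1)
  · have h0 : 0 < t := by linarith
    rw [abs_mul, abs_of_pos (w_pos t), mul_comm]
    refine mul_le_mul ((hM t h0).trans ?_) (w_le3 h0) (w_pos t).le hM0
    exact mul_le_of_le_one_right hM0 (xh_le1 ht)

lemma step3_fub {f : ℝ → ℝ} (hf : GB f) : ∫ t in Ioi (0:ℝ), t * (f t * n1 t) = -4 * ∫ x in Ioi (0:ℝ), (4 + x^2) ^ (-(3/2):ℝ) * Hk f x := by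
  obtain ⟨C, hC, hb⟩ := hf.2
  have hi : Integrable (Function.uncurry fun t x : ℝ => JJ (x * t) * (f t * t) * (4 + x^2) ^ (-(3/2):ℝ)) ((volume.restrict (Ioi 0)).prod (volume.restrict (Ioi 0))) := by
    have hm : AEStronglyMeasurable (Function.uncurry fun t x : ℝ => JJ (x * t) * (f t * t) * (4 + x^2) ^ (-(3/2):ℝ)) ((volume.restrict (Ioi 0)).prod (volume.restrict (Ioi 0))) := by
      have h1 : Continuous fun p : ℝ × ℝ => JJ (p.2 * p.1) := JJ_c.comp (by fun_prop)
      have h2 : Continuous fun p : ℝ × ℝ => (4 + p.2^2) ^ (-(3/2):ℝ) := w_c.comp continuous_snd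
      have h3 : AEStronglyMeasurable (fun t => f t * t) (volume.restrict (Ioi 0)) := ct_meas fun t ht => (hf.1 t ht).mul continuousAt_id
      exact (h1.aestronglyMeasurable.mul (h3.comp_fst)).mul h2.aestronglyMeasurable
    have hw : IntegrableOn (fun x : ℝ => (4 + x^2) ^ (-(3/2):ℝ) * x ^ (-(1/2):ℝ)) (Ioi 0) :=
      wH_int (M := 1) (fun x hx => continuousAt_rpow_const _ _ (Or.inl hx.ne')) fun x hx => by rw [abs_of_pos (by positivity), one_mul]
    refine ((ms_int.const_mul (C * 5)).mul_prod hw).mono' hm ?_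
    rw [Measure.prod_restrict]
    filter_upwards [ae_restrict_mem (measurableSet_Ioi.prod measurableSet_Ioi)] with p hp
    have := Hk_ptbd hC (hb p.1 hp.1) (x := p.2) hp.2 hp.1
    simp only [Function.uncurry]
    rw [norm_mul, Real.norm_of_nonneg (w_pos p.2).le]
    exact (mul_le_mul_of_nonneg_right this (w_pos p.2).le).trans (le_of_eq (by ring))
  have e1 : ∫ t in Ioi (0:ℝ), t * (f t * n1 t) = -4 * ∫ t in Ioi (0:ℝ), ∫ x in Ioi (0:ℝ), JJ (x * t) * (f t * t) * (4 + x^2) ^ (-(3/2):ℝ) := by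
    rw [← integral_const_mul]
    refine setIntegral_congr_fun measurableSet_Ioi fun t ht => ?_
    beta_reduce
    rw [n1_fourier ht, ← mul_assoc, mul_left_comm, ← integral_const_mul]
    congr 2; ext x; ring
  rw [e1, integral_integral_swap hi]
  congr 2; ext x
  rw [integral_mul_const, mul_comm]; rfl

lemma T0_d {x : ℝ} (hx : 0 < x) : HasDerivAt (Hk q0) (-(Hk q1 x + 2 * Hk q0 x) / x) x := Hk_d GBs.1 GBs.2.1 (fun _ => q0_d) hx
lemma T1_d {x : ℝ} (hx : 0 < x) : HasDerivAt (Hk q1) (-(Hk q2 x + 2 * Hk q1 x) / x) x := Hk_d GBs.2.1 GBs.2.2.1 (fun _ => q1_d) hx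
lemma T2_d {x : ℝ} (hx : 0 < x) : HasDerivAt (Hk q2) (-(Hk q3 x + 2 * Hk q2 x) / x) x := Hk_d GBs.2.2.1 GBs.2.2.2.1 (fun _ => q2_d) hx

theorem step3 : (∫ t in Ioi (0:ℝ), I0 t * (K0 t)^5 * t * (1 - 8*t^2)) =
    4 * π^2 * ∫ x in Ioi (0:ℝ), Hk q0 x * ((4 + x^2) ^ (-(5/2):ℝ) * (9/2 * x^2 - 2)) := by
  have hv : ∀ x : ℝ, (4 + x^2) ^ (-(3/2):ℝ) = (4 + x^2) * (4 + x^2) ^ (-(5/2):ℝ) := by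
    intro x
    have : 0 < 4 + x^2 := by positivity
    rw [show (-(3/2):ℝ) = 1 + -(5/2) by norm_num, rpow_add this, rpow_one]
  have vc : Continuous fun x : ℝ => (4 + x^2) ^ (-(5/2):ℝ) := Continuous.rpow_const (by fun_prop) fun x => Or.inl (by positivity)
  have gbf : GB fun t => 13/2 * q0 t + 5 * q1 t := (GBs.1.cm _).add (GBs.2.1.cm _)
  rw [step1.2, step2]
  have e0 : ∀ t, t * (13/2 * nn t ^ 2 * n1 t + 10 * nn t * n1 t ^ 2) = t * ((13/2 * q0 t + 5 * q1 t) * n1 t) := by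
    intro t; unfold q0 q1; ring
  simp only [e0]
  rw [step3_fub gbf]
  obtain ⟨M0, hM0, b0⟩ := Hk_bd GBs.1
  obtain ⟨M1, hM1, b1⟩ := Hk_bd GBs.2.1
  have c0 : ∀ x, 0 < x → ContinuousAt (Hk q0) x := fun x hx => (T0_d hx).continuousAt
  have c1 : ∀ x, 0 < x → ContinuousAt (Hk q1) x := fun x hx => (T1_d hx).continuousAt
  have i0 := wH_int c0 b0
  have i1 := wH_int c1 b1
  have i2 : IntegrableOn (fun x => Hk q0 x * ((4 + x^2) ^ (-(5/2):ℝ) * (9/2 * x^2 - 2))) (Ioi 0) := by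
    refine (i0.norm.const_mul (9/2)).mono' (ct_meas fun t ht => ?_) (.of_forall fun x => ?_)
    · have := c0 t ht
      fun_prop
    · have hp : 0 < (4 + x^2) ^ (-(5/2):ℝ) := by positivity
      rw [norm_mul, norm_mul, norm_mul, Real.norm_of_nonneg (w_pos x).le, hv, Real.norm_of_nonneg hp.le]
      have : ‖9/2 * x^2 - 2‖ ≤ 9/2 * (4 + x^2) := by rw [Real.norm_eq_abs, abs_le]; constructor <;> nlinarith [sq_nonneg x]
      calc _ ≤ ‖Hk q0 x‖ * ((4 + x^2) ^ (-(5/2):ℝ) * (9/2 * (4 + x^2))) := by gcongr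
        _ = _ := by ring
  have hsum : ∀ x, 0 < x → (4 + x^2) ^ (-(3/2):ℝ) * Hk (fun t => 13/2 * q0 t + 5 * q1 t) x
      = 13/2 * ((4 + x^2) ^ (-(3/2):ℝ) * Hk q0 x) + 5 * ((4 + x^2) ^ (-(3/2):ℝ) * Hk q1 x) := by
    intro x hx; rw [Hk_add GBs.1 GBs.2.1 hx]; ring
  have key : ∫ x in Ioi (0:ℝ), (-1/5 * ((4 + x^2) ^ (-(3/2):ℝ) * Hk (fun t => 13/2 * q0 t + 5 * q1 t) x) - 3/5 * (Hk q0 x * ((4 + x^2) ^ (-(5/2):ℝ) * (9/2 * x^2 - 2)))) = 0 - 0 := by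
    refine ftc_Ioi (f := fun x => x * (4 + x^2) ^ (-(3/2):ℝ) * Hk q0 x) (fun x hx => ?_) ?_ ?_ ?_
    · have hx0 : 0 < x := hx
      have h4 : 4 + x^2 ≠ 0 := by positivity
      have dw := (((hasDerivAt_pow 2 x).const_add 4).rpow_const (p := -(3/2)) (Or.inl h4))
      refine (((hasDerivAt_id x).fun_mul dw).fun_mul (T0_d hx)).congr_deriv ?_
      rw [hsum x hx, show (-(3/2) - 1 : ℝ) = -(5/2) by norm_num, hv]
      simp only [id]
      generalize (4 + x^2) ^ (-(5/2):ℝ) = v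
      generalize Hk q0 x = A
      generalize Hk q1 x = B
      field_simp
      push_cast
      ring
    · refine Integrable.sub (Integrable.const_mul ?_ _) (i2.const_mul _)
      refine (((i0.const_mul (13/2)).add (i1.const_mul 5)).congr ?_)
      filter_upwards [ae_restrict_mem measurableSet_Ioi] with x hx
      exact (hsum x hx).symm
    · refine tend0_pw (C := M0) (a := 1/2) (by norm_num) fun t ht => ?_
      have ht0 := ht.1
      rw [abs_mul, abs_mul, abs_of_pos ht0, abs_of_pos (w_pos t)]
      calc _ ≤ t * 1 * (M0 * t ^ (-(1/2):ℝ)) := by gcongr; exacts [w_le1 t, b0 t ht0]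
        _ = M0 * (t ^ (1:ℝ) * t ^ (-(1/2):ℝ)) := by rw [rpow_one]; ring
        _ = _ := by rw [← rpow_add ht0]; norm_num
    · refine tendtop_pw (C := M0) (b := 2) (by norm_num) fun t ht => ?_
      have ht0 : 0 < t := by linarith
      rw [abs_mul, abs_mul, abs_of_pos ht0, abs_of_pos (w_pos t)]
      calc _ ≤ t * t ^ (-3:ℝ) * (M0 * 1) := by
            gcongr
            · exact w_le3 ht0
            · exact (b0 t ht0).trans (by gcongr; exact xh_le1 ht)
        _ = M0 * (t ^ (1:ℝ) * t ^ (-3:ℝ)) := by rw [rpow_one]; ring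
        _ = _ := by rw [← rpow_add ht0]; norm_num
  rw [integral_sub, integral_const_mul, integral_const_mul] at key
  · linarith [congrArg (fun z => π^2 * z) key]
  · refine Integrable.const_mul ?_ _
    refine (((i0.const_mul (13/2)).add (i1.const_mul 5)).congr ?_)
    filter_upwards [ae_restrict_mem measurableSet_Ioi] with x hx
    exact (hsum x hx).symm
  · exact i2.const_mul _

end BL

namespace BL

lemma kap_d (x t : ℝ) : HasDerivAt (fun t => JJ (x * t)) (x * jd (x * t)) t :=
  ((JJ_d (x*t)).comp t ((hasDerivAt_id t).const_mul x)).congr_deriv (by simp; ring)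
lemma kap1_d (x t : ℝ) : HasDerivAt (fun t => x * t * jd (x * t)) (-(x^2 * t * JJ (x * t))) t :=
  ((sjd_d (x*t)).comp t ((hasDerivAt_id t).const_mul x)).congr_deriv (by simp; ring)
lemma kap1_le {x t : ℝ} (hx : 0 < x) (ht : 0 < t) : |x * t * jd (x * t)| ≤ x * t := by
  rw [abs_mul, abs_of_pos (by positivity)]
  exact mul_le_of_le_one_right (by positivity) (jd_le _)

lemma GB.bd {f : ℝ → ℝ} (hf : GB f) : ∃ C, 0 ≤ C ∧ ∀ t, 0 < t → (t ≤ 1 → |f t| ≤ C * t ^ (-(1/2):ℝ)) ∧ (1 ≤ t → |f t| ≤ C * t ^ (-2:ℝ)) := by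
  obtain ⟨-, C, hC, hb⟩ := hf
  refine ⟨C, hC, fun t ht => ⟨fun h => (hb t ht).trans (le_of_eq ?_), fun h => (hb t ht).trans (le_of_eq ?_)⟩⟩
  · rw [(m1_le ht).1 h, ← rpow_natCast, ← rpow_mul ht.le]; norm_num
  · rw [(m1_le ht).2 h, show (1/t)^2 = t ^ (-2:ℝ) by rw [rpow_neg ht.le, one_div, inv_pow]; norm_cast]

noncomputable def f1 (t : ℝ) : ℝ := q1 t + 2 * q0 t
noncomputable def f2 (t : ℝ) : ℝ := q2 t + 4 * q1 t + 4 * q0 t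
lemma f1_GB : GB f1 := GBs.2.1.add (GBs.1.cm 2)
lemma f2_GB : GB f2 := (GBs.2.2.1.add (GBs.2.1.cm 4)).add (GBs.1.cm 4)
lemma f1_d {t : ℝ} (ht : 0 < t) : HasDerivAt f1 ((q2 t + 2 * q1 t) / t) t :=
  ((q1_d ht).fun_add ((q0_d ht).const_mul 2)).congr_deriv (by ring)
lemma f2_d {t : ℝ} (ht : 0 < t) : HasDerivAt f2 ((q3 t + 4 * q2 t + 4 * q1 t) / t) t :=
  (((q2_d ht).fun_add ((q1_d ht).const_mul 4)).fun_add ((q0_d ht).const_mul 4)).congr_deriv (by ring)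

lemma tpow {t : ℝ} (ht : 0 < t) {a b c : ℝ} (h : a + b = c) : t ^ a * t ^ b = t ^ c := by rw [← rpow_add ht, h]

theorem rode {x : ℝ} (hx : 0 < x) : (x^4 + 20*x^2 + 64) * Hk q3 x + (60*x^2 + 384) * Hk q2 x + (72*x^2 + 768) * Hk q1 x + (32*x^2 + 512) * Hk q0 x = 0 := by
  obtain ⟨g0, g1, g2, g3, g4⟩ := GBs
  obtain ⟨C, hC, hb⟩ := q_fin
  obtain ⟨A, hA, ha⟩ := f1_GB.bd
  obtain ⟨B, hB, hb'⟩ := f2_GB.bd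
  obtain ⟨D, hD, hd⟩ := g3.bd
  obtain ⟨E, hE, he⟩ := g4.bd
  have i0 := Hk_int g0 hx
  have i1 := Hk_int g1 hx
  have i2 := Hk_int g2 hx
  have i3 := Hk_int g3 hx
  set W : ℝ → ℝ := fun t => x^2 * ((x * t * jd (x * t)) * q3 t - JJ (x * t) * q4 t) + 64 * t^2 * (f1 t * (x * t * jd (x * t)) - f2 t * JJ (x * t)) with hW
  have wb : ∀ t, 0 < t → ∀ M N P : ℝ, |q3 t| ≤ M → |q4 t| ≤ N → |f1 t| ≤ P → |f2 t| ≤ P → |W t| ≤ x^2 * (x * t * M + N) + 64 * t^2 * (P * (x * t) + P) := by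
    intro t ht M N P h1 h2 h3 h4
    have k1 := kap1_le hx ht
    have k2 := JJ_le (x * t)
    have p1 : |(x * t * jd (x * t)) * q3 t| ≤ x * t * M := by rw [abs_mul]; gcongr
    have p2 : |JJ (x * t) * q4 t| ≤ 1 * N := by rw [abs_mul]; gcongr
    have p3 : |f1 t * (x * t * jd (x * t))| ≤ P * (x * t) := by rw [abs_mul]; gcongr; exact (abs_nonneg _).trans h3
    have p4 : |f2 t * JJ (x * t)| ≤ P * 1 := by rw [abs_mul]; gcongr; exact (abs_nonneg _).trans h3
    refine (abs_add_le _ _).trans (add_le_add ?_ ?_)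
    · rw [abs_mul, abs_of_pos (by positivity : 0 < x^2)]
      gcongr
      exact (abs_sub _ _).trans (by linarith)
    · rw [abs_mul, abs_of_pos (by positivity : 0 < 64 * t^2)]
      gcongr
      exact (abs_sub _ _).trans (by linarith)
  set f : ℝ → ℝ := fun t => JJ (x * t) * (((x^4 + 20*x^2 + 64) * q3 t + (60*x^2 + 384) * q2 t + (72*x^2 + 768) * q1 t + (32*x^2 + 512) * q0 t) * t) with hf
  have hfe : ∀ t, f t = (x^4 + 20*x^2 + 64) * (JJ (x * t) * (q3 t * t)) + (60*x^2 + 384) * (JJ (x * t) * (q2 t * t)) + (72*x^2 + 768) * (JJ (x * t) * (q1 t * t)) + (32*x^2 + 512) * (JJ (x * t) * (q0 t * t)) := by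
    intro t; simp only [hf]; ring
  have j3 := i3.const_mul (x^4 + 20*x^2 + 64)
  have j2 := i2.const_mul (60*x^2 + 384)
  have j1 := i1.const_mul (72*x^2 + 768)
  have j0 := i0.const_mul (32*x^2 + 512)
  have key : ∫ t in Ioi (0:ℝ), -(f t) = 0 - 0 := by
    refine ftc_Ioi (f := W) (fun t ht => ?_) ?_ ?_ ?_
    · have ht0 : 0 < t := ht
      have d := ((((kap1_d x t).fun_mul (q3_d ht)).fun_sub ((kap_d x t).fun_mul (q4_d ht))).const_mul (x^2)).fun_add
        ((((hasDerivAt_pow 2 t).const_mul 64)).fun_mul (((f1_d ht).fun_mul (kap1_d x t)).fun_sub ((f2_d ht).fun_mul (kap_d x t))))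
      refine d.congr_deriv ?_
      simp only [hf]
      unfold f1 f2
      generalize JJ (x * t) = a
      generalize jd (x * t) = b
      generalize q0 t = a0
      generalize q1 t = a1
      generalize q2 t = a2
      generalize q3 t = a3
      generalize q4 t = a4
      field_simp
      push_cast
      ring
    · simp only [hfe]
      exact ((((j3.add j2).add j1).add j0)).neg
    · refine tend0_pw (C := x^2 * (x * D + C) + 64 * ((A+B) * x + (A+B))) (a := 1/2) (by norm_num) fun t ht => ?_
      have ht0 := ht.1
      have u0 : 0 < t ^ (-(1/2):ℝ) := by positivity
      have e1 : t * t ^ (-(1/2):ℝ) = t ^ (1/2:ℝ) := by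
        have := tpow ht0 (show (1:ℝ) + -(1/2) = 1/2 by norm_num); rwa [rpow_one] at this
      have p1 := ((ha t ht0).1 ht.2).trans (mul_le_mul_of_nonneg_right (by linarith : A ≤ A + B) u0.le)
      have p2 := ((hb' t ht0).1 ht.2).trans (mul_le_mul_of_nonneg_right (by linarith : B ≤ A + B) u0.le)
      refine (wb t ht0 _ _ _ ((hd t ht0).1 ht.2) ((hb t ht0).1 ht.2).1 p1 p2).trans ?_
      have t2 : t^2 ≤ 1 := by nlinarith [ht.2]
      calc _ = x^2 * (x * D * (t * t ^ (-(1/2):ℝ)) + C * t ^ (1/2:ℝ)) + 64 * ((A+B) * x * (t^2 * (t * t ^ (-(1/2):ℝ))) + (A+B) * (t * (t * t ^ (-(1/2):ℝ)))) := by ring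
        _ ≤ x^2 * (x * D * t ^ (1/2:ℝ) + C * t ^ (1/2:ℝ)) + 64 * ((A+B) * x * (1 * t ^ (1/2:ℝ)) + (A+B) * (1 * t ^ (1/2:ℝ))) := by
          rw [e1]; gcongr; exact ht.2
        _ = _ := by ring
    · refine tendtop_pw (C := x^2 * (x * D + E) + 64 * (C * x + C)) (b := 1) (by norm_num) fun t ht => ?_
      have ht0 : 0 < t := by linarith
      obtain ⟨p1, p2⟩ := (hb t ht0).2 ht
      refine (wb t ht0 _ _ _ ((hd t ht0).2 ht) ((he t ht0).2 ht) p1 p2).trans ?_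
      have e1 : t ^ (-2:ℝ) = (t⁻¹)^2 := by rw [rpow_neg ht0.le, inv_pow]; norm_cast
      have e2 : t ^ (-4:ℝ) = (t⁻¹)^4 := by rw [rpow_neg ht0.le, inv_pow]; norm_cast
      have i1 : t⁻¹ ≤ 1 := inv_le_one_of_one_le₀ ht
      have i0 : 0 < t⁻¹ := by positivity
      rw [e1, e2, rpow_neg_one]
      calc _ = x^2 * (x * D * t⁻¹ + E * (t⁻¹ * t⁻¹)) + 64 * (C * x * t⁻¹ + C * (t⁻¹ * t⁻¹)) := by field_simp
        _ ≤ x^2 * (x * D * t⁻¹ + E * (t⁻¹ * 1)) + 64 * (C * x * t⁻¹ + C * (t⁻¹ * 1)) := by gcongr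
        _ = _ := by ring
  rw [integral_neg] at key
  simp only [hfe] at key
  rw [integral_add (by exact ((j3.add j2).add j1)) j0, integral_add (by exact (j3.add j2)) j1, integral_add j3 j2] at key
  simp only [integral_const_mul] at key
  unfold Hk
  linarith

lemma ft_int {f : ℝ → ℝ} (hf : GB f) {C : ℝ} (hC : 0 ≤ C) (h : ∀ t, 1 ≤ t → |f t| ≤ C * t ^ (-4:ℝ)) : IntegrableOn (fun t => f t * t) (Ioi 0) := by
  obtain ⟨A, hA, ha⟩ := hf.bd
  refine int_pw (C := A + C) (a := 1/2) (b := 3) (ct_meas fun t ht => (hf.1 t ht).mul continuousAt_id) (by norm_num) (by norm_num) (fun t ht => ?_) (fun t ht => ?_)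
  · have ht0 := ht.1
    rw [abs_mul, abs_of_pos ht0]
    calc _ ≤ |f t| * 1 := by gcongr; exact ht.2
      _ ≤ (A + C) * t ^ (-(1/2):ℝ) := by rw [mul_one]; exact ((ha t ht0).1 ht.2).trans (by gcongr; linarith)
  · have ht0 : 0 < t := by linarith
    rw [abs_mul, abs_of_pos ht0]
    have e : t ^ (-4:ℝ) * t = t ^ (-3:ℝ) := by
      have := tpow ht0 (show (-4:ℝ) + 1 = -3 by norm_num); rwa [rpow_one] at this
    calc _ ≤ (C * t ^ (-4:ℝ)) * t := by gcongr; exact h t ht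
      _ = C * t ^ (-3:ℝ) := by rw [mul_assoc, e]
      _ ≤ _ := by gcongr; linarith

lemma H0_lim {f : ℝ → ℝ} (hf : GB f) (hi : IntegrableOn (fun t => f t * t) (Ioi 0)) :
    Filter.Tendsto (Hk f) (nhdsWithin 0 (Ioi 0)) (nhds (∫ t in Ioi (0:ℝ), f t * t)) := by
  refine tendsto_integral_filter_of_dominated_convergence (fun t => ‖f t * t‖) (.of_forall fun x => Hk_meas hf x) (.of_forall fun x => .of_forall fun t => ?_) hi.norm (.of_forall fun t => ?_)
  · rw [norm_mul]; exact mul_le_of_le_one_left (norm_nonneg _) (JJ_le _)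
  · have : Filter.Tendsto (fun x => JJ (x * t) * (f t * t)) (nhds 0) (nhds (JJ (0 * t) * (f t * t))) := by
      have := JJ_c
      exact Continuous.tendsto (by fun_prop) 0
    rw [zero_mul, JJ_zero, one_mul] at this
    exact this.mono_left nhdsWithin_le_nhds

lemma F1_lim : Filter.Tendsto (fun x => Hk q1 x + 2 * Hk q0 x) (nhdsWithin 0 (Ioi 0)) (nhds (1/4)) ∧
    Filter.Tendsto (fun x => Hk q2 x + 4 * Hk q1 x + 4 * Hk q0 x) (nhdsWithin 0 (Ioi 0)) (nhds 0) := by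
  obtain ⟨C, hC, hb⟩ := q_fin
  obtain ⟨A, hA, ha⟩ := f1_GB.bd
  obtain ⟨A0, hA0, ha0⟩ := GBs.1.bd
  have i1 := ft_int f1_GB hC fun t ht => ((hb t (by linarith)).2 ht).1
  have i2 := ft_int f2_GB hC fun t ht => ((hb t (by linarith)).2 ht).2
  have l1 := H0_lim f1_GB i1
  have l2 := H0_lim f2_GB i2
  have z0 : ∀ {f : ℝ → ℝ} {K : ℝ}, 0 ≤ K → (∀ t, 0 < t → t ≤ 1 → |f t| ≤ K * t ^ (-(1/2):ℝ)) → Filter.Tendsto (fun t => t^2 * f t) (nhdsWithin 0 (Ioi 0)) (nhds 0) := by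
    intro f K hK h
    refine tend0_pw (C := K) (a := 3/2) (by norm_num) fun t ht => ?_
    rw [abs_mul, abs_of_pos (by have := ht.1; positivity)]
    calc _ ≤ t^2 * (K * t ^ (-(1/2):ℝ)) := by gcongr; exact h t ht.1 ht.2
      _ = K * (t ^ (2:ℝ) * t ^ (-(1/2):ℝ)) := by rw [rpow_two]; ring
      _ = _ := by rw [tpow ht.1 (show (2:ℝ) + -(1/2) = 3/2 by norm_num)]
  have e1 : ∫ t in Ioi (0:ℝ), f1 t * t = 1/4 - 0 := by
    refine ftc_Ioi (f := fun t => t^2 * q0 t) (fun t ht => ?_) i1 (z0 hA0 fun t h0 h1 => (ha0 t h0).1 h1) t2n2_lim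
    have ht0 : 0 < t := ht
    refine ((hasDerivAt_pow 2 t).fun_mul (q0_d ht)).congr_deriv ?_
    unfold f1; push_cast; field_simp; ring
  have e2 : ∫ t in Ioi (0:ℝ), f2 t * t = 0 - 0 := by
    refine ftc_Ioi (f := fun t => t^2 * f1 t) (fun t ht => ?_) i2 (z0 hA fun t h0 h1 => (ha t h0).1 h1) ?_
    · have ht0 : 0 < t := ht
      refine ((hasDerivAt_pow 2 t).fun_mul (f1_d ht)).congr_deriv ?_
      unfold f1 f2; push_cast; field_simp; ring
    · refine tendtop_pw (C := C) (b := 2) (by norm_num) fun t ht => ?_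
      have ht0 : 0 < t := by linarith
      rw [abs_mul, abs_of_pos (by positivity)]
      calc _ ≤ t^2 * (C * t ^ (-4:ℝ)) := by gcongr; exact ((hb t ht0).2 ht).1
        _ = C * (t ^ (2:ℝ) * t ^ (-4:ℝ)) := by rw [rpow_two]; ring
        _ = _ := by rw [tpow ht0 (show (2:ℝ) + -4 = -2 by norm_num)]
  rw [e1, sub_zero] at l1
  rw [e2, sub_zero] at l2
  obtain ⟨g0, g1, g2, -, -⟩ := GBs
  refine ⟨l1.congr' ?_, l2.congr' ?_⟩
  all_goals filter_upwards [self_mem_nhdsWithin] with x hx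
  · have := Hk_add g1 g0 hx 1 2
    simp only [one_mul] at this; exact this
  · have h1 := Hk_add g2 (f1_GB.cm 1) hx 1 1
    have h2 := Hk_add f1_GB f1_GB hx 0 1
    have h3 := Hk_add (g2.add (g1.cm 4)) g0 hx 1 4
    have h4 := Hk_add g2 g1 hx 1 4
    simp only [one_mul] at h3 h4
    rw [← h4, ← h3]; rfl

lemma T2_lim : Filter.Tendsto (fun x => x^2 * Hk q2 x) Filter.atTop (nhds 0) := by
  obtain ⟨g0, g1, g2, g3, g4⟩ := GBs
  obtain ⟨C, hC, hb⟩ := q_fin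
  obtain ⟨D, hD, hd⟩ := g3.bd
  obtain ⟨E, hE, he⟩ := g4.bd
  obtain ⟨A, hA, ha⟩ := g2.bd
  have i4 : IntegrableOn (fun t => q4 t / t) (Ioi 0) := by
    refine int_pw (C := C + E) (a := 1/2) (b := 2) (ct_meas fun t ht => (g4.1 t ht).div continuousAt_id ht.ne') (by norm_num) (by norm_num) (fun t ht => ?_) (fun t ht => ?_)
    · rw [abs_div, abs_of_pos ht.1, div_le_iff₀ ht.1, mul_assoc]
      have := tpow ht.1 (show (-(1/2):ℝ) + 1 = 1/2 by norm_num)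
      rw [rpow_one] at this; rw [this]
      exact (((hb t ht.1).1 ht.2).1).trans (by have := ht.1; gcongr; linarith)
    · have ht0 : 0 < t := by linarith
      rw [abs_div, abs_of_pos ht0]
      exact (div_le_self (abs_nonneg _) ht).trans (((he t ht0).2 ht).trans (by gcongr; linarith))
  have lim : Filter.Tendsto (fun x => ∫ t in Ioi (0:ℝ), JJ (x * t) * (q4 t / t)) Filter.atTop (nhds (∫ t in Ioi (0:ℝ), 0)) := by
    refine tendsto_integral_filter_of_dominated_convergence (fun t => ‖q4 t / t‖) (.of_forall fun x => ?_) (.of_forall fun x => .of_forall fun t => ?_) i4.norm ?_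
    · refine (JJ_c.comp (by fun_prop : Continuous fun t => x * t)).aestronglyMeasurable.mul i4.1
    · rw [norm_mul]; exact mul_le_of_le_one_left (norm_nonneg _) (JJ_le _)
    · filter_upwards [ae_restrict_mem measurableSet_Ioi] with t ht
      have h1 : Filter.Tendsto (fun x => 5 * (x * t) ^ (-(1/2):ℝ)) Filter.atTop (nhds 0) := by
        have := ((tendsto_rpow_neg_atTop (by norm_num : (0:ℝ) < 1/2)).comp (Filter.tendsto_id.atTop_mul_const ht)).const_mul 5
        simpa using this
      have h2 : Filter.Tendsto (fun x => JJ (x * t)) Filter.atTop (nhds 0) := by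
        refine squeeze_zero_norm' ?_ h1
        filter_upwards [Filter.eventually_gt_atTop 0] with x hx
        exact JJ_decay (mul_pos hx ht)
      simpa using h2.mul_const (q4 t / t)
  rw [integral_zero] at lim
  have e : ∀ x, 0 < x → x^2 * Hk q2 x = -∫ t in Ioi (0:ℝ), JJ (x * t) * (q4 t / t) := by
    intro x hx
    have j2 := (Hk_int g2 hx).const_mul (x^2)
    have j4 : IntegrableOn (fun t => JJ (x * t) * (q4 t / t)) (Ioi 0) := by
      refine i4.norm.mono' ((JJ_c.comp (by fun_prop : Continuous fun t => x * t)).aestronglyMeasurable.mul i4.1) (.of_forall fun t => ?_)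
      rw [norm_mul]; exact mul_le_of_le_one_left (norm_nonneg _) (JJ_le _)
    have key : ∫ t in Ioi (0:ℝ), -(x^2 * (JJ (x * t) * (q2 t * t)) + JJ (x * t) * (q4 t / t)) = 0 - 0 := by
      refine ftc_Ioi (f := fun t => x * t * jd (x * t) * q2 t - JJ (x * t) * q3 t) (fun t ht => ?_) (j2.add j4).neg ?_ ?_
      · have ht0 : 0 < t := ht
        refine (((kap1_d x t).fun_mul (q2_d ht)).fun_sub ((kap_d x t).fun_mul (q3_d ht))).congr_deriv ?_
        field_simp; ring
      · refine tend0_pw (C := x * A + C) (a := 1/2) (by norm_num) fun t ht => ?_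
        have ht0 := ht.1
        refine (abs_sub _ _).trans ?_
        rw [abs_mul, abs_mul (JJ _), add_mul]
        have := tpow ht0 (show (1:ℝ) + -(1/2) = 1/2 by norm_num)
        rw [rpow_one] at this
        refine add_le_add ?_ ?_
        · calc _ ≤ (x * t) * (A * t ^ (-(1/2):ℝ)) := by gcongr; exacts [kap1_le hx ht0, (ha t ht0).1 ht.2]
            _ = _ := by rw [← this]; ring
        · exact (mul_le_of_le_one_left (abs_nonneg _) (JJ_le _)).trans ((hb t ht0).1 ht.2).2
      · refine tendtop_pw (C := x * A + D) (b := 1) (by norm_num) fun t ht => ?_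
        have ht0 : 0 < t := by linarith
        refine (abs_sub _ _).trans ?_
        rw [abs_mul, abs_mul (JJ _), add_mul]
        have := tpow ht0 (show (1:ℝ) + -2 = -1 by norm_num)
        rw [rpow_one] at this
        refine add_le_add ?_ ?_
        · calc _ ≤ (x * t) * (A * t ^ (-2:ℝ)) := by gcongr; exacts [kap1_le hx ht0, (ha t ht0).2 ht]
            _ = _ := by rw [← this]; ring
        · refine (mul_le_of_le_one_left (abs_nonneg _) (JJ_le _)).trans (((hd t ht0).2 ht).trans ?_)
          exact mul_le_mul_of_nonneg_left (rpow_le_rpow_of_exponent_le ht (by norm_num)) hD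
    rw [integral_neg, integral_add j2 j4, integral_const_mul] at key
    unfold Hk; linarith
  refine (lim.neg.congr' ?_).trans (by simp)
  filter_upwards [Filter.eventually_gt_atTop 0] with x hx
  exact (e x hx).symm

end BL

namespace BL

noncomputable def psi (X χ : ℝ) : ℝ := arcsin (√X * sin χ)
noncomputable def cp (X χ : ℝ) : ℝ := √(1 - (√X * sin χ)^2)
noncomputable def Vi (X : ℝ) : ℝ := (1/π) * ∫ χ in (0:ℝ)..π, cos (2/3 * psi X χ)
noncomputable def Ui (X : ℝ) : ℝ := (1/π) * ∫ χ in (0:ℝ)..π, -(1/3) * (sin (2/3 * psi X χ) * (√X * sin χ / cp X χ))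

lemma ys_lt {X : ℝ} (hX : X < 1) (χ : ℝ) : (√X * sin χ)^2 < 1 := by
  rw [mul_pow]
  rcases le_total X 0 with h | h
  · rw [sqrt_eq_zero_of_nonpos h]; norm_num
  · rw [sq_sqrt h]; nlinarith [sin_sq_le_one χ, sq_nonneg (sin χ)]
lemma cp_pos {X : ℝ} (hX : X < 1) (χ : ℝ) : 0 < cp X χ := sqrt_pos.2 (by linarith [ys_lt hX χ])
lemma cp_sq {X : ℝ} (hX : X < 1) (χ : ℝ) : cp X χ ^ 2 = 1 - (√X * sin χ)^2 := sq_sqrt (by linarith [ys_lt hX χ])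
lemma psi_bd {X : ℝ} (hX : X < 1) {χ : ℝ} (h : χ ∈ Icc 0 π) : 0 ≤ psi X χ ∧ psi X χ < π/2 := by
  have h1 := ys_lt hX χ
  refine ⟨arcsin_nonneg.2 (mul_nonneg (sqrt_nonneg _) (sin_nonneg_of_nonneg_of_le_pi h.1 h.2)), ?_⟩
  rw [psi, arcsin_lt_pi_div_two]; nlinarith
lemma cp_eq (X χ : ℝ) : cos (psi X χ) = cp X χ := by rw [psi, cos_arcsin, cp]
lemma sin_psi {X : ℝ} (hX : X < 1) (χ : ℝ) : sin (psi X χ) = √X * sin χ := by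
  have h1 := ys_lt hX χ
  exact sin_arcsin (by nlinarith) (by nlinarith)

lemma psi_c : Continuous fun p : ℝ × ℝ => psi p.1 p.2 := by unfold psi; fun_prop
lemma cp_c : Continuous fun p : ℝ × ℝ => cp p.1 p.2 := by unfold cp; fun_prop
lemma f_c : Continuous fun p : ℝ × ℝ => cos (2/3 * psi p.1 p.2) := by have := psi_c; fun_prop
lemma f1_c (s : Set ℝ) : ContinuousOn (fun p : ℝ × ℝ => -(1/3) * (sin (2/3 * psi p.1 p.2) * (√p.1 * sin p.2 / cp p.1 p.2))) (Iio 1 ×ˢ s) := by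
  have h1 := psi_c
  have h2 := cp_c
  refine ContinuousOn.mul (by fun_prop) (ContinuousOn.mul (by fun_prop) (ContinuousOn.div (by fun_prop) (by fun_prop) fun p hp => (cp_pos hp.1 _).ne'))

lemma psi_dX {X : ℝ} (h0 : 0 < X) (h1 : X < 1) (χ : ℝ) : HasDerivAt (fun X => psi X χ) (√X * sin χ / cp X χ / 2 / X) X := by
  have h := ys_lt h1 χ
  refine ((hasDerivAt_arcsin (x := √X * sin χ) (by nlinarith) (by nlinarith)).comp X ((hasDerivAt_sqrt h0.ne').mul_const (sin χ))).congr_deriv ?_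
  have := cp_pos h1 χ
  change 1 / cp X χ * _ = _
  have e := sq_sqrt h0.le
  have := sqrt_pos.2 h0
  field_simp
  linear_combination (-sin χ) * e
lemma cp_dX {X : ℝ} (h0 : 0 < X) (h1 : X < 1) (χ : ℝ) : HasDerivAt (fun X => cp X χ) (-((√X * sin χ)^2 / cp X χ / 2 / X)) X := by
  have hp := cp_pos h1 χ
  have h := ((psi_dX h0 h1 χ).cos)
  rw [sin_psi h1] at h
  simp only [cp_eq] at h
  exact h.congr_deriv (by ring)
lemma y_dX {X : ℝ} (h0 : 0 < X) (χ : ℝ) : HasDerivAt (fun X => √X * sin χ) (√X * sin χ / 2 / X) X := by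
  refine ((hasDerivAt_sqrt h0.ne').mul_const (sin χ)).congr_deriv ?_
  have e := sq_sqrt h0.le
  have := sqrt_pos.2 h0
  field_simp
  linear_combination (-sin χ) * e
lemma psi_dc {X : ℝ} (h1 : X < 1) (χ : ℝ) : HasDerivAt (fun χ => psi X χ) (√X * cos χ / cp X χ) χ := by
  have h := ys_lt h1 χ
  exact ((hasDerivAt_arcsin (x := √X * sin χ) (by nlinarith) (by nlinarith)).comp χ ((hasDerivAt_sin χ).const_mul (√X))).congr_deriv (by
    change 1 / cp X χ * _ = _; ring)
lemma cp_dc {X : ℝ} (h1 : X < 1) (χ : ℝ) : HasDerivAt (fun χ => cp X χ) (-(√X * sin χ) * (√X * cos χ / cp X χ)) χ := by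
  have h := ((psi_dc h1 χ).cos)
  rw [sin_psi h1] at h
  simpa only [cp_eq] using h

lemma VU_d {X : ℝ} (hX : X ∈ Ioo (0:ℝ) 1) : HasDerivAt Vi (Ui X / X) X ∧ HasDerivAt Ui (-Vi X / (9 * (1 - X))) X := by
  have sub : ∀ s : Set ℝ, Ioo (0:ℝ) 1 ×ˢ s ⊆ Iio 1 ×ˢ s := fun s => prod_mono Ioo_subset_Iio_self subset_rfl
  have key := avg_ode (U := Ioo 0 1) isOpen_Ioo (f := fun X χ => cos (2/3 * psi X χ))
    (f1 := fun X χ => -(1/3) * (sin (2/3 * psi X χ) * (√X * sin χ / cp X χ)))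
    (f2 := fun X χ => -(1/9) * (cos (2/3 * psi X χ) * (√X * sin χ / cp X χ)^2) - 1/6 * (sin (2/3 * psi X χ) * (√X * sin χ / cp X χ^3)))
    (fθ := fun X χ => -(1/(6*(1-X))) * (√X * cos χ * (sin (2/3 * psi X χ) / cp X χ)))
    (σ := fun X => X) (q := fun X => -(X/(9*(1-X)))) continuousOn_id (fun x hx => hx.1.ne') f_c.continuousOn ((f1_c _).mono (sub _)) ?_ ?_ ?_ ?_ ?_ ?_ hX
  · refine ⟨(key.1.const_mul (1/π)).congr_deriv (by unfold Ui; ring), (key.2.const_mul (1/π)).congr_deriv ?_⟩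
    have := hX.1
    unfold Vi
    have : 1 - X ≠ 0 := by linarith [hX.2]
    field_simp
  · have h1 := psi_c
    have h2 := cp_c
    have h3 : ∀ p ∈ Ioo (0:ℝ) 1 ×ˢ Icc 0 π, cp p.1 p.2 ≠ 0 := fun p hp => (cp_pos hp.1.2 _).ne'
    have h4 : ∀ p ∈ Ioo (0:ℝ) 1 ×ˢ Icc 0 π, cp p.1 p.2 ^ 3 ≠ 0 := fun p hp => pow_ne_zero _ (h3 p hp)
    exact ContinuousOn.sub (ContinuousOn.mul (by fun_prop) (ContinuousOn.mul (by fun_prop) (ContinuousOn.pow (ContinuousOn.div (by fun_prop) (by fun_prop) h3) 2)))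
      (ContinuousOn.mul (by fun_prop) (ContinuousOn.mul (by fun_prop) (ContinuousOn.div (by fun_prop) (by fun_prop) h4)))
  · intro x hx y _
    refine (((psi_dX hx.1 hx.2 y).const_mul (2/3)).cos).congr_deriv ?_
    ring
  · intro x hx y _
    have hp := cp_pos hx.2 y
    have hs := cp_sq hx.2 y
    have := hx.1
    refine ((((psi_dX hx.1 hx.2 y).const_mul (2/3)).sin.fun_mul ((y_dX hx.1 y).fun_div (cp_dX hx.1 hx.2 y) hp.ne')).const_mul (-(1/3))).congr_deriv ?_
    generalize cp x y = c at *
    generalize √x * sin y = z at *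
    generalize sin (2/3 * psi x y) = S
    generalize cos (2/3 * psi x y) = K
    field_simp
    linear_combination (-162 * S * z) * hs
  · intro x hx y _
    have hp := cp_pos hx.2 y
    have hs := cp_sq hx.2 y
    have h1 : 0 < 1 - x := by linarith [hx.2]
    have hx0 := hx.1
    refine ((((hasDerivAt_cos y).const_mul (√x)).fun_mul ((((psi_dc hx.2 y).const_mul (2/3)).sin).fun_div (cp_dc hx.2 y) hp.ne')).const_mul (-(1/(6*(1-x))))).congr_deriv ?_
    have hz : (√x * cos y)^2 = x - (√x * sin y)^2 := by
      rw [mul_pow, mul_pow, sq_sqrt hx0.le, cos_sq']; ring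
    rw [mul_neg]
    generalize cp x y = c at *
    generalize √x * sin y = z at *
    generalize √x * cos y = p at *
    generalize sin (2/3 * psi x y) = S
    generalize cos (2/3 * psi x y) = K
    have e : x = p^2 + z^2 := by linarith
    have e2 : c^2 = 1 - z^2 := hs
    have e3 : c^2 - p^2 = 1 - x := by linarith
    rw [← e3] at h1 ⊢
    have e4 : x = 1 - c^2 + p^2 := by linarith
    have e5 : z^2 = 1 - c^2 := by linarith
    rw [e4]
    field_simp
    ring_nf
    simp only [e5]
    ring_nf
  · intro x hx; simp [psi]
  · intro x hx; simp [psi]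

end BL

namespace BL

lemma Vi_ca (X : ℝ) : ContinuousAt Vi X :=
  (pcont pi_pos.le isOpen_univ (mem_univ X) (f := fun X χ => cos (2/3 * psi X χ)) f_c.continuousOn).const_mul (1/π)
lemma Ui_ca {X : ℝ} (h : X < 1) : ContinuousAt Ui X :=
  (pcont pi_pos.le isOpen_Iio (mem_Iio.2 h) (f := fun X χ => -(1/3) * (sin (2/3 * psi X χ) * (√X * sin χ / cp X χ))) (f1_c _)).const_mul (1/π)
lemma Vi_0 : Vi 0 = 1 := by
  have := pi_pos.ne'
  simp [Vi, psi]
lemma Ui_0 : Ui 0 = 0 := by simp [Ui, psi]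
lemma Vi_1 : Vi 1 = 3 * √3 / (2 * π) := by
  have hp := pi_pos
  have h1 : IntervalIntegrable (fun χ => cos (2/3 * psi 1 χ)) volume 0 (π/2) := by
    have := psi_c; exact Continuous.intervalIntegrable (by fun_prop) _ _
  have h2 : IntervalIntegrable (fun χ => cos (2/3 * psi 1 χ)) volume (π/2) π := by
    have := psi_c; exact Continuous.intervalIntegrable (by fun_prop) _ _
  have e1 : ∫ χ in (0:ℝ)..(π/2), cos (2/3 * psi 1 χ) = ∫ χ in (0:ℝ)..(π/2), cos (2/3 * χ) := by
    refine intervalIntegral.integral_congr fun x hx => ?_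
    rw [uIcc_of_le (by linarith)] at hx
    have : psi 1 x = x := by
      rw [psi, sqrt_one, one_mul]; exact arcsin_sin (by linarith [hx.1]) hx.2
    simp only [this]
  have e2 : ∫ χ in (π/2)..π, cos (2/3 * psi 1 χ) = ∫ χ in (0:ℝ)..(π/2), cos (2/3 * psi 1 χ) := by
    have := intervalIntegral.integral_comp_sub_left (fun χ => cos (2/3 * psi 1 χ)) π (a := 0) (b := π/2)
    rw [show π - π/2 = π/2 by ring, sub_zero] at this
    rw [← this]
    simp only [psi, sin_pi_sub]
  have e3 : ∫ χ in (0:ℝ)..(π/2), cos (2/3 * χ) = 3/2 * sin (π/3) := by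
    rw [intervalIntegral.integral_comp_mul_left (fun x => cos x) (by norm_num), integral_cos]
    rw [show 2/3 * (π/2) = π/3 by ring]; simp
  rw [Vi, ← intervalIntegral.integral_add_adjacent_intervals h1 h2, e2, e1, e3, sin_pi_div_three]
  field_simp; ring
lemma Vi_bd (X : ℝ) : 1/2 ≤ Vi X ∧ Vi X ≤ 1 := by
  have hp := pi_pos
  have hi : IntervalIntegrable (fun χ => cos (2/3 * psi X χ)) volume 0 π := by
    have := psi_c; exact Continuous.intervalIntegrable (by fun_prop) _ _
  have h1 : ∫ χ in (0:ℝ)..π, (1/2:ℝ) ≤ ∫ χ in (0:ℝ)..π, cos (2/3 * psi X χ) := by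
    refine intervalIntegral.integral_mono_on hp.le (by simp) hi fun χ _ => ?_
    rw [← cos_pi_div_three, ← cos_abs (2/3 * _)]
    have h2 := arcsin_le_pi_div_two (√X * sin χ)
    have h3 := neg_pi_div_two_le_arcsin (√X * sin χ)
    refine cos_le_cos_of_nonneg_of_le_pi (abs_nonneg _) (by linarith) (abs_le.2 ?_)
    unfold psi
    constructor <;> linarith
  have h2 : ∫ χ in (0:ℝ)..π, cos (2/3 * psi X χ) ≤ ∫ χ in (0:ℝ)..π, (1:ℝ) :=
    intervalIntegral.integral_mono_on hp.le hi (by simp) fun χ _ => cos_le_one _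
  simp only [intervalIntegral.integral_const, sub_zero, smul_eq_mul] at h1 h2
  rw [Vi, one_div π, inv_mul_eq_div, le_div_iff₀ hp, div_le_iff₀ hp]
  constructor <;> linarith
lemma U_anti : AntitoneOn Ui (Ico 0 1) := by
  refine antitoneOn_of_deriv_nonpos (convex_Ico 0 1) (fun x hx => (Ui_ca hx.2).continuousWithinAt) ?_ ?_
  · rw [interior_Ico]; exact fun x hx => (VU_d hx).2.differentiableAt.differentiableWithinAt
  · rw [interior_Ico]; intro x hx
    rw [(VU_d hx).2.deriv]
    exact div_nonpos_of_nonpos_of_nonneg (by linarith [(Vi_bd x).1]) (by linarith [hx.2])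
lemma U_bd {X : ℝ} (hX : X ∈ Ico (0:ℝ) 1) : Ui X ≤ 0 ∧ -Ui X ≤ 8/9 * ((1 - X)^(-(1/8):ℝ) - 1) := by
  refine ⟨Ui_0 ▸ U_anti ⟨le_rfl, one_pos⟩ hX hX.1, ?_⟩
  have h : MonotoneOn (fun x => Ui x + 8/9 * (1 - x)^(-(1/8):ℝ)) (Ico 0 1) := by
    have hd : ∀ x ∈ Ico (0:ℝ) 1, HasDerivAt (fun x : ℝ => 8/9 * (1 - x)^(-(1/8):ℝ)) (1/9 * (1 - x)^(-(9/8):ℝ)) x := by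
      intro x hx
      refine ((((hasDerivAt_id x).const_sub 1).rpow_const (p := -(1/8)) (Or.inl (by simp only [id]; linarith [hx.2]))).const_mul (8/9)).congr_deriv ?_
      norm_num; ring
    refine monotoneOn_of_deriv_nonneg (convex_Ico 0 1) (fun x hx => ((Ui_ca hx.2).add (hd x hx).continuousAt).continuousWithinAt) ?_ ?_
    · rw [interior_Ico]; exact fun x hx => ((VU_d hx).2.add (hd x ⟨hx.1.le, hx.2⟩)).differentiableAt.differentiableWithinAt
    · rw [interior_Ico]; intro x hx
      rw [((VU_d hx).2.fun_add (hd x ⟨hx.1.le, hx.2⟩)).deriv]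
      have h1 : 0 < 1 - x := by linarith [hx.2]
      have h2 : (1 - x)⁻¹ ≤ (1 - x)^(-(9/8):ℝ) := by
        rw [← rpow_neg_one]; exact rpow_le_rpow_of_exponent_ge h1 (by linarith [hx.1]) (by norm_num)
      have h3 : Vi x / (9 * (1 - x)) ≤ 1/9 * (1 - x)⁻¹ := by
        rw [div_le_iff₀ (by linarith)]; field_simp; linarith [(Vi_bd x).2]
      rw [neg_div]; linarith
  have := h ⟨le_rfl, one_pos⟩ hX hX.1
  simp only [Ui_0, sub_zero, one_rpow] at this
  linarith

noncomputable def bb (X : ℝ) : ℝ := Vi X - 3 * Ui X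
noncomputable def aa (X : ℝ) : ℝ := Vi X + 3 * Ui X
noncomputable def bt (X : ℝ) : ℝ := 2 * (1 - X) * Ui X + 2/3 * X * Vi X
lemma bb_d {X : ℝ} (hX : X ∈ Ioo (0:ℝ) 1) : HasDerivAt bb (bt X / (2 * X * (1 - X))) X := by
  refine ((VU_d hX).1.fun_sub ((VU_d hX).2.const_mul 3)).congr_deriv ?_
  have := hX.1
  have : 1 - X ≠ 0 := by linarith [hX.2]
  unfold bt
  field_simp; ring
lemma bt_d {X : ℝ} (hX : X ∈ Ioo (0:ℝ) 1) : HasDerivAt bt (4/9 * bb X) X := by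
  refine (((((hasDerivAt_id X).const_sub 1).const_mul 2).fun_mul (VU_d hX).2).fun_add (((hasDerivAt_id X).const_mul (2/3)).fun_mul (VU_d hX).1)).congr_deriv ?_
  have := hX.1
  have : 1 - X ≠ 0 := by linarith [hX.2]
  simp only [id, bb]
  field_simp; ring
lemma bb_ca {X : ℝ} (h : X < 1) : ContinuousAt bb X := (Vi_ca X).sub ((Ui_ca h).const_mul 3)
lemma bt_ca {X : ℝ} (h : X < 1) : ContinuousAt bt X := by
  have h1 := Vi_ca X
  have h2 := Ui_ca h
  unfold bt; fun_prop
lemma bb_0 : bb 0 = 1 := by simp [bb, Vi_0, Ui_0]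
lemma bt_0 : bt 0 = 0 := by simp [bt, Ui_0]
lemma bb_bd {X : ℝ} (hX : X ∈ Ico (0:ℝ) 1) : 1/2 ≤ bb X ∧ bb X ≤ 3 * (1 - X)^(-(1/8):ℝ) := by
  have h1 := Vi_bd X
  have h2 := U_bd hX
  have h3 : 1 ≤ (1 - X)^(-(1/8):ℝ) := one_le_rpow_of_pos_of_le_one_of_nonpos (by linarith [hX.2]) (by linarith [hX.1]) (by norm_num)
  unfold bb
  constructor <;> linarith
lemma bt_1 : Filter.Tendsto bt (nhdsWithin 1 (Iio 1)) (nhds (√3/π)) := by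
  have h1 : Filter.Tendsto (fun X => 2/3 * X * Vi X) (nhdsWithin 1 (Iio 1)) (nhds (√3/π)) := by
    have : ContinuousAt (fun X => 2/3 * X * Vi X) 1 := by have := Vi_ca 1; fun_prop
    have h := this.tendsto.mono_left (nhdsWithin_le_nhds (s := Iio 1))
    rw [Vi_1] at h
    convert h using 2; field_simp
  have h2 : Filter.Tendsto (fun X => 2 * (1 - X) * Ui X) (nhdsWithin 1 (Iio 1)) (nhds 0) := by
    have h3 : Filter.Tendsto (fun X : ℝ => 2 * (1 - X)^(7/8:ℝ)) (nhdsWithin 1 (Iio 1)) (nhds 0) := by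
      have : ContinuousAt (fun X : ℝ => 2 * (1 - X)^(7/8:ℝ)) 1 := by
        refine ContinuousAt.mul continuousAt_const (ContinuousAt.rpow_const (by fun_prop) (Or.inr (by norm_num)))
      have h := this.tendsto.mono_left (nhdsWithin_le_nhds (s := Iio 1))
      simpa using h
    refine squeeze_zero_norm' ?_ h3
    filter_upwards [Ioo_mem_nhdsLT (show (0:ℝ) < 1 by norm_num)] with X hX
    have h4 := U_bd ⟨hX.1.le, hX.2⟩
    have h5 : 0 < 1 - X := by linarith [hX.2]
    rw [norm_mul, norm_of_nonneg (by linarith), norm_eq_abs, abs_of_nonpos h4.1, mul_assoc]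
    have : (1 - X)^(7/8:ℝ) = (1 - X) * (1 - X)^(-(1/8):ℝ) := by
      nth_rw 2 [← rpow_one (1 - X)]; rw [← rpow_add h5]; norm_num
    rw [this]
    have := rpow_pos_of_pos h5 (-(1/8))
    have : -Ui X ≤ (1 - X)^(-(1/8):ℝ) := by linarith
    gcongr
  have := h2.add h1
  rwa [zero_add] at this

lemma ps_d {a : ℕ → ℝ} (ha : ∀ n, |a n| ≤ 1) {x : ℝ} (hx : |x| < 1) :
    Summable (fun n => a n * x^n) ∧ Summable (fun n : ℕ => a n * (n * x^(n-1))) ∧ HasDerivAt (fun x => ∑' n, a n * x^n) (∑' n : ℕ, a n * (n * x^(n-1))) x := by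
  obtain ⟨r, hr, hr1⟩ := exists_between hx
  have hr0 : 0 < r := (abs_nonneg x).trans_lt hr
  have hs : Summable (fun n : ℕ => n * r^(n-1)) := by
    have h := (summable_pow_mul_geometric_of_norm_lt_one 1 (r := r) (by rwa [norm_of_nonneg hr0.le])).mul_right r⁻¹
    refine h.congr fun n => ?_
    cases n with
    | zero => simp
    | succ n => simp; field_simp; ring
  have hb : ∀ n : ℕ, ∀ y ∈ Ioo (-r) r, ‖a n * (n * y^(n-1))‖ ≤ n * r^(n-1) := by
    intro n y hy
    rw [norm_mul, norm_mul, norm_pow, norm_eq_abs, norm_eq_abs y, norm_of_nonneg (Nat.cast_nonneg n)]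
    calc _ ≤ 1 * (n * r^(n-1)) := by
          gcongr
          · exact ha n
          · exact (abs_lt.2 hy).le
      _ = _ := one_mul _
  have hx' : x ∈ Ioo (-r) r := abs_lt.1 hr
  refine ⟨?_, hs.of_norm_bounded fun n => hb n x hx', ?_⟩
  · refine (summable_geometric_of_lt_one (abs_nonneg x) hx).of_norm_bounded fun n => ?_
    rw [norm_mul, norm_pow, norm_eq_abs, norm_eq_abs]
    exact mul_le_of_le_one_left (by positivity) (ha n)
  · exact hasDerivAt_tsum_of_isPreconnected hs isOpen_Ioo isPreconnected_Ioo
      (fun n y hy => (hasDerivAt_pow n y).const_mul (a n)) hb (y₀ := 0) ⟨by linarith, hr0⟩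
      (summable_of_ne_finset_zero (s := {0}) fun n hn => by
        have : n ≠ 0 := by simpa using hn
        simp [this]) hx'

noncomputable def cf (n : ℕ) : ℝ := ris (-1/3) n * ris (1/3) n / ris 1 n / n.factorial
lemma cf_0 : cf 0 = 1 := by simp [cf, ris]
lemma cf_s (n : ℕ) : ((n:ℝ)+1)^2 * cf (n+1) = (n^2 - 1/9) * cf n := by
  have h : ris 1 n ≠ 0 := by
    unfold ris; exact Finset.prod_ne_zero_iff.2 fun k _ => by positivity
  have h2 : (n.factorial : ℝ) ≠ 0 := by positivity
  have h3 : (n:ℝ) + 1 ≠ 0 := by positivity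
  have e : ∀ a, ris a (n+1) = ris a n * (a + n) := fun a => by simp [ris, Finset.prod_range_succ]
  rw [cf, cf, e, e, e, Nat.factorial_succ]
  push_cast
  rw [show (1:ℝ) + n = n + 1 by ring]
  field_simp; ring
lemma cf_bd (n : ℕ) : |cf n| ≤ 1 ∧ |n * cf n| ≤ 1 := by
  induction n with
  | zero => simp [cf_0]
  | succ n ih =>
    have h := cf_s n
    have hn : (0:ℝ) ≤ n := Nat.cast_nonneg n
    have key : ((n:ℝ)+1)^2 * |cf (n+1)| ≤ (n+1) * min 1 1 := by
      have : ((n:ℝ)+1)^2 * |cf (n+1)| = |(n:ℝ)^2 - 1/9| * |cf n| := by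
        rw [← abs_mul, ← h, abs_mul, abs_of_nonneg (by positivity : (0:ℝ) ≤ ((n:ℝ)+1)^2)]
      rw [this, min_self, mul_one]
      rcases Nat.eq_zero_or_pos n with h0 | h0
      · subst h0; simp [cf_0]; norm_num [abs_of_nonpos]
      · have h1 : (1:ℝ) ≤ n := by exact_mod_cast h0
        rw [abs_of_nonneg (by nlinarith)]
        have h3 : n * |cf n| ≤ 1 := by have := ih.2; rwa [abs_mul, abs_of_nonneg hn] at this
        nlinarith [abs_nonneg (cf n), ih.1]
    rw [min_self, mul_one] at key
    have k2 : ((n:ℝ)+1) * |cf (n+1)| ≤ 1 := by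
      have : (0:ℝ) < n + 1 := by positivity
      by_contra hc
      push Not at hc
      nlinarith
    push_cast
    rw [abs_mul, abs_of_nonneg (by positivity : (0:ℝ) ≤ (n:ℝ)+1)]
    exact ⟨by nlinarith [abs_nonneg (cf (n+1))], k2⟩
lemma pFq_V {x : ℝ} (hx : x ∈ Ioo (0:ℝ) 1) : pFq [-1/3, 1/3] [1] x = Vi x := by
  have e : pFq [-1/3, 1/3] [1] x = ∑' n, cf n * x^n := by
    unfold pFq; congr 1; ext n; simp [cf]; ring
  have d0 := fun (x:ℝ) (hx : |x| < 1) => ps_d (a := cf) (fun n => (cf_bd n).1) hx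
  have d1 := fun (x:ℝ) (hx : |x| < 1) => ps_d (a := fun n => n * cf n) (fun n => (cf_bd n).2) hx
  have ab : ∀ x ∈ Ioo (0:ℝ) 1, |x| < 1 := fun x hx => by rw [abs_of_pos hx.1]; exact hx.2
  have z : |(0:ℝ)| < 1 := by norm_num
  have key := ode_unique (b := 1) (c := 1) (F := fun x => ∑' n, cf n * x^n) (F1 := fun x => ∑' n : ℕ, n * cf n * x^n) (G := Vi) (G1 := Ui)
    (σ := fun X => X) (q := fun X => -(X/(9*(1-X)))) (fun x hx => hx.1.ne') (fun x _ => by linarith [(Vi_bd x).1]) ?_ ?_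
    (fun x hx => (VU_d hx).1) (fun x hx => (VU_d hx).2.congr_deriv ?_) ?_ ?_ ?_ ?_ x hx
  · rw [e]; simpa using key
  · intro x hx
    refine (d0 x (ab x hx)).2.2.congr_deriv ?_
    rw [← tsum_div_const]
    congr 1; ext n
    cases n with
    | zero => simp
    | succ n => have := hx.1; simp; field_simp; ring
  · intro x hx
    refine (d1 x (ab x hx)).2.2.congr_deriv ?_
    have h1 : 0 < 1 - x := by linarith [hx.2]
    have hx0 := hx.1
    have s0 := (d0 x (ab x hx)).1
    have s1 := (d1 x (ab x hx)).2.1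
    set S := ∑' n : ℕ, n * cf n * (n * x^(n-1)) with hS
    have a1 : S = ∑' n : ℕ, ((n:ℝ)^2 - 1/9) * cf n * x^n := by
      rw [hS, s1.tsum_eq_zero_add]
      simp only [Nat.cast_zero, zero_mul, zero_add]
      congr 1; ext n
      rw [← cf_s]; push_cast; ring
    have a2 : S = x * S - 1/9 * ∑' n, cf n * x^n := by
      nth_rw 1 [a1]
      rw [hS, ← tsum_mul_left, ← tsum_mul_left, ← (s1.mul_left x).tsum_sub (s0.mul_left _)]
      congr 1; ext n
      cases n with
      | zero => simp
      | succ n => simp; ring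
    have : S = -(∑' n, cf n * x^n) / (9 * (1 - x)) := by
      rw [eq_div_iff (by positivity)]; linarith
    rw [this]; field_simp
  · have := hx.1
    field_simp
  · have := (d0 0 z).2.2.continuousAt.tendsto.mono_left (nhdsWithin_le_nhds (s := Ioi 0))
    convert this using 2
    rw [tsum_eq_single 0 fun n hn => by simp [hn]]; simp [cf_0]
  · have := (d1 0 z).2.2.continuousAt.tendsto.mono_left (nhdsWithin_le_nhds (s := Ioi 0))
    convert this using 2
    rw [tsum_eq_single 0 fun n hn => by simp [hn]]; simp
  · have := (Vi_ca 0).tendsto.mono_left (nhdsWithin_le_nhds (s := Ioi 0))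
    rwa [Vi_0] at this
  · have := (Ui_ca (X := 0) one_pos).tendsto.mono_left (nhdsWithin_le_nhds (s := Ioi 0))
    rwa [Ui_0] at this

end BL

namespace BL

lemma int01 {f : ℝ → ℝ} {C a : ℝ} (ha : -1 < a) (hc : ∀ x ∈ Ioo (0:ℝ) 1, ContinuousAt f x) (h : ∀ x ∈ Ioo (0:ℝ) 1, |f x| ≤ C * (1 - x)^a) : IntegrableOn f (Ioo 0 1) := by
  have h1 : IntegrableOn (fun x : ℝ => C * (1 - x)^a) (Ioo 0 1) := by
    have := ((intervalIntegral.intervalIntegrable_rpow' ha (a := 1) (b := 0)).comp_sub_left 1).const_mul C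
    norm_num at this
    exact (intervalIntegrable_iff_integrableOn_Ioo_of_le zero_le_one).1 this
  refine h1.mono' (ContinuousOn.aestronglyMeasurable (fun x hx => (hc x hx).continuousWithinAt) measurableSet_Ioo) ?_
  exact (ae_restrict_iff' measurableSet_Ioo).2 (Filter.Eventually.of_forall fun x hx => h x hx)

lemma step7 : ∫ x in (0:ℝ)..1, bb x * (2 * bb x + 5 * aa x) / √(1 - x) = 7 * ∫ x in (0:ℝ)..1, (pFq [-1/3, 1/3] [1] x)^2 / √(1 - x) := by
  have hs : ∀ x ∈ Ioo (0:ℝ) 1, 0 < 1 - x := fun x hx => by linarith [hx.2]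
  have e0 : ∫ x in (0:ℝ)..1, (pFq [-1/3, 1/3] [1] x)^2 / √(1 - x) = ∫ x in (0:ℝ)..1, Vi x^2 / √(1 - x) := by
    rw [intervalIntegral.integral_of_le zero_le_one, intervalIntegral.integral_of_le zero_le_one, integral_Ioc_eq_integral_Ioo, integral_Ioc_eq_integral_Ioo]
    exact setIntegral_congr_fun measurableSet_Ioo fun x hx => by simp only [pFq_V hx]
  have is : ∀ x ∈ Ioo (0:ℝ) 1, 1 / √(1 - x) = (1 - x)^(-(1/2):ℝ) := fun x hx => by
    rw [sqrt_eq_rpow, rpow_neg (hs x hx).le, one_div]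
  have i1 : IntervalIntegrable (fun x => 7 * (Vi x^2 / √(1 - x))) volume 0 1 := by
    rw [intervalIntegrable_iff_integrableOn_Ioo_of_le zero_le_one]
    refine int01 (C := 7) (a := -(1/2)) (by norm_num) (fun x hx => ?_) fun x hx => ?_
    · have := Vi_ca x
      exact continuousAt_const.mul ((this.pow 2).div (by fun_prop) (sqrt_pos.2 (hs x hx)).ne')
    · rw [← is x hx, abs_of_nonneg (by positivity)]
      have := Vi_bd x
      have : Vi x^2 ≤ 1 := by nlinarith
      gcongr
  set g : ℝ → ℝ := fun x => (-(1/2) * Ui x^2 - 2/9 * (Ui x * Vi x)) / √(1 - x) with hg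
  have ub : ∀ x ∈ Ioo (0:ℝ) 1, |Ui x| ≤ (1 - x)^(-(1/8):ℝ) := fun x hx => by
    have h4 := U_bd ⟨hx.1.le, hx.2⟩
    have := rpow_pos_of_pos (hs x hx) (-(1/8))
    rw [abs_of_nonpos h4.1]; linarith
  have i2 : IntervalIntegrable g volume 0 1 := by
    rw [intervalIntegrable_iff_integrableOn_Ioo_of_le zero_le_one]
    refine int01 (C := 1) (a := -(3/4)) (by norm_num) (fun x hx => ?_) fun x hx => ?_
    · have := Vi_ca x
      have := Ui_ca hx.2
      exact ContinuousAt.div (by fun_prop) (by fun_prop) (sqrt_pos.2 (hs x hx)).ne'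
    · have h1 := ub x hx
      have h2 := Vi_bd x
      have h3 : 1 ≤ (1 - x)^(-(1/8):ℝ) := one_le_rpow_of_pos_of_le_one_of_nonpos (hs x hx) (by linarith [hx.1]) (by norm_num)
      have e : (1 - x)^(-(3/4):ℝ) = ((1 - x)^(-(1/8):ℝ))^2 * (1 / √(1 - x)) := by
        rw [is x hx, pow_two, ← rpow_add (hs x hx), ← rpow_add (hs x hx)]; norm_num
      simp only [hg]
      rw [e, div_eq_mul_one_div _ (√(1 - x)), abs_mul, abs_of_nonneg (by positivity : 0 ≤ 1 / √(1 - x)), one_mul]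
      gcongr
      set k := (1 - x)^(-(1/8):ℝ)
      have := abs_le.1 h1
      rw [abs_le]
      have q1 : Ui x^2 ≤ k^2 := by nlinarith
      have q2 : |Ui x * Vi x| ≤ k^2 := by
        rw [abs_mul, abs_of_pos (by linarith : 0 < Vi x)]; nlinarith [abs_nonneg (Ui x)]
      have := abs_le.1 q2
      constructor <;> nlinarith [sq_nonneg (Ui x)]
  have z : ∫ x in (0:ℝ)..1, g x = 0 := by
    have := intervalIntegral.integral_eq_sub_of_hasDerivAt_of_tendsto (f := fun x => √(1 - x) * Ui x^2) (fa := 0) (fb := 0) one_pos (fun x hx => ?_) i2 ?_ ?_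
    · simpa using this
    · refine ((((hasDerivAt_id x).const_sub 1).sqrt (hs x hx).ne').fun_mul ((VU_d hx).2.fun_pow 2)).congr_deriv ?_
      simp only [id, hg]
      have h1 := sqrt_pos.2 (hs x hx)
      have h2 := sq_sqrt (hs x hx).le
      rw [show 9 * (1 - x) = 9 * √(1 - x)^2 by rw [h2]]
      generalize √(1 - x) = r at *
      field_simp
      norm_num; ring
    · have : ContinuousAt (fun x => √(1 - x) * Ui x^2) 0 := by have := Ui_ca (X := 0) one_pos; fun_prop
      simpa [Ui_0] using this.tendsto.mono_left (nhdsWithin_le_nhds (s := Ioi 0))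
    · have h3 : Filter.Tendsto (fun X : ℝ => (1 - X)^(1/4:ℝ)) (nhdsWithin 1 (Iio 1)) (nhds 0) := by
        have : ContinuousAt (fun X : ℝ => (1 - X)^(1/4:ℝ)) 1 :=
          ContinuousAt.rpow_const (by fun_prop) (Or.inr (by norm_num))
        have h := this.tendsto.mono_left (nhdsWithin_le_nhds (s := Iio 1))
        simpa using h
      refine squeeze_zero_norm' ?_ h3
      filter_upwards [Ioo_mem_nhdsLT (show (0:ℝ) < 1 by norm_num)] with X hX
      have e : (1 - X)^(1/4:ℝ) = √(1 - X) * ((1 - X)^(-(1/8):ℝ))^2 := by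
        rw [sqrt_eq_rpow, pow_two, ← rpow_add (hs X hX), ← rpow_add (hs X hX)]; norm_num
      rw [e, norm_mul, norm_pow, norm_of_nonneg (sqrt_nonneg _)]
      have := ub X hX
      gcongr; exact this
  rw [e0, ← intervalIntegral.integral_const_mul]
  calc _ = ∫ x in (0:ℝ)..1, (7 * (Vi x^2 / √(1 - x)) + 54 * g x) := by
        congr 1; ext x; simp only [hg, bb, aa]; ring
    _ = _ := by rw [intervalIntegral.integral_add i1 (i2.const_mul 54), intervalIntegral.integral_const_mul 54, z]; ring

lemma bt_bd {X : ℝ} (hX : X ∈ Ico (0:ℝ) 1) : |bt X| ≤ 3 * X := by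
  have h1 := Vi_bd X
  have h2 := U_bd hX
  have h5 : 0 < 1 - X := by linarith [hX.2]
  have h3 : (1 - X) * (1 - X)^(-(1/8):ℝ) ≤ 1 := by
    have : (1 - X)^(7/8:ℝ) = (1 - X) * (1 - X)^(-(1/8):ℝ) := by
      nth_rw 2 [← rpow_one (1 - X)]; rw [← rpow_add h5]; norm_num
    rw [← this]; exact rpow_le_one h5.le (by linarith [hX.1]) (by norm_num)
  have h4 : (1 - X) * (-Ui X) ≤ 8/9 * X := by nlinarith
  have h6 : 0 ≤ (1 - X) * (-Ui X) := mul_nonneg h5.le (by linarith)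
  have h7 : X * Vi X ≤ X := by nlinarith [hX.1]
  have h8 : 0 ≤ X * Vi X := mul_nonneg hX.1 (by linarith)
  unfold bt
  rw [abs_le]; constructor <;> linarith [hX.1]

end BL

namespace BL

noncomputable def XX (φ y α : ℝ) : ℝ := (1 - cos φ * cos y - sin φ * sin y * cos α) / 2
noncomputable def mm (X : ℝ) : ℝ := bt X / (2 * X * (1 - X))

lemma mm_d {X : ℝ} (hX : X ∈ Ioo (0:ℝ) 1) : HasDerivAt mm ((4/9 * bb X - 2 * (1 - 2*X) * mm X) / (2 * X * (1 - X))) X := by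
  have h0 := hX.1
  have h1 : 1 - X ≠ 0 := by linarith [hX.2]
  refine ((bt_d hX).fun_div (((hasDerivAt_id X).const_mul 2).fun_mul ((hasDerivAt_id X).const_sub 1)) (by simp only [id]; positivity)).congr_deriv ?_
  simp only [id, mm]
  field_simp; ring
lemma XX_mem {φ y α : ℝ} (h1 : π/2 ≤ φ) (h2 : φ < π) (hy : y ∈ Ioo (-(π - φ)) (π - φ)) : XX φ y α ∈ Ioo (0:ℝ) 1 := by
  have hs : 0 < sin φ := sin_pos_of_pos_of_lt_pi (by linarith [pi_pos]) h2
  have e1 : cos φ * cos y + |sin φ * sin y * cos α| < 1 := by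
    have a : |sin φ * sin y * cos α| ≤ sin φ * sin |y| := by
      rw [abs_mul, abs_mul, abs_of_pos hs, abs_sin_eq_sin_abs_of_abs_le_pi (by rw [abs_le]; constructor <;> linarith [hy.1, hy.2])]
      have : 0 ≤ sin |y| := by
        refine sin_nonneg_of_nonneg_of_le_pi (abs_nonneg _) ?_
        rw [abs_le]; constructor <;> linarith [hy.1, hy.2]
      exact mul_le_of_le_one_right (by positivity) (abs_cos_le_one _)
    have b : cos φ * cos y + sin φ * sin |y| < 1 := by
      rw [← cos_abs y, ← cos_sub]
      have : |y| < π - φ := abs_lt.2 ⟨by linarith [hy.1], hy.2⟩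
      have := cos_lt_cos_of_nonneg_of_le_pi (x := 0) (y := φ - |y|) le_rfl (by linarith [abs_nonneg y]) (by linarith)
      rwa [cos_zero] at this
    linarith
  have e2 : -1 < cos φ * cos y - |sin φ * sin y * cos α| := by
    have a : |sin φ * sin y * cos α| ≤ sin φ * sin |y| := by
      rw [abs_mul, abs_mul, abs_of_pos hs, abs_sin_eq_sin_abs_of_abs_le_pi (by rw [abs_le]; constructor <;> linarith [hy.1, hy.2])]
      have : 0 ≤ sin |y| := by
        refine sin_nonneg_of_nonneg_of_le_pi (abs_nonneg _) ?_
        rw [abs_le]; constructor <;> linarith [hy.1, hy.2]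
      exact mul_le_of_le_one_right (by positivity) (abs_cos_le_one _)
    have b : -1 < cos φ * cos y - sin φ * sin |y| := by
      rw [← cos_abs y, ← cos_add]
      have : |y| < π - φ := abs_lt.2 ⟨by linarith [hy.1], hy.2⟩
      have := cos_lt_cos_of_nonneg_of_le_pi (x := φ + |y|) (y := π) (by linarith [abs_nonneg y, pi_pos]) le_rfl (by linarith)
      rwa [cos_pi] at this
    linarith
  have := le_abs_self (sin φ * sin y * cos α)
  have := neg_abs_le (sin φ * sin y * cos α)
  unfold XX
  constructor <;> linarith

lemma comp_con {g : ℝ → ℝ} (hg : ∀ X ∈ Ioo (0:ℝ) 1, ContinuousAt g X) {φ : ℝ} (h1 : π/2 ≤ φ) (h2 : φ < π) (s : Set ℝ) : ContinuousOn (fun p : ℝ × ℝ => g (XX φ p.1 p.2)) (Ioo (-(π - φ)) (π - φ) ×ˢ s) := by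
  intro p hp
  have : ContinuousAt (fun p : ℝ × ℝ => XX φ p.1 p.2) p := by unfold XX; fun_prop
  exact (ContinuousAt.comp (f := fun p : ℝ × ℝ => XX φ p.1 p.2) (hg _ (XX_mem h1 h2 hp.1)) this).continuousWithinAt

lemma legadd {φ : ℝ} (h1 : π/2 ≤ φ) (h2 : φ < π) : ∀ y ∈ Ioo 0 (π - φ), ∫ α in (0:ℝ)..π, bb (XX φ y α) = π * bb (sin (φ/2)^2) * bb (sin (y/2)^2) := by
  have hp := pi_pos
  set U := Ioo (-(π - φ)) (π - φ) with hU
  have sub : Ioo 0 (π - φ) ⊆ U := Ioo_subset_Ioo_left (by linarith)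
  have sub2 : Ioo 0 (π - φ) ×ˢ Icc 0 π ⊆ U ×ˢ Icc 0 π := prod_mono sub subset_rfl
  have c1 : ContinuousOn (fun p : ℝ × ℝ => bb (XX φ p.1 p.2)) (U ×ˢ Icc 0 π) := comp_con (fun X hX => bb_ca hX.2) h1 h2 _
  have c2 : ContinuousOn (fun p : ℝ × ℝ => mm (XX φ p.1 p.2)) (U ×ˢ Icc 0 π) := comp_con (fun X hX => (mm_d hX).continuousAt) h1 h2 _
  have c3 : ContinuousOn (fun p : ℝ × ℝ => (fun X => (4/9 * bb X - 2 * (1 - 2*X) * mm X) / (2 * X * (1 - X))) (XX φ p.1 p.2)) (U ×ˢ Icc 0 π) :=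
    comp_con (g := fun X => (4/9 * bb X - 2 * (1 - 2*X) * mm X) / (2 * X * (1 - X))) (fun X hX => by
      have := bb_ca hX.2
      have := (mm_d hX).continuousAt
      have : 2 * X * (1 - X) ≠ 0 := mul_ne_zero (by linarith [hX.1]) (by linarith [hX.2])
      fun_prop (disch := assumption)) h1 h2 _
  have sp : ∀ y ∈ Ioo 0 (π - φ), 0 < sin y := fun y hy => sin_pos_of_pos_of_lt_pi hy.1 (by linarith [hy.2])
  have dXy : ∀ y α, HasDerivAt (fun y => XX φ y α) ((cos φ * sin y - sin φ * cos y * cos α)/2) y := fun y α => by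
    refine (((((hasDerivAt_cos y).const_mul (cos φ)).const_sub 1).fun_sub (((hasDerivAt_sin y).const_mul (sin φ)).mul_const (cos α))).div_const 2).congr_deriv ?_
    ring
  have dXa : ∀ y α, HasDerivAt (fun α => XX φ y α) (sin φ * sin y * sin α/2) α := fun y α => by
    refine ((((hasDerivAt_cos α).const_mul (sin φ * sin y)).const_sub (1 - cos φ * cos y)).div_const 2).congr_deriv ?_
    ring
  have dp : ∀ y α, HasDerivAt (fun y => sin y * ((cos φ * sin y - sin φ * cos y * cos α)/2)) (cos y * ((cos φ * sin y - sin φ * cos y * cos α)/2) + sin y * ((cos φ * cos y + sin φ * sin y * cos α)/2)) y := fun y α => by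
    refine ((hasDerivAt_sin y).fun_mul ((((hasDerivAt_sin y).const_mul (cos φ)).fun_sub (((hasDerivAt_cos y).const_mul (sin φ)).mul_const (cos α))).div_const 2)).congr_deriv ?_
    ring
  have sm : ∀ y ∈ Ioo 0 (π - φ), sin (y/2)^2 ∈ Ioo (0:ℝ) 1 := fun y hy => by
    have a : 0 < sin (y/2) := sin_pos_of_pos_of_lt_pi (by linarith [hy.1]) (by linarith [hy.2])
    have b : 0 < cos (y/2) := cos_pos_of_mem_Ioo ⟨by linarith [hy.1], by linarith [hy.2]⟩
    exact ⟨by positivity, by nlinarith [sin_sq_add_cos_sq (y/2)]⟩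
  have dS : ∀ y, HasDerivAt (fun y => sin (y/2)^2) (sin (y/2) * cos (y/2)) y := fun y => by
    refine ((((hasDerivAt_id y).div_const 2).sin).fun_pow 2).congr_deriv ?_
    simp only [id]; ring
  have s2 : ∀ y, sin y = 2 * sin (y/2) * cos (y/2) := fun y => by rw [← sin_two_mul]; congr 1; ring
  have key := fun y hy => avg_ode (U := Ioo 0 (π - φ)) isOpen_Ioo (f := fun y α => bb (XX φ y α))
    (f1 := fun y α => sin y * ((cos φ * sin y - sin φ * cos y * cos α)/2) * mm (XX φ y α))
    (f2 := fun y α => sin y * (cos y * ((cos φ * sin y - sin φ * cos y * cos α)/2) + sin y * ((cos φ * cos y + sin φ * sin y * cos α)/2)) * mm (XX φ y α) + (sin y * ((cos φ * sin y - sin φ * cos y * cos α)/2))^2 * (fun X => (4/9 * bb X - 2 * (1 - 2*X) * mm X) / (2 * X * (1 - X))) (XX φ y α))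
    (fθ := fun y α => sin φ * sin y * sin α/2 * mm (XX φ y α))
    (σ := sin) (q := fun y => 2/9 * sin y^2) continuous_sin.continuousOn (fun y hy => (sp y hy).ne') (c1.mono sub2) ((ContinuousOn.mul (by fun_prop) c2).mono sub2)
    (((ContinuousOn.mul (by fun_prop) c2).add (ContinuousOn.mul (by fun_prop) c3)).mono sub2) ?_ ?_ ?_ ?_ ?_ (x := y) hy
  · have res := ode_unique (b := π - φ) (c := π * bb (sin (φ/2)^2)) (F := fun y => ∫ α in (0:ℝ)..π, bb (XX φ y α)) (F1 := fun y => ∫ α in (0:ℝ)..π, sin y * ((cos φ * sin y - sin φ * cos y * cos α)/2) * mm (XX φ y α))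
      (G := fun y => bb (sin (y/2)^2)) (G1 := fun y => bt (sin (y/2)^2)) (σ := sin) (q := fun y => 2/9 * sin y^2) (fun y hy => (sp y hy).ne') ?_ (fun y hy => (key y hy).1) (fun y hy => (key y hy).2) ?_ ?_ ?_ ?_ ?_ ?_
    · exact res
    · intro y hy; linarith [(bb_bd ⟨(sm y hy).1.le, (sm y hy).2⟩).1]
    · intro y hy
      refine ((bb_d (sm y hy)).comp y (dS y)).congr_deriv ?_
      have := sp y hy
      rw [s2 y] at this ⊢
      have e : 1 - sin (y/2)^2 = cos (y/2)^2 := by rw [cos_sq']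
      rw [e]
      have a : sin (y/2) ≠ 0 := by rintro h; simp [h] at this
      have b : cos (y/2) ≠ 0 := by rintro h; simp [h] at this
      field_simp
    · intro y hy
      refine ((bt_d (sm y hy)).comp y (dS y)).congr_deriv ?_
      have := sp y hy
      field_simp
      rw [s2 y]; ring
    · have h := (pcont pi_pos.le isOpen_Ioo (show (0:ℝ) ∈ U from ⟨by linarith, by linarith⟩) (f := fun y α => bb (XX φ y α)) c1).tendsto.mono_left (nhdsWithin_le_nhds (s := Ioi 0))
      have e : ∀ α, XX φ 0 α = sin (φ/2)^2 := fun α => by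
        rw [XX, sin_zero, cos_zero, sin_sq_eq_half_sub, show 2 * (φ/2) = φ by ring]; ring
      simpa [e] using h
    · have h := (pcont pi_pos.le isOpen_Ioo (show (0:ℝ) ∈ U from ⟨by linarith, by linarith⟩) (f := fun y α => sin y * ((cos φ * sin y - sin φ * cos y * cos α)/2) * mm (XX φ y α)) (ContinuousOn.mul (by fun_prop) c2)).tendsto.mono_left (nhdsWithin_le_nhds (s := Ioi 0))
      simpa using h
    · have : ContinuousAt (fun y => bb (sin (y/2)^2)) 0 := ContinuousAt.comp (f := fun y => sin (y/2)^2) (bb_ca (by simp)) (by fun_prop)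
      have h := this.tendsto.mono_left (nhdsWithin_le_nhds (s := Ioi 0))
      simpa [bb_0] using h
    · have : ContinuousAt (fun y => bt (sin (y/2)^2)) 0 := ContinuousAt.comp (f := fun y => sin (y/2)^2) (bt_ca (by simp)) (by fun_prop)
      have h := this.tendsto.mono_left (nhdsWithin_le_nhds (s := Ioi 0))
      simpa [bt_0] using h
  · intro y hy α _
    refine (HasDerivAt.comp (h := fun y => XX φ y α) y (bb_d (XX_mem h1 h2 (sub hy))) (dXy y α)).congr_deriv ?_
    have := sp y hy
    change mm _ * _ = _
    field_simp
  · intro y hy α _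
    refine ((dp y α).fun_mul (HasDerivAt.comp (h := fun y => XX φ y α) y (mm_d (XX_mem h1 h2 (sub hy))) (dXy y α))).congr_deriv ?_
    have := sp y hy
    simp only [Function.comp]
    generalize (4/9 * bb (XX φ y α) - 2 * (1 - 2*XX φ y α) * mm (XX φ y α)) / (2 * XX φ y α * (1 - XX φ y α)) = E
    field_simp
  · intro y hy α _
    refine ((((hasDerivAt_sin α).const_mul (sin φ * sin y)).div_const 2).fun_mul ((mm_d (XX_mem h1 h2 (sub hy))).comp α (dXa y α))).congr_deriv ?_
    have hX := XX_mem (α := α) h1 h2 (sub hy)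
    simp only [Function.comp]
    have hE : (4/9 * bb (XX φ y α) - 2 * (1 - 2*XX φ y α) * mm (XX φ y α)) / (2 * XX φ y α * (1 - XX φ y α)) * (2 * XX φ y α * (1 - XX φ y α)) = 4/9 * bb (XX φ y α) - 2 * (1 - 2*XX φ y α) * mm (XX φ y α) :=
      div_mul_cancel₀ _ (mul_ne_zero (by linarith [hX.1]) (by linarith [hX.2]))
    generalize (4/9 * bb (XX φ y α) - 2 * (1 - 2*XX φ y α) * mm (XX φ y α)) / (2 * XX φ y α * (1 - XX φ y α)) = E at hE ⊢
    generalize mm (XX φ y α) = m at *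
    generalize bb (XX φ y α) = b at *
    have a1 := sin_sq_add_cos_sq φ
    have a2 := sin_sq_add_cos_sq y
    have a3 := sin_sq_add_cos_sq α
    have i1 : (sin y * ((cos φ * sin y - sin φ * cos y * cos α)/2))^2 + (sin φ * sin y * sin α/2)^2 = sin y^2 * (XX φ y α * (1 - XX φ y α)) := by
      unfold XX
      linear_combination sin y^2/4 * ((cos φ^2 + sin φ^2 * cos α^2) * a2 + sin φ^2 * a3 + a1)
    have i2 : sin y * (cos y * ((cos φ * sin y - sin φ * cos y * cos α)/2) + sin y * ((cos φ * cos y + sin φ * sin y * cos α)/2)) + sin φ * sin y * cos α/2 = sin y^2 * (1 - 2 * XX φ y α) := by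
      unfold XX
      linear_combination (-(sin φ * sin y * cos α/2)) * a2
    linear_combination m * i2 + E * i1 + sin y^2 / 2 * hE
  · intro y _; simp
  · intro y _; simp

end BL

namespace BL

lemma cosint : IntervalIntegrable (fun β => cos β^(-(1/4):ℝ)) volume 0 (π/2) := by
  have hp := pi_pos
  have h1 : IntervalIntegrable (fun x : ℝ => (1 - 2/π * x)^(-(1/4):ℝ)) volume 0 (π/2) := by
    have := ((intervalIntegral.intervalIntegrable_rpow' (r := -(1/4)) (by norm_num) (a := 1) (b := 0)).comp_sub_left 1).comp_mul_left (c := 2/π)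
    have e : 1 / (2/π) = π/2 := by field_simp
    simpa [e] using this
  rw [intervalIntegrable_iff_integrableOn_Ioo_of_le (by positivity)] at h1 ⊢
  refine h1.mono' (measurable_cos.pow_const _).aestronglyMeasurable ((ae_restrict_iff' measurableSet_Ioo).2 (Filter.Eventually.of_forall fun x hx => ?_))
  have c := one_sub_mul_le_cos hx.1.le hx.2.le
  have d : 0 < 1 - 2/π * x := by
    have := mul_lt_mul_of_pos_left hx.2 (show 0 < 2/π by positivity)
    have e : 2/π * (π/2) = 1 := by field_simp
    linarith
  rw [norm_of_nonneg (rpow_nonneg (by linarith) _)]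
  exact rpow_le_rpow_of_nonpos d c (by norm_num)

lemma leglim {φ : ℝ} (h1 : π/2 ≤ φ) (h2 : φ < π) : ∫ α in (0:ℝ)..π, bb (1 - (sin φ * cos (α/2))^2) = π * bb (sin (φ/2)^2) * bb (cos (φ/2)^2) := by
  have hp := pi_pos
  have hs : 0 < sin φ := sin_pos_of_pos_of_lt_pi (by linarith) h2
  have ev : ∀ᶠ y in nhdsWithin (π - φ) (Iio (π - φ)), y ∈ Ioo 0 (π - φ) := Ioo_mem_nhdsLT (by linarith)
  have ev2 : ∀ᶠ y in nhdsWithin (π - φ) (Iio (π - φ)), sin φ / 2 < sin y := by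
    have : Filter.Tendsto sin (nhdsWithin (π - φ) (Iio (π - φ))) (nhds (sin φ)) := by
      have := continuous_sin.continuousAt (x := π - φ) |>.tendsto.mono_left (nhdsWithin_le_nhds (s := Iio (π - φ)))
      rwa [sin_pi_sub] at this
    exact this.eventually (lt_mem_nhds (by linarith))
  have T1 : Filter.Tendsto (fun y => π * bb (sin (φ/2)^2) * bb (sin (y/2)^2)) (nhdsWithin (π - φ) (Iio (π - φ))) (nhds (π * bb (sin (φ/2)^2) * bb (cos (φ/2)^2))) := by
    have e : sin ((π - φ)/2) = cos (φ/2) := by rw [← sin_pi_div_two_sub]; congr 1; ring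
    have : ContinuousAt (fun y => bb (sin (y/2)^2)) (π - φ) := ContinuousAt.comp (f := fun y => sin (y/2)^2) (bb_ca (by
      rw [e]
      have : 0 < sin (φ/2) := sin_pos_of_pos_of_lt_pi (by linarith) (by linarith)
      nlinarith [sin_sq_add_cos_sq (φ/2)])) (by fun_prop)
    have h := (this.tendsto.mono_left (nhdsWithin_le_nhds (s := Iio (π - φ)))).const_mul (π * bb (sin (φ/2)^2))
    rwa [e] at h
  have T2 : Filter.Tendsto (fun y => ∫ α in (0:ℝ)..π, bb (XX φ y α)) (nhdsWithin (π - φ) (Iio (π - φ))) (nhds (∫ α in (0:ℝ)..π, bb (1 - (sin φ * cos (α/2))^2))) := by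
    refine intervalIntegral.tendsto_integral_filter_of_dominated_convergence (fun α => 3 * (sin φ^2/2)^(-(1/8):ℝ) * cos (1/2 * α)^(-(1/4):ℝ)) ?_ ?_ ?_ ?_
    · filter_upwards [ev] with y hy
      have c1 := comp_con (g := bb) (fun X hX => bb_ca hX.2) h1 h2 univ
      rw [uIoc_of_le hp.le]
      have : ContinuousOn (fun α => bb (XX φ y α)) (Ioc 0 π) := c1.comp (f := fun α => (y, α)) (by fun_prop) fun α _ => ⟨⟨by linarith [hy.1], hy.2⟩, mem_univ _⟩
      exact this.aestronglyMeasurable measurableSet_Ioc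
    · filter_upwards [ev, ev2] with y hy hy2
      filter_upwards [Measure.ae_ne volume π] with α hne hα
      rw [uIoc_of_le hp.le] at hα
      have hc : 0 < cos (1/2 * α) := cos_pos_of_mem_Ioo ⟨by linarith [hα.1], by
        have := lt_of_le_of_ne hα.2 hne
        linarith⟩
      have hX := XX_mem (α := α) h1 h2 (y := y) ⟨by linarith [hy.1], hy.2⟩
      have hb := bb_bd ⟨hX.1.le, hX.2⟩
      rw [norm_of_nonneg (by linarith [hb.1]), mul_assoc]
      refine hb.2.trans ?_
      have e : cos α = 2 * cos (1/2 * α)^2 - 1 := by rw [← cos_two_mul]; congr 1; ring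
      have low : sin φ^2/2 * cos (1/2 * α)^2 ≤ 1 - XX φ y α := by
        have : 1 - XX φ y α = (1 + cos (φ + y))/2 + sin φ * sin y * cos (1/2 * α)^2 := by
          rw [XX, e, cos_add]; ring
        rw [this]
        have := neg_one_le_cos (φ + y)
        have : sin φ^2/2 ≤ sin φ * sin y := by nlinarith
        have := mul_le_mul_of_nonneg_right this (sq_nonneg (cos (1/2 * α)))
        linarith
      have e2 : (sin φ^2/2)^(-(1/8):ℝ) * cos (1/2 * α)^(-(1/4):ℝ) = (sin φ^2/2 * cos (1/2 * α)^2)^(-(1/8):ℝ) := by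
        rw [mul_rpow (by positivity) (by positivity), ← rpow_natCast (cos _), ← rpow_mul hc.le]; norm_num
      rw [e2]
      gcongr 3 * ?_
      exact rpow_le_rpow_of_nonpos (by positivity) low (by norm_num)
    · have := (cosint.comp_mul_left (c := 1/2)).const_mul (3 * (sin φ^2/2)^(-(1/8):ℝ))
      have e : π/2/(1/2) = π := by ring
      rwa [zero_div, e] at this
    · filter_upwards [Measure.ae_ne volume π] with α hne hα
      rw [uIoc_of_le hp.le] at hα
      have hc : 0 < cos (α/2) := cos_pos_of_mem_Ioo ⟨by linarith [hα.1], by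
        have := lt_of_le_of_ne hα.2 hne
        linarith⟩
      have e : XX φ (π - φ) α = 1 - (sin φ * cos (α/2))^2 := by
        have e : cos α = 2 * cos (α/2)^2 - 1 := by rw [← cos_two_mul]; congr 1; ring
        rw [XX, sin_pi_sub, cos_pi_sub, e]
        linear_combination (1/2) * sin_sq_add_cos_sq φ
      have : ContinuousAt (fun y => bb (XX φ y α)) (π - φ) := ContinuousAt.comp (f := fun y => XX φ y α) (bb_ca (by
        rw [e]; have := mul_pos hs hc; nlinarith)) (by unfold XX; fun_prop)
      have h := this.tendsto.mono_left (nhdsWithin_le_nhds (s := Iio (π - φ)))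
      rwa [e] at h
  refine tendsto_nhds_unique T2 (T1.congr' ?_)
  filter_upwards [ev] with y hy
  exact (legadd h1 h2 y hy).symm

lemma legfin {φ : ℝ} (h : φ ∈ Ioo 0 π) : bb (sin (φ/2)^2) * bb (cos (φ/2)^2) = 2/π * ∫ β in (0:ℝ)..(π/2), bb (1 - (sin φ * cos β)^2) := by
  have hp := pi_pos
  have e : ∫ α in (0:ℝ)..π, bb (1 - (sin φ * cos (α/2))^2) = 2 * ∫ β in (0:ℝ)..(π/2), bb (1 - (sin φ * cos β)^2) := by
    have := intervalIntegral.integral_comp_div (fun β => bb (1 - (sin φ * cos β)^2)) (c := 2) two_ne_zero (a := 0) (b := π)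
    simpa using this
  rcases le_total (π/2) φ with h1 | h1
  · have := leglim h1 h.2
    rw [e] at this
    rw [eq_comm, div_mul_eq_mul_div, div_eq_iff hp.ne']; linarith
  · have := leglim (φ := π - φ) (by linarith) (by linarith [h.1])
    rw [sin_pi_sub, e, show (π - φ)/2 = π/2 - φ/2 by ring, sin_pi_div_two_sub, cos_pi_div_two_sub] at this
    rw [eq_comm, div_mul_eq_mul_div, div_eq_iff hp.ne']; linarith

end BL

namespace BL

noncomputable def uf (φ : ℝ) : ℝ := (4 * cos (φ/3)^2 - 1)/3
noncomputable def xf (φ : ℝ) : ℝ := 4 * sin (φ/3) / √(4 * cos (φ/3)^2 - 1)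
noncomputable def Gf (φ : ℝ) : ℝ := Hk q0 (xf φ) / uf φ
noncomputable def G1f (φ : ℝ) : ℝ := -(cos (φ/3) * (Hk q1 (xf φ) + 2 * uf φ * Hk q0 (xf φ)) / uf φ)
noncomputable def G2f (φ : ℝ) : ℝ := 3/4 * (1 - uf φ) * (Hk q1 (xf φ) + 2 * uf φ * Hk q0 (xf φ)) + cos (φ/3)^2 * (Hk q2 (xf φ) + 4 * uf φ * Hk q1 (xf φ) + 4 * uf φ * Hk q0 (xf φ)) / uf φ

lemma cs {φ : ℝ} (h : φ ∈ Ioo 0 π) : 1/2 < cos (φ/3) ∧ 0 < sin (φ/3) ∧ 0 < sin φ := by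
  refine ⟨?_, sin_pos_of_pos_of_lt_pi (by linarith [h.1]) (by linarith [h.1, h.2]), sin_pos_of_pos_of_lt_pi h.1 h.2⟩
  rw [← cos_pi_div_three]
  exact cos_lt_cos_of_nonneg_of_le_pi (by linarith [h.1]) (by linarith [pi_pos]) (by linarith [h.2])
lemma uf_bd {φ : ℝ} (h : φ ∈ Ioo 0 π) : 0 < uf φ ∧ uf φ < 1 := by
  have := cs h
  have := sin_sq_add_cos_sq (φ/3)
  unfold uf
  constructor <;> nlinarith
lemma sinf (φ : ℝ) : sin φ = 3 * sin (φ/3) * uf φ := by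
  have := sin_three_mul (φ/3)
  rw [show 3 * (φ/3) = φ by ring] at this
  rw [this, uf]
  linear_combination (-4 * sin (φ/3)) * sin_sq_add_cos_sq (φ/3)
lemma cosf (φ : ℝ) : cos φ = cos (φ/3) * (3 * uf φ - 2) := by
  have := cos_three_mul (φ/3)
  rw [show 3 * (φ/3) = φ by ring] at this
  rw [this, uf]; ring
lemma c2f (φ : ℝ) : cos (φ/3)^2 = (1 + 3 * uf φ)/4 := by rw [uf]; ring
lemma s2f (φ : ℝ) : sin (φ/3)^2 = 3 * (1 - uf φ)/4 := by rw [uf]; linear_combination sin_sq_add_cos_sq (φ/3)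
lemma xf_pos {φ : ℝ} (h : φ ∈ Ioo 0 π) : 0 < xf φ :=
  div_pos (by linarith [cs h]) (sqrt_pos.2 (by have := (uf_bd h).1; unfold uf at this; linarith))
lemma xf_sq {φ : ℝ} (h : φ ∈ Ioo 0 π) : xf φ^2 = 4/uf φ - 4 := by
  have := (uf_bd h).1
  have e : 4 * cos (φ/3)^2 - 1 = 3 * uf φ := by rw [uf]; ring
  rw [xf, e, div_pow, sq_sqrt (by positivity), mul_pow, s2f]
  field_simp
lemma xf_d {φ : ℝ} (h : φ ∈ Ioo 0 π) : HasDerivAt xf (xf φ * cos (φ/3) / sin φ) φ := by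
  have hu := (uf_bd h).1
  have hs := cs h
  have e : 4 * cos (φ/3)^2 - 1 = 3 * uf φ := by rw [uf]; ring
  have p : 0 < 4 * cos (φ/3)^2 - 1 := by linarith
  have d3 : HasDerivAt (fun φ : ℝ => φ/3) (1/3) φ := (hasDerivAt_id φ).div_const 3
  refine ((d3.sin.const_mul 4).fun_div ((((d3.cos.fun_pow 2).const_mul 4).sub_const 1).sqrt p.ne') (sqrt_pos.2 p).ne').congr_deriv ?_
  rw [xf, e, sinf φ]
  have q := sqrt_pos.2 (show 0 < 3 * uf φ by linarith)
  have q2 := sq_sqrt (show 0 ≤ 3 * uf φ by linarith)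
  have e3 := s2f φ
  have := hs.2.1
  generalize √(3 * uf φ) = r at *
  generalize sin (φ/3) = s at *
  generalize cos (φ/3) = c at *
  generalize uf φ = u at *
  have : u = r^2/3 := by linarith
  subst this
  field_simp
  norm_num
  linear_combination (c * 8) * e3
lemma cf_d {φ : ℝ} (h : φ ∈ Ioo 0 π) : HasDerivAt (fun φ => cos (φ/3)) (-(3/4 * uf φ * (1 - uf φ)) / sin φ) φ := by
  refine ((hasDerivAt_id φ).div_const 3).cos.congr_deriv ?_
  have := (cs h).2.2
  have e3 := s2f φ
  rw [eq_div_iff this.ne', sinf φ]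
  simp only [id]
  linear_combination (-uf φ) * e3
lemma uf_d {φ : ℝ} (h : φ ∈ Ioo 0 π) : HasDerivAt uf (-(2 * (1 - uf φ) * cos (φ/3) * uf φ) / sin φ) φ := by
  refine (((((cf_d h).fun_pow 2).const_mul 4).sub_const 1).div_const 3).congr_deriv ?_
  have := (cs h).2.2
  field_simp
  norm_num; ring
lemma R_d {φ : ℝ} (h : φ ∈ Ioo 0 π) {f g : ℝ → ℝ} (hf : HasDerivAt (Hk f) (-(Hk g (xf φ) + 2 * Hk f (xf φ)) / xf φ) (xf φ)) :
    HasDerivAt (fun φ => Hk f (xf φ)) (-(cos (φ/3) * (Hk g (xf φ) + 2 * Hk f (xf φ))) / sin φ) φ := by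
  refine (hf.comp φ (xf_d h)).congr_deriv ?_
  have := xf_pos h
  have := (cs h).2.2
  field_simp

lemma G_d {φ : ℝ} (h : φ ∈ Ioo 0 π) : HasDerivAt Gf (G1f φ / sin φ) φ ∧ HasDerivAt G1f (G2f φ / sin φ) φ ∧
    HasDerivAt G2f ((4 * (2/9 * sin φ^2) * G1f φ + 4 * (2/9 * sin φ^2) * cos φ * Gf φ) / sin φ) φ := by
  have hx := xf_pos h
  have d0 := R_d h (T0_d hx)
  have d1 := R_d h (T1_d hx)
  have d2 := R_d h (T2_d hx)
  have dc := cf_d h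
  have du := uf_d h
  have hu := (uf_bd h).1
  have hS := (cs h).2.2
  have ro := rode hx
  rw [show xf φ^4 = (xf φ^2)^2 by ring, xf_sq h] at ro
  have ec := c2f φ
  have e1 : sin φ^2 = 27/4 * (1 - uf φ) * uf φ^2 := by rw [sinf φ]; linear_combination (9 * uf φ^2) * s2f φ
  refine ⟨(d0.fun_div du hu.ne').congr_deriv ?_, ((dc.fun_mul (d1.fun_add ((du.const_mul 2).fun_mul d0))).fun_div du hu.ne').fun_neg.congr_deriv ?_,
    ((((du.const_sub 1).const_mul (3/4)).fun_mul (d1.fun_add ((du.const_mul 2).fun_mul d0))).fun_add (((dc.fun_pow 2).fun_mul ((d2.fun_add ((du.const_mul 4).fun_mul d1)).fun_add ((du.const_mul 4).fun_mul d0))).fun_div du hu.ne')).congr_deriv ?_⟩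
  all_goals
    rw [eq_div_iff hS.ne']
    try rw [e1, cosf φ]
    simp only [Gf, G1f, G2f]
    generalize sin φ = S at *
    generalize cos (φ/3) = c at *
    generalize uf φ = u at *
    generalize Hk q0 (xf φ) = R0 at *
    generalize Hk q1 (xf φ) = R1 at *
    generalize Hk q2 (xf φ) = R2 at *
  · field_simp; ring
  · field_simp; ring
  · generalize Hk q3 (xf φ) = R3 at *
    field_simp at ro ⊢
    norm_num
    have e3 : c^3 = c * ((1 + 3 * u)/4) := by rw [← ec]; ring
    simp only [e3]
    linear_combination (-(9/16) * c) * ro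

end BL

namespace BL

noncomputable def af (φ : ℝ) : ℝ := bb (sin (φ/2)^2)
noncomputable def a1f (φ : ℝ) : ℝ := bt (sin (φ/2)^2)
noncomputable def bf (φ : ℝ) : ℝ := bb (cos (φ/2)^2)
noncomputable def b1f (φ : ℝ) : ℝ := -bt (cos (φ/2)^2)
noncomputable def Bf (p p1 q q1 : ℝ → ℝ) (φ : ℝ) : ℝ := 2 * (Gf φ * (p1 φ * q1 φ) - Gf φ * (2/9 * sin φ^2) * (p φ * q φ)) - G1f φ * (p1 φ * q φ + p φ * q1 φ) + G2f φ * (p φ * q φ)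

lemma hf {φ : ℝ} (h : φ ∈ Ioo 0 π) : 0 < sin (φ/2) ∧ 0 < cos (φ/2) ∧ sin φ = 2 * sin (φ/2) * cos (φ/2) ∧ sin (φ/2)^2 ∈ Ioo (0:ℝ) 1 ∧ cos (φ/2)^2 ∈ Ioo (0:ℝ) 1 := by
  have a : 0 < sin (φ/2) := sin_pos_of_pos_of_lt_pi (by linarith [h.1]) (by linarith [h.2, h.1])
  have b : 0 < cos (φ/2) := cos_pos_of_mem_Ioo ⟨by linarith [h.1, h.2], by linarith [h.2]⟩
  have c := sin_sq_add_cos_sq (φ/2)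
  exact ⟨a, b, by rw [← sin_two_mul]; congr 1; ring, ⟨by positivity, by nlinarith⟩, ⟨by positivity, by nlinarith⟩⟩
lemma a_d {φ : ℝ} (h : φ ∈ Ioo 0 π) : HasDerivAt af (a1f φ / sin φ) φ ∧ HasDerivAt a1f (2/9 * sin φ^2 * af φ / sin φ) φ ∧ HasDerivAt bf (b1f φ / sin φ) φ ∧ HasDerivAt b1f (2/9 * sin φ^2 * bf φ / sin φ) φ := by
  obtain ⟨a, b, c, d, e⟩ := hf h
  have dS : HasDerivAt (fun y => sin (y/2)^2) (sin (φ/2) * cos (φ/2)) φ := by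
    refine ((((hasDerivAt_id φ).div_const 2).sin).fun_pow 2).congr_deriv ?_
    simp only [id]; ring
  have dC : HasDerivAt (fun y => cos (y/2)^2) (-(sin (φ/2) * cos (φ/2))) φ := by
    refine ((((hasDerivAt_id φ).div_const 2).cos).fun_pow 2).congr_deriv ?_
    simp only [id]; ring
  have e1 : 1 - sin (φ/2)^2 = cos (φ/2)^2 := by rw [cos_sq']
  have e2 : 1 - cos (φ/2)^2 = sin (φ/2)^2 := by rw [sin_sq]
  refine ⟨((bb_d d).comp φ dS).congr_deriv ?_, ((bt_d d).comp φ dS).congr_deriv ?_, ((bb_d e).comp φ dC).congr_deriv ?_, (HasDerivAt.fun_neg (HasDerivAt.comp (h := fun y => cos (y/2)^2) φ (bt_d e) dC)).congr_deriv ?_⟩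
  · rw [c, e1, a1f]; field_simp
  · rw [c, af]; field_simp; norm_num
  · rw [c, e2, b1f]; field_simp
  · rw [c, bf]; field_simp; norm_num
lemma B_d {p p1 q q1 : ℝ → ℝ} {φ : ℝ} (h : φ ∈ Ioo 0 π) (hp : HasDerivAt p (p1 φ / sin φ) φ) (hp1 : HasDerivAt p1 (2/9 * sin φ^2 * p φ / sin φ) φ)
    (hq : HasDerivAt q (q1 φ / sin φ) φ) (hq1 : HasDerivAt q1 (2/9 * sin φ^2 * q φ / sin φ) φ) : HasDerivAt (Bf p p1 q q1) 0 φ := by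
  obtain ⟨g0, g1, g2⟩ := G_d h
  have hs := (cs h).2.2
  have k : HasDerivAt (fun φ => 2/9 * sin φ^2) (4/9 * sin φ * cos φ) φ := by
    refine (((hasDerivAt_sin φ).fun_pow 2).const_mul (2/9)).congr_deriv ?_
    ring
  refine (((((g0.fun_mul (hp1.fun_mul hq1)).fun_sub ((g0.fun_mul k).fun_mul (hp.fun_mul hq))).const_mul 2).fun_sub (g1.fun_mul ((hp1.fun_mul hq).fun_add (hp.fun_mul hq1)))).fun_add (g2.fun_mul (hp.fun_mul hq))).congr_deriv ?_
  field_simp; ring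

lemma x2_lim {f : ℝ → ℝ} (hf : GB f) : Filter.Tendsto (fun x => x^2 * Hk f x) (nhdsWithin 0 (Ioi 0)) (nhds 0) ∧ Filter.Tendsto (Hk f) Filter.atTop (nhds 0) := by
  obtain ⟨M, hM, h⟩ := Hk_bd hf
  refine ⟨tend0_pw (C := M) (a := 3/2) (by norm_num) fun x hx => ?_, tendtop_pw (C := M) (b := 1/2) (by norm_num) fun x hx => h x (by linarith)⟩
  rw [abs_mul, abs_of_nonneg (sq_nonneg x)]
  have e : x^(3/2:ℝ) = x^2 * x^(-(1/2):ℝ) := by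
    rw [← rpow_natCast x 2, ← rpow_add hx.1]; norm_num
  rw [e]
  nlinarith [h x hx.1, sq_nonneg x]
lemma ev0 : ∀ᶠ φ in nhdsWithin (0:ℝ) (Ioi 0), φ ∈ Ioo 0 π := Ioo_mem_nhdsGT pi_pos
lemma evp : ∀ᶠ φ in nhdsWithin π (Iio π), φ ∈ Ioo 0 π := Ioo_mem_nhdsLT pi_pos
lemma c0 {f : ℝ → ℝ} (h : ContinuousAt f 0) : Filter.Tendsto f (nhdsWithin 0 (Ioi 0)) (nhds (f 0)) := h.tendsto.mono_left nhdsWithin_le_nhds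
lemma cpi {f : ℝ → ℝ} (h : ContinuousAt f π) : Filter.Tendsto f (nhdsWithin π (Iio π)) (nhds (f π)) := h.tendsto.mono_left nhdsWithin_le_nhds
lemma xf_0 : Filter.Tendsto xf (nhdsWithin 0 (Ioi 0)) (nhdsWithin 0 (Ioi 0)) := by
  refine tendsto_nhdsWithin_iff.2 ⟨?_, ev0.mono fun φ h => xf_pos h⟩
  have : ContinuousAt xf 0 := by
    unfold xf
    exact ContinuousAt.div (by fun_prop) (by fun_prop) (by norm_num)
  simpa [xf] using c0 this
lemma uf_c : Continuous uf := by unfold uf; fun_prop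
lemma uf_0 : Filter.Tendsto uf (nhdsWithin 0 (Ioi 0)) (nhds 1) := by
  have := c0 uf_c.continuousAt
  convert this using 2; norm_num [uf]
lemma uf_p : Filter.Tendsto uf (nhdsWithin π (Iio π)) (nhds 0) := by
  have := cpi uf_c.continuousAt
  convert this using 2; norm_num [uf]
lemma xf_p : Filter.Tendsto xf (nhdsWithin π (Iio π)) Filter.atTop := by
  have h1 : Filter.Tendsto (fun φ => √(4 * cos (φ/3)^2 - 1)) (nhdsWithin π (Iio π)) (nhdsWithin 0 (Ioi 0)) := by
    refine tendsto_nhdsWithin_iff.2 ⟨?_, evp.mono fun φ h => sqrt_pos.2 (by nlinarith [(cs h).1])⟩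
    have := cpi (f := fun φ => √(4 * cos (φ/3)^2 - 1)) (by fun_prop)
    convert this using 2; norm_num
  have h2 : Filter.Tendsto (fun φ => 4 * sin (φ/3)) (nhdsWithin π (Iio π)) (nhds (4 * sin (π/3))) := cpi (f := fun φ => 4 * sin (φ/3)) (by fun_prop)
  exact h2.pos_mul_atTop (by rw [sin_pi_div_three]; positivity) (tendsto_inv_nhdsGT_zero.comp h1)
lemma u1 {φ : ℝ} (h : φ ∈ Ioo 0 π) : 1 - uf φ = xf φ^2 * uf φ / 4 := by
  have := (uf_bd h).1
  rw [xf_sq h]; field_simp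
lemma s2u (φ : ℝ) : 2/9 * sin φ^2 = 3/2 * (1 - uf φ) * uf φ^2 := by rw [sinf φ]; linear_combination (2 * uf φ^2) * s2f φ
lemma bt_le {X S : ℝ} (hX : X ∈ Ioo (0:ℝ) (1/2)) (hS : S^2 = 4 * X * (1 - X)) : |bt X| ≤ 7 * (2/9 * S^2) := by
  have := bt_bd (X := X) ⟨hX.1.le, by linarith [hX.2]⟩
  rw [hS]; nlinarith [hX.1, hX.2]

lemma ab_lim : (Filter.Tendsto af (nhdsWithin 0 (Ioi 0)) (nhds 1) ∧ Filter.Tendsto a1f (nhdsWithin 0 (Ioi 0)) (nhds 0) ∧ ∀ᶠ φ in nhdsWithin (0:ℝ) (Ioi 0), |a1f φ| ≤ 7 * (2/9 * sin φ^2)) ∧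
    (Filter.Tendsto bf (nhdsWithin π (Iio π)) (nhds 1) ∧ Filter.Tendsto b1f (nhdsWithin π (Iio π)) (nhds 0) ∧ ∀ᶠ φ in nhdsWithin π (Iio π), |b1f φ| ≤ 7 * (2/9 * sin φ^2)) := by
  have t1 : Filter.Tendsto (fun φ => sin (φ/2)^2) (nhdsWithin 0 (Ioi 0)) (nhds 0) := by
    have := c0 (f := fun φ => sin (φ/2)^2) (by fun_prop)
    convert this using 2; norm_num
  have t2 : Filter.Tendsto (fun φ => cos (φ/2)^2) (nhdsWithin π (Iio π)) (nhds 0) := by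
    have := cpi (f := fun φ => cos (φ/2)^2) (by fun_prop)
    convert this using 2; norm_num
  have b0 : Filter.Tendsto bb (nhds 0) (nhds 1) := by have := (bb_ca (X := 0) one_pos).tendsto; rwa [bb_0] at this
  have b1 : Filter.Tendsto bt (nhds 0) (nhds 0) := by have := (bt_ca (X := 0) one_pos).tendsto; rwa [bt_0] at this
  refine ⟨⟨b0.comp t1, b1.comp t1, ?_⟩, ⟨b0.comp t2, ?_, ?_⟩⟩
  · filter_upwards [ev0, t1.eventually (gt_mem_nhds (show (0:ℝ) < 1/2 by norm_num))] with φ h h1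
    obtain ⟨a, b, c, d, e⟩ := hf h
    exact bt_le ⟨d.1, h1⟩ (by rw [c, ← cos_sq']; ring)
  · have := (b1.comp t2).neg; rw [neg_zero] at this; exact this
  · filter_upwards [evp, t2.eventually (gt_mem_nhds (show (0:ℝ) < 1/2 by norm_num))] with φ h h1
    obtain ⟨a, b, c, d, e⟩ := hf h
    rw [b1f, abs_neg]
    exact bt_le ⟨e.1, h1⟩ (by rw [c, ← sin_sq]; ring)

lemma lim0 : Filter.Tendsto (fun φ => Gf φ * (2/9 * sin φ^2)) (nhdsWithin 0 (Ioi 0)) (nhds 0) ∧ Filter.Tendsto G1f (nhdsWithin 0 (Ioi 0)) (nhds (-(1/4))) ∧ Filter.Tendsto G2f (nhdsWithin 0 (Ioi 0)) (nhds 0) := by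
  have r0 := (x2_lim GBs.1).1.comp xf_0
  have r1 := (x2_lim GBs.2.1).1.comp xf_0
  have f1 := F1_lim.1.comp xf_0
  have f2 := F1_lim.2.comp xf_0
  have hc : Filter.Tendsto (fun φ => cos (φ/3)) (nhdsWithin 0 (Ioi 0)) (nhds 1) := by simpa using c0 (f := fun φ => cos (φ/3)) (by fun_prop)
  have hu := uf_0
  simp only [Function.comp_def] at r0 r1 f1 f2
  refine ⟨?_, ?_, ?_⟩
  · have := (r0.mul (hu.pow 2)).const_mul (3/8)
    norm_num at this
    refine this.congr' (ev0.mono fun φ h => ?_)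
    have u0 := (uf_bd h).1
    have e := u1 h
    beta_reduce; rw [s2u, Gf, e]; field_simp; ring
  · have := ((hc.mul f1).div hu one_ne_zero).neg.add ((hc.mul r0).div_const 2)
    norm_num at this
    refine this.congr' (ev0.mono fun φ h => ?_)
    have u0 := (uf_bd h).1
    have e := u1 h
    rw [G1f]
    field_simp
    linear_combination (-4 * cos (φ/3) * Hk q0 (xf φ)) * e
  · have := ((hc.pow 2).mul ((f2.div hu one_ne_zero).sub (r1.add r0))).add ((((r1.add ((hu.mul r0).const_mul 2)).mul hu)).const_mul (3/16))
    norm_num at this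
    refine this.congr' (ev0.mono fun φ h => ?_)
    have u0 := (uf_bd h).1
    have e := u1 h
    have e' : xf φ^2 = 4 * (1 - uf φ) / uf φ := by rw [e]; field_simp
    rw [G2f, e']
    field_simp; ring

lemma limp : Filter.Tendsto (fun φ => Gf φ * (2/9 * sin φ^2)) (nhdsWithin π (Iio π)) (nhds 0) ∧ Filter.Tendsto (fun φ => G1f φ * (2/9 * sin φ^2)) (nhdsWithin π (Iio π)) (nhds 0) ∧ Filter.Tendsto G2f (nhdsWithin π (Iio π)) (nhds 0) := by
  have r0 := (x2_lim GBs.1).2.comp xf_p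
  have r1 := (x2_lim GBs.2.1).2.comp xf_p
  have r2 := (x2_lim GBs.2.2.1).2.comp xf_p
  have t2 := T2_lim.comp xf_p
  have hc := cpi (f := fun φ => cos (φ/3)) (by fun_prop)
  have hu := uf_p
  simp only [Function.comp_def] at r0 r1 r2 t2
  refine ⟨?_, ?_, ?_⟩
  · have := (r0.mul ((hu.const_sub 1).mul hu)).const_mul (3/2)
    norm_num at this
    refine this.congr' (evp.mono fun φ h => ?_)
    have u0 := (uf_bd h).1
    beta_reduce; rw [s2u, Gf]; field_simp
  · have := ((hc.mul (r1.add ((hu.mul r0).const_mul 2))).mul ((hu.const_sub 1).mul hu)).const_mul (-(3/2))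
    norm_num at this
    refine this.congr' (evp.mono fun φ h => ?_)
    have u0 := (uf_bd h).1
    beta_reduce; rw [s2u, G1f]; field_simp
  · have := (((hu.const_sub 1).mul (r1.add ((hu.mul r0).const_mul 2))).const_mul (3/4)).add ((hc.pow 2).mul (((t2.const_mul (1/4)).add r2).add ((r1.add r0).const_mul 4)))
    norm_num at this
    refine this.congr' (evp.mono fun φ h => ?_)
    have u0 := (uf_bd h).1
    have e := u1 h
    have e' : xf φ^2 = 4 * (1 - uf φ) / uf φ := by rw [e]; field_simp
    rw [G2f, e']
    field_simp; ring

lemma Baa : ∀ φ ∈ Ioo 0 π, Bf af a1f af a1f φ = 0 := by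
  refine const_of isOpen_Ioo isPreconnected_Ioo (fun φ h => B_d h (a_d h).1 (a_d h).2.1 (a_d h).1 (a_d h).2.1) (l := nhdsWithin 0 (Ioi 0)) ev0 ?_
  obtain ⟨⟨l1, l2, l3⟩, -⟩ := ab_lim
  obtain ⟨g0, g1, g2⟩ := lim0
  have p : Filter.Tendsto (fun φ => Gf φ * (a1f φ * a1f φ)) (nhdsWithin 0 (Ioi 0)) (nhds 0) := by
    have := (g0.abs.mul l2.abs).const_mul 7
    norm_num at this
    refine squeeze_zero_norm' (l3.mono fun φ h => ?_) this
    rw [norm_eq_abs, abs_mul, abs_mul]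
    have := mul_le_mul_of_nonneg_left h (mul_nonneg (abs_nonneg (Gf φ)) (abs_nonneg (a1f φ)))
    linarith
  have := (((p.sub (g0.mul (l1.mul l1))).const_mul 2).sub (g1.mul ((l2.mul l1).add (l1.mul l2)))).add (g2.mul (l1.mul l1))
  norm_num at this
  exact this
lemma Bbb : ∀ φ ∈ Ioo 0 π, Bf bf b1f bf b1f φ = 0 := by
  refine const_of isOpen_Ioo isPreconnected_Ioo (fun φ h => B_d h (a_d h).2.2.1 (a_d h).2.2.2 (a_d h).2.2.1 (a_d h).2.2.2) (l := nhdsWithin π (Iio π)) evp ?_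
  obtain ⟨-, l1, l2, l3⟩ := ab_lim
  obtain ⟨g0, g1, g2⟩ := limp
  have p : Filter.Tendsto (fun φ => Gf φ * (b1f φ * b1f φ)) (nhdsWithin π (Iio π)) (nhds 0) := by
    have := (g0.abs.mul l2.abs).const_mul 7
    norm_num at this
    refine squeeze_zero_norm' (l3.mono fun φ h => ?_) this
    rw [norm_eq_abs, abs_mul, abs_mul]
    have := mul_le_mul_of_nonneg_left h (mul_nonneg (abs_nonneg (Gf φ)) (abs_nonneg (b1f φ)))
    linarith
  have p1 : Filter.Tendsto (fun φ => G1f φ * b1f φ) (nhdsWithin π (Iio π)) (nhds 0) := by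
    have := g1.abs.const_mul 7
    norm_num at this
    refine squeeze_zero_norm' (l3.mono fun φ h => ?_) this
    rw [norm_eq_abs, abs_mul]
    have := mul_le_mul_of_nonneg_left h (abs_nonneg (G1f φ))
    linarith
  have := (((p.sub (g0.mul (l1.mul l1))).const_mul 2).sub ((p1.mul l1).const_mul 2)).add (g2.mul (l1.mul l1))
  norm_num at this
  refine this.congr fun φ => ?_
  unfold Bf; ring
lemma a1b_lim : Filter.Tendsto (fun φ => a1f φ * bf φ) (nhdsWithin 0 (Ioi 0)) (nhds 0) ∧ Filter.Tendsto b1f (nhdsWithin 0 (Ioi 0)) (nhds (-(√3/π))) := by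
  constructor
  · have : Filter.Tendsto (fun φ => 9 * (sin (φ/2)^2)^(7/8:ℝ)) (nhdsWithin 0 (Ioi 0)) (nhds 0) := by
      have := c0 (f := fun φ => 9 * (sin (φ/2)^2)^(7/8:ℝ)) (ContinuousAt.mul (by fun_prop) (ContinuousAt.rpow_const (by fun_prop) (Or.inr (by norm_num))))
      norm_num at this; exact this
    refine squeeze_zero_norm' (ev0.mono fun φ h => ?_) this
    obtain ⟨a, b, c, d, e⟩ := hf h
    have h1 := bt_bd ⟨d.1.le, d.2⟩
    have h2 := bb_bd ⟨e.1.le, e.2⟩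
    rw [← sin_sq] at h2
    have e : (sin (φ/2)^2)^(7/8:ℝ) = sin (φ/2)^2 * (sin (φ/2)^2)^(-(1/8):ℝ) := by
      nth_rw 2 [← rpow_one (sin (φ/2)^2)]; rw [← rpow_add d.1]; norm_num
    rw [e, norm_mul, norm_eq_abs, norm_of_nonneg (by unfold bf; linarith)]
    calc _ ≤ 3 * sin (φ/2)^2 * (3 * (sin (φ/2)^2)^(-(1/8):ℝ)) := mul_le_mul h1 h2.2 (by linarith) (by positivity)
      _ = _ := by ring
  · refine (bt_1.comp (tendsto_nhdsWithin_iff.2 ⟨?_, ev0.mono fun φ h => (hf h).2.2.2.2.2⟩)).neg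
    have := c0 (f := fun φ => cos (φ/2)^2) (by fun_prop)
    convert this using 2; norm_num

theorem ident {φ : ℝ} (h : φ ∈ Ioo 0 π) : Hk q0 (xf φ) = π/(4*√3) * uf φ * (af φ * bf φ) := by
  have hp := pi_pos
  obtain ⟨⟨l1, l2, -⟩, -⟩ := ab_lim
  obtain ⟨m1, m2⟩ := a1b_lim
  have hw : ∀ φ ∈ Ioo 0 π, af φ * b1f φ - a1f φ * bf φ = -(√3/π) := by
    refine const_of isOpen_Ioo isPreconnected_Ioo (fun φ h => ?_) (l := nhdsWithin 0 (Ioi 0)) ev0 ?_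
    · obtain ⟨d1, d2, d3, d4⟩ := a_d h
      refine ((d1.fun_mul d4).fun_sub (d2.fun_mul d3)).congr_deriv (by ring)
    · simpa using (l1.mul m2).sub m1
  have hB : ∀ φ ∈ Ioo 0 π, Bf af a1f bf b1f φ = Bf af a1f bf b1f (π/2) := by
    have d : ∀ φ ∈ Ioo 0 π, HasDerivAt (Bf af a1f bf b1f) 0 φ := fun φ h => B_d h (a_d h).1 (a_d h).2.1 (a_d h).2.2.1 (a_d h).2.2.2
    have m : π/2 ∈ Ioo 0 π := ⟨by linarith, by linarith⟩
    exact const_of isOpen_Ioo isPreconnected_Ioo d (l := nhds (π/2)) (isOpen_Ioo.mem_nhds m) (d _ m).continuousAt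
  obtain ⟨k, hk⟩ : ∃ k, ∀ φ ∈ Ioo 0 π, Gf φ = k * (af φ * bf φ) := by
    refine ⟨-Bf af a1f bf b1f (π/2) * (π/√3)^2, fun φ h => ?_⟩
    have e1 := Baa φ h
    have e2 := Bbb φ h
    have e3 := hB φ h
    have e4 := hw φ h
    generalize Bf af a1f bf b1f (π/2) = K at *
    have e5 : (√3/π)^2 * Gf φ = -K * (af φ * bf φ) := by
      have : (√3/π)^2 = (af φ * b1f φ - a1f φ * bf φ)^2 := by rw [e4]; ring
      rw [this, ← e3]
      unfold Bf at *
      linear_combination (bf φ^2/2) * e1 + (af φ^2/2) * e2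
    have s3 : √3 ≠ 0 := by positivity
    field_simp at e5 ⊢
    linarith
  have hk1 : ∀ φ ∈ Ioo 0 π, G1f φ = k * (a1f φ * bf φ + af φ * b1f φ) := fun φ h => by
    obtain ⟨d1, d2, d3, d4⟩ := a_d h
    have e := ((d1.fun_mul d3).const_mul k).congr_of_eventuallyEq (Filter.eventuallyEq_of_mem (isOpen_Ioo.mem_nhds h) hk)
    have := (G_d h).1.unique e
    have hs := (cs h).2.2
    field_simp at this
    linarith
  have hk2 : k = π/(4*√3) := by
    have t := ((m1.add (l1.mul m2)).const_mul k).congr' (ev0.mono fun φ h => (hk1 φ h).symm)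
    have := tendsto_nhds_unique t lim0.2.1
    have s3 : √3 ≠ 0 := by positivity
    field_simp at this ⊢
    linarith
  have := hk φ h
  have u0 := (uf_bd h).1
  rw [Gf, div_eq_iff u0.ne', hk2] at this
  rw [this]; ring

end BL

namespace BL

noncomputable def hh (φ : ℝ) : ℝ := uf φ * (18 - 20 * uf φ) * cos (φ/3)
noncomputable def ht (ψ : ℝ) : ℝ := 2 * cos (ψ/3) + 5 * cos (5 * ψ/3)

lemma xf_img : xf '' Ioo 0 π = Ioi 0 := by
  refine Subset.antisymm (image_subset_iff.2 fun φ h => xf_pos h) ?_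
  exact isPreconnected_Ioo.intermediate_value_Ioi (l₁ := nhdsWithin 0 (Ioi 0)) (l₂ := nhdsWithin π (Iio π)) (Filter.le_principal_iff.2 ev0) (Filter.le_principal_iff.2 evp)
    (fun φ h => (xf_d h).continuousAt.continuousWithinAt) (xf_0.mono_right nhdsWithin_le_nhds) xf_p

lemma sub1 : ∫ x in Ioi (0:ℝ), Hk q0 x * ((4 + x^2) ^ (-(5/2):ℝ) * (9/2 * x^2 - 2)) = π/288 * ∫ φ in Ioo 0 π, af φ * bf φ * hh φ := by
  have hm : MonotoneOn xf (Ioo 0 π) := by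
    refine monotoneOn_of_deriv_nonneg (convex_Ioo _ _) (fun φ h => (xf_d h).continuousAt.continuousWithinAt) ?_ ?_
    · rw [interior_Ioo]; exact fun φ h => (xf_d h).differentiableAt.differentiableWithinAt
    · rw [interior_Ioo]; intro φ h
      rw [(xf_d h).deriv]
      have := xf_pos h
      have := cs h
      exact div_nonneg (mul_nonneg (by linarith) (by linarith)) (by linarith)
  rw [← xf_img, integral_image_eq_integral_deriv_smul_of_monotoneOn measurableSet_Ioo (fun φ h => (xf_d h).hasDerivWithinAt) hm, ← integral_const_mul]
  refine setIntegral_congr_fun measurableSet_Ioo fun φ h => ?_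
  have u0 := (uf_bd h).1
  have hs := cs h
  have e : 4 * cos (φ/3)^2 - 1 = 3 * uf φ := by rw [uf]; ring
  have s2 := sq_sqrt u0.le
  have sp := sqrt_pos.2 u0
  have s3 := sq_sqrt (show (0:ℝ) ≤ 3 by norm_num)
  have w : (4/uf φ) ^ (-(5/2):ℝ) = uf φ^2 * √(uf φ) / 32 := by
    rw [rpow_neg (by positivity), ← inv_rpow (by positivity), inv_div, show (5/2:ℝ) = 2 + 1/2 by norm_num, rpow_add (by positivity), ← sqrt_eq_rpow, sqrt_div u0.le,
      show √(4:ℝ) = 2 by rw [show (4:ℝ) = 2^2 by norm_num, sqrt_sq (by norm_num)]]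
    norm_num; ring
  simp only [smul_eq_mul]
  rw [ident h, xf_sq h, show 4 + (4/uf φ - 4) = 4/uf φ by ring, w, xf, e, sqrt_mul (by norm_num), sinf φ, hh]
  have := hs.2.1
  have s3p : 0 < √(3:ℝ) := by positivity
  generalize √(uf φ) = r at *
  generalize √(3:ℝ) = t at *
  field_simp
  rw [s3]; ring

lemma hh_ht (ψ : ℝ) : hh (π/2 + ψ) + hh (π/2 - ψ) = 4 * √3/9 * ht ψ := by
  have k : ∀ φ, hh φ = 8/9 * cos (φ/3) - 2/3 * cos (3 * (φ/3)) - 20/9 * cos (5 * (φ/3)) := fun φ => by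
    have e5 : cos (5 * (φ/3)) = 16 * cos (φ/3)^5 - 20 * cos (φ/3)^3 + 5 * cos (φ/3) := by
      rw [show 5 * (φ/3) = 3 * (φ/3) + 2 * (φ/3) by ring, cos_add, cos_three_mul, sin_three_mul, cos_two_mul, sin_two_mul]
      have := sin_sq (φ/3)
      linear_combination (8 * sin (φ/3)^2 * cos (φ/3) + 8 * cos (φ/3) * (1 - cos (φ/3)^2) - 6 * cos (φ/3)) * this
    rw [e5, cos_three_mul, hh, uf]; ring
  have m : ∀ A B : ℝ, cos (A + B) + cos (A - B) = 2 * cos A * cos B := fun A B => by rw [cos_add, cos_sub]; ring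
  have m1 := m (π/6) (ψ/3)
  have m2 := m (π/2) ψ
  have m3 := m (π - π/6) (5 * ψ/3)
  rw [cos_pi_div_six] at m1
  rw [cos_pi_div_two] at m2
  rw [cos_pi_sub, cos_pi_div_six] at m3
  rw [k, k, ht]
  rw [show (π/2+ψ)/3 = π/6 + ψ/3 by ring, show (π/2-ψ)/3 = π/6 - ψ/3 by ring, show 3 * (π/6 + ψ/3) = π/2 + ψ by ring, show 3 * (π/6 - ψ/3) = π/2 - ψ by ring,
    show 5 * (π/6 + ψ/3) = π - π/6 + 5 * ψ/3 by ring, show 5 * (π/6 - ψ/3) = π - π/6 - 5 * ψ/3 by ring]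
  linear_combination (8/9) * m1 - 2/3 * m2 - 20/9 * m3

noncomputable def FP (p : ℝ × ℝ) : ℝ := bb (1 - (cos p.1 * cos p.2)^2)

lemma FP_int : IntegrableOn FP (Ioo 0 (π/2) ×ˢ Ioo 0 (π/2)) (volume.prod volume) := by
  have hc : IntegrableOn (fun β => cos β^(-(1/4):ℝ)) (Ioo 0 (π/2)) := by
    have := cosint; rwa [intervalIntegrable_iff_integrableOn_Ioo_of_le (by positivity)] at this
  have hi := (Integrable.mul_prod hc hc).const_mul 3
  rw [Measure.prod_restrict] at hi
  refine hi.mono' (ContinuousOn.aestronglyMeasurable (fun p hp => ?_) (measurableSet_Ioo.prod measurableSet_Ioo)) ((ae_restrict_iff' (measurableSet_Ioo.prod measurableSet_Ioo)).2 (Filter.Eventually.of_forall fun p hp => ?_))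
  all_goals
    have a : 0 < cos p.1 := cos_pos_of_mem_Ioo ⟨by linarith [hp.1.1, pi_pos], hp.1.2⟩
    have b : 0 < cos p.2 := cos_pos_of_mem_Ioo ⟨by linarith [hp.2.1, pi_pos], hp.2.2⟩
    have ab := mul_pos a b
  · refine (ContinuousAt.comp (f := fun p : ℝ × ℝ => 1 - (cos p.1 * cos p.2)^2) (bb_ca (by nlinarith)) (by fun_prop)).continuousWithinAt
  · have ab1 : cos p.1 * cos p.2 ≤ 1 := mul_le_one₀ (cos_le_one _) b.le (cos_le_one _)
    have := bb_bd (X := 1 - (cos p.1 * cos p.2)^2) ⟨by nlinarith, by nlinarith⟩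
    rw [FP, norm_eq_abs, abs_of_nonneg (by linarith)]
    refine this.2.trans_eq ?_
    rw [sub_sub_cancel, ← rpow_natCast, ← rpow_mul ab.le, ← mul_rpow a.le b.le]; norm_num

noncomputable def DD (ψ : ℝ) : ℝ := af (π/2 + ψ) * bf (π/2 + ψ)
lemma DD_eq {ψ : ℝ} (h : ψ ∈ Ioo 0 (π/2)) : DD ψ = 2/π * ∫ β in Ioo 0 (π/2), FP (ψ, β) := by
  have := legfin (φ := π/2 + ψ) ⟨by linarith [h.1, pi_pos], by linarith [h.2]⟩
  rw [DD, af, bf, this, intervalIntegral.integral_of_le (by positivity), integral_Ioc_eq_integral_Ioo, show sin (π/2 + ψ) = cos ψ by rw [add_comm, sin_add_pi_div_two]]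
  rfl
lemma DD_neg (ψ : ℝ) : DD (-ψ) = DD ψ := by
  unfold DD af bf
  rw [show (π/2 + -ψ)/2 = π/2 - (π/2 + ψ)/2 by ring, sin_pi_div_two_sub, cos_pi_div_two_sub, mul_comm]
lemma DD_int : IntervalIntegrable DD volume 0 (π/2) := by
  rw [intervalIntegrable_iff_integrableOn_Ioo_of_le (by positivity)]
  have := FP_int
  rw [IntegrableOn, ← Measure.prod_restrict] at this
  refine IntegrableOn.congr_fun (this.integral_prod_left.const_mul (2/π)) (fun ψ h => (DD_eq h).symm) measurableSet_Ioo

lemma sub2 : ∫ φ in Ioo 0 π, af φ * bf φ * hh φ = 4 * √3/9 * (2/π) * ∫ p in Ioo 0 (π/2) ×ˢ Ioo 0 (π/2), FP p * ht p.1 := by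
  have cu : Continuous hh := by have := uf_c; unfold hh; fun_prop
  have ct : Continuous ht := by unfold ht; fun_prop
  have i1 : IntervalIntegrable (fun ψ => DD ψ * hh (π/2 + ψ)) volume 0 (π/2) := DD_int.mul_continuousOn (by fun_prop)
  have i2 : IntervalIntegrable (fun ψ => DD ψ * hh (π/2 - ψ)) volume 0 (π/2) := DD_int.mul_continuousOn (by fun_prop)
  have e3 : (fun ψ => DD ψ * hh (π/2 + ψ)) = fun ψ => (fun ψ => DD ψ * hh (π/2 - ψ)) (-ψ) := by ext ψ; simp only [DD_neg, sub_neg_eq_add]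
  have i3 : IntervalIntegrable (fun ψ => DD ψ * hh (π/2 + ψ)) volume (-(π/2)) 0 := by
    have := (IntervalIntegrable.iff_comp_neg enorm_ne_top).1 i2
    rw [neg_zero] at this; rw [e3]; exact this.symm
  have s1 : ∫ φ in Ioo 0 π, af φ * bf φ * hh φ = ∫ ψ in (-(π/2))..(π/2), DD ψ * hh (π/2 + ψ) := by
    rw [← integral_Ioc_eq_integral_Ioo, ← intervalIntegral.integral_of_le pi_pos.le]
    have := intervalIntegral.integral_comp_add_left (fun φ => af φ * bf φ * hh φ) (π/2) (a := -(π/2)) (b := π/2)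
    rw [add_neg_cancel, add_halves] at this
    rw [← this]; rfl
  have s2 : ∫ ψ in (-(π/2))..0, DD ψ * hh (π/2 + ψ) = ∫ ψ in (0:ℝ)..(π/2), DD ψ * hh (π/2 - ψ) := by
    rw [e3, intervalIntegral.integral_comp_neg (fun ψ => DD ψ * hh (π/2 - ψ))]; simp
  have hF := FP_int
  have hFt : IntegrableOn (fun p => FP p * ht p.1) (Ioo 0 (π/2) ×ˢ Ioo 0 (π/2)) (volume.prod volume) := by
    refine Integrable.mul_bdd (c := 7) hF (by fun_prop) (Filter.Eventually.of_forall fun p => ?_)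
    unfold ht
    have := abs_le.1 (abs_cos_le_one (p.1/3))
    have := abs_le.1 (abs_cos_le_one (5 * p.1/3))
    rw [norm_eq_abs, abs_le]; constructor <;> linarith
  rw [s1, ← intervalIntegral.integral_add_adjacent_intervals i3 i1, s2, ← intervalIntegral.integral_add i2 i1, Measure.volume_eq_prod, setIntegral_prod _ hFt,
    intervalIntegral.integral_of_le (by positivity), integral_Ioc_eq_integral_Ioo, ← integral_const_mul]
  refine setIntegral_congr_fun measurableSet_Ioo fun ψ h => ?_
  simp only []
  rw [integral_mul_const, ← mul_add, add_comm (hh _), hh_ht, DD_eq h]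
  ring

end BL

namespace BL

noncomputable def Ph (p : ℝ × ℝ) : ℝ × ℝ := (psi p.1 p.2, arctan (√p.1 * cos p.2 / √(1 - p.1)))
noncomputable def PM (X χ : ℝ) : Matrix (Fin 2) (Fin 2) ℝ :=
  !![sin χ / (2 * √X * cp X χ), √X * cos χ / cp X χ; cos χ / (2 * √X * √(1 - X) * cp X χ^2), -(√X * sin χ * √(1 - X) / cp X χ^2)]
noncomputable def PL (p : ℝ × ℝ) : ℝ × ℝ →L[ℝ] ℝ × ℝ := (Matrix.toLin (.finTwoProd ℝ) (.finTwoProd ℝ) (PM p.1 p.2)).toContinuousLinearMap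

lemma cp_sq' {X : ℝ} (h : X ∈ Ioo (0:ℝ) 1) (χ : ℝ) : cp X χ^2 = √(1 - X)^2 + (√X * cos χ)^2 := by
  rw [cp_sq h.2, mul_pow, mul_pow, sq_sqrt h.1.le, sq_sqrt (by linarith [h.2])]
  linear_combination (-X) * (sin_sq_add_cos_sq χ)

lemma Ph_d {p : ℝ × ℝ} (h : p.1 ∈ Ioo (0:ℝ) 1) : HasFDerivAt Ph (PL p) p := by
  obtain ⟨X, χ⟩ := p
  simp only at h
  have k0 := cp_pos h.2 χ
  have k2 := cp_sq' h χ
  have k1 : cp X χ = √(1 - (√X * sin χ)^2) := rfl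
  have a0 := sqrt_pos.2 h.1
  have b0 := sqrt_pos.2 (show 0 < 1 - X by linarith [h.2])
  have a2 := sq_sqrt h.1.le
  have b2 := sq_sqrt (show 0 ≤ 1 - X by linarith [h.2])
  have y1 := ys_lt h.2 χ
  unfold PL PM
  rw [Matrix.toLin_finTwoProd_toContinuousLinearMap]
  have hX : HasFDerivAt (fun p : ℝ × ℝ => √p.1) _ (X, χ) := (hasDerivAt_sqrt h.1.ne').comp_hasFDerivAt (f := Prod.fst) (X, χ) (hasFDerivAt_fst (𝕜 := ℝ) (E := ℝ) (F := ℝ) (p := (X, χ)))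
  have hY : HasFDerivAt (fun p : ℝ × ℝ => √(1 - p.1)) _ (X, χ) := ((hasDerivAt_sqrt (show 1 - X ≠ 0 by linarith [h.2]))).comp_hasFDerivAt (f := fun p : ℝ × ℝ => 1 - p.1) (X, χ) ((hasFDerivAt_fst (𝕜 := ℝ) (E := ℝ) (F := ℝ) (p := (X, χ))).const_sub 1)
  have hs : HasFDerivAt (fun p : ℝ × ℝ => sin p.2) _ (X, χ) := (hasDerivAt_sin χ).comp_hasFDerivAt (f := Prod.snd) (X, χ) (hasFDerivAt_snd (𝕜 := ℝ) (E := ℝ) (F := ℝ) (p := (X, χ)))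
  have hc : HasFDerivAt (fun p : ℝ × ℝ => cos p.2) _ (X, χ) := (hasDerivAt_cos χ).comp_hasFDerivAt (f := Prod.snd) (X, χ) (hasFDerivAt_snd (𝕜 := ℝ) (E := ℝ) (F := ℝ) (p := (X, χ)))
  have hi : HasFDerivAt (fun p : ℝ × ℝ => (√(1 - p.1))⁻¹) _ (X, χ) := (hasDerivAt_inv b0.ne').comp_hasFDerivAt (f := fun p : ℝ × ℝ => √(1 - p.1)) (X, χ) hY
  have h1 := (hasDerivAt_arcsin (x := √X * sin χ) (by nlinarith) (by nlinarith)).comp_hasFDerivAt (f := fun p : ℝ × ℝ => √p.1 * sin p.2) (X, χ) (hX.fun_mul hs)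
  have h2 := (hasDerivAt_arctan (√X * cos χ * (√(1 - X))⁻¹)).comp_hasFDerivAt (f := fun p : ℝ × ℝ => √p.1 * cos p.2 * (√(1 - p.1))⁻¹) (X, χ) ((hX.fun_mul hc).fun_mul hi)
  have e2 : 1 + (√X * cos χ * (√(1 - X))⁻¹)^2 = cp X χ^2 / √(1 - X)^2 := by rw [k2]; field_simp
  rw [e2] at h2
  rw [← k1] at h1
  refine (h1.prodMk h2).congr_fderiv ?_
  have hX1 : X = 1 - √(1 - X)^2 := by linarith
  have l1 : √X^2 + √(1-X)^2 = 1 := by linarith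
  ext <;> simp
  · field_simp
  · field_simp
    rw [l1, mul_one]
  · field_simp
  · field_simp

lemma PL_det {p : ℝ × ℝ} (h : p.1 ∈ Ioo (0:ℝ) 1) : |(PL p).det| = 1 / (2 * √(1 - p.1) * cp p.1 p.2) := by
  obtain ⟨X, χ⟩ := p
  simp only at h
  have k0 := cp_pos h.2 χ
  have k2 := cp_sq' h χ
  have a0 := sqrt_pos.2 h.1
  have b0 := sqrt_pos.2 (show 0 < 1 - X by linarith [h.2])
  have a2 := sq_sqrt h.1.le
  have b2 := sq_sqrt (show 0 ≤ 1 - X by linarith [h.2])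
  have : (PL (X, χ)).det = -(1 / (2 * √(1 - X) * cp X χ)) := by
    unfold PL PM
    rw [LinearMap.det_toContinuousLinearMap, LinearMap.det_toLin, Matrix.det_fin_two_of]
    field_simp
    have l1 : √X^2 + √(1-X)^2 = 1 := by linarith
    rw [k2]
    linear_combination (-√(1-X)^2) * sin_sq_add_cos_sq χ + (cos χ^2) * l1
  rw [this, abs_neg, abs_of_pos (by positivity)]

lemma Ph_cos {p : ℝ × ℝ} (h : p ∈ Ioo (0:ℝ) 1 ×ˢ Ioo 0 (π/2)) : 1 - (cos (Ph p).1 * cos (Ph p).2)^2 = p.1 ∧ Ph p ∈ Ioo 0 (π/2) ×ˢ Ioo 0 (π/2) := by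
  obtain ⟨X, χ⟩ := p
  obtain ⟨h, hχ⟩ := h
  simp only at h hχ
  have hs : 0 < sin χ := sin_pos_of_pos_of_lt_pi hχ.1 (by linarith [hχ.2, pi_pos])
  have hc : 0 < cos χ := cos_pos_of_mem_Ioo ⟨by linarith [hχ.1, pi_pos], hχ.2⟩
  have k0 := cp_pos h.2 χ
  have k2 := cp_sq' h χ
  have a0 := sqrt_pos.2 h.1
  have b0 := sqrt_pos.2 (show 0 < 1 - X by linarith [h.2])
  have b2 := sq_sqrt (show 0 ≤ 1 - X by linarith [h.2])
  refine ⟨?_, ⟨?_, (psi_bd h.2 ⟨hχ.1.le, by linarith [hχ.2, pi_pos]⟩).2⟩, ?_, arctan_lt_pi_div_two _⟩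
  · simp only [Ph]
    rw [mul_pow, cp_eq, cos_sq_arctan, k2]
    have : 0 < √(1 - X)^2 + (√X * cos χ)^2 := by positivity
    have e : 1 + (√X * cos χ / √(1 - X))^2 = (√(1 - X)^2 + (√X * cos χ)^2) / √(1 - X)^2 := by field_simp
    rw [e, one_div_div, mul_div_cancel₀ _ this.ne']; linarith
  · exact arcsin_pos.2 (by positivity)
  · exact arctan_pos.2 (by positivity)

lemma Ph_inj : InjOn Ph (Ioo (0:ℝ) 1 ×ˢ Ioo 0 (π/2)) := by
  rintro ⟨X, χ⟩ h ⟨Y, ξ⟩ h' e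
  have e1 := (Ph_cos h).1
  have e2 := (Ph_cos h').1
  rw [e, e2] at e1
  simp only at e1
  subst e1
  have hY := h'.1
  simp only at hY
  have e3 : sin (psi Y χ) = sin (psi Y ξ) := by rw [show psi Y χ = psi Y ξ from congrArg Prod.fst e]
  rw [sin_psi hY.2, sin_psi hY.2] at e3
  have e4 := mul_left_cancel₀ (sqrt_pos.2 hY.1).ne' e3
  have a := h.2
  have b := h'.2
  simp only at a b
  rw [injOn_sin ⟨by linarith [a.1, pi_pos], a.2.le⟩ ⟨by linarith [b.1, pi_pos], b.2.le⟩ e4]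

lemma Ph_img : Ph '' (Ioo (0:ℝ) 1 ×ˢ Ioo 0 (π/2)) = Ioo 0 (π/2) ×ˢ Ioo 0 (π/2) := by
  refine Subset.antisymm (image_subset_iff.2 fun p h => (Ph_cos h).2) ?_
  rintro ⟨ψ, β⟩ ⟨h1, h2⟩
  simp only at h1 h2
  have s1 : 0 < sin ψ := sin_pos_of_pos_of_lt_pi h1.1 (by linarith [h1.2, pi_pos])
  have c1 : 0 < cos ψ := cos_pos_of_mem_Ioo ⟨by linarith [h1.1, pi_pos], h1.2⟩
  have s2 : 0 < sin β := sin_pos_of_pos_of_lt_pi h2.1 (by linarith [h2.2, pi_pos])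
  have c2 : 0 < cos β := cos_pos_of_mem_Ioo ⟨by linarith [h2.1, pi_pos], h2.2⟩
  have e1 := sin_sq_add_cos_sq ψ
  have e2 := sin_sq_add_cos_sq β
  obtain ⟨X, hX⟩ : ∃ X, X = 1 - (cos ψ * cos β)^2 := ⟨_, rfl⟩
  have hXs : X = sin ψ^2 + (cos ψ * sin β)^2 := by rw [hX]; linear_combination -e1 - cos ψ^2 * e2
  have hX1 : X ∈ Ioo (0:ℝ) 1 := ⟨by rw [hXs]; positivity, by rw [hX]; linarith [show 0 < (cos ψ * cos β)^2 by positivity]⟩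
  have a0 := sqrt_pos.2 hX1.1
  have a2 := sq_sqrt hX1.1.le
  have lt : sin ψ / √X < 1 := by
    rw [div_lt_one a0]; exact lt_sqrt_of_sq_lt (by rw [hXs]; linarith [show 0 < (cos ψ * sin β)^2 by positivity])
  have pos : 0 < sin ψ / √X := by positivity
  have sc : sin (arcsin (sin ψ / √X)) = sin ψ / √X := sin_arcsin (by linarith) lt.le
  refine ⟨(X, arcsin (sin ψ / √X)), ⟨hX1, arcsin_pos.2 pos, arcsin_lt_pi_div_two.2 lt⟩, ?_⟩
  simp only [Ph, psi]
  rw [sc, mul_div_cancel₀ _ a0.ne', arcsin_sin (by linarith [h1.1, pi_pos]) h1.2.le, cos_arcsin]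
  have e3 : √X * √(1 - (sin ψ/√X)^2) = cos ψ * sin β := by
    rw [← sqrt_mul hX1.1.le, div_pow, a2, mul_sub, mul_div_cancel₀ _ hX1.1.ne', mul_one, show X - sin ψ^2 = (cos ψ * sin β)^2 by rw [hXs]; ring, sqrt_sq (by positivity)]
  have e4 : √(1 - X) = cos ψ * cos β := by
    rw [hX, sub_sub_cancel, sqrt_sq (by positivity)]
  rw [e3, e4, mul_div_mul_left _ _ c1.ne', ← tan_eq_sin_div_cos, arctan_tan (by linarith [h2.1, pi_pos]) h2.2]

end BL

namespace BL

lemma half {f : ℝ → ℝ} (hf : Continuous f) (hs : ∀ x, f (π - x) = f x) : ∫ x in (0:ℝ)..π, f x = 2 * ∫ x in (0:ℝ)..(π/2), f x := by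
  have e : ∫ x in (π/2)..π, f x = ∫ x in (0:ℝ)..(π/2), f x := by
    have := intervalIntegral.integral_comp_sub_left f π (a := 0) (b := π/2)
    simp only [hs] at this
    rw [this, sub_zero, sub_half]
  rw [← intervalIntegral.integral_add_adjacent_intervals (hf.intervalIntegrable 0 (π/2)) (hf.intervalIntegrable (π/2) π), e]; ring

lemma inner_eq {X : ℝ} (h : X ∈ Ioo (0:ℝ) 1) : ∫ χ in Ioo 0 (π/2), ht (psi X χ) / cp X χ = π/2 * (2 * bb X + 5 * aa X) := by
  have cc : Continuous fun χ => psi X χ := psi_c.comp (by fun_prop : Continuous fun χ : ℝ => (X, χ))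
  have ck : Continuous fun χ => cp X χ := cp_c.comp (by fun_prop : Continuous fun χ : ℝ => (X, χ))
  have k0 := fun χ => cp_pos h.2 χ
  have c1 : Continuous fun χ => cos (2/3 * psi X χ) := by fun_prop
  have c2 : Continuous fun χ => -(1/3) * (sin (2/3 * psi X χ) * (√X * sin χ / cp X χ)) :=
    continuous_const.mul ((by fun_prop : Continuous fun χ => sin (2/3 * psi X χ)).mul ((by fun_prop : Continuous fun χ => √X * sin χ).div ck fun χ => (k0 χ).ne'))
  have sp : ∀ χ, psi X (π - χ) = psi X χ := fun χ => by rw [psi, psi, sin_pi_sub]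
  have sk : ∀ χ, cp X (π - χ) = cp X χ := fun χ => by rw [cp, cp, sin_pi_sub]
  have hV := half c1 (fun χ => by rw [sp])
  have hU := half c2 (fun χ => by rw [sp, sk, sin_pi_sub])
  have e : ∀ χ, ht (psi X χ) / cp X χ = 7 * cos (2/3 * psi X χ) + 9 * (-(1/3) * (sin (2/3 * psi X χ) * (√X * sin χ / cp X χ))) := fun χ => by
    have := k0 χ
    have e1 : cos (psi X χ/3) = cos (2/3 * psi X χ) * cp X χ + sin (2/3 * psi X χ) * (√X * sin χ) := by
      rw [← cp_eq, ← sin_psi h.2, mul_comm (cos _), mul_comm (sin _), ← cos_sub]; congr 1; ring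
    have e2 : cos (5 * psi X χ/3) = cos (2/3 * psi X χ) * cp X χ - sin (2/3 * psi X χ) * (√X * sin χ) := by
      rw [← cp_eq, ← sin_psi h.2, ← cos_add]; congr 1; ring
    rw [ht, e1, e2]; field_simp; ring
  simp only [e]
  rw [← integral_Ioc_eq_integral_Ioo, ← intervalIntegral.integral_of_le (by positivity), intervalIntegral.integral_add ((c1.const_mul 7).intervalIntegrable _ _) ((c2.const_mul 9).intervalIntegrable _ _),
    intervalIntegral.integral_const_mul, intervalIntegral.integral_const_mul, bb, aa, Vi, Ui, hV, hU]
  have := pi_pos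
  generalize (∫ χ in (0:ℝ)..(π/2), cos (2/3 * psi X χ)) = A
  generalize (∫ χ in (0:ℝ)..(π/2), -(1/3) * (sin (2/3 * psi X χ) * (√X * sin χ / cp X χ))) = B
  field_simp; ring

lemma sub3 : ∫ p in Ioo 0 (π/2) ×ˢ Ioo 0 (π/2), FP p * ht p.1 = π/4 * ∫ x in (0:ℝ)..1, bb x * (2 * bb x + 5 * aa x) / √(1 - x) := by
  have mT : MeasurableSet (Ioo (0:ℝ) 1 ×ˢ Ioo 0 (π/2)) := measurableSet_Ioo.prod measurableSet_Ioo
  have ct : Continuous ht := by unfold ht; fun_prop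
  have hFt : IntegrableOn (fun p => FP p * ht p.1) (Ioo 0 (π/2) ×ˢ Ioo 0 (π/2)) volume := by
    refine Integrable.mul_bdd (c := 7) FP_int (by fun_prop) (Filter.Eventually.of_forall fun p => ?_)
    unfold ht
    have := abs_le.1 (abs_cos_le_one (p.1/3))
    have := abs_le.1 (abs_cos_le_one (5 * p.1/3))
    rw [norm_eq_abs, abs_le]; constructor <;> linarith
  have hd : ∀ p ∈ Ioo (0:ℝ) 1 ×ˢ Ioo 0 (π/2), HasFDerivWithinAt Ph (PL p) (Ioo (0:ℝ) 1 ×ˢ Ioo 0 (π/2)) p := fun p hp => (Ph_d hp.1).hasFDerivWithinAt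
  have hcg : ∀ p ∈ Ioo (0:ℝ) 1 ×ˢ Ioo 0 (π/2), |(PL p).det| • (FP (Ph p) * ht (Ph p).1) = 1/2 * (bb p.1 / √(1 - p.1)) * (ht (psi p.1 p.2) / cp p.1 p.2) := fun p hp => by
    have := cp_pos hp.1.2 p.2
    have b0 := sqrt_pos.2 (show 0 < 1 - p.1 by linarith [hp.1.2])
    rw [PL_det hp.1, FP, (Ph_cos hp).1, smul_eq_mul, Ph]; field_simp
  rw [← Ph_img] at hFt ⊢
  rw [integrableOn_image_iff_integrableOn_abs_det_fderiv_smul volume mT hd Ph_inj] at hFt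
  have hi := hFt.congr_fun hcg mT
  rw [integral_image_eq_integral_abs_det_fderiv_smul volume mT hd Ph_inj, setIntegral_congr_fun mT hcg, Measure.volume_eq_prod, setIntegral_prod _ hi,
    intervalIntegral.integral_of_le zero_le_one, integral_Ioc_eq_integral_Ioo, ← integral_const_mul]
  refine setIntegral_congr_fun measurableSet_Ioo fun X h => ?_
  simp only []
  rw [integral_const_mul, inner_eq h]; ring

theorem final : (∫ t in Ioi (0:ℝ), I0 t * (K0 t)^5 * t * (1 - 8*t^2)) = (7 * π^3 / (108 * √3)) * ∫ x in (0:ℝ)..1, (pFq [-1/3, 1/3] [1] x)^2 / √(1 - x) := by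
  rw [step3, sub1, sub2, sub3, step7]
  have s3 := sq_sqrt (show (0:ℝ) ≤ 3 by norm_num)
  have : 0 < √(3:ℝ) := by positivity
  have := pi_pos
  generalize (∫ x in (0:ℝ)..1, (pFq [-1/3, 1/3] [1] x)^2 / √(1 - x)) = J
  field_simp
  rw [s3]; ring

end BL

theorem broadhurst_laporta_integral :
    (∫ t in Ioi (0:ℝ), I0 t * (K0 t)^5 * t * (1 - 8*t^2))
    = (7 * π^3 / (108 * Real.sqrt 3)) *
        ∫ x in (0:ℝ)..1, (pFq [-1/3, 1/3] [1] x)^2 / Real.sqrt (1 - x) := by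
  exact BL.final
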